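/- Let k₁, k₂ > 0 with k₁+k₂ ≥ 1/2 and k₂−k₁ > −1/2, t ∈ ℝ, 0 < φ < π. Then the continuous Hahn transform ℱ is an isometry into L²(ℝ, w(x)dx): for all f, g in the linear span of {𝐪_n = (conj(q_n), q_n) : n ∈ ℤ_{≥0}}, ∫_ℝ (ℱf)(x) conj((ℱg)(x)) w(x) dx = ∫_0^∞ [ conj(g₁(ρ)) f₁(ρ) − h(ρ) conj(g₁(ρ)) f₂(ρ) − conj(h(ρ)) conj(g₂(ρ)) f₁(ρ) + conj(g₂(ρ)) f₂(ρ) ] (W₀(ρ)/(1−|h(ρ)|²)) dρ. -/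

import Mathlib

noncomputable section

open MeasureTheory Filter Topology Set Asymptotics ComplexConjugate
open Complex (I)

/-- Pochhammer symbol `(a)ₙ = a(a+1)⋯(a+n-1)`. -/
def poch (a : ℂ) (n : ℕ) : ℂ := ∏ k ∈ Finset.range n, (a + k)

/-- Generalized hypergeometric series `ₚF_q(a; b; z)` as a sum. -/
def pFq (a b : List ℂ) (z : ℂ) : ℂ :=
  ∑' n : ℕ, ((a.map fun c => poch c n).prod / (b.map fun c => poch c n).prod) * z ^ n /
    (n.factorial : ℂ)

def F21 (a b c z : ℂ) : ℂ := pFq [a, b] [c] z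
def F32 (a b c d e z : ℂ) : ℂ := pFq [a, b, c] [d, e] z

/-- The weight function `w(z)`. -/
def wfun (k₁ k₂ t φ : ℝ) (z : ℂ) : ℂ :=
  ((1 / (2 * Real.pi) : ℝ) : ℂ) *
    Complex.exp ((2 * z + (t : ℂ)) * (2 * (φ : ℂ) - (Real.pi : ℂ))) *
    Complex.Gamma ((k₁ : ℂ) + I * t + I * z) * Complex.Gamma ((k₁ : ℂ) - I * t - I * z) *
    Complex.Gamma ((k₂ : ℂ) + I * z) * Complex.Gamma ((k₂ : ℂ) - I * z)

/-- The `i`-periodic function `p(z) = (1/π) e^{πz} sin(π(k₁ − it − iz))`. -/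
def pper (k₁ t : ℝ) (z : ℂ) : ℂ :=
  (1 / (Real.pi : ℂ)) * Complex.exp ((Real.pi : ℂ) * z) *
    Complex.sin ((Real.pi : ℂ) * ((k₁ : ℂ) - I * t - I * z))

/-- The continuous Hahn function `φ_ρ`. -/
def phiC (k₁ k₂ t φ : ℝ) (ρ : ℂ) (z : ℂ) : ℂ :=
  Complex.exp (-2 * (φ : ℂ) * z) * pper k₁ t z *
    (Complex.Gamma (1 - (k₁ : ℂ) + I * t + I * z) / Complex.Gamma ((k₁ : ℂ) + I * z + I * t)) *
    F32 ((k₂ : ℂ) - I * z) ((k₂ : ℂ) - (k₁ : ℂ) + 1/2 + I * ρ)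
      ((k₂ : ℂ) - (k₁ : ℂ) + 1/2 - I * ρ) (2 * (k₂ : ℂ)) ((k₂ : ℂ) - (k₁ : ℂ) + I * t + 1) 1

/-- The spectral weight `W₀(ρ)`. -/
def W0 (k₁ k₂ t φ : ℝ) (ρ : ℝ) : ℝ :=
  (1 / (2 * Real.pi)) * Real.exp (-t * (2 * φ - Real.pi)) *
    ‖Complex.Gamma ((k₂ : ℂ) - k₁ + 1/2 + I * ρ) * Complex.Gamma ((k₁ : ℂ) + k₂ - 1/2 + I * ρ) *
        Complex.Gamma (1/2 + I * t + I * ρ) * Complex.Gamma (1/2 - I * t + I * ρ) /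
        (Complex.Gamma (2 * (k₂ : ℂ)) * Complex.Gamma ((k₂ : ℂ) - k₁ + I * t + 1) *
          Complex.Gamma (2 * I * ρ))‖ ^ 2

/-- `h(ρ)`. -/
def hfun (k₁ k₂ t : ℝ) (ρ : ℝ) : ℂ :=
  Complex.Gamma (1/2 + I * t + I * ρ) * Complex.Gamma (1/2 + I * t - I * ρ) /
    (Complex.Gamma ((k₁ : ℂ) - k₂ + I * t) * Complex.Gamma ((k₂ : ℂ) - k₁ + I * t + 1))

/-- The function `q_n(ρ)`, where `F` is the analytic continuation of `₂F₁` to `ℂ∖[1,∞)`. -/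
def qfun (k₁ k₂ t φ : ℝ) (F : ℂ → ℂ → ℂ → ℂ → ℂ) (n : ℕ) (ρ : ℝ) : ℂ :=
  Complex.exp (((t * (2 * φ - Real.pi) : ℝ) : ℂ)) *
    (-Complex.exp (-I * φ) / (1 - Complex.exp (-2 * I * φ))) ^ (2 * (k₂ : ℂ) + n) *
    ((-1 : ℂ) ^ n * Complex.Gamma (2 * (k₂ : ℂ)) * poch ((k₂ : ℂ) - k₁ + 1/2 + I * ρ) n *
        poch ((k₂ : ℂ) - k₁ + 1/2 - I * ρ) n) /
      ((n.factorial : ℂ) * poch ((k₂ : ℂ) - k₁ + I * t + 1) n) *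
    F ((n : ℂ) + k₂ - k₁ + 1/2 + I * ρ) ((n : ℂ) + k₂ - k₁ + 1/2 - I * ρ)
      ((n : ℂ) + k₂ - k₁ + I * t + 1) (1 / (1 - Complex.exp (2 * I * φ)))

/-- The pair `𝐪_n = (conj q_n, q_n)`. -/
def qpair (k₁ k₂ t φ : ℝ) (F : ℂ → ℂ → ℂ → ℂ → ℂ) (n : ℕ) : ℝ → ℂ × ℂ :=
  fun ρ => (conj (qfun k₁ k₂ t φ F n ρ), qfun k₁ k₂ t φ F n ρ)

/-- The continuous Hahn transform of a pair `f = (f₁, f₂)`. -/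
def Fop (k₁ k₂ t φ : ℝ) (f : ℝ → ℂ × ℂ) (x : ℝ) : ℂ :=
  ∫ ρ in Ioi (0:ℝ),
    (phiC k₁ k₂ t φ (ρ : ℂ) (x : ℂ) * (f ρ).1 -
        phiC k₁ k₂ t φ (ρ : ℂ) (x : ℂ) * hfun k₁ k₂ t ρ * (f ρ).2 -
        conj (phiC k₁ k₂ t φ (ρ : ℂ) (x : ℂ)) * conj (hfun k₁ k₂ t ρ) * (f ρ).1 +
        conj (phiC k₁ k₂ t φ (ρ : ℂ) (x : ℂ)) * (f ρ).2) *
      (((W0 k₁ k₂ t φ ρ / (1 - ‖hfun k₁ k₂ t ρ‖ ^ 2)) : ℝ) : ℂ)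

open Complex (GammaSeq_tendsto_Gamma Gamma_add_one Gamma_conj Gamma_mul_Gamma_one_sub Gamma_ne_zero Gamma_ne_zero_of_re_pos I_ne_zero I_sq abs_im_le_norm abs_re_le_norm add_re conj_I conj_conj conj_ofReal continuous_conj continuous_ofReal continuous_re cpow_add cpow_def_of_ne_zero cpow_natCast cpow_neg differentiableAt_Gamma differentiable_one_div_Gamma exp_mul_I exp_nat_mul im measurable_ofReal mul_conj mul_conj' normSq_apply normSq_eq_norm_sq norm_I norm_conj norm_cpow_eq_rpow_re_of_pos norm_exp norm_exp_ofReal_mul_I norm_ofNat norm_real ofRealCLM ofReal_add ofReal_cos ofReal_cosh ofReal_cpow ofReal_exp ofReal_log ofReal_mul ofReal_neg ofReal_one ofReal_re ofReal_sin ofReal_sinh ofReal_zero one_re re re_le_norm re_ofReal_mul real_smul slitPlane slitPlane_ne_zero sub_re)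
open Real (add_one_le_exp continuous_fourierChar cos cosh cosh_eq cosh_pos cosh_sq cosh_two_mul dist_eq exp exp_add exp_le_exp exp_le_one_iff exp_log exp_lt_one_iff exp_neg exp_pos log_exp log_neg measurable_log mul_rpow neg_one_le_cos norm_eq_abs norm_of_nonneg one_le_rpow pi_gt_three pi_ne_zero pi_pos rpow_add rpow_def_of_pos rpow_le_one rpow_le_rpow rpow_le_rpow_of_exponent_ge rpow_le_rpow_of_nonpos rpow_natCast rpow_neg rpow_nonneg rpow_one rpow_pos_of_pos rpow_sub_one rpow_zero sin sin_sq_add_cos_sq sinh sinh_pos_iff sinh_two_mul sqrt sqrt_sq volume_Icc)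
local notation "bpos" => (by positivity)
local notation "blin" => (by linarith)
local notation "bfun" => (by fun_prop)
local notation "bnum" => (by norm_num)
local notation "bsl" => (by simp; linarith)
local notation "bsimp" => (by simp)
local notation "bomega" => (by omega)
set_option hygiene false in
local notation "nR" => ((n:ℝ)+1)
set_option hygiene false in
local notation "jR" => ((j:ℝ)+1)
local notation "zR" => (0:ℝ)
set_option hygiene false in
local notation "xC" => (x:ℂ)
set_option hygiene false in
local notation "nC" => (n:ℂ)
local notation "nnn" => (norm_nonneg _)
local notation "cexp" => Complex.exp
local notation "π" => Real.pi
set_option hygiene false in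
local notation "aₖ" => (k₂-k₁+1/2)
set_option hygiene false in
local notation "bₖ" => (k₁+k₂-1/2)
set_option hygiene false in
local notation "phiCₖ" => phiC k₁ k₂ t φ
set_option hygiene false in
local notation "W0ₖ" => W0 k₁ k₂ t φ



lemma poch_zero (a : ℂ) : poch a 0 = 1 := by simp [poch]

lemma poch_succ (a : ℂ) (n : ℕ) : poch a (n+1) = poch a n * (a + n) := by
  simp [poch, Finset.prod_range_succ]

lemma poch_succ' (a : ℂ) (n : ℕ) : poch a (n+1) = a * poch (a+1) n := by
  simp only [poch, Finset.prod_range_succ']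
  rw [mul_comm]; simp [add_assoc, add_comm (1:ℂ)]

lemma poch_ne_zero {a : ℂ} (h : ∀ m : ℕ, a ≠ -m) (n : ℕ) : poch a n ≠ 0 := by
  rw [poch, Finset.prod_ne_zero_iff]
  intro k _ hk
  exact h k (eq_neg_of_add_eq_zero_left hk)

lemma ne_neg_nat_of_re_pos {a : ℂ} (h : 0 < a.re) (m : ℕ) : a ≠ -m := by
  intro h'
  rw [h'] at h
  simp at h
  have := Nat.cast_nonneg (α := ℝ) m
  linarith

lemma ne_neg_nat_of_im_ne {a : ℂ} (h : a.im ≠ 0) (m : ℕ) : a ≠ -m := by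
  intro h'
  rw [h'] at h
  simp at h

lemma Gamma_add_nat {a : ℂ} (h : ∀ m : ℕ, a ≠ -m) (n : ℕ) :
    Complex.Gamma (a + n) = poch a n * Complex.Gamma a := by
  induction n with
  | zero => simp [poch_zero]
  | succ n ih =>
    have : a + n ≠ 0 := fun hk => h n (eq_neg_of_add_eq_zero_left hk)
    rw [poch_succ, Nat.cast_succ, ← add_assoc, Gamma_add_one _ this, ih]; ring

lemma poch_conj (a : ℂ) (n : ℕ) : poch (conj a) n = conj (poch a n) := by
  simp [poch, map_prod]

lemma poch_one (n : ℕ) : poch 1 n = n.factorial := by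
  induction n with
  | zero => simp [poch_zero]
  | succ n ih => rw [poch_succ, ih, Nat.factorial_succ]; push_cast; ring

lemma poch_eq_asc (a : ℂ) (n : ℕ) : poch a n = (ascPochhammer ℂ n).eval a := by
  induction n with
  | zero => simp [poch_zero]
  | succ n ih => rw [poch_succ, ih, ascPochhammer_succ_eval]

lemma binom_hasSum (a : ℂ) {z : ℂ} (hz : ‖z‖ < 1) :
    HasSum (fun n : ℕ => poch a n / n.factorial * z ^ n) ((1 - z) ^ (-a)) := by
  have h := Complex.one_div_one_sub_cpow_hasFPowerSeriesOnBall_zero a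
  have h2 := h.hasSum (y := z) (by simpa [Metric.mem_eball, edist_zero_right, enorm_eq_nnnorm, ← NNReal.coe_lt_coe] using hz)
  simp only [zero_add] at h2
  rw [cpow_neg, ← one_div]
  refine h2.congr_fun fun n => ?_
  rw [FormalMultilinearSeries.ofScalars_apply_eq, smul_eq_mul]
  congr 1
  rw [div_eq_iff (by exact_mod_cast n.factorial_ne_zero), mul_comm, ← nsmul_eq_mul,
    ← Ring.descPochhammer_eq_factorial_smul_choose, poch_eq_asc,
    ← Polynomial.ascPochhammer_smeval_eq_eval]
  rw [Polynomial.descPochhammer_smeval_eq_ascPochhammer]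
  rw [← Polynomial.ascPochhammer_smeval_cast ℂ, ← Polynomial.ascPochhammer_smeval_cast ℂ]
  congr 1
  ring_nf

lemma poch_ratio_tendsto (A B : ℂ) (hA : ∀ m : ℕ, A ≠ -m) (hB : ∀ m : ℕ, B ≠ -m) :
    Tendsto (fun n : ℕ => poch A (n+1) / poch B (n+1) * nC ^ (B - A)) atTop
      (𝓝 (Complex.Gamma B / Complex.Gamma A)) := by
  have h1 := GammaSeq_tendsto_Gamma A
  have h2 := GammaSeq_tendsto_Gamma B
  refine (h2.div h1 (Gamma_ne_zero hA)).congr' ?_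
  filter_upwards [eventually_gt_atTop 0] with n hn
  have hn' : nC ≠ 0 := by exact_mod_cast hn.ne'
  simp only [Complex.GammaSeq, Pi.div_apply]
  rw [Complex.cpow_sub _ _ hn']
  have e1 : ∏ j ∈ Finset.range (n+1), (A + j) ≠ 0 := poch_ne_zero hA (n+1)
  have e2 : ∏ j ∈ Finset.range (n+1), (B + j) ≠ 0 := poch_ne_zero hB (n+1)
  have e3 : nC ^ A ≠ 0 := by simp [Complex.cpow_eq_zero_iff, hn']
  have e4 : (n.factorial : ℂ) ≠ 0 := by exact_mod_cast n.factorial_ne_zero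
  simp only [poch]
  field_simp

lemma poch_zero_of_neg {A : ℂ} {m : ℕ} (h : A = -m) {n : ℕ} (hn : m < n) : poch A n = 0 := by
  rw [poch, Finset.prod_eq_zero_iff]
  exact ⟨m, by simpa using hn, by simp [h]⟩

lemma poch_ratio_bound (A B : ℂ) (hB : ∀ m : ℕ, B ≠ -m) :
    ∃ C : ℝ, 0 < C ∧ ∀ n : ℕ, ‖poch A n / poch B n‖ ≤ C * nR ^ (A.re - B.re) := by
  have key : ∃ C : ℝ, ∀ᶠ n : ℕ in atTop, ‖poch A n / poch B n‖ ≤ C * nR ^ (A.re - B.re) := by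
    by_cases hA : ∀ m : ℕ, A ≠ -m
    · have h := (poch_ratio_tendsto A B hA hB).norm
      have h2 := h.eventually_le_const (lt_add_one _)
      set K := ‖Complex.Gamma B / Complex.Gamma A‖ + 1
      have hK : 0 ≤ K := by positivity
      refine ⟨K * 3 ^ |A.re - B.re|, ?_⟩
      have h5 := (tendsto_sub_atTop_nat 1).eventually (h2.and (eventually_gt_atTop 0))
      filter_upwards [h5, eventually_gt_atTop 0] with n' hn' hn'0
      obtain ⟨n, rfl⟩ : ∃ n, n' = n + 1 := ⟨n' - 1, by omega⟩
      obtain ⟨hn, hn0⟩ := hn'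
      rw [Nat.add_sub_cancel] at hn hn0
      have hn0' : zR < n := by exact_mod_cast hn0
      rw [norm_mul] at hn
      rw [Complex.norm_natCast_cpow_of_pos hn0, sub_re] at hn
      have e : ‖poch A (n+1) / poch B (n+1)‖ ≤ K * (n:ℝ) ^ (A.re - B.re) := by
        rw [show B.re - A.re = - (A.re - B.re) by ring, rpow_neg hn0'.le, ← div_eq_mul_inv,
          div_le_iff₀ bpos] at hn
        exact hn
      refine e.trans ?_
      rw [mul_assoc]
      gcongr
      push_cast
      have hle : (n:ℝ) ≤ n + 1 + 1 := by linarith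
      have hle2 : (n:ℝ) + 1 + 1 ≤ 3 * n := by
        have : (1:ℝ) ≤ n := by exact_mod_cast hn0
        linarith
      rcases le_total 0 (A.re - B.re) with h0 | h0
      · calc (n:ℝ) ^ (A.re - B.re) ≤ ((n:ℝ)+1+1) ^ (A.re - B.re) := by gcongr
          _ ≤ _ := le_mul_of_one_le_left bpos (one_le_rpow bnum (abs_nonneg _))
      · rw [abs_of_nonpos h0]
        calc (n:ℝ) ^ (A.re - B.re) = 3 ^ (-(A.re - B.re)) * (3 * (n:ℝ)) ^ (A.re - B.re) := by
              rw [mul_rpow bnum hn0'.le, ← mul_assoc, ← rpow_add bnum]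
              simp
          _ ≤ _ := by
            gcongr ?_ * ?_
            exact rpow_le_rpow_of_nonpos bpos hle2 h0
    · push Not at hA
      obtain ⟨m, hm⟩ := hA
      refine ⟨0, ?_⟩
      filter_upwards [eventually_gt_atTop m] with n hn
      simp [poch_zero_of_neg hm hn]
  obtain ⟨C, hC⟩ := key
  obtain ⟨N, hN⟩ := eventually_atTop.1 hC
  refine ⟨|C| + 1 + ∑ n ∈ Finset.range N, ‖poch A n / poch B n‖ / nR ^ (A.re - B.re), by positivity, ?_⟩
  intro n
  have hp : 0 < nR ^ (A.re - B.re) := by positivity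
  rcases lt_or_ge n N with h | h
  · rw [← div_le_iff₀ hp]
    have := Finset.single_le_sum (f := fun n : ℕ => ‖poch A n / poch B n‖ / nR ^ (A.re - B.re))
      (fun i _ => by positivity) (Finset.mem_range.2 h)
    have := abs_nonneg C
    linarith
  · refine (hN n h).trans ?_
    gcongr
    have := le_abs_self C
    have h3 : 0 ≤ ∑ n ∈ Finset.range N, ‖poch A n / poch B n‖ / nR ^ (A.re - B.re) :=
      Finset.sum_nonneg (fun i _ => by positivity)
    linarith

def hc (a b c : ℂ) (n : ℕ) : ℂ := poch a n * poch b n / (poch c n * n.factorial)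

lemma F21_eq (a b c z : ℂ) : F21 a b c z = ∑' n, hc a b c n * z ^ n := by
  simp only [F21, pFq, hc, List.map_cons, List.map_nil, List.prod_cons, List.prod_nil, mul_one]
  congr 1; ext n; ring

lemma fact_ne (n : ℕ) : (n.factorial : ℂ) ≠ 0 := by exact_mod_cast n.factorial_ne_zero

lemma one_ne_neg_nat (m : ℕ) : (1:ℂ) ≠ -m := ne_neg_nat_of_re_pos bsimp m

lemma hc_bound (A B D : ℂ) (hD : ∀ m : ℕ, D ≠ -m) :
    ∃ C : ℝ, 0 < C ∧ ∀ n : ℕ, ‖hc A B D n‖ ≤ C * nR ^ (A.re + B.re - D.re - 1) := by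
  obtain ⟨C1, h1, H1⟩ := poch_ratio_bound A D hD
  obtain ⟨C2, h2, H2⟩ := poch_ratio_bound B 1 one_ne_neg_nat
  refine ⟨C1 * C2, by positivity, fun n => ?_⟩
  have e : hc A B D n = (poch A n / poch D n) * (poch B n / poch 1 n) := by
    rw [hc, poch_one]; ring
  rw [e, norm_mul]
  calc _ ≤ (C1 * nR ^ (A.re - D.re)) * (C2 * nR ^ (B.re - (1:ℂ).re)) := by
        gcongr
        · exact H1 n
        · exact H2 n
    _ = C1 * C2 * (nR ^ (A.re - D.re) * nR ^ (B.re - 1)) := by simp; ring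
    _ = _ := by
        rw [← rpow_add bpos]; congr 2; ring

lemma hc_rec (A B D : ℂ) (hD : ∀ m : ℕ, D ≠ -m) (n : ℕ) :
    (nC+1) * (D + n) * hc A B D (n+1) = (A + n) * (B + n) * hc A B D n := by
  have h1 := poch_ne_zero hD n
  have h2 : D + n ≠ 0 := fun h => hD n (eq_neg_of_add_eq_zero_left h)
  have h3 := fact_ne n
  have h4 : nC+1 ≠ 0 := by exact_mod_cast n.succ_ne_zero
  simp only [hc, poch_succ, Nat.factorial_succ]
  push_cast
  field_simp

lemma summable_pow_poly (σ : ℝ) {x : ℝ} (h0 : 0 ≤ x) (h1 : x < 1) :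
    Summable (fun n : ℕ => nR ^ σ * x ^ n) := by
  obtain ⟨k, hk⟩ := exists_nat_ge σ
  have h : Summable (fun n : ℕ => ((n:ℝ)^k * x ^ n)) := summable_pow_mul_geometric_of_norm_lt_one k (by
    rwa [norm_of_nonneg h0])
  have h' := (summable_nat_add_iff 1).2 h
  rcases h0.eq_or_lt with h00 | h00
  · refine summable_of_ne_finset_zero (s := {0}) fun n hn => ?_
    rw [← h00, zero_pow (by simpa using hn), mul_zero]
  · refine Summable.of_nonneg_of_le (fun n => by positivity) (fun n => ?_) (h'.mul_left (x⁻¹))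
    push_cast
    calc nR ^ σ * x ^ n ≤ nR ^ (k:ℝ) * x ^ n := by
          gcongr; linarith [Nat.cast_nonneg (α := ℝ) n]
      _ = _ := by rw [rpow_natCast, pow_succ]; field_simp

/-- general power series with polynomially bounded coefficients -/
def pser (c : ℕ → ℂ) (z : ℂ) : ℂ := ∑' n, c n * z ^ n

def PB (c : ℕ → ℂ) : Prop := ∃ C σ : ℝ, ∀ n : ℕ, ‖c n‖ ≤ C * nR ^ σ

lemma PB.summable {c : ℕ → ℂ} (h : PB c) {z : ℂ} (hz : ‖z‖ < 1) :
    Summable (fun n => ‖c n * z ^ n‖) := by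
  obtain ⟨C, σ, h⟩ := h
  refine Summable.of_nonneg_of_le (fun n => by positivity) (fun n => ?_)
    ((summable_pow_poly σ (norm_nonneg z) hz).mul_left C)
  rw [norm_mul, norm_pow, ← mul_assoc]
  gcongr
  exact h n

lemma PB.hasSum {c : ℕ → ℂ} (h : PB c) {z : ℂ} (hz : ‖z‖ < 1) :
    HasSum (fun n => c n * z ^ n) (pser c z) := (h.summable hz).of_norm.hasSum

def dsh (c : ℕ → ℂ) : ℕ → ℂ := fun n => (nC+1) * c (n+1)

lemma PB.dsh {c : ℕ → ℂ} (h : PB c) : PB (dsh c) := by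
  obtain ⟨C, σ, h⟩ := h
  have hC : 0 ≤ C := by
    have := (norm_nonneg _).trans (h 0)
    simpa using this
  refine ⟨C * 2 ^ |σ|, σ + 1, fun n => ?_⟩
  simp only [_root_.dsh, norm_mul]
  have e : ‖nC+1‖ = (n:ℝ)+1 := by
    rw [show nC+1 = ((n+1:ℕ):ℂ) by push_cast; rfl, Complex.norm_natCast]; push_cast; rfl
  have hn : zR < (n:ℝ) + 1 := by positivity
  rw [e, rpow_add hn, rpow_one]
  have h1 := h (n+1)
  push_cast at h1
  have h2 : ((n:ℝ)+1+1) ^ σ ≤ 2 ^ |σ| * nR ^ σ := by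
    rcases le_total 0 σ with h0 | h0
    · rw [abs_of_nonneg h0, ← mul_rpow bnum hn.le]
      gcongr
      linarith
    · calc ((n:ℝ)+1+1) ^ σ ≤ nR ^ σ :=
            rpow_le_rpow_of_nonpos hn blin h0
        _ ≤ _ := le_mul_of_one_le_left bpos (one_le_rpow bnum (abs_nonneg _))
  calc nR * ‖c (n+1)‖ ≤ nR * (C * (2 ^ |σ| * nR ^ σ)) := by
        gcongr; exact h1.trans (by gcongr)
    _ = _ := by ring

lemma PB.hasDerivAt {c : ℕ → ℂ} (h : PB c) {z : ℂ} (hz : ‖z‖ < 1) :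
    HasDerivAt (pser c) (pser (_root_.dsh c) z) z := by
  obtain ⟨r, hr1, hr2⟩ := exists_between hz
  have hr0 : 0 ≤ r := (norm_nonneg z).trans hr1.le
  have hs : Summable (fun n : ℕ => ‖_root_.dsh c n‖ * r ^ n) := by
    have := h.dsh.summable (z := (r:ℂ)) (by rwa [norm_real, norm_of_nonneg hr0])
    simpa [norm_real, abs_of_nonneg hr0] using this
  let u : ℕ → ℝ := fun n => n * ‖c n‖ * r ^ (n-1)
  have hu : Summable u := by
    rw [← summable_nat_add_iff 1]
    refine hs.congr fun n => ?_
    simp only [u, _root_.dsh, norm_mul, Nat.add_sub_cancel]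
    rw [show nC+1 = ((n+1:ℕ):ℂ) by push_cast; rfl, Complex.norm_natCast]
  have key := hasDerivAt_tsum_of_isPreconnected (u := u) (t := Metric.ball (0:ℂ) r)
    (g := fun n z => c n * z ^ n) (g' := fun n z => c n * (n * z ^ (n-1))) (y₀ := 0) (y := z) hu
    Metric.isOpen_ball (convex_ball _ _).isPreconnected
    (fun n y _ => ((hasDerivAt_pow n y).const_mul (c n)))
    (fun n y hy => by
      simp only [u, norm_mul, norm_pow, Complex.norm_natCast]
      have : ‖y‖ ≤ r := by simpa using (mem_ball_zero_iff.1 hy).le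
      calc ‖c n‖ * (n * ‖y‖^(n-1)) ≤ ‖c n‖ * (n * r^(n-1)) := by gcongr
        _ = _ := by ring)
    (Metric.mem_ball_self ((norm_nonneg z).trans_lt hr1)) (by
      refine summable_of_ne_finset_zero (s := {0}) fun n hn => ?_
      rw [zero_pow (by simpa using hn), mul_zero]) (by simpa using hr1)
  have e : ∑' n, c n * (n * z ^ (n-1)) = pser (_root_.dsh c) z := by
    rw [pser, Summable.tsum_eq_zero_add]
    · simp only [CharP.cast_eq_zero, zero_mul, mul_zero, zero_add]
      congr 1; ext n
      simp [_root_.dsh]; ring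
    · rw [← summable_nat_add_iff 1]
      refine (h.dsh.hasSum hz).summable.congr fun n => ?_
      simp [_root_.dsh]; ring
  rw [← e]
  exact key

lemma PB.differentiableOn {c : ℕ → ℂ} (h : PB c) : DifferentiableOn ℂ (pser c) (Metric.ball 0 1) :=
  fun _ hz => (h.hasDerivAt (mem_ball_zero_iff.1 hz)).differentiableAt.differentiableWithinAt

lemma hc_PB (A B D : ℂ) (hD : ∀ m : ℕ, D ≠ -m) : PB (hc A B D) := by
  obtain ⟨C, _, h⟩ := hc_bound A B D hD
  exact ⟨C, _, h⟩

lemma F21_pser (A B D : ℂ) : F21 A B D = pser (hc A B D) := by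
  ext z; rw [F21_eq, pser]

/-- hypergeometric ODE -/
lemma F21_ode (A B D : ℂ) (hD : ∀ m : ℕ, D ≠ -m) {z : ℂ} (hz : ‖z‖ < 1) :
    z * (1 - z) * pser (dsh (dsh (hc A B D))) z + (D - (A + B + 1) * z) * pser (dsh (hc A B D)) z
      - A * B * pser (hc A B D) z = 0 := by
  have hP := hc_PB A B D hD
  set c := hc A B D with hcd
  have s0 := hP.hasSum hz
  have s1 := hP.dsh.hasSum hz
  have s2 := hP.dsh.dsh.hasSum hz
  -- z c' as sum n c n z^n
  have t1 : HasSum (fun n : ℕ => nC * c n * z ^ n) (z * pser (dsh c) z) := by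
    have : HasSum (fun n : ℕ => ((n+1:ℕ):ℂ) * c (n+1) * z ^ (n+1)) (z * pser (dsh c) z) := by
      refine (s1.mul_left z).congr_fun fun n => ?_
      simp [dsh]; ring
    rw [hasSum_nat_add_iff (f := fun n : ℕ => nC * c n * z ^ n)] at this
    simpa using this
  have t2 : HasSum (fun n : ℕ => nC * dsh c n * z ^ n) (z * pser (dsh (dsh c)) z) := by
    have : HasSum (fun n : ℕ => ((n+1:ℕ):ℂ) * dsh c (n+1) * z ^ (n+1)) (z * pser (dsh (dsh c)) z) := by
      refine (s2.mul_left z).congr_fun fun n => ?_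
      simp [dsh]; ring
    rw [hasSum_nat_add_iff (f := fun n : ℕ => nC * dsh c n * z ^ n)] at this
    simpa using this
  have t3 : HasSum (fun n : ℕ => nC * (nC-1) * c n * z ^ n) (z^2 * pser (dsh (dsh c)) z) := by
    have : HasSum (fun n : ℕ => ((n+1:ℕ):ℂ) * (((n+1:ℕ):ℂ)-1) * c (n+1) * z ^ (n+1)) (z^2 * pser (dsh (dsh c)) z) := by
      rw [show z^2 * pser (dsh (dsh c)) z = z * (z * pser (dsh (dsh c)) z) by ring]
      refine (t2.mul_left z).congr_fun fun n => ?_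
      simp [dsh]; ring
    rw [hasSum_nat_add_iff (f := fun n : ℕ => nC * (nC-1) * c n * z ^ n)] at this
    simpa using this
  have L := t2.add (s1.mul_left D)
  have R := (t3.add (t1.mul_left (A+B+1))).add (s0.mul_left (A*B))
  have E := L.unique (R.congr_fun fun n => by
    have := hc_rec A B D hD n
    rw [← hcd] at this
    simp only [dsh]
    linear_combination (z^n) * this)
  linear_combination E

lemma poch_add (a : ℂ) (k m : ℕ) : poch a (k+m) = poch a k * poch (a+k) m := by
  induction m with
  | zero => simp [poch_zero]
  | succ m ih => rw [← add_assoc, poch_succ, ih, poch_succ]; push_cast; ring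

lemma chu_vandermonde (n : ℕ) : ∀ (E C : ℂ), (∀ m : ℕ, C ≠ -m) →
    ∑ k ∈ Finset.range (n+1), (-1:ℂ)^k * (n.choose k) * (poch E k / poch C k)
      = poch (C - E) n / poch C n := by
  induction n with
  | zero => intro E C _; simp [poch_zero]
  | succ n ih =>
    intro E C hC
    have hC1 : ∀ m : ℕ, C + 1 ≠ -m := fun m h => hC (m+1) (by push_cast; linear_combination h)
    have hC0 : C ≠ 0 := by simpa using hC 0
    have hCn : C + n ≠ 0 := fun h => hC n (eq_neg_of_add_eq_zero_left h)
    have h1 := ih E C hC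
    have h2 := ih (E+1) (C+1) hC1
    have e : ∑ k ∈ Finset.range (n+1+1), (-1:ℂ)^k * ((n+1).choose k) * (poch E k / poch C k)
        = ∑ k ∈ Finset.range (n+1), (-1:ℂ)^k * (n.choose k) * (poch E k / poch C k)
        - (E/C) * ∑ k ∈ Finset.range (n+1), (-1:ℂ)^k * (n.choose k) * (poch (E+1) k / poch (C+1) k) := by
      rw [Finset.sum_range_succ']
      have a1 : ∀ k ∈ Finset.range (n+1), (-1:ℂ)^(k+1) * ((n+1).choose (k+1)) * (poch E (k+1) / poch C (k+1))
          = (-1:ℂ)^(k+1) * (n.choose (k+1)) * (poch E (k+1) / poch C (k+1)) -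
            (E/C) * ((-1:ℂ)^k * (n.choose k) * (poch (E+1) k / poch (C+1) k)) := by
        intro k _
        have := poch_ne_zero hC1 k
        rw [Nat.choose_succ_succ, poch_succ' E, poch_succ' C]
        push_cast
        field_simp
        ring
      rw [Finset.sum_congr rfl a1, Finset.sum_sub_distrib, ← Finset.mul_sum]
      have a2 : ∑ k ∈ Finset.range (n+1), (-1:ℂ)^k * (n.choose k) * (poch E k / poch C k)
         = ∑ k ∈ Finset.range (n+1), (-1:ℂ)^(k+1) * (n.choose (k+1)) * (poch E (k+1) / poch C (k+1)) + 1 := by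
        have := Finset.sum_range_succ' (fun k => (-1:ℂ)^k * (n.choose k) * (poch E k / poch C k)) (n+1)
        rw [Finset.sum_range_succ] at this
        simpa [poch_zero] using this
      rw [a2]
      simp [poch_zero]
      ring
    have hp := poch_ne_zero hC n
    have hp1 : poch (C+1) n = poch C n * (C+n) / C := by
      rw [eq_div_iff hC0, ← poch_succ, poch_succ']; ring
    rw [e, h1, h2, hp1, poch_succ, poch_succ, show C + 1 - (E+1) = C - E by ring]
    field_simp
    ring

lemma norm_poch_le {a : ℂ} {s : ℝ} (h : ‖a‖ ≤ s) (n : ℕ) : ‖poch a n‖ ≤ ‖poch (s:ℂ) n‖ := by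
  have hs := (norm_nonneg a).trans h
  simp only [poch, norm_prod]
  refine Finset.prod_le_prod (fun _ _ => norm_nonneg _) fun k _ => ?_
  rw [show ((s:ℂ) + k) = ((s + k : ℝ):ℂ) by push_cast; rfl, norm_real,
    norm_of_nonneg bpos]
  exact (norm_add_le _ _).trans (by rw [Complex.norm_natCast]; gcongr)

lemma norm_poch_real {s : ℝ} (hs : 0 ≤ s) (n : ℕ) : ((‖poch (s:ℂ) n‖:ℝ):ℂ) = poch (s:ℂ) n := by
  simp only [poch, norm_prod]
  push_cast
  refine Finset.prod_congr rfl fun k _ => ?_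
  rw [show ((s:ℂ) + k) = ((s + k : ℝ):ℂ) by push_cast; rfl, norm_real,
    norm_of_nonneg bpos]

lemma binom_hasSum_real {s x : ℝ} (hs : 0 ≤ s) (h0 : 0 ≤ x) (h1 : x < 1) :
    HasSum (fun n : ℕ => ‖poch (s:ℂ) n‖ / n.factorial * x ^ n) ((1 - x) ^ (-s)) := by
  have h := binom_hasSum (s:ℂ) (z := xC) (by rwa [norm_real, norm_of_nonneg h0])
  rw [← Complex.hasSum_ofReal]
  convert h using 2 with n
  · push_cast; rw [norm_poch_real hs]
  · rw [ofReal_cpow blin]; push_cast; rfl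

lemma hasSum_antidiagonal {f : ℕ × ℕ → ℂ} {T : ℂ} (h : HasSum f T) :
    HasSum (fun n => ∑ p ∈ Finset.HasAntidiagonal.antidiagonal n, f p) T := by
  have h2 := (Finset.HasAntidiagonal.sigmaAntidiagonalEquivProd (A := ℕ)).hasSum_iff.2 h
  refine h2.sigma fun n => ?_
  have := hasSum_fintype (fun p : Finset.HasAntidiagonal.antidiagonal n => f p)
  rw [Finset.sum_coe_sort (Finset.HasAntidiagonal.antidiagonal n) f] at this
  exact this

lemma pfaff (A B C : ℂ) (hC : ∀ m : ℕ, C ≠ -m) {z : ℂ} (hz : ‖z‖ < 1/4) :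
    F21 A B C z = (1 - z) ^ (-A) * F21 A (C - B) C (z / (z - 1)) := by
  have hz1 : ‖z‖ < 1 := by linarith
  have h1z : 1 - z ≠ 0 := by
    intro h
    have : z = 1 := by linear_combination -h
    rw [this] at hz1; simp at hz1
  have hzm : z - 1 ≠ 0 := by intro h; apply h1z; linear_combination -h
  have hlow : 3/4 ≤ ‖1 - z‖ := by
    have := norm_sub_norm_le (1:ℂ) z
    rw [norm_one] at this; linarith
  have hw : ‖z / (z-1)‖ < 1 := by
    rw [norm_div, norm_sub_rev, div_lt_one blin]; linarith
  let f : ℕ × ℕ → ℂ := fun p => hc A (C-B) C p.1 * (-1)^p.1 * (poch (A + p.1) p.2 / p.2.factorial) * z ^ (p.1+p.2)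
  have hPB := hc_PB A (C-B) C hC
  have inner : ∀ k, HasSum (fun m => f (k, m)) (hc A (C-B) C k * (-1)^k * z^k * (1 - z) ^ (-(A+k))) := by
    intro k
    refine ((binom_hasSum (A+k) hz1).mul_left (hc A (C-B) C k * (-1)^k * z^k)).congr_fun fun m => ?_
    simp only [f]; rw [pow_add]; ring
  have hsum : Summable f := by
    rw [← summable_norm_iff]
    have nn : ∀ k m, ‖f (k,m)‖ ≤ ‖hc A (C-B) C k‖ * ‖z‖^k * (‖poch ((‖A‖ + k : ℝ):ℂ) m‖ / m.factorial * ‖z‖^m) := by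
      intro k m
      simp only [f, norm_mul, norm_pow, norm_neg, norm_one, one_pow, mul_one, norm_div, Complex.norm_natCast]
      rw [pow_add]
      have : ‖poch (A + k) m‖ ≤ ‖poch ((‖A‖ + k : ℝ):ℂ) m‖ :=
        norm_poch_le ((norm_add_le _ _).trans (by rw [Complex.norm_natCast])) m
      calc _ = ‖hc A (C-B) C k‖ * ‖z‖^k * (‖poch (A + k) m‖ / m.factorial * ‖z‖^m) := by ring
        _ ≤ _ := by gcongr
    have hs : ∀ k : ℕ, HasSum (fun m : ℕ => ‖hc A (C-B) C k‖ * ‖z‖^k * (‖poch ((‖A‖ + k : ℝ):ℂ) m‖ / m.factorial * ‖z‖^m))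
        (‖hc A (C-B) C k‖ * ‖z‖^k * (1 - ‖z‖) ^ (-(‖A‖ + k))) := fun k =>
      (binom_hasSum_real bpos (norm_nonneg z) hz1).mul_left _
    rw [summable_prod_of_nonneg (fun _ => norm_nonneg _)]
    refine ⟨fun k => Summable.of_nonneg_of_le (fun _ => norm_nonneg _) (nn k) (hs k).summable, ?_⟩
    have hx : ‖((‖z‖ / (1 - ‖z‖) : ℝ) : ℂ)‖ < 1 := by
      rw [norm_real, norm_of_nonneg (div_nonneg nnn blin),
        div_lt_one blin]
      linarith
    refine Summable.of_nonneg_of_le (fun k => tsum_nonneg fun _ => norm_nonneg _) (fun k => ?_)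
      ((hPB.summable hx).mul_left ((1 - ‖z‖) ^ (-‖A‖)))
    refine (Summable.tsum_le_tsum (nn k) (Summable.of_nonneg_of_le (fun _ => norm_nonneg _) (nn k) (hs k).summable) (hs k).summable).trans ?_
    rw [(hs k).tsum_eq, norm_mul, norm_pow, norm_real, norm_of_nonneg (div_nonneg nnn blin)]
    rw [neg_add, rpow_add blin, rpow_neg blin (k:ℝ), rpow_natCast, div_pow]
    apply le_of_eq; ring
  have h1 : HasSum f (F21 A B C z) := by
    have h := hasSum_antidiagonal hsum.hasSum
    have : ∀ n, ∑ p ∈ Finset.HasAntidiagonal.antidiagonal n, f p = hc A B C n * z ^ n := by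
      intro n
      rw [Finset.Nat.sum_antidiagonal_eq_sum_range_succ_mk]
      have cv := chu_vandermonde n (C - B) C hC
      rw [sub_sub_cancel] at cv
      have : hc A B C n = poch A n / n.factorial * (poch B n / poch C n) := by rw [hc]; ring
      rw [this, ← cv, Finset.mul_sum, Finset.sum_mul]
      refine Finset.sum_congr rfl fun k hk => ?_
      have hk' : k ≤ n := Nat.lt_succ_iff.1 (Finset.mem_range.1 hk)
      simp only [f, hc]
      have e1 : poch A n = poch A k * poch (A + k) (n-k) := by rw [← poch_add, Nat.add_sub_cancel' hk']
      have e2 : (n.choose k : ℂ) = n.factorial / (k.factorial * (n-k).factorial) :=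
        Nat.cast_choose ℂ hk'
      rw [e1, e2, Nat.add_sub_cancel' hk']
      have := fact_ne n
      have := fact_ne k
      have := fact_ne (n-k)
      have := poch_ne_zero hC k
      field_simp
    rw [F21_eq, ← funext this, h.tsum_eq]
    exact hsum.hasSum
  have h2 := h1.prod_fiberwise inner
  have h3 : HasSum (fun k => hc A (C-B) C k * (-1)^k * z^k * (1 - z) ^ (-(A+k))) ((1 - z) ^ (-A) * F21 A (C - B) C (z / (z - 1))) := by
    rw [F21_pser]
    refine ((hPB.hasSum hw).mul_left ((1-z)^(-A))).congr_fun fun k => ?_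
    rw [neg_add, cpow_add _ _ h1z, cpow_neg _ (k:ℂ), cpow_natCast, div_pow,
      show z - 1 = (-1) * (1 - z) by ring, mul_pow]
    have := pow_ne_zero k h1z
    have : ((-1:ℂ)^k) * (-1)^k = 1 := by rw [← mul_pow]; simp
    field_simp
    linear_combination (hc A (C-B) C k * z^k * (1-z)^(-A)) * this
  exact h2.unique h3

lemma F21_symm (A B C z : ℂ) : F21 A B C z = F21 B A C z := by
  rw [F21_eq, F21_eq]; congr 1; ext n; simp only [hc]; ring

lemma one_sub_slit {z : ℂ} (hz : ‖z‖ < 1) : 1 - z ∈ slitPlane := by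
  left
  have := re_le_norm z
  simp; linarith

lemma euler_tr (A B C : ℂ) (hC : ∀ m : ℕ, C ≠ -m) {z : ℂ} (hz : ‖z‖ < 1) :
    F21 A B C z = (1 - z) ^ (C - A - B) * F21 (C - A) (C - B) C z := by
  have small : ∀ z : ℂ, ‖z‖ < 1/8 → F21 A B C z = (1 - z) ^ (C - A - B) * F21 (C - A) (C - B) C z := by
    intro z hz
    have hz1 : ‖z‖ < 1 := by linarith
    have hsl := one_sub_slit hz1
    have h1z : 1 - z ≠ 0 := slitPlane_ne_zero hsl
    have hzm : z - 1 ≠ 0 := by intro h; apply h1z; linear_combination -h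
    have hlow : 7/8 ≤ ‖1 - z‖ := by
      have := norm_sub_norm_le (1:ℂ) z
      rw [norm_one] at this; linarith
    have hw : ‖z / (z-1)‖ < 1/4 := by
      rw [norm_div, norm_sub_rev, div_lt_iff₀ blin]; linarith
    rw [pfaff A B C hC blin, F21_symm A, pfaff (C-B) A C hC hw]
    have e1 : 1 - z / (z-1) = (1 - z)⁻¹ := by
      rw [show z - 1 = -(1-z) by ring, div_neg, sub_neg_eq_add]; field_simp; ring
    have e2 : z / (z-1) / (z / (z-1) - 1) = z := by
      rw [show z / (z-1) - 1 = - (1 - z / (z-1)) by ring, e1]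
      rw [show z - 1 = -(1-z) by ring]; field_simp
    rw [e1, e2, Complex.inv_cpow _ _ (Complex.slitPlane_arg_ne_pi hsl), ← cpow_neg, neg_neg,
      ← mul_assoc, ← cpow_add _ _ h1z, F21_symm (C-B)]
    congr 2; ring
  have an1 : AnalyticOnNhd ℂ (F21 A B C) (Metric.ball 0 1) := by
    rw [F21_pser]; exact (hc_PB A B C hC).differentiableOn.analyticOnNhd Metric.isOpen_ball
  have an2 : AnalyticOnNhd ℂ (fun z => (1 - z) ^ (C - A - B) * F21 (C - A) (C - B) C z) (Metric.ball 0 1) := by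
    apply DifferentiableOn.analyticOnNhd _ Metric.isOpen_ball
    apply DifferentiableOn.mul
    · refine DifferentiableOn.cpow_const bfun ?_
      intro z hz
      exact one_sub_slit (mem_ball_zero_iff.1 hz)
    · rw [F21_pser]; exact (hc_PB _ _ C hC).differentiableOn
  refine an1.eqOn_of_preconnected_of_eventuallyEq an2 (convex_ball _ _).isPreconnected
    (Metric.mem_ball_self one_pos) ?_ (mem_ball_zero_iff.2 hz)
  filter_upwards [Metric.ball_mem_nhds (0:ℂ) (show zR < 1/8 by norm_num)] with w hw
  exact small w (mem_ball_zero_iff.1 hw)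

lemma beta_integrable {u v : ℂ} (hu : 0 < u.re) (hv : 0 < v.re) :
    IntegrableOn (fun x : ℝ => xC^(u-1) * (1 - xC)^(v-1)) (Ioo 0 1) := by
  have h := Complex.betaIntegral_convergent hu hv
  rw [intervalIntegrable_iff_integrableOn_Ioo_of_le zero_le_one] at h
  exact h

lemma beta_integral {u v : ℂ} (hu : 0 < u.re) (hv : 0 < v.re) :
    ∫ x in Ioo zR 1, xC^(u-1) * (1 - xC)^(v-1) =
      Complex.Gamma u * Complex.Gamma v / Complex.Gamma (u+v) := by
  rw [← Complex.betaIntegral_eq_Gamma_mul_div u v hu hv, Complex.betaIntegral,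
    intervalIntegral.integral_of_le zero_le_one, integral_Ioc_eq_integral_Ioo]

lemma norm_cpow_unit {x : ℝ} (hx : x ∈ Ioo zR 1) (u v : ℂ) :
    ‖xC^(u-1) * (1 - xC)^(v-1)‖ = x^(u.re-1) * (1-x)^(v.re-1) := by
  rw [norm_mul, norm_cpow_eq_rpow_re_of_pos hx.1,
    show (1 - xC) = ((1-x : ℝ):ℂ) by push_cast; rfl,
    norm_cpow_eq_rpow_re_of_pos (by linarith [hx.2])]
  simp

lemma beta_integrable_real {u v : ℝ} (hu : 0 < u) (hv : 0 < v) :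
    IntegrableOn (fun x : ℝ => x^(u-1) * (1 - x)^(v-1)) (Ioo 0 1) := by
  have h := (beta_integrable (u := u) (v := v) (by simpa) (by simpa)).norm
  refine (integrableOn_congr_fun (fun x hx => ?_) measurableSet_Ioo).1 h
  have := norm_cpow_unit hx (u:ℂ) (v:ℂ)
  simpa using this

lemma pow_sum_bound {σ : ℝ} (hσ : 0 < σ) : ∃ K : ℝ, 0 < K ∧ ∀ x : ℝ, 0 ≤ x → x < 1 →
    ∑' n : ℕ, nR ^ (σ-1) * x ^ n ≤ K * (1 - x) ^ (-σ) := by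
  obtain ⟨C, hC, h⟩ := poch_ratio_bound 1 (σ:ℂ) (ne_neg_nat_of_re_pos (by simpa))
  refine ⟨C, hC, fun x h0 h1 => ?_⟩
  have hs := binom_hasSum_real hσ.le h0 h1
  rw [← hs.tsum_eq, ← tsum_mul_left]
  refine Summable.tsum_le_tsum (fun n => ?_) (summable_pow_poly _ h0 h1) (hs.summable.mul_left C)
  rw [← mul_assoc]
  gcongr
  have h2 := h n
  have hp : 0 < ‖poch (σ:ℂ) n‖ := norm_pos_iff.2 (poch_ne_zero (ne_neg_nat_of_re_pos (by simpa)) n)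
  rw [norm_div, poch_one, Complex.norm_natCast, one_re, ofReal_re,
    show (1:ℝ) - σ = -(σ-1) by ring, rpow_neg bpos, ← div_eq_mul_inv,
    div_le_div_iff₀ hp bpos] at h2
  rw [← mul_div_assoc, le_div_iff₀ bpos]
  linarith

/-- integration of a power series against a beta weight -/
lemma beta_series {c : ℕ → ℂ} {C σ : ℝ} (hσ : 0 < σ)
    (hc : ∀ n : ℕ, ‖c n‖ ≤ C * nR ^ (σ-1)) {u v : ℂ} (hu : 0 < u.re) (hv : σ < v.re) :
    IntegrableOn (fun x : ℝ => xC^(u-1) * (1 - xC)^(v-1) * pser c x) (Ioo 0 1) ∧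
    HasSum (fun n : ℕ => c n * (Complex.Gamma (u+n) * Complex.Gamma v / Complex.Gamma (u+n+v)))
      (∫ x in Ioo zR 1, xC^(u-1) * (1 - xC)^(v-1) * pser c x) := by
  have hPB : PB c := ⟨C, σ-1, hc⟩
  have hC : 0 ≤ C := by simpa using (norm_nonneg _).trans (hc 0)
  have hv0 : 0 < v.re := hσ.trans hv
  obtain ⟨K, hK, hKb⟩ := pow_sum_bound hσ
  have nx : ∀ x ∈ Ioo zR 1, ‖xC‖ < 1 := fun x hx => by
    rw [norm_real, norm_of_nonneg hx.1.le]; exact hx.2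
  have bsum : ∀ x ∈ Ioo zR 1, ∑' n, ‖c n * xC^n‖ ≤ C * K * (1-x)^(-σ) := by
    intro x hx
    calc ∑' n, ‖c n * xC^n‖ ≤ ∑' n : ℕ, C * (nR ^ (σ-1) * x ^ n) := by
          refine Summable.tsum_le_tsum (fun n => ?_) (hPB.summable (nx x hx))
            ((summable_pow_poly _ hx.1.le hx.2).mul_left C)
          rw [norm_mul, norm_pow, norm_real, norm_of_nonneg hx.1.le, ← mul_assoc]
          have := pow_nonneg hx.1.le n
          gcongr; exact hc n
      _ ≤ _ := by rw [tsum_mul_left, mul_assoc]; exact mul_le_mul_of_nonneg_left (hKb x hx.1.le hx.2) hC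
  have mb : ∀ n, AEStronglyMeasurable (fun x : ℝ => xC^(u-1) * (1 - xC)^(v-1) * (c n * xC^n)) (volume.restrict (Ioo 0 1)) := by
    intro n
    exact (beta_integrable hu hv0).aestronglyMeasurable.mul bfun
  have dom : IntegrableOn (fun x : ℝ => C * K * (x^(u.re-1) * (1-x)^((v.re-σ)-1))) (Ioo 0 1) :=
    (beta_integrable_real hu blin).const_mul _
  have pe : ∀ x ∈ Ioo zR 1, x^(u.re-1) * (1-x)^(v.re-1) * (1-x)^(-σ) = x^(u.re-1) * (1-x)^((v.re-σ)-1) := by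
    intro x hx
    rw [mul_assoc, ← rpow_add (by linarith [hx.2])]; congr 2; ring
  have hs : ∀ x ∈ Ioo zR 1, HasSum (fun n => xC^(u-1) * (1 - xC)^(v-1) * (c n * xC^n)) (xC^(u-1) * (1 - xC)^(v-1) * pser c x) :=
    fun x hx => (hPB.hasSum (nx x hx)).mul_left _
  have bi : IntegrableOn (fun x : ℝ => ∑' n, ‖xC^(u-1) * (1 - xC)^(v-1) * (c n * xC^n)‖) (Ioo 0 1) := by
    refine Integrable.mono' dom ?_ ?_
    · have : AEMeasurable (fun x : ℝ => ∑' n, ‖xC^(u-1) * (1 - xC)^(v-1) * (c n * xC^n)‖) (volume.restrict (Ioo 0 1)) := by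
        refine aemeasurable_of_tendsto_metrizable_ae (u := atTop) (f := fun (N:ℕ) (x:ℝ) => ∑ n ∈ Finset.range N, ‖xC^(u-1) * (1 - xC)^(v-1) * (c n * xC^n)‖) ?_ ?_
        · intro N
          exact Finset.aemeasurable_fun_sum _ fun n _ => (mb n).norm.aemeasurable
        · rw [ae_restrict_iff' measurableSet_Ioo]
          refine Eventually.of_forall fun x hx => ?_
          refine Summable.tendsto_sum_tsum_nat ?_
          simp only [norm_mul _ (c _ * _)]
          exact (hPB.summable (nx x hx)).mul_left _
      exact this.aestronglyMeasurable
    · rw [ae_restrict_iff' measurableSet_Ioo]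
      refine Eventually.of_forall fun x hx => ?_
      rw [norm_of_nonneg (tsum_nonneg fun _ => norm_nonneg _)]
      simp only [norm_mul _ (c _ * _)]
      rw [tsum_mul_left, norm_cpow_unit hx, ← pe x hx]
      have := bsum x hx
      have h1 : 0 ≤ x^(u.re-1) * (1-x)^(v.re-1) :=
        mul_nonneg (rpow_nonneg hx.1.le _) (rpow_nonneg (by linarith [hx.2]) _)
      calc _ ≤ x^(u.re-1) * (1-x)^(v.re-1) * (C * K * (1-x)^(-σ)) := by gcongr
        _ = _ := by ring
  have main := hasSum_integral_of_dominated_convergence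
    (μ := volume.restrict (Ioo zR 1))
    (F := fun (n:ℕ) (x:ℝ) => xC^(u-1) * (1 - xC)^(v-1) * (c n * xC^n))
    (f := fun x : ℝ => xC^(u-1) * (1 - xC)^(v-1) * pser c x)
    (fun n x => ‖xC^(u-1) * (1 - xC)^(v-1) * (c n * xC^n)‖) mb
    (fun n => Eventually.of_forall fun x => le_rfl)
    (by
      rw [ae_restrict_iff' measurableSet_Ioo]
      refine Eventually.of_forall fun x hx => ?_
      simp only [norm_mul _ (c _ * _)]
      exact (hPB.summable (nx x hx)).mul_left _) bi
    (by
      rw [ae_restrict_iff' measurableSet_Ioo]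
      exact Eventually.of_forall hs)
  refine ⟨?_, main.congr_fun fun n => ?_⟩
  · refine Integrable.mono' bi ?_ ?_
    · refine aestronglyMeasurable_of_tendsto_ae atTop (f := fun (N:ℕ) (x:ℝ) => ∑ n ∈ Finset.range N, xC^(u-1) * (1 - xC)^(v-1) * (c n * xC^n)) ?_ ?_
      · intro N
        exact Finset.aestronglyMeasurable_fun_sum _ fun n _ => mb n
      · rw [ae_restrict_iff' measurableSet_Ioo]
        exact Eventually.of_forall fun x hx => (hs x hx).tendsto_sum_nat
    · rw [ae_restrict_iff' measurableSet_Ioo]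
      refine Eventually.of_forall fun x hx => ?_
      rw [← (hs x hx).tsum_eq]
      refine norm_tsum_le_tsum_norm ?_
      simp only [norm_mul _ (c _ * _)]
      exact (hPB.summable (nx x hx)).mul_left _
  · have hun : 0 < (u + n).re := by
      simp; positivity
    rw [← beta_integral hun hv0, ← integral_const_mul]
    refine setIntegral_congr_fun measurableSet_Ioo fun x hx => ?_
    have hx0 : xC ≠ 0 := by exact_mod_cast hx.1.ne'
    rw [show u + n - 1 = (u - 1) + n by ring, cpow_add _ _ hx0, cpow_natCast]
    ring

lemma hc_bound' (A B D : ℂ) (hD : ∀ m : ℕ, D ≠ -m) {σ : ℝ} (h : A.re + B.re - D.re ≤ σ) :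
    ∃ C : ℝ, ∀ n : ℕ, ‖hc A B D n‖ ≤ C * nR ^ (σ - 1) := by
  obtain ⟨C, hC, H⟩ := hc_bound A B D hD
  refine ⟨C, fun n => (H n).trans ?_⟩
  have : (1:ℝ) ≤ (n:ℝ)+1 := by linarith [Nat.cast_nonneg (α := ℝ) n]
  gcongr

/-- beta integral of a Gauss function -/
lemma beta_hc (A B D : ℂ) (hD : ∀ m : ℕ, D ≠ -m) {u v : ℂ} (hu : 0 < u.re) (hv : 0 < v.re)
    (hv' : A.re + B.re - D.re < v.re) :
    IntegrableOn (fun x : ℝ => xC^(u-1) * (1 - xC)^(v-1) * pser (hc A B D) x) (Ioo 0 1) ∧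
    HasSum (fun n : ℕ => hc A B D n * (Complex.Gamma (u+n) * Complex.Gamma v / Complex.Gamma (u+n+v)))
      (∫ x in Ioo zR 1, xC^(u-1) * (1 - xC)^(v-1) * pser (hc A B D) x) := by
  obtain ⟨σ, h1, h2⟩ := exists_between (max_lt hv hv')
  obtain ⟨C, hC⟩ := hc_bound' A B D hD ((le_max_right _ _).trans h1.le)
  exact beta_series ((le_max_left _ _).trans_lt h1) hC hu h2

lemma thomae (α α' β D c P : ℂ) (hD : ∀ m : ℕ, D ≠ -m) (hc0 : ∀ m : ℕ, c ≠ -m) (hsum : α' + β = D)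
    (hα : 0 < α.re) (h1 : 0 < (c - α).re) (h2 : 0 < (c - α').re) (hP : 0 < P.re)
    (hs : 0 < (c - α - α' + P).re) :
    HasSum (fun n => hc (D - P) α' D n * (poch α n / poch c n))
      (Complex.Gamma c * Complex.Gamma (c - α - α' + P) /
        (Complex.Gamma (c - α) * Complex.Gamma (c - α') * Complex.Gamma P) *
        ∫ x in Ioo zR 1, xC^(P-1) * (1 - xC)^(c-α'-1) * pser (hc α β D) x) := by
  set s := c - α - α' + P with hsd
  have A1 := (beta_hc (D-P) α' D hD hα h1 (by
    have : 0 < s.re := hs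
    simp only [hsd, add_re, sub_re] at this ⊢; linarith)).2
  have A2 := (beta_hc P β D hD hα hs (by
    rw [← hsum]
    simp only [hsd, add_re, sub_re] at h1 ⊢; linarith)).2
  have A3 := (beta_hc α β D hD hP h2 (by
    rw [← hsum]
    simp only [add_re, sub_re] at h1 ⊢; linarith)).2
  have gα := Gamma_ne_zero_of_re_pos hα
  have g1 := Gamma_ne_zero_of_re_pos h1
  have g2 := Gamma_ne_zero_of_re_pos h2
  have gP := Gamma_ne_zero_of_re_pos hP
  have gs := Gamma_ne_zero_of_re_pos hs
  have gc := Gamma_ne_zero hc0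
  have nα := ne_neg_nat_of_re_pos hα
  have nP := ne_neg_nat_of_re_pos hP
  have eqI : ∫ x in Ioo zR 1, xC^(α-1) * (1 - xC)^(c-α-1) * pser (hc (D-P) α' D) x
      = ∫ x in Ioo zR 1, xC^(α-1) * (1 - xC)^(s-1) * pser (hc P β D) x := by
    refine setIntegral_congr_fun measurableSet_Ioo fun x hx => ?_
    have hx1 : ‖xC‖ < 1 := by rw [norm_real, norm_of_nonneg hx.1.le]; exact hx.2
    simp only [← F21_pser]
    rw [euler_tr (D-P) α' D hD hx1, show D - (D-P) = P by ring, show D - α' = β by rw [← hsum]; ring,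
      ← mul_assoc, mul_assoc _ ((1 - xC)^(c-α-1)),
      ← cpow_add _ _ (slitPlane_ne_zero (one_sub_slit hx1))]
    congr 3
    rw [hsd]; ring
  set I1 := ∫ x in Ioo zR 1, xC^(α-1) * (1 - xC)^(s-1) * pser (hc P β D) x
  set M := ∫ x in Ioo zR 1, xC^(P-1) * (1 - xC)^(c-α'-1) * pser (hc α β D) x
  have eqM : I1 = Complex.Gamma α * Complex.Gamma s / (Complex.Gamma P * Complex.Gamma (c-α')) * M := by
    refine A2.unique ((A3.mul_left _).congr_fun fun n => ?_)
    rw [Gamma_add_nat nα, Gamma_add_nat nP, show α + n + s = P + n + (c - α') by rw [hsd]; ring]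
    simp only [hc]
    field_simp
  have : Complex.Gamma c * Complex.Gamma s / (Complex.Gamma (c - α) * Complex.Gamma (c - α') * Complex.Gamma P) * M
     = Complex.Gamma c / (Complex.Gamma α * Complex.Gamma (c - α)) * I1 := by
    rw [eqM]; field_simp
  rw [this, ← eqI]
  refine (A1.mul_left _).congr_fun fun n => ?_
  rw [show α + n + (c - α) = c + n by ring, Gamma_add_nat nα, Gamma_add_nat hc0]
  have := poch_ne_zero hc0 n
  field_simp

open scoped FourierTransform SchwartzMap in
lemma fourier_L2 (f : ℝ → ℂ) (h1 : Integrable f) (h2 : MemLp f 2) :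
    ((𝓕 (h2.toLp f) : Lp (α := ℝ) ℂ 2) : ℝ → ℂ) =ᵐ[volume] 𝓕 f := by
  set G : Lp (α := ℝ) ℂ 2 volume := 𝓕 (h2.toLp f) with hG
  have hcont : Continuous (𝓕 f) := by
    have := VectorFourier.fourierIntegral_continuous (L := innerₗ ℝ) (μ := volume)
      continuous_fourierChar (by exact continuous_inner) h1
    exact this
  have hGl : LocallyIntegrable (G : ℝ → ℂ) := (Lp.memLp G).locallyIntegrable bnum
  have key : ∀ᵐ x, (G : ℝ → ℂ) x - 𝓕 f x = 0 := by
    apply ae_eq_zero_of_integral_contDiff_smul_eq_zero (hGl.sub hcont.locallyIntegrable)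
    intro g hg hgc
    have hgc' : HasCompactSupport (fun x => (g x : ℂ)) := hgc.comp_left (g := fun x : ℝ => xC) rfl
    have hg' : ContDiff ℝ ((⊤ : ℕ∞) : WithTop ℕ∞) (fun x => (g x : ℂ)) := ofRealCLM.contDiff.comp hg
    let s : 𝓢(ℝ, ℂ) := hgc'.toSchwartzMap hg'
    have e1 := congrArg (fun T => T s) (Lp.fourier_toTemperedDistribution_eq (h2.toLp f))
    simp only [TemperedDistribution.fourier_apply, Lp.toTemperedDistribution_apply] at e1
    have e2 : ∫ x, (𝓕 s) x • (h2.toLp f : ℝ → ℂ) x = ∫ x, (𝓕 s) x • f x :=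
      integral_congr_ae (by filter_upwards [h2.coeFn_toLp] with x hx; rw [hx])
    rw [e2] at e1
    have e3 := VectorFourier.integral_fourierIntegral_smul_eq_flip (L := innerₗ ℝ) (μ := volume) (ν := volume)
      continuous_fourierChar (by exact continuous_inner) (s.integrable) h1
    have e4 : ∫ x, (𝓕 s) x • f x = ∫ x, s x • 𝓕 f x := by
      rw [SchwartzMap.fourier_coe]
      simpa [Real.fourier_eq, VectorFourier.fourierIntegral] using e3
    rw [e4] at e1
    have i1 : Integrable (fun x => g x • (G : ℝ → ℂ) x) :=
      hGl.integrable_smul_left_of_hasCompactSupport hg.continuous hgc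
    have i2 : Integrable (fun x => g x • 𝓕 f x) :=
      hcont.locallyIntegrable.integrable_smul_left_of_hasCompactSupport hg.continuous hgc
    have : ∫ x, g x • ((G : ℝ → ℂ) x - 𝓕 f x) = (∫ x, g x • (G : ℝ → ℂ) x) - ∫ x, g x • 𝓕 f x := by
      rw [← integral_sub i1 i2]; simp only [smul_sub]
    rw [show (fun x => g x • ((⇑G - 𝓕 f) x)) = fun x => g x • ((G : ℝ → ℂ) x - 𝓕 f x) from rfl]
    rw [this, sub_eq_zero]
    have e5 : ∀ u : ℝ → ℂ, ∫ x, s x • u x = ∫ x, g x • u x := fun u => by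
      apply integral_congr_ae; filter_upwards with x
      show (g x : ℂ) • u x = g x • u x
      simp
    rw [← e5, ← e5]; exact e1.symm
  filter_upwards [key] with x hx
  exact sub_eq_zero.mp hx

/-- Fourier transform with kernel `e^{ixy}`. -/
def FT (f : ℝ → ℂ) (x : ℝ) : ℂ := ∫ y : ℝ, cexp (I * x * y) * f y

open scoped FourierTransform in
lemma FT_eq (f : ℝ → ℂ) (x : ℝ) : FT f x = 𝓕 f (-(2 * π)⁻¹ * x) := by
  rw [FT, Real.fourier_real_eq_integral_exp_smul]
  apply integral_congr_ae; filter_upwards with y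
  rw [smul_eq_mul]; congr 2
  have : (π : ℂ) ≠ 0 := by exact_mod_cast pi_ne_zero
  push_cast; field_simp

lemma memLp_comp_mul (f : ℝ → ℂ) (hf : MemLp f 2) (c : ℝ) (hc : c ≠ 0) :
    MemLp (fun x => f (c * x)) 2 := by
  have hm : AEStronglyMeasurable (fun x => f (c * x)) := by
    refine hf.1.comp_quasiMeasurePreserving ⟨by fun_prop, ?_⟩
    rw [Real.map_volume_mul_left hc]
    exact Measure.smul_absolutelyContinuous
  rw [memLp_two_iff_integrable_sq_norm hm]
  rw [memLp_two_iff_integrable_sq_norm hf.1] at hf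
  exact hf.comp_mul_left' hc

open scoped FourierTransform in
lemma FT_memLp (f : ℝ → ℂ) (h1 : Integrable f) (h2 : MemLp f 2) : MemLp (FT f) 2 := by
  have hpi : -(2 * π)⁻¹ ≠ 0 := by have := pi_pos; simp [this.ne']
  have : MemLp (𝓕 f) 2 := (Lp.memLp (𝓕 (h2.toLp f))).ae_eq (fourier_L2 f h1 h2)
  rw [funext (FT_eq f)]
  exact memLp_comp_mul _ this _ hpi

open scoped FourierTransform in
lemma FT_inner (f g : ℝ → ℂ) (h1 : Integrable f) (h2 : MemLp f 2) (h3 : Integrable g)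
    (h4 : MemLp g 2) :
    ∫ x, FT f x * conj (FT g x) = 2 * π * ∫ y, f y * conj (g y) := by
  have e := Lp.inner_fourier_eq (h4.toLp g) (h2.toLp f)
  rw [L2.inner_def, L2.inner_def] at e
  have e1 : ∫ a, inner ℂ ((𝓕 (h4.toLp g) : Lp (α := ℝ) ℂ 2 volume) a) ((𝓕 (h2.toLp f) : Lp (α := ℝ) ℂ 2 volume) a)
      = ∫ a, 𝓕 f a * conj (𝓕 g a) := by
    apply integral_congr_ae
    filter_upwards [fourier_L2 f h1 h2, fourier_L2 g h3 h4] with x hx hx'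
    rw [hx, hx']; simp [RCLike.inner_apply]
  have e2 : ∫ a, inner ℂ ((h4.toLp g) a) ((h2.toLp f) a) = ∫ a, f a * conj (g a) := by
    apply integral_congr_ae
    filter_upwards [h2.coeFn_toLp, h4.coeFn_toLp] with x hx hx'
    rw [hx, hx']; simp [RCLike.inner_apply]
  rw [e1, e2] at e
  rw [← e]
  simp only [FT_eq]
  rw [Measure.integral_comp_mul_left (fun a => 𝓕 f a * conj (𝓕 g a))]
  simp [abs_of_pos pi_pos]

/-- Cross pairing: identify the inverse transform of `M` on an open set by testing. -/
lemma FT_cross (M G K : ℝ → ℂ) (U : Set ℝ) (hU : IsOpen U) (hM : MemLp M 2)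
    (hG1 : Integrable G) (hG2 : MemLp G 2) (hGU : ∀ y ∉ U, G y = 0) (hK : LocallyIntegrableOn K U)
    (hη : ∀ η : ℝ → ℝ, ContDiff ℝ ((⊤ : ℕ∞) : WithTop ℕ∞) η → HasCompactSupport η → tsupport η ⊆ U →
      ∫ x, M x * FT (fun y => (η y : ℂ)) x = ∫ y, η y * K y) :
    ∫ x, M x * FT G x = ∫ y, K y * G y := by
  have hpi := pi_pos
  let c : ℝ := -(2 * π)
  have hc : c ≠ 0 := by simp [c, hpi.ne']
  have hM' : MemLp (fun x => conj (M (c * x))) 2 := (memLp_comp_mul M hM c hc).star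
  let H0 : Lp (α := ℝ) ℂ 2 volume := (Lp.fourierTransformₗᵢ ℝ ℂ).symm (hM'.toLp _)
  have rep : ∀ g : ℝ → ℂ, Integrable g → MemLp g 2 →
      ∫ x, M x * FT g x = 2 * π * ∫ y, conj (H0 y) * g y := by
    intro g h1 h2
    have e := (Lp.fourierTransformₗᵢ ℝ ℂ).inner_map_map H0 (h2.toLp g)
    rw [LinearIsometryEquiv.apply_symm_apply, L2.inner_def, L2.inner_def] at e
    have e1 : ∫ a, inner ℂ ((hM'.toLp _) a) ((Lp.fourierTransformₗᵢ ℝ ℂ (h2.toLp g)) a)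
      = ∫ a, M (c * a) * FT g (c * a) := by
      apply integral_congr_ae
      filter_upwards [hM'.coeFn_toLp, fourier_L2 g h1 h2] with x hx hx'
      rw [hx, show (Lp.fourierTransformₗᵢ ℝ ℂ (h2.toLp g)) x = _ from hx', FT_eq]
      rw [show -(2 * π)⁻¹ * (c * x) = x by simp only [c]; field_simp]
      simp [RCLike.inner_apply, mul_comm]
    have e2 : ∫ a, inner ℂ (H0 a) ((h2.toLp g) a) = ∫ a, conj (H0 a) * g a := by
      apply integral_congr_ae
      filter_upwards [h2.coeFn_toLp] with x hx
      rw [hx]; simp [RCLike.inner_apply, mul_comm]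
    rw [e1, e2, Measure.integral_comp_mul_left (fun a => M a * FT g a)] at e
    rw [← e]
    simp [c, abs_of_pos hpi]
    field_simp
  rw [rep G hG1 hG2]
  have hl : LocallyIntegrable (fun y => 2 * π * conj (H0 y)) := by
    have : LocallyIntegrable (fun y => conj (H0 y)) :=
      ((Lp.memLp H0).star).locallyIntegrable bnum
    exact this.smul (2 * π : ℂ)
  have key : ∀ᵐ y, y ∈ U → 2 * π * conj (H0 y) - K y = 0 := by
    apply hU.ae_eq_zero_of_integral_contDiff_smul_eq_zero
      (hl.locallyIntegrableOn U |>.sub hK)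
    intro η h1 h2 h3
    have hη1 : Continuous (fun y => (η y : ℂ)) := continuous_ofReal.comp h1.continuous
    have hη2 : HasCompactSupport (fun y => (η y : ℂ)) := h2.comp_left (g := fun x : ℝ => xC) rfl
    have i1 : Integrable (fun x => η x • (2 * π * conj (H0 x))) :=
      hl.integrable_smul_left_of_hasCompactSupport h1.continuous h2
    have i2 : Integrable (fun x => η x • K x) := by
      have : IntegrableOn (fun x => η x • K x) (tsupport η) := by
        exact (hK.integrableOn_compact_subset h3 h2).continuousOn_smul h1.continuous.continuousOn h2
      refine (integrableOn_iff_integrable_of_support_subset ?_).mp this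
      intro x hx
      apply subset_tsupport
      intro h0; apply hx; simp [h0]
    have := hη η h1 h2 h3
    rw [rep _ (hη1.integrable_of_hasCompactSupport hη2) (hη1.memLp_of_hasCompactSupport hη2)] at this
    have e : ∀ x, η x • ((fun y => 2 * π * conj (H0 y)) - K) x
       = η x • (2 * π * conj (H0 x)) - η x • K x := fun x => smul_sub _ _ _
    simp_rw [e]
    rw [integral_sub i1 i2, sub_eq_zero, ← integral_const_mul] at *
    simp only [real_smul]
    rw [← this]
    congr 1; ext x; ring
  rw [← integral_const_mul]
  apply integral_congr_ae
  filter_upwards [key] with y hy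
  by_cases h : y ∈ U
  · rw [← sub_eq_zero.mp (hy h)]; ring
  · simp [hGU y h]

lemma prod_bound (s : ℕ → ℝ) (M : ℝ) (h0 : ∀ j, 0 ≤ s j) (hM : 0 ≤ M)
    (h : ∀ j, s (j+1) ≤ s j * (1 + M / jR^2)) (j : ℕ) : s j ≤ s 0 * exp (2 * M) := by
  have key : ∀ j : ℕ, s j ≤ s 0 * exp (M * (2 - 2 / jR)) := by
    intro j
    induction j with
    | zero => simp
    | succ j ih =>
      refine (h j).trans ?_
      have hj : zR < (j:ℝ) + 1 := by positivity
      have e1 : 1 + M / jR^2 ≤ exp (M * (2 / jR - 2 / ((j:ℝ)+2))) := by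
        have e2 := add_one_le_exp (M * (2 / jR - 2 / ((j:ℝ)+2)))
        have e3 : 1 / jR^2 ≤ 2 / jR - 2 / ((j:ℝ)+2) := by
          rw [div_sub_div _ _ bpos bpos, div_le_div_iff₀ bpos bpos]
          nlinarith
        have e4 := mul_le_mul_of_nonneg_left e3 hM
        rw [mul_one_div] at e4
        linarith
      calc s j * (1 + M / jR^2)
          ≤ (s 0 * exp (M * (2 - 2 / jR))) * exp (M * (2 / jR - 2 / ((j:ℝ)+2))) := by
            gcongr
            exact mul_nonneg (h0 0) (exp_pos _).le
        _ = s 0 * exp (M * (2 - 2 / (((j+1:ℕ):ℝ)+1))) := by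
            rw [mul_assoc, ← exp_add]; congr 2; push_cast; ring
  refine (key j).trans (mul_le_mul_of_nonneg_left (exp_le_exp.mpr ?_) (h0 0))
  have : zR ≤ 2 / jR := by positivity
  nlinarith

lemma prod_lim (t : ℕ → ℂ) (M T : ℝ) (κ : ℂ) (hT : ∀ j, ‖t j‖ ≤ T) (hM : 0 ≤ M)
    (h : ∀ j, ‖t (j+1) - t j‖ ≤ ‖t j‖ * (M / jR^2)) (hk : Tendsto t atTop (𝓝 κ)) (j : ℕ) :
    ‖t j - κ‖ ≤ 2 * M * T / jR := by
  have hT0 : 0 ≤ T := (norm_nonneg _).trans (hT 0)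
  have key : ∀ m : ℕ, ‖t j - t (j+m)‖ ≤ M * T * (2 / jR - 2 / ((j:ℝ)+m+1)) := by
    intro m
    induction m with
    | zero => simp
    | succ m ih =>
      have e0 : ‖t j - t (j+(m+1))‖ ≤ ‖t j - t (j+m)‖ + ‖t (j+m+1) - t (j+m)‖ := by
        have : t j - t (j+(m+1)) = (t j - t (j+m)) - (t (j+m+1) - t (j+m)) := by
          rw [← add_assoc]; ring
        rw [this]; exact norm_sub_le _ _
      have e1 := h (j+m)
      have e2 : ‖t (j+m)‖ * (M / (((j+m:ℕ):ℝ)+1)^2) ≤ M * T * (2 / ((j:ℝ)+m+1) - 2 / ((j:ℝ)+m+2)) := by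
        have e3 : 1 / ((j:ℝ)+m+1)^2 ≤ 2 / ((j:ℝ)+m+1) - 2 / ((j:ℝ)+m+2) := by
          rw [div_sub_div _ _ bpos bpos, div_le_div_iff₀ bpos bpos]
          have : zR ≤ (j:ℝ)+m := by positivity
          nlinarith
        calc _ ≤ T * (M / (((j+m:ℕ):ℝ)+1)^2) := by gcongr; exact hT _
          _ = M * T * (1 / ((j:ℝ)+m+1)^2) := by push_cast; ring
          _ ≤ _ := by gcongr
      have e4 : M * T * (2 / jR - 2 / ((j:ℝ)+(m+1:ℕ)+1)) = M * T * (2 / jR - 2 / ((j:ℝ)+m+1))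
        + M * T * (2 / ((j:ℝ)+m+1) - 2 / ((j:ℝ)+m+2)) := by push_cast; ring
      linarith
  have lim : Tendsto (fun m => ‖t j - t (j+m)‖) atTop (𝓝 ‖t j - κ‖) := by
    have : Tendsto (fun m => t (j+m)) atTop (𝓝 κ) := by
      simpa [add_comm] using (tendsto_add_atTop_iff_nat j).mpr hk
    exact (tendsto_const_nhds.sub this).norm
  refine le_of_tendsto' lim fun m => (key m).trans ?_
  have : 0 ≤ 2 / ((j:ℝ)+m+1) := by positivity
  have h3 : 0 ≤ M * T := mul_nonneg hM hT0
  calc _ ≤ M * T * (2 / jR) := by gcongr; linarith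
    _ = _ := by ring

/-- coefficients of the Jacobi kernel -/
def pj (a b ρ : ℝ) (n : ℕ) : ℂ := hc (a - I * ρ) (b - I * ρ) ((a:ℂ) + b) n
def kap (a b ρ : ℝ) : ℂ := Complex.Gamma ((a:ℂ) + b) * Complex.Gamma (-2 * I * ρ) /
  (Complex.Gamma (a - I * ρ) * Complex.Gamma (b - I * ρ))
def ej (a b ρ : ℝ) (n : ℕ) : ℂ := pj a b ρ n - kap a b ρ * (poch (-2 * I * ρ) n / n.factorial)

def tj (a b ρ : ℝ) (n : ℕ) : ℂ := poch (a - I * ρ) n * poch (b - I * ρ) n /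
  (poch ((a:ℂ) + b) n * poch (-2 * I * ρ) n)

lemma ne_neg_nat_imag (b ρ : ℝ) (h : ρ ≠ 0) : ∀ m : ℕ, (b - I * ρ : ℂ) ≠ -m := by
  intro m hm
  have := congrArg im hm
  simp at this; exact h this

lemma lam_ne (ρ : ℝ) (h : ρ ≠ 0) : ∀ m : ℕ, (-2 * I * ρ : ℂ) ≠ -m := by
  intro m hm
  have := congrArg im hm
  simp at this; exact h this

lemma ab_ne (a b : ℝ) (h : 0 < a + b) : ∀ m : ℕ, ((a:ℂ) + b) ≠ -m :=
  ne_neg_nat_of_re_pos (by simpa using h)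

lemma tj_tendsto (a b ρ : ℝ) (hab : 0 < a + b) (h : ρ ≠ 0) :
    Tendsto (tj a b ρ) atTop (𝓝 (kap a b ρ)) := by
  have h1 := poch_ratio_tendsto (a - I * ρ) ((a:ℂ) + b) (ne_neg_nat_imag a ρ h) (ab_ne a b hab)
  have h2 := poch_ratio_tendsto (b - I * ρ) (-2 * I * ρ) (ne_neg_nat_imag b ρ h) (lam_ne ρ h)
  have h3 := h1.mul h2
  rw [← tendsto_add_atTop_iff_nat 1]
  have e : Complex.Gamma ((a:ℂ) + b) / Complex.Gamma (a - I * ρ) * (Complex.Gamma (-2 * I * ρ) /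
    Complex.Gamma (b - I * ρ)) = kap a b ρ := by rw [kap]; field_simp
  rw [e] at h3
  refine h3.congr' ?_
  filter_upwards [eventually_gt_atTop 0] with n hn
  have hn' : nC ≠ 0 := by exact_mod_cast hn.ne'
  have e1 : nC ^ ((a:ℂ) + b - (a - I * ρ)) * nC ^ (-2 * I * ρ - (b - I * ρ) : ℂ) = 1 := by
    rw [← cpow_add _ _ hn']
    rw [show (a:ℂ) + b - (a - I * ρ) + (-2 * I * ρ - (b - I * ρ)) = 0 by ring, Complex.cpow_zero]
  rw [tj]
  calc _ = poch (a - I * ρ) (n+1) / poch ((a:ℂ) + b) (n+1) * (poch (b - I * ρ) (n+1) / poch (-2 * I * ρ) (n+1))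
        * (nC ^ ((a:ℂ) + b - (a - I * ρ)) * nC ^ (-2 * I * ρ - (b - I * ρ) : ℂ)) := by ring
    _ = _ := by rw [e1]; ring

lemma lam_bound (δ N : ℝ) (hδ : 0 < δ) : ∃ C > 0, ∀ ρ ∈ Icc δ N, ∀ j : ℕ,
    ‖poch (-2 * I * ρ) j / (j.factorial : ℂ)‖ ≤ C / jR := by
  obtain ⟨M, hM0, hM1, hM2⟩ : ∃ M : ℝ, 0 ≤ M ∧ 4 * N ≤ M ∧ 6 * N^2 ≤ M :=
    ⟨max (max 0 (4*N)) (6*N^2), by simp, by simp, by simp⟩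
  refine ⟨exp (2 * M), exp_pos _, fun ρ hρ j => ?_⟩
  have hρ0 : 0 < ρ := hδ.trans_le hρ.1
  have := prod_bound (fun j => jR * ‖poch (-2 * I * ρ) j / (j.factorial : ℂ)‖) M
    (fun j => by positivity) hM0 ?_ j
  · simp only [Nat.cast_zero, zero_add, one_mul, poch_zero, Nat.factorial_zero, Nat.cast_one, div_one,
      norm_one] at this
    rw [le_div_iff₀ bpos]; linarith
  · intro j
    show (((j+1:ℕ):ℝ)+1) * ‖poch (-2 * I * ρ) (j+1) / ((j+1).factorial : ℂ)‖ ≤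
      jR * ‖poch (-2 * I * ρ) j / (j.factorial : ℂ)‖ * (1 + M / jR^2)
    have hj : zR < (j:ℝ) + 1 := by positivity
    have e : ‖poch (-2 * I * ρ) (j+1) / ((j+1).factorial : ℂ)‖ =
        ‖poch (-2 * I * ρ) j / (j.factorial : ℂ)‖ * (‖(-2 * I * ρ + j : ℂ)‖ / jR) := by
      rw [poch_succ, Nat.factorial_succ]; push_cast
      rw [norm_div, norm_mul, norm_mul, norm_div]
      have : ‖(j:ℂ) + 1‖ = (j:ℝ) + 1 := by
        rw [show (j:ℂ) + 1 = ((j+1:ℕ):ℂ) by push_cast; rfl, Complex.norm_natCast]; push_cast; rfl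
      rw [this]; field_simp
    rw [e]
    have key : (((j+1:ℕ):ℝ)+1) * (‖(-2 * I * ρ + j : ℂ)‖ / jR) ≤ jR * (1 + M / jR^2) := by
      have e2 : ‖(-2 * I * ρ + j : ℂ)‖^2 = 4*ρ^2 + j^2 := by
        rw [← normSq_eq_norm_sq, normSq_apply]; simp; ring
      have hN : ρ ≤ N := hρ.2
      have e5 : jR * (1 + M / jR^2) = (jR^2 + M) / jR := by field_simp
      rw [e5, mul_div_assoc', div_le_div_iff_of_pos_right hj]
      push_cast
      rcases Nat.eq_zero_or_pos j with h0 | h0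
      · subst h0
        have : ‖(-2 * I * ρ + (0:ℕ) : ℂ)‖ = 2 * ρ := by simp [abs_of_pos hρ0]
        rw [this]; push_cast; linarith
      · have h1 : (1:ℝ) ≤ j := by exact_mod_cast h0
        have e3 : ‖(-2 * I * ρ + j : ℂ)‖ ≤ j + 2 * N^2 / j := by
          apply abs_le_of_sq_le_sq' _ bpos |>.2
          rw [e2]
          have : ((j:ℝ) + 2 * N^2 / j)^2 = j^2 + 4*N^2 + (2 * N^2 / j)^2 := by field_simp; ring
          rw [this]
          have : ρ^2 ≤ N^2 := by nlinarith
          nlinarith [sq_nonneg (2 * N^2 / j)]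
        have e4 : 2 * N^2 / j * ((j:ℝ)+2) ≤ M := by
          rw [div_mul_eq_mul_div, div_le_iff₀ blin]
          nlinarith [sq_nonneg N]
        nlinarith
    calc _ = ‖poch (-2 * I * ρ) j / (j.factorial : ℂ)‖ * ((((j+1:ℕ):ℝ)+1) * (‖(-2 * I * ρ + j : ℂ)‖ / jR)) := by ring
      _ ≤ ‖poch (-2 * I * ρ) j / (j.factorial : ℂ)‖ * (jR * (1 + M / jR^2)) := by gcongr
      _ = _ := by ring

lemma tj_bound (a b δ N : ℝ) (hab : 0 < a + b) (hδ : 0 < δ) : ∃ C > 0, ∀ ρ ∈ Icc δ N,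
    (∀ j : ℕ, ‖tj a b ρ j‖ ≤ C) ∧ ∀ j : ℕ, ‖tj a b ρ j - kap a b ρ‖ ≤ C / jR := by
  let m := min (min δ (1/2)) (min (a+b) 1)
  have hm : 0 < m := by simp [m, hδ, hab]
  let M := (|a * b| + N * (a+b) + N^2) / (m * m)
  rcases lt_or_ge N δ with hN | hN
  · exact ⟨1, one_pos, fun ρ hρ => absurd (hρ.1.trans hρ.2) (not_le.mpr hN)⟩
  have hN0 : 0 < N := hδ.trans_le hN
  have hM0 : 0 ≤ M := by positivity
  let T := exp (2 * M)
  have hT : 0 < T := exp_pos _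
  have hstep : ∀ ρ ∈ Icc δ N, ∀ j : ℕ, ‖tj a b ρ (j+1) - tj a b ρ j‖ ≤ ‖tj a b ρ j‖ * (M / jR^2) := by
    intro ρ hρ j
    have hρ0 : 0 < ρ := hδ.trans_le hρ.1
    have n1 : (-2 * I * ρ + j : ℂ) ≠ 0 := fun h => lam_ne ρ hρ0.ne' j (by linear_combination h)
    have n2 : ((a:ℂ) + b + j) ≠ 0 := fun h => ab_ne a b hab j (by linear_combination h)
    have e : tj a b ρ (j+1) - tj a b ρ j = tj a b ρ j *
        ((a * b + I * ρ * (a + b) - ρ^2) / (((a:ℂ) + b + j) * (-2 * I * ρ + j))) := by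
      rw [tj, tj, poch_succ, poch_succ, poch_succ, poch_succ]
      have p1 := poch_ne_zero (lam_ne ρ hρ0.ne') j
      have p2 := poch_ne_zero (ab_ne a b hab) j
      obtain ⟨L, hL⟩ : ∃ L : ℂ, L = -2 * I * ρ := ⟨_, rfl⟩
      rw [← hL] at p1 n1 ⊢
      have hIL : I * ρ = -L / 2 := by rw [hL]; ring
      have hr : (ρ:ℂ)^2 = -(L/2)^2 := by rw [hL]; ring_nf; simp only [I_sq]; ring
      rw [hIL, hr]
      field_simp
      ring
    rw [e, norm_mul]
    gcongr
    rw [norm_div, norm_mul]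
    have l1 : m * jR ≤ ‖(a:ℂ) + b + j‖ := by
      rw [show (a:ℂ) + b + j = ((a + b + j : ℝ) : ℂ) by push_cast; rfl, norm_real, norm_eq_abs,
        abs_of_pos bpos]
      have h1 : m ≤ a + b := (min_le_right _ _).trans (min_le_left _ _)
      have h2 : m ≤ 1 := (min_le_right _ _).trans (min_le_right _ _)
      have : zR ≤ j := by positivity
      nlinarith
    have l2 : m * jR ≤ ‖(-2 * I * ρ + j : ℂ)‖ := by
      have h1 : m ≤ δ := (min_le_left _ _).trans (min_le_left _ _)
      have h2 : m ≤ 1/2 := (min_le_left _ _).trans (min_le_right _ _)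
      rcases Nat.eq_zero_or_pos j with h0 | h0
      · subst h0
        have : ‖(-2 * I * ρ + (0:ℕ) : ℂ)‖ = 2 * ρ := by simp [abs_of_pos hρ0]
        rw [this]; push_cast; linarith [hρ.1]
      · have h3 : (1:ℝ) ≤ j := by exact_mod_cast h0
        have := abs_re_le_norm (-2 * I * ρ + j : ℂ)
        have e0 : (-2 * I * ρ + j : ℂ).re = j := by simp
        rw [e0, Nat.abs_cast] at this
        refine le_trans ?_ this
        nlinarith
    have l3 : ‖(a * b + I * ρ * (a + b) - ρ^2 : ℂ)‖ ≤ |a * b| + N * (a+b) + N^2 := by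
      have e1 : ‖(a * b : ℂ)‖ = |a * b| := by rw [← ofReal_mul, norm_real]; rfl
      have e2 : ‖(I * ρ * (a + b) : ℂ)‖ = ρ * (a+b) := by
        rw [norm_mul, norm_mul, norm_I, ← ofReal_add, norm_real, norm_real,
          norm_eq_abs, norm_eq_abs, abs_of_pos hρ0, abs_of_pos hab]; ring
      have e3 : ‖(ρ^2 : ℂ)‖ = ρ^2 := by rw [norm_pow, norm_real, norm_eq_abs, sq_abs]
      have := norm_sub_le (a * b + I * ρ * (a + b) : ℂ) (ρ^2 : ℂ)
      have := norm_add_le (a * b : ℂ) (I * ρ * (a + b) : ℂ)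
      have : ρ * (a+b) ≤ N * (a+b) := by nlinarith [hρ.2]
      have : ρ^2 ≤ N^2 := by nlinarith [hρ.2]
      linarith
    calc _ ≤ (|a * b| + N * (a+b) + N^2) / ((m * jR) * (m * jR)) := by gcongr
      _ = _ := by simp only [M]; field_simp
  have hbd : ∀ ρ ∈ Icc δ N, ∀ j : ℕ, ‖tj a b ρ j‖ ≤ T := by
    intro ρ hρ j
    have := prod_bound (fun j => ‖tj a b ρ j‖) M (fun j => norm_nonneg _) hM0 (fun j => by
      have h1 := hstep ρ hρ j
      have h2 := norm_sub_norm_le (tj a b ρ (j+1)) (tj a b ρ j)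
      show ‖tj a b ρ (j+1)‖ ≤ ‖tj a b ρ j‖ * _
      linarith) j
    simpa [tj, poch_zero] using this
  refine ⟨max T (2 * M * T), lt_max_of_lt_left hT, fun ρ hρ => ⟨fun j => (hbd ρ hρ j).trans (le_max_left _ _), fun j => ?_⟩⟩
  refine (prod_lim (tj a b ρ) M T _ (hbd ρ hρ) hM0 (hstep ρ hρ) (tj_tendsto a b ρ hab (hδ.trans_le hρ.1).ne') j).trans ?_
  gcongr
  exact le_max_right _ _

lemma pj_eq (a b ρ : ℝ) (h : ρ ≠ 0) (j : ℕ) :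
    pj a b ρ j = tj a b ρ j * (poch (-2 * I * ρ) j / j.factorial) := by
  rw [pj, tj, hc]
  have p1 := poch_ne_zero (lam_ne ρ h) j
  generalize poch (-2 * I * ρ) j = q at p1 ⊢
  field_simp

/-- uniform bounds on the coefficients -/
lemma pj_bounds (a b δ N : ℝ) (hab : 0 < a + b) (hδ : 0 < δ) : ∃ C > 0, ∀ ρ ∈ Icc δ N,
    ‖kap a b ρ‖ ≤ C ∧ ∀ j : ℕ, ‖pj a b ρ j‖ ≤ C / jR ∧ ‖ej a b ρ j‖ ≤ C / jR^2 := by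
  obtain ⟨C1, h1, H1⟩ := lam_bound δ N hδ
  obtain ⟨C2, h2, H2⟩ := tj_bound a b δ N hab hδ
  refine ⟨C1 * C2 + C2, by positivity, fun ρ hρ => ⟨?_, fun j => ⟨?_, ?_⟩⟩⟩
  · have := le_of_tendsto' (tj_tendsto a b ρ hab (hδ.trans_le hρ.1).ne').norm (H2 ρ hρ).1
    nlinarith
  · rw [pj_eq a b ρ (hδ.trans_le hρ.1).ne', norm_mul]
    calc _ ≤ C2 * (C1 / jR) := by gcongr; exacts [(H2 ρ hρ).1 j, H1 ρ hρ j]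
      _ = C1 * C2 / jR := by ring
      _ ≤ _ := by gcongr; linarith
  · rw [ej, pj_eq a b ρ (hδ.trans_le hρ.1).ne', ← sub_mul, norm_mul]
    calc _ ≤ C2 / jR * (C1 / jR) := by gcongr; exacts [(H2 ρ hρ).2 j, H1 ρ hρ j]
      _ = C1 * C2 / jR^2 := by field_simp
      _ ≤ _ := by gcongr; linarith

lemma measurable_tsum_on {α : Type*} [MeasurableSpace α] (g : ℕ → α → ℂ) (hg : ∀ n, Measurable (g n))
    (S : Set α) (hS : MeasurableSet S) (hs : ∀ x ∈ S, Summable (fun n => g n x)) :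
    Measurable (S.indicator fun x => ∑' n, g n x) := by
  refine measurable_of_tendsto_metrizable (f := fun N => S.indicator (fun x => ∑ n ∈ Finset.range N, g n x))
    (fun N => (Finset.measurable_fun_sum _ fun n _ => hg n).indicator hS) ?_
  rw [tendsto_pi_nhds]
  intro x
  by_cases hx : x ∈ S
  · simp only [indicator_of_mem hx]; exact (hs x hx).hasSum.tendsto_sum_nat
  · simp only [indicator_of_notMem hx]; exact tendsto_const_nhds

lemma measurable_Gamma : Measurable Complex.Gamma := by
  have := differentiable_one_div_Gamma.continuous.measurable.inv
  convert this using 1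
  ext s; simp

lemma continuous_poch (n : ℕ) : Continuous (fun z : ℂ => poch z n) := by
  unfold poch; fun_prop

lemma measurable_hc {α : Type*} [MeasurableSpace α] (A B C : α → ℂ) (hA : Measurable A) (hB : Measurable B)
    (hC : Measurable C) (n : ℕ) : Measurable (fun x => hc (A x) (B x) (C x) n) := by
  unfold hc
  have h := (continuous_poch n).measurable
  exact ((h.comp hA).mul (h.comp hB)).div ((h.comp hC).mul measurable_const)

lemma measurable_pj (a b : ℝ) (n : ℕ) : Measurable (fun ρ => pj a b ρ n) := by
  unfold pj
  exact measurable_hc _ _ _ bfun bfun bfun n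

lemma measurable_kap (a b : ℝ) : Measurable (kap a b) := by
  unfold kap
  have h := measurable_Gamma
  have h2 : Measurable (fun ρ : ℝ => Complex.Gamma (-2 * I * ρ)) := h.comp bfun
  have h3 : Measurable (fun ρ : ℝ => Complex.Gamma (a - I * ρ)) := h.comp bfun
  have h4 : Measurable (fun ρ : ℝ => Complex.Gamma (b - I * ρ)) := h.comp bfun
  exact (measurable_const.mul h2).div (h3.mul h4)

lemma measurable_ej (a b : ℝ) (n : ℕ) : Measurable (fun ρ => ej a b ρ n) := by
  unfold ej
  have h2 : Measurable (fun ρ : ℝ => poch (-2 * I * ρ) n) := (continuous_poch n).measurable.comp bfun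
  exact (measurable_pj a b n).sub ((measurable_kap a b).mul (h2.div measurable_const))

def rr (y : ℝ) : ℝ := 1 - exp (-y)

lemma rr_pos {y : ℝ} (hy : 0 < y) : 0 < rr y := by
  have := exp_lt_one_iff.mpr (show -y < 0 by linarith)
  unfold rr; linarith

lemma rr_lt (y : ℝ) : rr y < 1 := by
  have := exp_pos (-y); unfold rr; linarith

lemma rr_norm {y : ℝ} (hy : 0 < y) : ‖(rr y : ℂ)‖ < 1 := by
  rw [norm_real, norm_of_nonneg (rr_pos hy).le]; exact rr_lt y

lemma rr_deriv (y : ℝ) : HasDerivAt (fun y => (rr y : ℂ)) (1 - rr y) y := by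
  have : HasDerivAt rr (exp (-y)) y := by
    have := ((hasDerivAt_neg y).exp).const_sub 1
    simp only [mul_neg, mul_one, neg_neg] at this
    exact this
  convert this.ofReal_comp using 1
  simp [rr]

def jk (a b ρ y : ℝ) : ℂ := cexp (I * ρ * y) * pser (pj a b ρ) (rr y)
def jkd (a b ρ y : ℝ) : ℂ := cexp (I * ρ * y) *
  (I * ρ * pser (pj a b ρ) (rr y) + (1 - rr y) * pser (dsh (pj a b ρ)) (rr y))

lemma pj_PB (a b ρ : ℝ) (hab : 0 < a + b) : PB (pj a b ρ) := hc_PB _ _ _ (ab_ne a b hab)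

lemma exp_deriv (ρ y : ℝ) : HasDerivAt (fun y : ℝ => cexp (I * ρ * y))
    (cexp (I * ρ * y) * (I * ρ)) y := by
  have : HasDerivAt (fun y : ℝ => (I * ρ * y : ℂ)) (I * ρ) y := by
    simpa using (ofRealCLM.hasDerivAt (x := y)).const_mul (I * ρ : ℂ)
  exact this.cexp

lemma jk_deriv (a b ρ : ℝ) (hab : 0 < a + b) {y : ℝ} (hy : 0 < y) :
    HasDerivAt (jk a b ρ) (jkd a b ρ y) y := by
  have h1 := ((pj_PB a b ρ hab).hasDerivAt (rr_norm hy)).comp y (rr_deriv y)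
  have := (exp_deriv ρ y).mul h1
  refine this.congr_deriv ?_
  simp only [jkd, Function.comp_apply]; ring

/-- the Jacobi ODE -/
lemma jkd_deriv (a b ρ : ℝ) (hab : 0 < a + b) {y : ℝ} (hy : 0 < y) :
    ∃ j2 : ℂ, HasDerivAt (jkd a b ρ) j2 y ∧
      rr y * j2 + (a + b) * (1 - rr y) * jkd a b ρ y = (a * b * (1 - rr y) - ρ ^ 2) * jk a b ρ y := by
  have hP := pj_PB a b ρ hab
  have h0 := (hP.hasDerivAt (rr_norm hy)).comp y (rr_deriv y)
  have h1 := (hP.dsh.hasDerivAt (rr_norm hy)).comp y (rr_deriv y)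
  have h2 := (exp_deriv ρ y).mul ((h0.const_mul (I * ρ)).add (((rr_deriv y).const_sub 1).mul h1))
  refine ⟨_, h2, ?_⟩
  have ode := F21_ode (a - I * ρ) (b - I * ρ) ((a:ℂ) + b) (ab_ne a b hab) (rr_norm hy)
  simp only [jkd, jk, Function.comp_apply, Pi.add_apply, Pi.mul_apply]
  change rr y * (1 - rr y) * pser (dsh (dsh (pj a b ρ))) (rr y) + _ * pser (dsh (pj a b ρ)) (rr y)
    - _ * pser (pj a b ρ) (rr y) = 0 at ode
  generalize pser (dsh (dsh (pj a b ρ))) (rr y) = F2 at *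
  generalize pser (dsh (pj a b ρ)) (rr y) = F1 at *
  generalize pser (pj a b ρ) (rr y) = F0 at *
  generalize cexp (I * ρ * y) = E at *
  generalize (rr y : ℂ) = r at *
  have hI : I ^ 2 = -1 := I_sq
  linear_combination E * (1 - r) * ode + (E * F0 * (ρ:ℂ)^2) * hI

/-- realness -/
lemma jk_conj (a b ρ : ℝ) (hab : 0 < a + b) {y : ℝ} (hy : 0 < y) : conj (jk a b ρ y) = jk a b ρ y := by
  have hn := rr_norm hy
  have h1 : jk a b ρ y = cexp (-I * ρ * y) * F21 (a + I * ρ) (b + I * ρ) ((a:ℂ) + b) (rr y) := by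
    have e := euler_tr (a - I * ρ) (b - I * ρ) ((a:ℂ) + b) (ab_ne a b hab) hn
    rw [F21_pser] at e
    rw [jk, show pj a b ρ = hc (a - I * ρ) (b - I * ρ) ((a:ℂ) + b) from rfl, e, ← mul_assoc]
    congr 1
    · have : (1 - (rr y : ℂ)) = ((exp (-y) : ℝ) : ℂ) := by simp [rr]
      rw [this, cpow_def_of_ne_zero (by exact_mod_cast (exp_pos _).ne'),
        ← ofReal_log (exp_pos _).le, log_exp, ← Complex.exp_add]
      congr 1; push_cast; ring
    · rw [F21_symm]; congr 1 <;> ring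
  conv_lhs => rw [h1]
  rw [map_mul, ← Complex.exp_conj, jk, F21_pser]
  congr 1
  · congr 1; simp
  · rw [pser, pser, Complex.conj_tsum]
    congr 1; ext n
    simp only [hc, pj, map_mul, map_div₀, map_pow, conj_ofReal, ← poch_conj, map_add, conj_I,
      Complex.conj_natCast, neg_mul, ← sub_eq_add_neg]

def E1 (a b ρ : ℝ) : ℂ := ∑' n, ej a b ρ n

lemma summable_sq_inv : Summable (fun j : ℕ => 1 / jR^2) := by
  have := (summable_nat_add_iff 1).mpr (Real.summable_one_div_nat_pow.mpr (show 1 < 2 by norm_num))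
  simpa using this

lemma summable_rpow_inv : Summable (fun j : ℕ => jR ^ (-(3/2) : ℝ)) := by
  have := (summable_nat_add_iff 1).mpr (Real.summable_nat_rpow.mpr (show (-(3/2):ℝ) < -1 by norm_num))
  simpa using this

/-- uniform bounds and asymptotics -/
lemma jk_bounds (a b δ N : ℝ) (hab : 0 < a + b) (hδ : 0 < δ) : ∃ C > 0, ∀ ρ ∈ Icc δ N,
    ‖kap a b ρ‖ ≤ C ∧ ‖E1 a b ρ‖ ≤ C ∧ ∀ y > 0, ‖jk a b ρ y‖ ≤ C ∧ ‖jkd a b ρ y‖ ≤ C ∧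
      ‖jk a b ρ y - (kap a b ρ * cexp (-I * ρ * y) + E1 a b ρ * cexp (I * ρ * y))‖
        ≤ C * exp (-y/2) := by
  obtain ⟨C, hC, H⟩ := pj_bounds a b δ N hab hδ
  let S := ∑' j : ℕ, 1 / jR^2
  let S' := ∑' j : ℕ, jR ^ (-(3/2) : ℝ)
  have hS : 0 ≤ S := tsum_nonneg fun j => by positivity
  have hS' : 0 ≤ S' := tsum_nonneg fun j => by positivity
  have hE : ∀ ρ ∈ Icc δ N, ‖E1 a b ρ‖ ≤ C * S := by
    intro ρ hρ
    have := tsum_of_norm_bounded (f := ej a b ρ) (summable_sq_inv.mul_left C).hasSum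
      (fun j => by rw [mul_one_div]; exact ((H ρ hρ).2 j).2)
    rwa [tsum_mul_left] at this
  have hs : ∀ ρ ∈ Icc δ N, Summable (ej a b ρ) := fun ρ hρ =>
    Summable.of_norm_bounded (summable_sq_inv.mul_left C) (fun j => by rw [mul_one_div]; exact ((H ρ hρ).2 j).2)
  have hexp : ∀ x : ℝ, ‖cexp (I * x)‖ = 1 := fun x => by rw [mul_comm]; exact norm_exp_ofReal_mul_I x
  have hexp1 : ∀ ρ y : ℝ, ‖cexp (I * ρ * y)‖ = 1 := fun ρ y => by
    rw [mul_assoc, ← ofReal_mul]; exact hexp _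
  have hexp2 : ∀ ρ y : ℝ, ‖cexp (-I * ρ * y)‖ = 1 := fun ρ y => by
    rw [show -I * ρ * y = I * ((-(ρ*y) : ℝ) : ℂ) by push_cast; ring]; exact hexp _
  have asym : ∀ ρ ∈ Icc δ N, ∀ y > 0, ‖jk a b ρ y - (kap a b ρ * cexp (-I * ρ * y) +
      E1 a b ρ * cexp (I * ρ * y))‖ ≤ C * S' * exp (-y/2) := by
    intro ρ hρ y hy
    have hn := rr_norm hy
    have hr0 := (rr_pos hy).le
    have b1 := (binom_hasSum (-2 * I * ρ) hn).mul_left (kap a b ρ)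
    have b2 := (pj_PB a b ρ hab).hasSum hn
    have b3 := b2.sub b1
    have b4 := b3.sub (hs ρ hρ).hasSum
    have e1 : ∀ n : ℕ, ‖pj a b ρ n * (rr y:ℂ)^n - kap a b ρ * (poch (-2 * I * ρ) n / n.factorial * (rr y:ℂ)^n) - ej a b ρ n‖
        ≤ C * exp (-y/2) * nR ^ (-(3/2) : ℝ) := by
      intro n
      have : pj a b ρ n * (rr y:ℂ)^n - kap a b ρ * (poch (-2 * I * ρ) n / n.factorial * (rr y:ℂ)^n) - ej a b ρ n
          = - (ej a b ρ n * ((1 - rr y ^ n : ℝ) : ℂ)) := by rw [ej]; push_cast; ring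
      rw [this, norm_neg, norm_mul, norm_real]
      have q0 : rr y ^ n ≤ 1 := pow_le_one₀ hr0 (rr_lt y).le
      have q1 : 1 - rr y ^ n ≤ n * exp (-y) := by
        have := one_add_mul_le_pow (show (-2:ℝ) ≤ -exp (-y) by
          have := exp_le_one_iff.mpr (show -y ≤ 0 by linarith); linarith) n
        rw [show rr y = 1 + -exp (-y) by simp [rr]; ring]; linarith
      have q2 : 1 - rr y ^ n ≤ nR ^ (1/2 : ℝ) * exp (-y/2) := by
        have h1 : (1 - rr y ^ n) ≤ (1 - rr y ^ n) ^ (1/2:ℝ) := by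
          have h0 : 0 ≤ 1 - rr y ^ n := by linarith
          have h2 : 1 - rr y ^ n ≤ 1 := by have := pow_nonneg hr0 n; linarith
          conv_lhs => rw [← rpow_one (1 - rr y ^ n)]
          exact Real.rpow_le_rpow_of_exponent_ge_of_imp h0 h2 bnum bnum
        refine h1.trans ?_
        have h3 : exp (-y/2) = exp (-y) ^ (1/2:ℝ) := by rw [← Real.exp_mul]; congr 1; ring
        rw [h3, ← mul_rpow bpos (exp_pos _).le]
        apply rpow_le_rpow blin _ bnum
        have := exp_pos (-y)
        nlinarith
      rw [norm_of_nonneg blin]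
      calc _ ≤ C / nR^2 * (nR ^ (1/2 : ℝ) * exp (-y/2)) := by
            gcongr; exact ((H ρ hρ).2 n).2
        _ = C * exp (-y/2) * (nR ^ (1/2 : ℝ) / nR^2) := by ring
        _ = _ := by
            congr 1
            rw [← rpow_natCast, ← Real.rpow_sub bpos]; norm_num
    have e2 := tsum_of_norm_bounded ((summable_rpow_inv.mul_left (C * exp (-y/2))).hasSum) e1
    rw [b4.tsum_eq, tsum_mul_left] at e2
    have e3 : (1 - (rr y : ℂ)) ^ (-(-2 * I * ρ)) = cexp (-2 * I * ρ * y) := by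
      have : (1 - (rr y : ℂ)) = ((exp (-y) : ℝ) : ℂ) := by simp [rr]
      rw [this, cpow_def_of_ne_zero (by exact_mod_cast (exp_pos _).ne'),
        ← ofReal_log (exp_pos _).le, log_exp]
      congr 1; push_cast; ring
    rw [e3] at e2
    have e4 : jk a b ρ y - (kap a b ρ * cexp (-I * ρ * y) + E1 a b ρ * cexp (I * ρ * y))
      = cexp (I * ρ * y) * (pser (pj a b ρ) (rr y) - kap a b ρ * cexp (-2 * I * ρ * y) - E1 a b ρ) := by
      rw [jk, show cexp (-I * ρ * y) = cexp (I * ρ * y) * cexp (-2 * I * ρ * y) by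
        rw [← Complex.exp_add]; congr 1; ring]
      ring
    rw [e4, norm_mul, hexp1, one_mul]
    calc _ ≤ _ := e2
      _ = _ := by simp only [S']; ring
  have jb : ∀ ρ ∈ Icc δ N, ∀ y > 0, ‖jk a b ρ y‖ ≤ C + C * S + C * S' := by
    intro ρ hρ y hy
    have h1 := asym ρ hρ y hy
    have h2 := norm_sub_norm_le (jk a b ρ y) (kap a b ρ * cexp (-I * ρ * y) + E1 a b ρ * cexp (I * ρ * y))
    have h3 := norm_add_le (kap a b ρ * cexp (-I * ρ * y)) (E1 a b ρ * cexp (I * ρ * y))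
    rw [norm_mul, norm_mul, hexp1, hexp2, mul_one, mul_one] at h3
    have h4 : exp (-y/2) ≤ 1 := exp_le_one_iff.mpr blin
    have h5 : C * S' * exp (-y/2) ≤ C * S' := mul_le_of_le_one_right bpos h4
    linarith [(H ρ hρ).1, hE ρ hρ]
  refine ⟨C + C * S + C * S' + |N| * (C + C * S + C * S') + C, by positivity, fun ρ hρ => ⟨?_, ?_, fun y hy => ⟨?_, ?_, ?_⟩⟩⟩
  · have := (H ρ hρ).1; have : 0 ≤ |N| * (C + C * S + C * S') := by positivity
    have : 0 ≤ C * S := by positivity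
    have : 0 ≤ C * S' := by positivity
    linarith
  · have := hE ρ hρ; have : 0 ≤ |N| * (C + C * S + C * S') := by positivity
    have : 0 ≤ C * S' := by positivity
    linarith
  · have := jb ρ hρ y hy; have : 0 ≤ |N| * (C + C * S + C * S') := by positivity
    linarith
  · have e : jkd a b ρ y = I * ρ * jk a b ρ y + cexp (I * ρ * y) * ((1 - rr y) * pser (dsh (pj a b ρ)) (rr y)) := by
      rw [jkd, jk]; ring
    have h1 : ‖pser (dsh (pj a b ρ)) (rr y)‖ ≤ C * (1 - rr y)⁻¹ := by
      have g := (hasSum_geometric_of_lt_one (rr_pos hy).le (rr_lt y)).mul_left C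
      refine tsum_of_norm_bounded g (fun n => ?_)
      rw [norm_mul, norm_pow, norm_real, norm_of_nonneg (rr_pos hy).le]
      refine mul_le_mul_of_nonneg_right ?_ (pow_nonneg (rr_pos hy).le n)
      rw [show dsh (pj a b ρ) n = (nC + 1) * pj a b ρ (n+1) from rfl, norm_mul]
      have h2 := ((H ρ hρ).2 (n+1)).1
      have h3 : ‖nC + 1‖ = (n:ℝ) + 1 := by
        rw [show nC + 1 = ((n+1:ℕ):ℂ) by push_cast; rfl, Complex.norm_natCast]; push_cast; rfl
      rw [h3]
      calc nR * ‖pj a b ρ (n+1)‖ ≤ nR * (C / ((n+1:ℕ) + 1)) := by gcongr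
        _ ≤ C := by
          rw [mul_div_assoc', div_le_iff₀ bpos]; push_cast; nlinarith
    have h2 : ‖(1 - (rr y:ℂ)) * pser (dsh (pj a b ρ)) (rr y)‖ ≤ C := by
      have h4 : 0 < 1 - rr y := by linarith [rr_lt y]
      rw [norm_mul, show (1 - (rr y:ℂ)) = ((1 - rr y : ℝ):ℂ) by push_cast; rfl, norm_real, norm_of_nonneg h4.le]
      calc _ ≤ (1 - rr y) * (C * (1 - rr y)⁻¹) := by gcongr
        _ = C := by field_simp
    rw [e]
    refine (norm_add_le _ _).trans ?_
    rw [norm_mul, norm_mul, norm_I, one_mul, norm_mul (cexp _), hexp1, one_mul, norm_real, norm_eq_abs]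
    have h5 : |ρ| ≤ |N| := by
      rw [abs_of_pos (hδ.trans_le hρ.1)]; exact hρ.2.trans (le_abs_self N)
    have h6 : |ρ| * ‖jk a b ρ y‖ ≤ |N| * (C + C * S + C * S') := by
      gcongr; exact jb ρ hρ y hy
    have : 0 ≤ C * S := by positivity
    have : 0 ≤ C * S' := by positivity
    linarith
  · refine (asym ρ hρ y hy).trans ?_
    gcongr
    have : 0 ≤ |N| * (C + C * S + C * S') := by positivity
    have : 0 ≤ C * S := by positivity
    linarith

lemma measurable_jk (a b : ℝ) (hab : 0 < a + b) :
    Measurable ({p : ℝ × ℝ | 0 < p.2}.indicator fun p => jk a b p.1 p.2) := by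
  have hS : MeasurableSet {p : ℝ × ℝ | 0 < p.2} := measurableSet_lt measurable_const measurable_snd
  have h := measurable_tsum_on (fun n (p : ℝ × ℝ) => pj a b p.1 n * (rr p.2 : ℂ) ^ n) (fun n => by
    have h1 : Measurable (fun p : ℝ × ℝ => pj a b p.1 n) := (measurable_pj a b n).comp measurable_fst
    have h2 : Measurable (fun p : ℝ × ℝ => (rr p.2 : ℂ) ^ n) := by unfold rr; fun_prop
    exact h1.mul h2) {p : ℝ × ℝ | 0 < p.2} hS
    (fun p hp => ((pj_PB a b p.1 hab).summable (rr_norm hp)).of_norm)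
  have h2 : Measurable (fun p : ℝ × ℝ => cexp (I * p.1 * p.2)) := by fun_prop
  convert h2.mul h using 1
  ext p
  by_cases hp : p ∈ {p : ℝ × ℝ | 0 < p.2}
  · simp only [Pi.mul_apply, indicator_of_mem hp]; rfl
  · simp only [Pi.mul_apply, indicator_of_notMem hp, mul_zero]

lemma measurable_jkd (a b : ℝ) (hab : 0 < a + b) :
    Measurable ({p : ℝ × ℝ | 0 < p.2}.indicator fun p => jkd a b p.1 p.2) := by
  have hS : MeasurableSet {p : ℝ × ℝ | 0 < p.2} := measurableSet_lt measurable_const measurable_snd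
  have h := measurable_tsum_on (fun n (p : ℝ × ℝ) => dsh (pj a b p.1) n * (rr p.2 : ℂ) ^ n) (fun n => by
    have h1 : Measurable (fun p : ℝ × ℝ => dsh (pj a b p.1) n) :=
      ((measurable_pj a b (n+1)).comp measurable_fst).const_mul _
    have h2 : Measurable (fun p : ℝ × ℝ => (rr p.2 : ℂ) ^ n) := by unfold rr; fun_prop
    exact h1.mul h2) {p : ℝ × ℝ | 0 < p.2} hS
    (fun p hp => ((pj_PB a b p.1 hab).dsh.summable (rr_norm hp)).of_norm)
  have h2 : Measurable (fun p : ℝ × ℝ => cexp (I * p.1 * p.2) * (1 - rr p.2)) := by unfold rr; fun_prop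
  have h3 : Measurable (fun p : ℝ × ℝ => (I * p.1 : ℂ)) := by fun_prop
  convert (h3.mul (measurable_jk a b hab)).add (h2.mul h) using 1
  ext p
  by_cases hp : p ∈ {p : ℝ × ℝ | 0 < p.2}
  · simp only [Pi.mul_apply, Pi.add_apply, indicator_of_mem hp, jk, jkd, pser]; ring
  · simp only [Pi.mul_apply, Pi.add_apply, indicator_of_notMem hp, mul_zero, add_zero]

lemma measurable_E1 (a b δ N : ℝ) (hab : 0 < a + b) (hδ : 0 < δ) :
    Measurable ((Icc δ N).indicator (E1 a b)) := by
  obtain ⟨C, hC, H⟩ := pj_bounds a b δ N hab hδ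
  exact measurable_tsum_on (fun n ρ => ej a b ρ n) (measurable_ej a b) _ measurableSet_Icc fun ρ hρ =>
    Summable.of_norm_bounded (summable_sq_inv.mul_left C) (fun j => by rw [mul_one_div]; exact ((H ρ hρ).2 j).2)

structure BF (δ N M : ℝ) (f : ℝ → ℂ) : Prop where
  meas : Measurable f
  bd : ∀ ρ, ‖f ρ‖ ≤ M
  supp : ∀ ρ, ρ ∉ Icc δ N → f ρ = 0

lemma BF.nonneg {δ N M : ℝ} {f : ℝ → ℂ} (h : BF δ N M f) : 0 ≤ M := (norm_nonneg _).trans (h.bd 0)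

lemma BF.prod_le {δ N M : ℝ} {f : ℝ → ℂ} (h : BF δ N M f) (k : ℝ → ℂ) (C : ℝ)
    (hb : ∀ ρ ∈ Icc δ N, ‖k ρ‖ ≤ C) (ρ : ℝ) : ‖f ρ * k ρ‖ ≤ (Icc δ N).indicator (fun _ => M * C) ρ := by
  by_cases hρ : ρ ∈ Icc δ N
  · rw [indicator_of_mem hρ, norm_mul]
    exact mul_le_mul (h.bd ρ) (hb ρ hρ) nnn h.nonneg
  · rw [indicator_of_notMem hρ, h.supp ρ hρ]; simp

lemma ind_integrable (δ N C : ℝ) : Integrable ((Icc δ N).indicator (fun _ : ℝ => C)) := by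
  rw [integrable_indicator_iff measurableSet_Icc]
  exact integrableOn_const bsimp bsimp

lemma BF.integrable_mul {δ N M : ℝ} {f : ℝ → ℂ} (h : BF δ N M f) (k : ℝ → ℂ) (C : ℝ)
    (hk : Measurable k) (hb : ∀ ρ ∈ Icc δ N, ‖k ρ‖ ≤ C) : Integrable (fun ρ => f ρ * k ρ) :=
  (ind_integrable δ N (M*C)).mono' (h.meas.mul hk).aestronglyMeasurable (ae_of_all _ (h.prod_le k C hb))

lemma BF.norm_integral_le {δ N M : ℝ} {f : ℝ → ℂ} (h : BF δ N M f) (hN : δ ≤ N) (k : ℝ → ℂ) (C : ℝ)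
    (hb : ∀ ρ ∈ Icc δ N, ‖k ρ‖ ≤ C) : ‖∫ ρ, f ρ * k ρ‖ ≤ M * C * (N - δ) := by
  refine (norm_integral_le_of_norm_le (ind_integrable δ N (M*C)) (ae_of_all _ (h.prod_le k C hb))).trans ?_
  rw [integral_indicator measurableSet_Icc, setIntegral_const, smul_eq_mul, Measure.real, volume_Icc,
    ENNReal.toReal_ofReal blin]
  exact le_of_eq (by ring)

lemma BF.mul {δ N M C : ℝ} {f k : ℝ → ℂ} (h : BF δ N M f) (hk : Measurable k)
    (hb : ∀ ρ ∈ Icc δ N, ‖k ρ‖ ≤ C) (hC : 0 ≤ C) : BF δ N (M * C) (fun ρ => f ρ * k ρ) := by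
  refine ⟨h.meas.mul hk, fun ρ => (h.prod_le k C hb ρ).trans ?_, fun ρ hρ => by rw [h.supp ρ hρ, zero_mul]⟩
  exact indicator_le_self' (fun _ _ => mul_nonneg h.nonneg hC) ρ

lemma BF.integrable {δ N M : ℝ} {f : ℝ → ℂ} (h : BF δ N M f) : Integrable f := by
  simpa using h.integrable_mul (fun _ => 1) 1 measurable_const bsimp

lemma BF.memLp {δ N M : ℝ} {f : ℝ → ℂ} (h : BF δ N M f) : MemLp f 2 := by
  rw [memLp_two_iff_integrable_sq_norm h.meas.aestronglyMeasurable]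
  refine (ind_integrable δ N (M*M)).mono' (by have := h.meas; fun_prop) (ae_of_all _ fun ρ => ?_)
  have := h.prod_le f M (fun ρ _ => h.bd ρ) ρ
  rwa [norm_mul, ← pow_two, ← norm_of_nonneg (sq_nonneg ‖f ρ‖)] at this

lemma BF.sq_le {δ N M : ℝ} {f : ℝ → ℂ} (h : BF δ N M f) (hN : δ ≤ N) : ∫ ρ, ‖f ρ‖^2 ≤ M^2*(N-δ) := by
  refine (integral_mono (h.memLp.integrable_norm_pow bnum) (ind_integrable δ N (M*M)) fun ρ => ?_).trans ?_
  · have := h.prod_le f M (fun ρ _ => h.bd ρ) ρ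
    rwa [norm_mul, ← pow_two] at this
  rw [integral_indicator measurableSet_Icc, setIntegral_const, smul_eq_mul, Measure.real, volume_Icc,
    ENNReal.toReal_ofReal blin]
  exact le_of_eq (by ring)

lemma BF.conj {δ N M : ℝ} {f : ℝ → ℂ} (h : BF δ N M f) : BF δ N M (fun ρ => conj (f ρ)) :=
  ⟨(continuous_conj.measurable).comp h.meas, fun ρ => by rw [norm_conj]; exact h.bd ρ,
    fun ρ hρ => by rw [h.supp ρ hρ, map_zero]⟩

lemma FT_normsq (f : ℝ → ℂ) (h1 : Integrable f) (h2 : MemLp f 2) :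
    ∫ x, ‖FT f x‖^2 = 2 * π * ∫ y, ‖f y‖^2 := by
  have := FT_inner f f h1 h2 h1 h2
  simp_rw [mul_conj, normSq_eq_norm_sq] at this
  rw [integral_complex_ofReal, integral_complex_ofReal] at this
  exact_mod_cast this

lemma FT_tendsto (f : ℝ → ℂ) : Tendsto (FT f) (cocompact ℝ) (𝓝 0) := by
  have h := Real.zero_at_infty_fourier f
  have e : FT f = fun x => FourierTransform.fourier f (-(2 * π)⁻¹ * x) := funext (FT_eq f)
  rw [e]
  have hpi : -(2 * π)⁻¹ ≠ 0 := by have := pi_pos; simp [this.ne']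
  exact h.comp (Homeomorph.mulLeft₀ _ hpi).isClosedEmbedding.tendsto_cocompact

/-- differentiation under the integral -/
lemma BF.hasDerivAt {δ N M : ℝ} {f : ℝ → ℂ} (h : BF δ N M f) (K K' : ℝ → ℝ → ℂ) (y0 ε C : ℝ) (hε : 0 < ε)
    (hm : ∀ y ∈ Metric.ball y0 ε, Measurable (fun ρ => K ρ y)) (hm' : Measurable (fun ρ => K' ρ y0))
    (hb : ∀ ρ ∈ Icc δ N, ‖K ρ y0‖ ≤ C) (hb' : ∀ ρ ∈ Icc δ N, ∀ y ∈ Metric.ball y0 ε, ‖K' ρ y‖ ≤ C)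
    (hd : ∀ ρ ∈ Icc δ N, ∀ y ∈ Metric.ball y0 ε, HasDerivAt (K ρ) (K' ρ y) y) :
    HasDerivAt (fun y => ∫ ρ, f ρ * K ρ y) (∫ ρ, f ρ * K' ρ y0) y0 := by
  refine (hasDerivAt_integral_of_dominated_loc_of_deriv_le (F := fun y ρ => f ρ * K ρ y)
    (F' := fun y ρ => f ρ * K' ρ y) (Metric.ball_mem_nhds y0 hε) ?_ ?_ ?_ ?_ (ind_integrable δ N (M*C)) ?_).2
  · filter_upwards [Metric.ball_mem_nhds y0 hε] with y hy
    exact (h.meas.mul (hm y hy)).aestronglyMeasurable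
  · exact h.integrable_mul _ C (hm y0 (Metric.mem_ball_self hε)) hb
  · exact (h.meas.mul hm').aestronglyMeasurable
  · exact ae_of_all _ fun ρ y hy => h.prod_le (fun ρ => K' ρ y) C (fun ρ hρ => hb' ρ hρ y hy) ρ
  · refine ae_of_all _ fun ρ y hy => ?_
    by_cases hρ : ρ ∈ Icc δ N
    · exact (hd ρ hρ y hy).const_mul (f ρ)
    · simp only [h.supp ρ hρ, zero_mul]; exact hasDerivAt_const _ _

lemma meas_jk (a b : ℝ) (hab : 0 < a + b) {y : ℝ} (hy : 0 < y) : Measurable (fun ρ => jk a b ρ y) := by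
  have := (measurable_jk a b hab).comp (measurable_prodMk_right (y := y))
  convert this using 1; ext ρ; simp [indicator, hy]

lemma meas_jkd (a b : ℝ) (hab : 0 < a + b) {y : ℝ} (hy : 0 < y) : Measurable (fun ρ => jkd a b ρ y) := by
  have := (measurable_jkd a b hab).comp (measurable_prodMk_right (y := y))
  convert this using 1; ext ρ; simp [indicator, hy]

def vj (a b : ℝ) (f : ℝ → ℂ) (y : ℝ) : ℂ := ∫ ρ, f ρ * jk a b ρ y
def vjd (a b : ℝ) (f : ℝ → ℂ) (y : ℝ) : ℂ := ∫ ρ, f ρ * jkd a b ρ y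

lemma vj_deriv (a b δ N : ℝ) (hab : 0 < a + b) (hδ : 0 < δ) {M : ℝ} {f : ℝ → ℂ} (h : BF δ N M f)
    {y : ℝ} (hy : 0 < y) : HasDerivAt (vj a b f) (vjd a b f y) y := by
  obtain ⟨C, hC, H⟩ := jk_bounds a b δ N hab hδ
  have hp : ∀ z ∈ Metric.ball y y, 0 < z := fun z hz => by
    rw [Metric.mem_ball, dist_eq, abs_lt] at hz; linarith [hz.1]
  exact h.hasDerivAt (jk a b) (jkd a b) y y C hy (fun z hz => meas_jk a b hab (hp z hz)) (meas_jkd a b hab hy)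
    (fun ρ hρ => ((H ρ hρ).2.2 y hy).1) (fun ρ hρ z hz => ((H ρ hρ).2.2 z (hp z hz)).2.1)
    (fun ρ hρ z hz => jk_deriv a b ρ hab (hp z hz))

lemma rr_derivR (y : ℝ) : HasDerivAt rr (1 - rr y) y := by
  have := ((hasDerivAt_neg y).exp).const_sub 1
  simp only [mul_neg, mul_one, neg_neg] at this
  exact this.congr_deriv (by simp [rr])

lemma vjd_deriv (a b δ N : ℝ) (hab : 0 < a + b) (hδ : 0 < δ) {M : ℝ} {f : ℝ → ℂ} (h : BF δ N M f)
    {y : ℝ} (hy : 0 < y) : HasDerivAt (fun y => ((rr y ^ (a+b) : ℝ) : ℂ) * vjd a b f y)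
      (((rr y ^ (a+b-1) : ℝ) : ℂ) * (a * b * (1 - rr y) * vj a b f y - vj a b (fun ρ => f ρ * (ρ:ℂ)^2) y)) y := by
  obtain ⟨C, hC, H⟩ := jk_bounds a b δ N hab hδ
  have hp : ∀ z ∈ Metric.ball y (y/2), y / 2 < z := fun z hz => by
    rw [Metric.mem_ball, dist_eq, abs_lt] at hz; linarith [hz.1]
  have hp' : ∀ z ∈ Metric.ball y (y/2), 0 < z := fun z hz => by linarith [hp z hz]
  let K : ℝ → ℝ → ℂ := fun ρ y => ((rr y ^ (a+b) : ℝ) : ℂ) * jkd a b ρ y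
  let K' : ℝ → ℝ → ℂ := fun ρ y => ((rr y ^ (a+b-1) : ℝ) : ℂ) * ((a * b * (1 - rr y) - ρ^2) * jk a b ρ y)
  have hone : ∀ z > 0, rr z ^ (a+b) ≤ 1 := fun z hz => rpow_le_one (rr_pos hz).le (rr_lt z).le hab.le
  have hr2 : 0 < rr (y/2) := rr_pos blin
  have hw : ∀ z ∈ Metric.ball y (y/2), rr z ^ (a+b-1) ≤ (rr (y/2))⁻¹ := fun z hz => by
    have hz0 := rr_pos (hp' z hz)
    rw [rpow_sub_one hz0.ne', div_eq_mul_inv]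
    have : rr (y/2) ≤ rr z := by
      unfold rr; have := exp_le_exp.mpr (show -z ≤ -(y/2) by linarith [hp z hz]); linarith
    calc rr z ^ (a+b) * (rr z)⁻¹ ≤ 1 * (rr (y/2))⁻¹ := by
          apply mul_le_mul (hone z (hp' z hz)) _ bpos bnum
          exact inv_anti₀ hr2 this
      _ = _ := one_mul _
  have key := h.hasDerivAt K K' y (y/2) (C + (rr (y/2))⁻¹ * ((|a*b| + N^2) * C)) blin
    (fun z hz => (meas_jkd a b hab (hp' z hz)).const_mul _)
    (by
      have := meas_jk a b hab hy
      exact Measurable.const_mul (Measurable.mul bfun this) _)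
    (fun ρ hρ => by
      have h1 := ((H ρ hρ).2.2 y hy).2.1
      have h2 : 0 ≤ (rr (y/2))⁻¹ * ((|a*b| + N^2) * C) := by positivity
      have h3 := rr_pos hy
      have : ‖K ρ y‖ ≤ 1 * C := by
        rw [norm_mul, norm_real, norm_of_nonneg bpos]
        exact mul_le_mul (hone y hy) h1 nnn bnum
      linarith)
    (fun ρ hρ z hz => by
      have h1 := ((H ρ hρ).2.2 z (hp' z hz)).1
      have h3 := rr_pos (hp' z hz)
      have h4 : ‖((a:ℂ) * b * (1 - rr z) - ρ^2)‖ ≤ |a*b| + N^2 := by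
        have e : ((a:ℂ) * b * (1 - rr z) - ρ^2) = ((a*b*(1-rr z) - ρ^2 : ℝ) : ℂ) := by push_cast; ring
        rw [e, norm_real, norm_eq_abs]
        refine (abs_sub _ _).trans ?_
        have h5 : |1 - rr z| ≤ 1 := by rw [abs_le]; constructor <;> linarith [rr_lt z]
        have h6 : |ρ^2| ≤ N^2 := by
          rw [abs_of_nonneg (sq_nonneg ρ)]; exact pow_le_pow_left₀ (by linarith [hρ.1]) hρ.2 2
        rw [abs_mul (a*b)]
        nlinarith [abs_nonneg (a*b)]
      have : ‖K' ρ z‖ ≤ (rr (y/2))⁻¹ * ((|a*b| + N^2) * C) := by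
        rw [norm_mul, norm_real, norm_of_nonneg bpos, norm_mul]
        have := hw z hz
        gcongr
      linarith)
    (fun ρ hρ z hz => by
      have hz0 := rr_pos (hp' z hz)
      obtain ⟨j2, hj, e⟩ := jkd_deriv a b ρ hab (hp' z hz)
      have h1 := ((rr_derivR z).rpow_const (p := a+b) (Or.inl hz0.ne')).ofReal_comp.mul hj
      refine h1.congr_deriv ?_
      simp only [K', ← e]
      rw [rpow_sub_one hz0.ne']
      have : (rr z : ℂ) ≠ 0 := by exact_mod_cast hz0.ne'
      push_cast
      field_simp; ring)
  have e1 : (fun y => ((rr y ^ (a+b) : ℝ) : ℂ) * vjd a b f y) = fun y => ∫ ρ, f ρ * K ρ y := by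
    ext y
    rw [vjd, ← integral_const_mul]; congr 1; ext ρ; simp only [K]; ring
  rw [e1]
  refine key.congr_deriv ?_
  rw [vj, vj, ← integral_const_mul, ← integral_sub, ← integral_const_mul]
  · congr 1; ext ρ; simp only [K']; ring
  · exact (h.integrable_mul _ C (meas_jk a b hab hy) (fun ρ hρ => ((H ρ hρ).2.2 y hy).1)).const_mul _
  · have h' : BF δ N (M * N^2) (fun ρ => f ρ * (ρ:ℂ)^2) := h.mul bfun (fun ρ hρ => by
      rw [norm_pow, norm_real, norm_of_nonneg (by linarith [hρ.1])]
      exact pow_le_pow_left₀ (by linarith [hρ.1]) hρ.2 2) bpos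
    exact (h'.integrable_mul _ C (meas_jk a b hab hy) (fun ρ hρ => ((H ρ hρ).2.2 y hy).1))

lemma rpow_sub_one_bound (s : ℝ) {r : ℝ} (h0 : 0 < r) (h1 : r < 1) :
    |r ^ s - 1| ≤ (|s| + 1) * ((1 - r) * r ^ s + (1 - r)) := by
  have hr : 0 ≤ (1 - r) * r ^ s := by have := rpow_pos_of_pos h0 s; nlinarith
  rcases le_or_gt 0 s with hs | hs
  · have h2 : r ^ s ≤ 1 := rpow_le_one h0.le h1.le hs
    rw [abs_of_nonpos blin, abs_of_nonneg hs]
    have h3 : 1 - r ^ s ≤ (s + 1) * (1 - r) := by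
      rcases le_or_gt 1 s with h | h
      · have := one_add_mul_self_le_rpow_one_add (s := r - 1) blin h
        rw [show 1 + (r - 1) = r by ring] at this
        nlinarith
      · have := rpow_le_rpow_of_exponent_ge h0 h1.le h.le
        rw [rpow_one] at this
        nlinarith
    nlinarith
  · have h2 : 1 ≤ r ^ s := Real.one_le_rpow_of_pos_of_le_one_of_nonpos h0 h1.le hs.le
    rw [abs_of_nonneg blin, abs_of_neg hs]
    rcases le_or_gt (-1) s with h | h
    · have h3 : r ≤ r ^ (-s) := by
        have := rpow_le_rpow_of_exponent_ge h0 h1.le (show -s ≤ 1 by linarith)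
        rwa [rpow_one] at this
      have h4 : r ^ s * r ^ (-s) = 1 := by rw [← rpow_add h0]; simp
      nlinarith
    · have := one_add_mul_self_le_rpow_one_add (s := r - 1) blin (show 1 ≤ -s by linarith)
      rw [show 1 + (r - 1) = r by ring] at this
      have h4 : r ^ s * r ^ (-s) = 1 := by rw [← rpow_add h0]; simp
      nlinarith

lemma rr_zero : rr 0 = 0 := by simp [rr]

lemma rr_cont : Continuous rr := by unfold rr; fun_prop

lemma rr_tendsto : Tendsto rr atTop (𝓝 1) := by
  have := (Real.tendsto_exp_neg_atTop_nhds_zero).const_sub 1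
  rw [sub_zero] at this
  exact this

lemma int_exp (f : ℝ → ℂ) (h : Integrable f) (x : ℝ) : Integrable (fun ρ : ℝ => cexp (I * x * ρ) * f ρ) := by
  refine h.norm.mono' ((by fun_prop : Measurable (fun ρ : ℝ => cexp (I * x * ρ))).aestronglyMeasurable.mul h.1)
    (ae_of_all _ fun ρ => ?_)
  rw [norm_mul, mul_assoc, ← ofReal_mul, mul_comm I, norm_exp_ofReal_mul_I, one_mul]

lemma rr_int (s : ℝ) (hs : -1 < s) : IntegrableOn (fun y => (1 - rr y) * rr y ^ s) (Ioi 0) := by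
  have hs1 : s + 1 ≠ 0 := by linarith
  refine integrableOn_Ioi_deriv_of_nonneg (g := fun y => rr y ^ (s+1) / (s+1)) (l := 1 ^ (s+1) / (s+1)) ?_ ?_ ?_ ?_
  · exact ((rr_cont.continuousAt.rpow_const (Or.inr blin)).div_const _).continuousWithinAt
  · intro y hy
    have := ((rr_derivR y).rpow_const (p := s+1) (Or.inl (rr_pos hy).ne')).div_const (s+1)
    refine this.congr_deriv ?_
    rw [add_sub_cancel_right]; field_simp
  · intro y hy
    have := rr_pos hy; have := rr_lt y
    have : 0 ≤ 1 - rr y := by linarith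
    positivity
  · exact (rr_tendsto.rpow_const (Or.inl bnum)).div_const _

lemma omega_int (s : ℝ) (hs : -1 < s) : IntegrableOn (fun y => rr y ^ s - 1) (Ioi 0) := by
  have h1 := rr_int s hs
  have h2 := rr_int 0 bnum
  simp only [rpow_zero, mul_one] at h2
  refine ((h1.add h2).const_mul (|s|+1)).mono' ?_ ?_
  · have := rr_cont.measurable
    exact (Measurable.sub bfun measurable_const).aestronglyMeasurable
  · filter_upwards [ae_restrict_mem measurableSet_Ioi] with y hy
    rw [norm_eq_abs]
    exact rpow_sub_one_bound s (rr_pos hy) (rr_lt y)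

lemma vj_asym (a b δ N : ℝ) (hab : 0 < a + b) (hδ : 0 < δ) (hN : δ ≤ N) : ∃ C > 0, ∀ M f, BF δ N M f →
    BF δ N (M * C) (fun ρ => f ρ * kap a b ρ) ∧ BF δ N (M * C) (fun ρ => f ρ * E1 a b ρ) ∧
    ∀ y > 0, ‖vj a b f y‖ ≤ M * C ∧ ‖vjd a b f y‖ ≤ M * C ∧
      ‖vj a b f y - (FT (fun ρ => f ρ * kap a b ρ) (-y) + FT (fun ρ => f ρ * E1 a b ρ) y)‖ ≤
        M * C * exp (-y/2) := by
  obtain ⟨C, hC, H⟩ := jk_bounds a b δ N hab hδ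
  have hL : 0 ≤ C * (N - δ) := mul_nonneg hC.le blin
  have hCC : C ≤ C + C * (N - δ) := by linarith
  refine ⟨C + C * (N - δ), by positivity, fun M f h => ?_⟩
  have hM := h.nonneg
  have hE1m := measurable_E1 a b δ N hab hδ
  have eE : (fun ρ => f ρ * E1 a b ρ) = fun ρ => f ρ * (Icc δ N).indicator (E1 a b) ρ := by
    ext ρ
    by_cases hρ : ρ ∈ Icc δ N
    · rw [indicator_of_mem hρ]
    · rw [h.supp ρ hρ]; simp
  have hk : BF δ N (M * (C + C * (N - δ))) (fun ρ => f ρ * kap a b ρ) :=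
    h.mul (measurable_kap a b) (fun ρ hρ => (H ρ hρ).1.trans hCC) bpos
  have he : BF δ N (M * (C + C * (N - δ))) (fun ρ => f ρ * E1 a b ρ) := by
    rw [eE]
    refine h.mul hE1m (fun ρ hρ => ?_) bpos
    rw [indicator_of_mem hρ]; exact (H ρ hρ).2.1.trans hCC
  refine ⟨hk, he, fun y hy => ⟨?_, ?_, ?_⟩⟩
  · refine (h.norm_integral_le hN _ C (fun ρ hρ => ((H ρ hρ).2.2 y hy).1)).trans ?_
    rw [mul_assoc]; gcongr; linarith
  · refine (h.norm_integral_le hN _ C (fun ρ hρ => ((H ρ hρ).2.2 y hy).2.1)).trans ?_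
    rw [mul_assoc]; gcongr; linarith
  · have i1 := int_exp _ hk.integrable (-y)
    have i2 := int_exp _ he.integrable y
    have e0 := integral_sub (h.integrable_mul _ C (meas_jk a b hab hy)
      (fun ρ hρ => ((H ρ hρ).2.2 y hy).1)) (i1.add i2)
    simp only [Pi.add_apply] at e0
    rw [vj, FT, FT, ← integral_add i1 i2, ← e0]
    have e : ∀ ρ : ℝ, f ρ * jk a b ρ y - (cexp (I * (-y:ℝ) * ρ) * (f ρ * kap a b ρ) + cexp (I * y * ρ) * (f ρ * E1 a b ρ))
        = f ρ * (jk a b ρ y - (kap a b ρ * cexp (-I * ρ * y) + E1 a b ρ * cexp (I * ρ * y))) := by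
      intro ρ
      rw [show (I * (-y:ℝ) * ρ : ℂ) = -I * ρ * y by push_cast; ring, show (I * y * ρ : ℂ) = I * ρ * y by ring]; ring
    rw [integral_congr_ae (ae_of_all _ e)]
    refine (h.norm_integral_le hN _ _ (fun ρ hρ => ((H ρ hρ).2.2 y hy).2.2)).trans ?_
    have := exp_pos (-y/2)
    calc M * (C * exp (-y/2)) * (N - δ) = M * (C * (N - δ)) * exp (-y/2) := by ring
      _ ≤ _ := by gcongr; linarith

lemma vj_cont (a b δ N : ℝ) (hab : 0 < a + b) (hδ : 0 < δ) {M : ℝ} {f : ℝ → ℂ} (h : BF δ N M f) :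
    ContinuousOn (vj a b f) (Ioi 0) := fun y hy =>
  (vj_deriv a b δ N hab hδ h hy).continuousAt.continuousWithinAt

lemma exp_neg_int : IntegrableOn (fun y : ℝ => exp (-y)) (Ioi 0) := integrableOn_exp_neg_Ioi 0

/-- L2 bound -/
lemma vj_L2 (a b δ N : ℝ) (hab : 0 < a + b) (hδ : 0 < δ) (hN : δ ≤ N) : ∃ C > 0, ∀ M f, BF δ N M f →
    IntegrableOn (fun y => ‖vj a b f y‖^2) (Ioi 0) ∧ IntegrableOn (fun y => ‖vj a b f y‖^2 * rr y ^ (a+b-1)) (Ioi 0) ∧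
    ∫ y in Ioi 0, ‖vj a b f y‖^2 * rr y ^ (a+b-1) ≤ M^2 * C := by
  obtain ⟨C, hC, H⟩ := vj_asym a b δ N hab hδ hN
  have ho := omega_int (a+b-1) blin
  set Ω := ∫ y in Ioi 0, |rr y ^ (a+b-1) - 1| with hΩ
  have hΩ0 : 0 ≤ Ω := integral_nonneg fun y => abs_nonneg _
  refine ⟨3 * (2 * π * (C^2 * (N - δ)) + 2 * π * (C^2*(N-δ)) + C^2) + C^2 * Ω,
    by have := pi_pos; have : 0 ≤ N - δ := by linarith
       positivity, fun M f h => ?_⟩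
  obtain ⟨hk, he, hv⟩ := H M f h
  have hM := h.nonneg
  have hmv : AEStronglyMeasurable (vj a b f) (volume.restrict (Ioi 0)) :=
    (vj_cont a b δ N hab hδ h).aestronglyMeasurable measurableSet_Ioi
  have iA : Integrable (fun x => ‖FT (fun ρ => f ρ * kap a b ρ) x‖^2) := (FT_memLp _ hk.integrable hk.memLp).integrable_norm_pow bnum
  have iE : Integrable (fun x => ‖FT (fun ρ => f ρ * E1 a b ρ) x‖^2) := (FT_memLp _ he.integrable he.memLp).integrable_norm_pow bnum
  have iA' : Integrable (fun x => ‖FT (fun ρ => f ρ * kap a b ρ) (-x)‖^2) := iA.comp_neg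
  have iG : Integrable (fun y => 3 * (‖FT (fun ρ => f ρ * kap a b ρ) (-y)‖^2 + ‖FT (fun ρ => f ρ * E1 a b ρ) y‖^2 +
    (M*C)^2 * exp (-y))) (volume.restrict (Ioi 0)) := by
    exact ((iA'.integrableOn.add iE.integrableOn).add (exp_neg_int.const_mul _)).const_mul 3
  have hb : ∀ y ∈ Ioi zR, ‖vj a b f y‖^2 ≤ 3 * (‖FT (fun ρ => f ρ * kap a b ρ) (-y)‖^2 + ‖FT (fun ρ => f ρ * E1 a b ρ) y‖^2 +
    (M*C)^2 * exp (-y)) := by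
    intro y hy
    have h1 := (hv y hy).2.2
    have h2 : (M*C)^2 * exp (-y) = (M*C*exp (-y/2))^2 := by
      rw [mul_pow _ (exp _), ← Real.exp_nat_mul]; congr 2; push_cast; ring
    rw [h2]
    set A := FT (fun ρ => f ρ * kap a b ρ) (-y)
    set E := FT (fun ρ => f ρ * E1 a b ρ) y
    have h3 : ‖vj a b f y‖ ≤ ‖A‖ + ‖E‖ + M*C*exp (-y/2) := by
      calc ‖vj a b f y‖ = ‖A + E + (vj a b f y - (A + E))‖ := by congr 1; ring
        _ ≤ _ := (norm_add₃_le).trans (by gcongr)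
    have := norm_nonneg (vj a b f y)
    nlinarith [sq_nonneg (‖A‖ - ‖E‖), sq_nonneg (‖A‖ - M*C*exp (-y/2)), sq_nonneg (‖E‖ - M*C*exp (-y/2))]
  have i1 : IntegrableOn (fun y => ‖vj a b f y‖^2) (Ioi 0) := by
    refine iG.mono' (hmv.norm.pow 2) ?_
    filter_upwards [ae_restrict_mem measurableSet_Ioi] with y hy
    rw [norm_of_nonneg (sq_nonneg _)]; exact hb y hy
  have i2 : IntegrableOn (fun y => ‖vj a b f y‖^2 * (rr y ^ (a+b-1) - 1)) (Ioi 0) := by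
    refine (ho.norm.const_mul ((M*C)^2)).mono' ((hmv.norm.pow 2).mul ho.1) ?_
    filter_upwards [ae_restrict_mem measurableSet_Ioi] with y hy
    rw [norm_mul, norm_of_nonneg (sq_nonneg _)]
    have := (hv y hy).1
    gcongr
  have es : ∀ y, ‖vj a b f y‖^2 * rr y ^ (a+b-1) = ‖vj a b f y‖^2 + ‖vj a b f y‖^2 * (rr y ^ (a+b-1) - 1) := fun y => by ring
  simp_rw [es]
  refine ⟨i1, i1.add i2, ?_⟩
  rw [integral_add i1 i2]
  have b1 : ∫ y in Ioi 0, ‖vj a b f y‖^2 ≤ M^2 * (3 * (2 * π * (C^2 * (N - δ)) + 2 * π * (C^2*(N-δ)) + C^2)) := by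
    refine (setIntegral_mono_on i1 iG measurableSet_Ioi hb).trans ?_
    have e3 := integral_add (iA'.integrableOn.add iE.integrableOn) (exp_neg_int.const_mul ((M*C)^2))
    have e4 := integral_add (iA'.integrableOn (s := Ioi 0)) iE.integrableOn
    simp only [Pi.add_apply] at e3
    rw [integral_const_mul, e3, e4, integral_const_mul, integral_exp_neg_Ioi]
    have c1 : ∫ y in Ioi 0, ‖FT (fun ρ => f ρ * kap a b ρ) (-y)‖^2 ≤ 2 * π * ((M*C)^2 * (N - δ)) := by
      refine (setIntegral_le_integral iA' (ae_of_all _ fun y => by positivity)).trans ?_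
      rw [integral_neg_eq_self (fun y => ‖FT (fun ρ => f ρ * kap a b ρ) y‖^2) volume, FT_normsq _ hk.integrable hk.memLp]
      exact mul_le_mul_of_nonneg_left (hk.sq_le hN) (by have := pi_pos; positivity)
    have c2 : ∫ y in Ioi 0, ‖FT (fun ρ => f ρ * E1 a b ρ) y‖^2 ≤ 2 * π * ((M*C)^2 * (N - δ)) := by
      refine (setIntegral_le_integral iE (ae_of_all _ fun y => by positivity)).trans ?_
      rw [FT_normsq _ he.integrable he.memLp]
      exact mul_le_mul_of_nonneg_left (he.sq_le hN) (by have := pi_pos; positivity)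
    simp only [neg_zero, Real.exp_zero, mul_one]
    nlinarith
  have b2 : ∫ y in Ioi 0, ‖vj a b f y‖^2 * (rr y ^ (a+b-1) - 1) ≤ M^2 * (C^2 * Ω) := by
    rw [hΩ, ← mul_assoc, ← mul_pow, ← integral_const_mul]
    refine setIntegral_mono_on i2 (ho.norm.const_mul ((M*C)^2)) measurableSet_Ioi fun y hy => ?_
    calc _ ≤ ‖vj a b f y‖^2 * |rr y ^ (a+b-1) - 1| := mul_le_mul_of_nonneg_left (le_abs_self _) (sq_nonneg _)
      _ ≤ _ := mul_le_mul_of_nonneg_right (pow_le_pow_left₀ nnn (hv y hy).1 2) (abs_nonneg _)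
  nlinarith

lemma BF.mul_cont {δ N M : ℝ} {f : ℝ → ℂ} (h : BF δ N M f) {k : ℝ → ℂ} (hk : Continuous k) :
    ∃ M', BF δ N M' (fun ρ => f ρ * k ρ) := by
  obtain ⟨C, hC⟩ := (isCompact_Icc (a := δ) (b := N)).exists_bound_of_continuousOn hk.continuousOn
  exact ⟨_, h.mul hk.measurable (C := max C 0) (fun ρ hρ => (hC ρ hρ).trans (le_max_left _ _)) (le_max_right _ _)⟩

lemma BF.add {δ N M M' : ℝ} {f g : ℝ → ℂ} (h : BF δ N M f) (h' : BF δ N M' g) :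
    BF δ N (M + M') (fun ρ => f ρ + g ρ) :=
  ⟨h.meas.add h'.meas, fun ρ => (norm_add_le _ _).trans (add_le_add (h.bd ρ) (h'.bd ρ)),
    fun ρ hρ => by rw [h.supp ρ hρ, h'.supp ρ hρ, add_zero]⟩

section J
variable {a b δ N : ℝ}

lemma vj_int (hab : 0 < a + b) (hδ : 0 < δ) {M : ℝ} {f : ℝ → ℂ} (h : BF δ N M f) {y : ℝ} (hy : 0 < y) :
    Integrable (fun ρ => f ρ * jk a b ρ y) := by
  obtain ⟨C, hC, H⟩ := jk_bounds a b δ N hab hδ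
  exact h.integrable_mul _ C (meas_jk a b hab hy) (fun ρ hρ => ((H ρ hρ).2.2 y hy).1)

lemma vj_add (hab : 0 < a + b) (hδ : 0 < δ) {M M' : ℝ} {f g : ℝ → ℂ} (h : BF δ N M f) (h' : BF δ N M' g)
    {y : ℝ} (hy : 0 < y) : vj a b (fun ρ => f ρ + g ρ) y = vj a b f y + vj a b g y := by
  unfold vj
  rw [← integral_add (vj_int hab hδ h hy) (vj_int hab hδ h' hy)]
  congr 1; ext ρ; ring

lemma vj_smul (f : ℝ → ℂ) (c : ℂ) (y : ℝ) : vj a b (fun ρ => f ρ * c) y = c * vj a b f y := by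
  unfold vj
  rw [← integral_const_mul]
  congr 1; ext ρ; ring

lemma vj_conj (hab : 0 < a + b) (f : ℝ → ℂ) {y : ℝ} (hy : 0 < y) : vj a b (fun ρ => conj (f ρ)) y = conj (vj a b f y) := by
  unfold vj
  rw [← integral_conj]
  congr 1; ext ρ; rw [map_mul, jk_conj a b ρ hab hy]

def Bl (a b : ℝ) (f g : ℝ → ℂ) : ℂ := ∫ y in Ioi 0, vj a b f y * vj a b g y * ((rr y ^ (a+b-1) : ℝ) : ℂ)

lemma Bl_int (hab : 0 < a + b) (hδ : 0 < δ) (hN : δ ≤ N) {M M' : ℝ} {f g : ℝ → ℂ} (h : BF δ N M f) (h' : BF δ N M' g) :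
    IntegrableOn (fun y => vj a b f y * vj a b g y * ((rr y ^ (a+b-1) : ℝ) : ℂ)) (Ioi 0) := by
  obtain ⟨C, hC, H⟩ := vj_L2 a b δ N hab hδ hN
  have h1 := (H M f h).2.1
  have h2 := (H M' g h').2.1
  have m1 := (vj_cont a b δ N hab hδ h).aestronglyMeasurable (μ := volume) measurableSet_Ioi
  have m2 := (vj_cont a b δ N hab hδ h').aestronglyMeasurable (μ := volume) measurableSet_Ioi
  have m3 : Measurable (fun y => ((rr y ^ (a+b-1) : ℝ) : ℂ)) := by have := rr_cont.measurable; fun_prop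
  refine (h1.add h2).mono' ((m1.mul m2).mul m3.aestronglyMeasurable) ?_
  filter_upwards [ae_restrict_mem measurableSet_Ioi] with y hy
  have hr := rpow_pos_of_pos (rr_pos hy) (a+b-1)
  rw [norm_mul, norm_mul, norm_real, norm_of_nonneg hr.le, Pi.add_apply, ← add_mul]
  gcongr
  nlinarith [sq_nonneg (‖vj a b f y‖ - ‖vj a b g y‖), sq_nonneg (‖vj a b f y‖), sq_nonneg (‖vj a b g y‖)]

lemma Bl_bound (hab : 0 < a + b) (hδ : 0 < δ) (hN : δ ≤ N) : ∃ C > 0, ∀ M M' f g, BF δ N M f → BF δ N M' g → ∀ s > 0,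
    ‖Bl a b f g‖ ≤ C * (M^2 / s + s * M'^2) := by
  obtain ⟨C, hC, H⟩ := vj_L2 a b δ N hab hδ hN
  refine ⟨C, hC, fun M M' f g h h' s hs => ?_⟩
  obtain ⟨-, h1, h1'⟩ := (H M f h)
  obtain ⟨-, h2, h2'⟩ := (H M' g h')
  have : ‖Bl a b f g‖ ≤ ∫ y in Ioi 0, (s⁻¹ * (‖vj a b f y‖^2 * rr y ^ (a+b-1)) + s * (‖vj a b g y‖^2 * rr y ^ (a+b-1))) := by
    refine norm_integral_le_of_norm_le ((h1.const_mul s⁻¹).add (h2.const_mul s)) ?_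
    filter_upwards [ae_restrict_mem measurableSet_Ioi] with y hy
    have hr := rpow_pos_of_pos (rr_pos hy) (a+b-1)
    rw [norm_mul, norm_mul, norm_real, norm_of_nonneg hr.le, ← mul_assoc, ← mul_assoc, ← add_mul]
    gcongr
    have e : s⁻¹ * ‖vj a b f y‖^2 + s * ‖vj a b g y‖^2 - ‖vj a b f y‖ * ‖vj a b g y‖ =
      s⁻¹ * ((‖vj a b f y‖ - s * ‖vj a b g y‖ / 2)^2 + 3/4 * (s * ‖vj a b g y‖)^2) := by field_simp; ring
    have : 0 ≤ s⁻¹ * ((‖vj a b f y‖ - s * ‖vj a b g y‖ / 2)^2 + 3/4 * (s * ‖vj a b g y‖)^2) := by positivity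
    linarith
  refine this.trans ?_
  rw [integral_add (h1.const_mul s⁻¹) (h2.const_mul s), integral_const_mul, integral_const_mul]
  calc _ ≤ s⁻¹ * (M^2 * C) + s * (M'^2 * C) := by gcongr
    _ = _ := by rw [div_eq_inv_mul]; ring

lemma Bl_add_left (hab : 0 < a + b) (hδ : 0 < δ) (hN : δ ≤ N) {M M' M'' : ℝ} {f f' g : ℝ → ℂ} (h : BF δ N M f)
    (h' : BF δ N M' f') (hg : BF δ N M'' g) : Bl a b (fun ρ => f ρ + f' ρ) g = Bl a b f g + Bl a b f' g := by
  unfold Bl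
  rw [← integral_add (Bl_int hab hδ hN h hg) (Bl_int hab hδ hN h' hg)]
  refine setIntegral_congr_fun measurableSet_Ioi fun y hy => ?_
  simp only [vj_add hab hδ h h' hy]; ring

lemma Bl_symm (f g : ℝ → ℂ) : Bl a b f g = Bl a b g f := by
  unfold Bl; congr 1; ext y; ring

lemma Bl_smul_left (f g : ℝ → ℂ) (c : ℂ) : Bl a b (fun ρ => f ρ * c) g = c * Bl a b f g := by
  unfold Bl
  rw [← integral_const_mul]
  congr 1; ext y; rw [vj_smul]; ring

lemma vj_tendsto (hab : 0 < a + b) (hδ : 0 < δ) (hN : δ ≤ N) {M : ℝ} {f : ℝ → ℂ} (h : BF δ N M f) :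
    Tendsto (vj a b f) atTop (𝓝 0) := by
  obtain ⟨C, hC, H⟩ := vj_asym a b δ N hab hδ hN
  obtain ⟨hk, he, hv⟩ := H M f h
  have t1 : Tendsto (fun y : ℝ => FT (fun ρ => f ρ * kap a b ρ) (-y)) atTop (𝓝 0) :=
    (FT_tendsto _).comp (tendsto_neg_atTop_atBot.mono_right atBot_le_cocompact)
  have t2 : Tendsto (fun y : ℝ => FT (fun ρ => f ρ * E1 a b ρ) y) atTop (𝓝 0) :=
    (FT_tendsto _).mono_left atTop_le_cocompact
  have t3 : Tendsto (fun y : ℝ => M * C * exp (-y/2)) atTop (𝓝 0) := by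
    have : Tendsto (fun y : ℝ => exp (-y/2)) atTop (𝓝 0) := by
      refine Real.tendsto_exp_atBot.comp ?_
      have := (tendsto_neg_atTop_atBot (G := ℝ)).atBot_div_const (show zR < 2 by norm_num)
      exact this
    simpa using this.const_mul (M*C)
  have t4 : Tendsto (fun y => vj a b f y - (FT (fun ρ => f ρ * kap a b ρ) (-y) + FT (fun ρ => f ρ * E1 a b ρ) y)) atTop (𝓝 0) := by
    refine squeeze_zero_norm' ?_ t3
    filter_upwards [eventually_gt_atTop 0] with y hy using (hv y hy).2.2
  have := t4.add (t1.add t2)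
  simpa using this

lemma Bl_sq (hab : 0 < a + b) (hδ : 0 < δ) (hN : δ ≤ N) {M M' : ℝ} {f g : ℝ → ℂ} (h : BF δ N M f) (h' : BF δ N M' g) :
    Bl a b (fun ρ => f ρ * (ρ:ℂ)^2) g = Bl a b f (fun ρ => g ρ * (ρ:ℂ)^2) := by
  obtain ⟨C, hC, H⟩ := vj_asym a b δ N hab hδ hN
  obtain ⟨-, -, hv⟩ := H M f h
  obtain ⟨-, -, hv'⟩ := H M' g h'
  obtain ⟨M1, h1⟩ := h.mul_cont (k := fun ρ : ℝ => (ρ:ℂ)^2) bfun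
  obtain ⟨M2, h2⟩ := h'.mul_cont (k := fun ρ : ℝ => (ρ:ℂ)^2) bfun
  have i1 := Bl_int hab hδ hN h1 h'
  have i2 := Bl_int hab hδ hN h h2
  let R : ℝ → ℂ := fun y => ((rr y ^ (a+b) : ℝ) : ℂ)
  let G : ℝ → ℂ := fun y => vj a b f y * (R y * vjd a b g y) - R y * vjd a b f y * vj a b g y
  have hR : ∀ y > 0, ‖R y‖ ≤ 1 := fun y hy => by
    have := rr_pos hy
    simp only [R]; rw [norm_real, norm_of_nonneg bpos]
    exact rpow_le_one (rr_pos hy).le (rr_lt y).le hab.le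
  have hG : ∀ y > 0, ‖G y‖ ≤ ‖R y‖ * ((M*C)*(M'*C) + (M*C)*(M'*C)) := fun y hy => by
    have c1 := (hv y hy).1; have c2 := (hv y hy).2.1; have c3 := (hv' y hy).1; have c4 := (hv' y hy).2.1
    have := h.nonneg; have := h'.nonneg
    calc ‖G y‖ ≤ ‖vj a b f y * (R y * vjd a b g y)‖ + ‖R y * vjd a b f y * vj a b g y‖ := norm_sub_le _ _
      _ = ‖R y‖ * (‖vj a b f y‖ * ‖vjd a b g y‖ + ‖vjd a b f y‖ * ‖vj a b g y‖) := by simp only [norm_mul]; ring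
      _ ≤ _ := by gcongr
  have hd : ∀ y ∈ Ioi zR, HasDerivAt G (vj a b (fun ρ => f ρ * (ρ:ℂ)^2) y * vj a b g y * ((rr y ^ (a+b-1) : ℝ) : ℂ) -
      vj a b f y * vj a b (fun ρ => g ρ * (ρ:ℂ)^2) y * ((rr y ^ (a+b-1) : ℝ) : ℂ)) y := by
    intro y hy
    have d1 := vj_deriv a b δ N hab hδ h hy
    have d2 := vj_deriv a b δ N hab hδ h' hy
    have d3 := vjd_deriv a b δ N hab hδ h hy
    have d4 := vjd_deriv a b δ N hab hδ h' hy
    refine ((d1.mul d4).sub (d3.mul d2)).congr_deriv ?_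
    ring
  have hR0 : R 0 = 0 := by simp only [R]; rw [rr_zero, Real.zero_rpow hab.ne']; simp
  have hRc : Continuous R := by
    simp only [R]
    exact continuous_ofReal.comp (rr_cont.rpow_const (fun _ => Or.inr hab.le))
  have key := integral_Ioi_of_hasDerivAt_of_tendsto (f := G) (m := 0) ?_ hd (i1.sub i2) ?_
  · rw [integral_sub i1 i2] at key
    have e0 : G 0 = 0 := by simp only [G, hR0]; simp
    rw [e0, sub_zero] at key
    exact sub_eq_zero.mp key
  · have e0 : G 0 = 0 := by simp only [G, hR0]; simp
    rw [ContinuousWithinAt, e0]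
    have t : Tendsto (fun y => ‖R y‖ * ((M*C)*(M'*C) + (M*C)*(M'*C))) (𝓝[Ici 0] 0) (𝓝 0) := by
      have := (hRc.norm.mul_const ((M*C)*(M'*C) + (M*C)*(M'*C))).tendsto 0
      rw [hR0] at this; simp only [norm_zero, zero_mul] at this
      exact this.mono_left nhdsWithin_le_nhds
    refine squeeze_zero_norm' ?_ t
    filter_upwards [self_mem_nhdsWithin] with y hy
    rcases (show zR ≤ y from hy).eq_or_lt with rfl | h0
    · rw [e0, hR0]; simp
    · exact hG y h0
  · have t1 := vj_tendsto hab hδ hN h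
    have t2 := vj_tendsto hab hδ hN h'
    have b1 : IsBoundedUnder (· ≤ ·) atTop (norm ∘ fun y => R y * vjd a b g y) := by
      refine isBoundedUnder_of_eventually_le (a := 1 * (M'*C)) ?_
      filter_upwards [eventually_gt_atTop 0] with y hy
      rw [Function.comp_apply, norm_mul]
      exact mul_le_mul (hR y hy) (hv' y hy).2.1 nnn bnum
    have b2 : IsBoundedUnder (· ≤ ·) atTop (norm ∘ fun y => R y * vjd a b f y) := by
      refine isBoundedUnder_of_eventually_le (a := 1 * (M*C)) ?_
      filter_upwards [eventually_gt_atTop 0] with y hy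
      rw [Function.comp_apply, norm_mul]
      exact mul_le_mul (hR y hy) (hv y hy).2.1 nnn bnum
    have := (t1.zero_mul_isBoundedUnder_le b1).sub (isBoundedUnder_le_mul_tendsto_zero b2 t2)
    simpa using this

lemma Bl_pow (hab : 0 < a + b) (hδ : 0 < δ) (hN : δ ≤ N) (n : ℕ) : ∀ {M M' : ℝ} {f g : ℝ → ℂ}, BF δ N M f → BF δ N M' g →
    Bl a b (fun ρ => f ρ * ((ρ:ℂ)^2)^n) g = Bl a b f (fun ρ => g ρ * ((ρ:ℂ)^2)^n) := by
  induction n with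
  | zero => intros; simp
  | succ n ih =>
    intro M M' f g h h'
    obtain ⟨M1, h1⟩ := h.mul_cont (k := fun ρ : ℝ => ((ρ:ℂ)^2)^n) bfun
    obtain ⟨M2, h2⟩ := h'.mul_cont (k := fun ρ : ℝ => (ρ:ℂ)^2) bfun
    have e1 := Bl_sq hab hδ hN h1 h'
    have e2 := ih h h2
    simp only [pow_succ, ← mul_assoc] at *
    rw [e1, e2]
    congr 1; ext ρ; ring

lemma Bl_poly (hab : 0 < a + b) (hδ : 0 < δ) (hN : δ ≤ N) (P : Polynomial ℝ) {M M' : ℝ} {f g : ℝ → ℂ} (h : BF δ N M f)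
    (h' : BF δ N M' g) :
    Bl a b (fun ρ => f ρ * ((P.eval (ρ^2) : ℝ) : ℂ)) g = Bl a b f (fun ρ => g ρ * ((P.eval (ρ^2) : ℝ) : ℂ)) := by
  induction P using Polynomial.induction_on' with
  | add p q hp hq =>
    obtain ⟨M1, h1⟩ := h.mul_cont (k := fun ρ : ℝ => ((p.eval (ρ^2) : ℝ) : ℂ)) bfun
    obtain ⟨M2, h2⟩ := h.mul_cont (k := fun ρ : ℝ => ((q.eval (ρ^2) : ℝ) : ℂ)) bfun
    obtain ⟨M1', h1'⟩ := h'.mul_cont (k := fun ρ : ℝ => ((p.eval (ρ^2) : ℝ) : ℂ)) bfun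
    obtain ⟨M2', h2'⟩ := h'.mul_cont (k := fun ρ : ℝ => ((q.eval (ρ^2) : ℝ) : ℂ)) bfun
    simp only [Polynomial.eval_add, ofReal_add, mul_add]
    rw [Bl_add_left hab hδ hN h1 h2 h', Bl_symm f, Bl_add_left hab hδ hN h1' h2' h, hp, hq, Bl_symm _ f, Bl_symm _ f]
  | monomial n c =>
    have := Bl_pow hab hδ hN n h h'
    simp only [Polynomial.eval_monomial]
    have e : ∀ (f : ℝ → ℂ), (fun ρ : ℝ => f ρ * ((c * (ρ^2)^n : ℝ) : ℂ)) = fun ρ => (f ρ * ((ρ:ℂ)^2)^n) * (c:ℂ) := by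
      intro f; ext ρ; push_cast; ring
    rw [e, e, Bl_smul_left, this, Bl_symm f, Bl_symm f, Bl_smul_left]

lemma Bl_cont (hab : 0 < a + b) (hδ : 0 < δ) (hN : δ ≤ N) (m : ℝ → ℝ) (hm : Continuous m) {M M' : ℝ} {f g : ℝ → ℂ} (h : BF δ N M f)
    (h' : BF δ N M' g) : Bl a b (fun ρ => f ρ * (m ρ : ℂ)) g = Bl a b f (fun ρ => g ρ * (m ρ : ℂ)) := by
  obtain ⟨C, hC, H⟩ := Bl_bound (a := a) (b := b) hab hδ hN
  have hM := h.nonneg; have hM' := h'.nonneg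
  rw [← sub_eq_zero, ← norm_eq_zero]
  refine le_antisymm (le_of_forall_pos_le_add fun η hη => ?_) nnn
  set ε := η / (C * ((M^2 + M'^2) + (M'^2 + M^2)) + 1) with hε
  have hε0 : 0 < ε := by positivity
  obtain ⟨P, hP⟩ := exists_polynomial_near_of_continuousOn (δ^2) (N^2) (fun x => m (sqrt x)) bfun ε hε0
  have hP' : ∀ ρ ∈ Icc δ N, ‖((m ρ - P.eval (ρ^2) : ℝ) : ℂ)‖ ≤ ε := fun ρ hρ => by
    have hρ0 : 0 ≤ ρ := by linarith [hρ.1]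
    have := hP (ρ^2) ⟨pow_le_pow_left₀ hδ.le hρ.1 2, pow_le_pow_left₀ hρ0 hρ.2 2⟩
    rw [sqrt_sq hρ0] at this
    rw [norm_real, norm_eq_abs, abs_sub_comm]; exact this.le
  have hmm : Measurable (fun ρ : ℝ => ((m ρ - P.eval (ρ^2) : ℝ) : ℂ)) := by have := hm.measurable; fun_prop
  have f1 := h.mul hmm hP' hε0.le
  have g1 := h'.mul hmm hP' hε0.le
  obtain ⟨M1, f2⟩ := h.mul_cont (k := fun ρ : ℝ => ((P.eval (ρ^2) : ℝ) : ℂ)) bfun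
  obtain ⟨M2, g2⟩ := h'.mul_cont (k := fun ρ : ℝ => ((P.eval (ρ^2) : ℝ) : ℂ)) bfun
  have e : ∀ (f : ℝ → ℂ), (fun ρ : ℝ => f ρ * (m ρ : ℂ)) = fun ρ => f ρ * ((m ρ - P.eval (ρ^2) : ℝ) : ℂ) + f ρ * ((P.eval (ρ^2) : ℝ) : ℂ) := by
    intro f; ext ρ; push_cast; ring
  rw [e f, e g, Bl_add_left hab hδ hN f1 f2 h', Bl_symm f, Bl_add_left hab hδ hN g1 g2 h, Bl_poly hab hδ hN P h h',
    Bl_symm f, add_sub_add_right_eq_sub, zero_add]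
  have b1 := H _ _ _ _ f1 h' ε hε0
  have b2 := H _ _ _ _ g1 h ε hε0
  have e1 : C * ((M * ε)^2/ε + ε * M'^2) = C * ε * (M^2 + M'^2) := by field_simp
  have e2 : C * ((M' * ε)^2/ε + ε * M^2) = C * ε * (M'^2 + M^2) := by field_simp
  rw [e1] at b1; rw [e2] at b2
  refine (norm_sub_le _ _).trans ((add_le_add b1 b2).trans ?_)
  have : C * ε * (M^2 + M'^2) + C * ε * (M'^2 + M^2) = ε * (C * ((M^2 + M'^2) + (M'^2 + M^2))) := by ring
  rw [this, hε, div_mul_eq_mul_div, div_le_iff₀ bpos]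
  nlinarith

lemma Bl_exp (hab : 0 < a + b) (hδ : 0 < δ) (hN : δ ≤ N) (τ : ℝ) {M M' : ℝ} {f g : ℝ → ℂ} (h : BF δ N M f)
    (h' : BF δ N M' g) : Bl a b (fun ρ => f ρ * cexp (I * τ * ρ)) g = Bl a b f (fun ρ => g ρ * cexp (I * τ * ρ)) := by
  have e : ∀ (f : ℝ → ℂ), (fun ρ : ℝ => f ρ * cexp (I * τ * ρ)) =
      fun ρ => f ρ * (cos (τ * ρ) : ℂ) + (f ρ * (sin (τ * ρ) : ℂ)) * I := by
    intro f; ext ρ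
    rw [show I * τ * ρ = ((τ * ρ : ℝ) : ℂ) * I by push_cast; ring, exp_mul_I]
    push_cast; ring
  have c1 := Bl_cont hab hδ hN (fun ρ => cos (τ * ρ)) bfun h h'
  have c2 := Bl_cont hab hδ hN (fun ρ => sin (τ * ρ)) bfun h h'
  obtain ⟨M1, f1⟩ := h.mul_cont (k := fun ρ : ℝ => (cos (τ * ρ) : ℂ)) bfun
  obtain ⟨M2, g1⟩ := h'.mul_cont (k := fun ρ : ℝ => (cos (τ * ρ) : ℂ)) bfun
  obtain ⟨M3, f2'⟩ := h.mul_cont (k := fun ρ : ℝ => (sin (τ * ρ) : ℂ) * I) bfun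
  obtain ⟨M4, g2'⟩ := h'.mul_cont (k := fun ρ : ℝ => (sin (τ * ρ) : ℂ) * I) bfun
  simp only [← mul_assoc] at f2' g2'
  rw [e f, e g, Bl_add_left hab hδ hN f1 f2' h', Bl_symm f, Bl_add_left hab hδ hN g1 g2' h, Bl_smul_left, Bl_smul_left,
    c1, c2, Bl_symm f, Bl_symm f]

end J

lemma tendsto_of_eps {x r : ℝ → ℝ} {K : ℝ} (hK : 0 ≤ K) (hr : Tendsto r atTop (𝓝 0))
    (h : ∀ ε > 0, ∀ τ, |x τ| ≤ (1 + ε⁻¹) * r τ + ε * K) : Tendsto x atTop (𝓝 0) := by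
  rw [Metric.tendsto_atTop]
  intro η hη
  set ε := η / (2 * (K + 1)) with hε
  have hε0 : 0 < ε := by positivity
  have h1 : Tendsto (fun τ => (1 + ε⁻¹) * r τ) atTop (𝓝 0) := by simpa using hr.const_mul (1 + ε⁻¹)
  have h2 := (h1.eventually (gt_mem_nhds (show 0 < η/2 by linarith)))
  obtain ⟨T, hT⟩ := eventually_atTop.mp h2
  refine ⟨T, fun τ hτ => ?_⟩
  rw [dist_eq, sub_zero]
  have h3 := h ε hε0 τ
  have h4 : ε * K ≤ η / 2 := by
    rw [hε, div_mul_eq_mul_div, div_le_iff₀ bpos]; nlinarith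
  linarith [hT τ hτ]

lemma shift_left_lim (G : ℝ → ℝ) (hG : Integrable G) :
    Tendsto (fun τ => ∫ y in Ioi 0, G (τ - y)) atTop (𝓝 (∫ y, G y)) := by
  have h := (aecover_Iio (μ := volume) (tendsto_id (α := ℝ) (x := atTop))).integral_tendsto_of_countably_generated hG
  refine h.congr fun τ => ?_
  rw [← integral_indicator measurableSet_Ioi, ← integral_indicator measurableSet_Iio]
  rw [← integral_sub_left_eq_self ((Iio (id τ)).indicator G) volume τ]
  congr 1; ext y; simp [indicator]

lemma shift_right_lim (G : ℝ → ℝ) (hG : Integrable G) :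
    Tendsto (fun τ => ∫ y in Ioi 0, G (τ + y)) atTop (𝓝 0) := by
  have h := (aecover_Iic (μ := volume) (tendsto_id (α := ℝ) (x := atTop))).integral_tendsto_of_countably_generated hG
  have h2 := h.const_sub (∫ y, G y)
  rw [sub_self] at h2
  refine h2.congr fun τ => ?_
  rw [← integral_add_compl (measurableSet_Iic (a := id τ)) hG, add_sub_cancel_left, compl_Iic]
  rw [← integral_indicator measurableSet_Ioi, ← integral_indicator measurableSet_Ioi]
  rw [← integral_add_left_eq_self ((Ioi (id τ)).indicator G) τ]
  congr 1; ext y; simp [indicator]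

section J
variable {a b δ N : ℝ}

/-- the Jacobi isometry (norm version) -/
lemma J_norm (hab : 0 < a + b) (hδ : 0 < δ) (hN : δ ≤ N) {M : ℝ} {f : ℝ → ℂ} (h : BF δ N M f) :
    ∫ y in Ioi 0, ‖vj a b f y‖^2 * rr y ^ (a+b-1) = 2 * π * ∫ ρ, ‖f ρ * kap a b ρ‖^2 := by
  obtain ⟨C, hC, H⟩ := vj_asym a b δ N hab hδ hN
  obtain ⟨C', hC', H'⟩ := vj_L2 a b δ N hab hδ hN
  obtain ⟨hk, he, -⟩ := H M f h
  have hM := h.nonneg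
  have ho := omega_int (a+b-1) blin
  let fτ : ℝ → ℝ → ℂ := fun τ ρ => f ρ * cexp (I * τ * ρ)
  have hexp : ∀ τ ρ : ℝ, ‖cexp (I * τ * ρ)‖ = 1 := fun τ ρ => by
    rw [mul_assoc, ← ofReal_mul, mul_comm I, norm_exp_ofReal_mul_I]
  have hτ : ∀ τ, BF δ N M (fτ τ) := fun τ => by
    have := h.mul (k := fun ρ : ℝ => cexp (I * τ * ρ)) (C := 1) bfun (fun ρ _ => (hexp τ ρ).le) bnum
    rwa [mul_one] at this
  -- invariance
  have hBl : ∀ g M', BF δ N M' g → ((∫ y in Ioi 0, ‖vj a b g y‖^2 * rr y ^ (a+b-1) : ℝ) : ℂ) = Bl a b g (fun ρ => conj (g ρ)) := by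
    intro g M' hg
    rw [Bl, ← integral_complex_ofReal]
    refine setIntegral_congr_fun measurableSet_Ioi fun y hy => ?_
    simp only [vj_conj hab g hy, mul_conj, normSq_eq_norm_sq]; push_cast; ring
  have inv : ∀ τ, ∫ y in Ioi 0, ‖vj a b (fτ τ) y‖^2 * rr y ^ (a+b-1) = ∫ y in Ioi 0, ‖vj a b f y‖^2 * rr y ^ (a+b-1) := by
    intro τ
    have := hBl (fτ τ) M (hτ τ)
    rw [Bl_exp hab hδ hN τ h (hτ τ).conj] at this
    have e : (fun ρ : ℝ => conj (fτ τ ρ) * cexp (I * τ * ρ)) = fun ρ => conj (f ρ) := by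
      ext ρ
      simp only [fτ, map_mul]
      rw [mul_assoc, mul_comm (conj (cexp _)), mul_conj, normSq_eq_norm_sq, hexp]; simp
    rw [e, ← hBl f M h] at this
    exact_mod_cast this
  let A : ℝ → ℝ → ℂ := fun τ y => FT (fun ρ => f ρ * kap a b ρ) (τ - y)
  let E : ℝ → ℝ → ℂ := fun τ y => FT (fun ρ => f ρ * E1 a b ρ) (τ + y)
  have hA : ∀ τ y, FT (fun ρ => fτ τ ρ * kap a b ρ) (-y) = A τ y := fun τ y => by
    simp only [A, FT, fτ]; congr 1; ext ρ
    rw [show I * ((τ - y : ℝ) : ℂ) * ρ = I * ((-y : ℝ):ℂ) * ρ + I * τ * ρ by push_cast; ring, Complex.exp_add]; ring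
  have hE : ∀ τ y, FT (fun ρ => fτ τ ρ * E1 a b ρ) y = E τ y := fun τ y => by
    simp only [E, FT, fτ]; congr 1; ext ρ
    rw [show I * ((τ + y : ℝ) : ℂ) * ρ = I * (y:ℂ) * ρ + I * τ * ρ by push_cast; ring, Complex.exp_add]; ring
  have tv : ∀ y > 0, Tendsto (fun τ => vj a b (fτ τ) y) atTop (𝓝 0) := fun y hy => by
    have := (FT_tendsto (fun ρ => f ρ * jk a b ρ y)).mono_left atTop_le_cocompact
    refine this.congr fun τ => ?_
    simp only [FT, vj, fτ]; congr 1; ext ρ; ring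
  have tA : ∀ y, Tendsto (fun τ => A τ y) atTop (𝓝 0) := fun y =>
    (FT_tendsto _).comp ((tendsto_atTop_add_const_right _ (-y) tendsto_id).mono_right atTop_le_cocompact)
  have tE : ∀ y, Tendsto (fun τ => E τ y) atTop (𝓝 0) := fun y =>
    (FT_tendsto _).comp ((tendsto_atTop_add_const_right _ y tendsto_id).mono_right atTop_le_cocompact)
  have iA : Integrable (fun x => ‖FT (fun ρ => f ρ * kap a b ρ) x‖^2) := (FT_memLp _ hk.integrable hk.memLp).integrable_norm_pow bnum
  have iE : Integrable (fun x => ‖FT (fun ρ => f ρ * E1 a b ρ) x‖^2) := (FT_memLp _ he.integrable he.memLp).integrable_norm_pow bnum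
  have iAτ : ∀ τ, Integrable (fun y => ‖A τ y‖^2) := fun τ => iA.comp_sub_left τ
  have iEτ : ∀ τ, Integrable (fun y => ‖E τ y‖^2) := fun τ => iE.comp_add_left τ
  have limA := shift_left_lim _ iA
  have limE := shift_right_lim _ iE
  have mv : ∀ τ, AEStronglyMeasurable (vj a b (fτ τ)) (volume.restrict (Ioi 0)) := fun τ =>
    (vj_cont a b δ N hab hδ (hτ τ)).aestronglyMeasurable measurableSet_Ioi
  have mFT : ∀ g : ℝ → ℂ, Integrable g → MemLp g 2 → AEStronglyMeasurable (FT g) := fun g h1 h2 => (FT_memLp g h1 h2).1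
  have mA : ∀ τ, AEStronglyMeasurable (A τ) := fun τ =>
    (mFT _ hk.integrable hk.memLp).comp_quasiMeasurePreserving (quasiMeasurePreserving_sub_left volume τ)
  have mE : ∀ τ, AEStronglyMeasurable (E τ) := fun τ =>
    (mFT _ he.integrable he.memLp).comp_quasiMeasurePreserving (quasiMeasurePreserving_add_left volume τ)
  let er : ℝ → ℝ → ℂ := fun τ y => vj a b (fτ τ) y - (A τ y + E τ y)
  have er_b : ∀ τ, ∀ y > 0, ‖er τ y‖ ≤ M * C * exp (-y/2) := fun τ y hy => by
    have := ((H M (fτ τ) (hτ τ)).2.2 y hy).2.2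
    rwa [hA, hE] at this
  have hsq : ∀ y : ℝ, (M*C)^2 * exp (-y) = (M*C*exp (-y/2))^2 := fun y => by
    rw [mul_pow _ (exp _), ← Real.exp_nat_mul]; congr 2; push_cast; ring
  have mer : ∀ τ, AEStronglyMeasurable (er τ) (volume.restrict (Ioi 0)) := fun τ =>
    (mv τ).sub ((mA τ).restrict.add (mE τ).restrict)
  have ier : ∀ τ, IntegrableOn (fun y => ‖er τ y‖^2) (Ioi 0) := fun τ => by
    refine (exp_neg_int.const_mul ((M*C)^2)).mono' ((mer τ).norm.pow 2) ?_
    filter_upwards [ae_restrict_mem measurableSet_Ioi] with y hy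
    rw [norm_of_nonneg (sq_nonneg _), hsq]
    exact pow_le_pow_left₀ nnn (er_b τ y hy) 2
  have limer : Tendsto (fun τ => ∫ y in Ioi 0, ‖er τ y‖^2) atTop (𝓝 0) := by
    have := tendsto_integral_filter_of_dominated_convergence (μ := volume.restrict (Ioi 0)) (l := atTop)
      (F := fun τ y => ‖er τ y‖^2) (f := fun _ => zR) (fun y => (M*C)^2 * exp (-y)) (Eventually.of_forall fun τ => (mer τ).norm.pow 2)
      (Eventually.of_forall fun τ => by
        filter_upwards [ae_restrict_mem measurableSet_Ioi] with y hy
        rw [norm_of_nonneg (sq_nonneg _), hsq]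
        exact pow_le_pow_left₀ nnn (er_b τ y hy) 2) (exp_neg_int.const_mul _) (by
        filter_upwards [ae_restrict_mem measurableSet_Ioi] with y hy
        have := (((tv y hy).sub ((tA y).add (tE y))).norm).pow 2
        simpa using this)
    simpa using this
  have lim1 : Tendsto (fun τ => ∫ y in Ioi 0, ‖vj a b (fτ τ) y‖^2 * (rr y ^ (a+b-1) - 1)) atTop (𝓝 0) := by
    have := tendsto_integral_filter_of_dominated_convergence (μ := volume.restrict (Ioi 0)) (l := atTop)
      (F := fun τ y => ‖vj a b (fτ τ) y‖^2 * (rr y ^ (a+b-1) - 1)) (f := fun _ => zR)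
      (fun y => (M*C)^2 * ‖rr y ^ (a+b-1) - 1‖) (Eventually.of_forall fun τ => ((mv τ).norm.pow 2).mul ho.1)
      (Eventually.of_forall fun τ => by
        filter_upwards [ae_restrict_mem measurableSet_Ioi] with y hy
        rw [norm_mul, norm_of_nonneg (sq_nonneg _)]
        have := ((H M (fτ τ) (hτ τ)).2.2 y hy).1
        gcongr) (ho.norm.const_mul _) (by
        filter_upwards [ae_restrict_mem measurableSet_Ioi] with y hy
        have := (((tv y hy).norm).pow 2).mul_const (rr y ^ (a+b-1) - 1)
        simpa using this)
    simpa using this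
  have lim2 : Tendsto (fun τ => (∫ y in Ioi 0, ‖vj a b (fτ τ) y‖^2) - ∫ y in Ioi 0, ‖A τ y‖^2) atTop (𝓝 0) := by
    have hr : Tendsto (fun τ => (∫ y in Ioi 0, ‖E τ y‖^2) * 2 + (∫ y in Ioi 0, ‖er τ y‖^2) * 2) atTop (𝓝 0) := by
      have := (limE.mul_const 2).add (limer.mul_const 2)
      simpa using this
    refine tendsto_of_eps (K := ∫ x, ‖FT (fun ρ => f ρ * kap a b ρ) x‖^2) (integral_nonneg fun _ => sq_nonneg _) hr ?_
    intro ε hε τ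
    have iv := (H' M (fτ τ) (hτ τ)).1
    rw [← integral_sub iv (iAτ τ).integrableOn]
    have iB : IntegrableOn (fun y => (1 + ε⁻¹) * (‖E τ y‖^2 * 2 + ‖er τ y‖^2 * 2) + ε * ‖A τ y‖^2) (Ioi 0) :=
      ((((iEτ τ).integrableOn.mul_const 2).add ((ier τ).mul_const 2)).const_mul _).add ((iAτ τ).integrableOn.const_mul _)
    have h1 : |∫ y in Ioi 0, (‖vj a b (fτ τ) y‖^2 - ‖A τ y‖^2)| ≤
        ∫ y in Ioi 0, ((1 + ε⁻¹) * (‖E τ y‖^2 * 2 + ‖er τ y‖^2 * 2) + ε * ‖A τ y‖^2) := by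
      rw [← norm_eq_abs]
      refine norm_integral_le_of_norm_le iB (ae_of_all _ fun y => ?_)
      have t1 : vj a b (fτ τ) y = A τ y + (E τ y + er τ y) := by simp only [er]; ring
      have t2 : ‖E τ y + er τ y‖^2 ≤ ‖E τ y‖^2 * 2 + ‖er τ y‖^2 * 2 := by
        have := norm_add_le (E τ y) (er τ y)
        nlinarith [norm_nonneg (E τ y + er τ y), sq_nonneg (‖E τ y‖ - ‖er τ y‖)]
      rw [t1]
      set R := E τ y + er τ y
      have t3 : |‖A τ y + R‖^2 - ‖A τ y‖^2| ≤ (1 + ε⁻¹) * ‖R‖^2 + ε * ‖A τ y‖^2 := by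
        have u1 := norm_add_le (A τ y) R
        have u2 := norm_sub_le (A τ y + R) R
        rw [add_sub_cancel_right] at u2
        have u3 : |‖A τ y + R‖ - ‖A τ y‖| ≤ ‖R‖ := by rw [abs_le]; constructor <;> linarith
        have u4 : ‖A τ y + R‖^2 - ‖A τ y‖^2 = (‖A τ y + R‖ - ‖A τ y‖) * (‖A τ y + R‖ + ‖A τ y‖) := by ring
        rw [u4, abs_mul, abs_of_nonneg (show 0 ≤ ‖A τ y + R‖ + ‖A τ y‖ by positivity)]
        have u5 : 2 * (‖R‖ * ‖A τ y‖) ≤ ε⁻¹ * ‖R‖^2 + ε * ‖A τ y‖^2 := by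
          have e : ε⁻¹ * ‖R‖^2 + ε * ‖A τ y‖^2 - 2 * (‖R‖ * ‖A τ y‖) = ε⁻¹ * (‖R‖ - ε * ‖A τ y‖)^2 := by field_simp; ring
          have : 0 ≤ ε⁻¹ * (‖R‖ - ε * ‖A τ y‖)^2 := by positivity
          linarith
        calc _ ≤ ‖R‖ * (‖A τ y‖ + ‖R‖ + ‖A τ y‖) := by gcongr
          _ ≤ _ := by nlinarith
      rw [norm_eq_abs]
      refine t3.trans ?_
      have : 0 ≤ 1 + ε⁻¹ := by positivity
      gcongr
    refine h1.trans ?_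
    have e1 := integral_add ((((iEτ τ).integrableOn (s := Ioi 0).mul_const 2).add ((ier τ).mul_const 2)).const_mul (1+ε⁻¹))
      ((iAτ τ).integrableOn.const_mul ε)
    have e2 := integral_add ((iEτ τ).integrableOn (s := Ioi 0).mul_const 2) ((ier τ).mul_const 2)
    simp only [Pi.add_apply] at e1 e2
    rw [e1, integral_const_mul, integral_const_mul, e2, integral_mul_const, integral_mul_const]
    gcongr
    refine (setIntegral_le_integral (iAτ τ) (ae_of_all _ fun y => sq_nonneg _)).trans (le_of_eq ?_)
    exact integral_sub_left_eq_self (fun x => ‖FT (fun ρ => f ρ * kap a b ρ) x‖^2) volume τ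
  have fin := (lim1.add lim2).add limA
  rw [FT_normsq _ hk.integrable hk.memLp, zero_add, zero_add] at fin
  refine tendsto_nhds_unique (tendsto_const_nhds (x := ∫ y in Ioi 0, ‖vj a b f y‖^2 * rr y ^ (a+b-1)) (f := atTop)) (fin.congr fun τ => ?_)
  rw [← inv τ]
  have iv := (H' M (fτ τ) (hτ τ)).1
  have iv2 := (H' M (fτ τ) (hτ τ)).2.1
  have i3 : IntegrableOn (fun y => ‖vj a b (fτ τ) y‖^2 * (rr y ^ (a+b-1) - 1)) (Ioi 0) := by
    have := iv2.sub iv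
    refine this.congr (ae_of_all _ fun y => ?_)
    simp only [Pi.sub_apply]; ring
  simp only [A]
  rw [add_assoc, sub_add_cancel, ← integral_add i3 iv]
  congr 1; ext y; ring

end J

lemma ker_int (σ : ℝ) (hσ : 0 < σ) : IntegrableOn (fun y => rr y ^ (σ-1) * exp (-y/2)) (Ioi 0) := by
  have h1 := (omega_int (σ-1) blin).norm
  have h2 : IntegrableOn (fun y : ℝ => exp (-y/2)) (Ioi 0) := by
    have := exp_neg_integrableOn_Ioi zR (b := 1/2) bnum
    refine this.congr_fun (fun y _ => ?_) measurableSet_Ioi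
    congr 1; ring
  refine (h1.add h2).mono' ?_ ?_
  · have := rr_cont.measurable
    exact (Measurable.mul bfun bfun).aestronglyMeasurable
  · filter_upwards [ae_restrict_mem measurableSet_Ioi] with y hy
    have hy' : zR < y := hy
    have e1 : exp (-y/2) ≤ 1 := exp_le_one_iff.mpr blin
    have e0 := exp_pos (-y/2)
    have r0 : 0 ≤ rr y ^ (σ-1) := rpow_nonneg (rr_pos hy).le _
    rw [norm_of_nonneg bpos]
    simp only [Pi.add_apply, norm_eq_abs]
    have := le_abs_self (rr y ^ (σ-1) - 1)
    have := abs_nonneg (rr y ^ (σ-1) - 1)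
    nlinarith

def kr (t : ℝ) (P : ℂ) (y : ℝ) : ℂ := (rr y : ℂ) ^ (P-1) * cexp (-(1/2 + I * t) * y)

lemma kr_norm (t : ℝ) (P : ℂ) {y : ℝ} (hy : 0 < y) : ‖kr t P y‖ = rr y ^ (P.re - 1) * exp (-y/2) := by
  unfold kr
  rw [norm_mul, norm_cpow_eq_rpow_re_of_pos (rr_pos hy), norm_exp]
  congr 2
  simp; ring

lemma kr_meas (t : ℝ) (P : ℂ) : Measurable (kr t P) := by
  have := rr_cont.measurable
  unfold kr
  fun_prop

def mv (t : ℝ) (v : ℝ → ℂ) (P : ℂ) : ℂ := ∫ y in Ioi zR, kr t P y * v y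

lemma mv_int (t : ℝ) (P : ℂ) (hP : 0 < P.re) (v : ℝ → ℂ) (C : ℝ)
    (hv : AEStronglyMeasurable v (volume.restrict (Ioi 0))) (hb : ∀ y > 0, ‖v y‖ ≤ C) :
    IntegrableOn (fun y => kr t P y * v y) (Ioi 0) := by
  refine ((ker_int P.re hP).mul_const C).mono' ((kr_meas t P).aestronglyMeasurable.mul hv) ?_
  filter_upwards [ae_restrict_mem measurableSet_Ioi] with y hy
  rw [norm_mul, kr_norm t P hy]
  exact mul_le_mul_of_nonneg_left (hb y hy)
    (mul_nonneg (rpow_nonneg (rr_pos hy).le _) (exp_pos _).le)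

lemma mv_bound (t : ℝ) (P : ℂ) (hP : 0 < P.re) (v : ℝ → ℂ) (C : ℝ)
    (hb : ∀ y > 0, ‖v y‖ ≤ C) :
    ‖mv t v P‖ ≤ (∫ y in Ioi zR, rr y ^ (P.re-1) * exp (-y/2)) * C := by
  rw [← integral_mul_const]
  refine norm_integral_le_of_norm_le ((ker_int P.re hP).mul_const C) ?_
  filter_upwards [ae_restrict_mem measurableSet_Ioi] with y hy
  rw [norm_mul, kr_norm t P hy]
  exact mul_le_mul_of_nonneg_left (hb y hy)
    (mul_nonneg (rpow_nonneg (rr_pos hy).le _) (exp_pos _).le)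

lemma rr_image : rr '' (Ioi 0) = Ioo 0 1 := by
  ext r
  constructor
  · rintro ⟨y, hy, rfl⟩; exact ⟨rr_pos hy, rr_lt y⟩
  · rintro ⟨h0, h1⟩
    refine ⟨-Real.log (1 - r), ?_, ?_⟩
    · have := log_neg (show 0 < 1 - r by linarith) blin
      simpa using this
    · unfold rr; rw [neg_neg, exp_log blin]; ring

lemma rr_inj : InjOn rr (Ioi 0) := by
  intro x _ y _ h
  unfold rr at h
  have : exp (-x) = exp (-y) := by linarith
  have := Real.exp_injective this
  linarith

lemma sub_rr (g : ℝ → ℂ) : ∫ r in Ioo zR 1, g r = ∫ y in Ioi zR, (exp (-y) : ℂ) * g (rr y) := by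
  rw [← rr_image, integral_image_eq_integral_abs_deriv_smul measurableSet_Ioi
    (fun y _ => (rr_derivR y).hasDerivWithinAt) rr_inj]
  refine setIntegral_congr_fun measurableSet_Ioi fun y _ => ?_
  have : 1 - rr y = exp (-y) := by unfold rr; ring
  simp only [this, abs_of_pos (exp_pos _), real_smul]

lemma mm_thomae (a b t ρ : ℝ) (hab : 0 < a + b) (ha : 0 < a) (P : ℂ) (hP : 0 < P.re) (hs : 0 < 1/2 - a + P.re) :
    HasSum (fun n => hc ((a:ℂ)+b-P) (a+I*ρ) ((a:ℂ)+b) n * (poch (a-I*ρ) n / poch (a+1/2+I*t) n))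
      (Complex.Gamma (a+1/2+I*t) * Complex.Gamma (1/2-a+I*t+P) /
        (Complex.Gamma (1/2+I*t+I*ρ) * Complex.Gamma (1/2+I*t-I*ρ) * Complex.Gamma P) * mv t (jk a b ρ) P) := by
  have h := thomae (a-I*ρ) (a+I*ρ) (b-I*ρ) ((a:ℂ)+b) (a+1/2+I*t) P (ab_ne a b hab)
    (ne_neg_nat_of_re_pos bsl) (by ring) (by simpa using ha) bsimp bsimp hP
    bsl
  have e : (∫ x in Ioo zR 1, xC^(P-1) * (1 - xC)^((a+1/2+I*t : ℂ)-(a+I*ρ)-1) *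
      pser (hc (a-I*ρ) (b-I*ρ) ((a:ℂ)+b)) x) = mv t (jk a b ρ) P := by
    rw [sub_rr]
    refine setIntegral_congr_fun measurableSet_Ioi fun y _ => ?_
    have e1 : (1 - (rr y : ℂ)) = cexp (((-y : ℝ)) : ℂ) := by
      unfold rr; push_cast; ring
    have e2 : (1 - (rr y : ℂ))^((a+1/2+I*t : ℂ)-(a+I*ρ)-1) =
        cexp (((-y : ℝ) : ℂ) * ((a+1/2+I*t : ℂ)-(a+I*ρ)-1)) := by
      rw [e1, cpow_def_of_ne_zero (Complex.exp_ne_zero _), ← ofReal_exp,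
        ← ofReal_log (exp_pos _).le, log_exp]
    beta_reduce
    rw [e2]
    have e3 : ((exp (-y) : ℝ) : ℂ) = cexp (((-y : ℝ)) : ℂ) := by push_cast; rfl
    rw [e3]
    unfold kr jk
    rw [show pj a b ρ = hc (a-I*ρ) (b-I*ρ) ((a:ℂ)+b) from rfl]
    have e4 : cexp (((-y : ℝ)) : ℂ) * cexp (((-y : ℝ) : ℂ) * ((a+1/2+I*t : ℂ)-(a+I*ρ)-1))
      = cexp (-(1/2 + I * t) * y) * cexp (I * ρ * y) := by
      rw [← Complex.exp_add, ← Complex.exp_add]; congr 1; push_cast; ring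
    linear_combination (rr y : ℂ)^(P-1) * pser (hc (a-I*ρ) (b-I*ρ) ((a:ℂ)+b)) (rr y) * e4
  rw [e] at h
  convert h using 2
  rw [show (a+1/2+I*t : ℂ) - (a-I*ρ) - (a+I*ρ) + P = 1/2-a+I*t+P by ring,
    show (a+1/2+I*t : ℂ) - (a-I*ρ) = 1/2+I*t+I*ρ by ring,
    show (a+1/2+I*t : ℂ) - (a+I*ρ) = 1/2+I*t-I*ρ by ring]

/-- log coordinate -/
lemma lr_deriv {y : ℝ} (hy : 0 < y) : HasDerivAt (fun y => Real.log (rr y)) ((1 - rr y)/rr y) y :=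
  (rr_derivR y).log (rr_pos hy).ne'

lemma lr_inj : InjOn (fun y => Real.log (rr y)) (Ioi 0) := by
  intro x hx y hy h
  exact rr_inj hx hy (Real.log_injOn_pos (rr_pos hx) (rr_pos hy) h)

lemma lr_image : (fun y => Real.log (rr y)) '' (Ioi 0) = Iio 0 := by
  ext u
  constructor
  · rintro ⟨y, hy, rfl⟩; exact log_neg (rr_pos hy) (rr_lt y)
  · intro hu
    have : exp u ∈ rr '' (Ioi 0) := by
      rw [rr_image]; exact ⟨exp_pos u, exp_lt_one_iff.mpr hu⟩
    obtain ⟨y, hy, h⟩ := this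
    exact ⟨y, hy, by simp [h]⟩

lemma lr_jac {y : ℝ} (hy : 0 < y) : |(1 - rr y)/rr y| = exp (-y) / rr y := by
  have : 1 - rr y = exp (-y) := by unfold rr; ring
  rw [this, abs_of_pos (div_pos (exp_pos _) (rr_pos hy))]

lemma sub_lr {E : Type*} [NormedAddCommGroup E] [NormedSpace ℝ E] (g : ℝ → E) : ∫ u in Iio zR, g u =
    ∫ y in Ioi zR, (exp (-y) / rr y) • g (Real.log (rr y)) := by
  rw [← lr_image, integral_image_eq_integral_abs_deriv_smul measurableSet_Ioi
    (fun y hy => (lr_deriv hy).hasDerivWithinAt) lr_inj]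
  exact setIntegral_congr_fun measurableSet_Ioi fun y hy => by simp only [lr_jac hy]

lemma sub_lr_int {E : Type*} [NormedAddCommGroup E] [NormedSpace ℝ E] (g : ℝ → E) : IntegrableOn g (Iio zR) ↔
    IntegrableOn (fun y => (exp (-y) / rr y) • g (Real.log (rr y))) (Ioi 0) := by
  rw [← lr_image, integrableOn_image_iff_integrableOn_abs_deriv_smul measurableSet_Ioi
    (fun y hy => (lr_deriv hy).hasDerivWithinAt) lr_inj]
  exact integrableOn_congr_fun (fun y hy => by simp only [lr_jac hy]) measurableSet_Ioi

def yl (u : ℝ) : ℝ := -Real.log (1 - exp u)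

lemma yl_lr {y : ℝ} (hy : 0 < y) : yl (Real.log (rr y)) = y := by
  unfold yl; rw [exp_log (rr_pos hy)]; unfold rr; simp

lemma yl_pos {u : ℝ} (hu : u < 0) : 0 < yl u := by
  have h1 := exp_lt_one_iff.mpr hu
  have h2 := exp_pos u
  have := log_neg (show 0 < 1 - exp u by linarith) blin
  unfold yl; linarith

lemma rr_yl {u : ℝ} (hu : u < 0) : rr (yl u) = exp u := by
  have h1 := exp_lt_one_iff.mpr hu
  unfold rr yl; rw [neg_neg, exp_log blin]; ring

def Gl (k₂ t : ℝ) (v : ℝ → ℂ) : ℝ → ℂ := (Iio zR).indicator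
  fun u => cexp (k₂ * u) * cexp ((1/2 - I * t) * yl u) * v (yl u)

lemma Gl_lr (k₂ t : ℝ) (v : ℝ → ℂ) {y : ℝ} (hy : 0 < y) :
    (exp (-y) / rr y) • Gl k₂ t v (Real.log (rr y)) = kr t k₂ y * v y := by
  have hm : Real.log (rr y) ∈ Iio zR := log_neg (rr_pos hy) (rr_lt y)
  rw [Gl, indicator_of_mem hm, yl_lr hy, real_smul, kr,
    cpow_def_of_ne_zero (by exact_mod_cast (rr_pos hy).ne'), ← ofReal_log (rr_pos hy).le]
  have e : ((exp (-y) / rr y : ℝ) : ℂ) = cexp (-y) * cexp (-Real.log (rr y)) := by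
    rw [← ofReal_neg, ← ofReal_exp, ← ofReal_neg, ← ofReal_exp,
      ← ofReal_mul, exp_neg (Real.log _), exp_log (rr_pos hy), div_eq_mul_inv]
  rw [e, ← Complex.exp_add, ← Complex.exp_add, ← mul_assoc, ← Complex.exp_add, ← Complex.exp_add]
  congr 2
  push_cast
  ring

lemma Gl_integrable (k₂ t : ℝ) (hk : 0 < k₂) (v : ℝ → ℂ) (C : ℝ)
    (hv : AEStronglyMeasurable v (volume.restrict (Ioi 0))) (hb : ∀ y > 0, ‖v y‖ ≤ C) :
    Integrable (Gl k₂ t v) := by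
  have : IntegrableOn (Gl k₂ t v) (Iio 0) := by
    rw [sub_lr_int]
    exact (mv_int t k₂ (by simpa using hk) v C hv hb).congr_fun (fun y hy => (Gl_lr k₂ t v hy).symm) measurableSet_Ioi
  have h2 := this.integrable_indicator measurableSet_Iio
  rwa [Gl, indicator_indicator, inter_self] at h2

lemma Gl_ind (k₂ t : ℝ) (v : ℝ → ℂ) : Gl k₂ t v = (Iio zR).indicator (Gl k₂ t v) := by
  unfold Gl; rw [indicator_indicator, inter_self]

lemma Gl_FT (k₂ t : ℝ) (v : ℝ → ℂ) (x : ℝ) : FT (Gl k₂ t v) x = mv t v (k₂ + I * x) := by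
  unfold FT mv
  have : (∫ y : ℝ, cexp (I*x*y) * Gl k₂ t v y) = ∫ u in Iio zR, cexp (I*x*u) * Gl k₂ t v u := by
    rw [← integral_indicator measurableSet_Iio]
    congr 1; ext u
    rw [Gl_ind]
    by_cases h : u ∈ Iio zR <;> simp [indicator, h]
  rw [this, sub_lr]
  refine setIntegral_congr_fun measurableSet_Ioi fun y hy => ?_
  beta_reduce
  rw [← mul_smul_comm, Gl_lr k₂ t v hy, kr, kr, show ((k₂:ℂ) + I * x - 1) = I*x + (k₂ - 1) by ring,
    cpow_add _ _ (by exact_mod_cast (rr_pos hy).ne'), cpow_def_of_ne_zero (x := rr y)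
      (by exact_mod_cast (rr_pos hy).ne') (I*x), ← ofReal_log (rr_pos hy).le,
    mul_comm (I*x) (Real.log (rr y) : ℂ)]
  ring

lemma Gl_norm_lr (k₂ t : ℝ) (v : ℝ → ℂ) {y : ℝ} (hy : 0 < y) :
    (exp (-y) / rr y) • ‖Gl k₂ t v (Real.log (rr y))‖^2 = ‖v y‖^2 * rr y ^ (2*k₂-1) := by
  have hm : Real.log (rr y) ∈ Iio zR := log_neg (rr_pos hy) (rr_lt y)
  rw [Gl, indicator_of_mem hm, yl_lr hy, smul_eq_mul, norm_mul, norm_mul, norm_exp, norm_exp,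
    rpow_def_of_pos (rr_pos hy)]
  have e : exp (-y) / rr y = exp (-y) * exp (-Real.log (rr y)) := by
    rw [exp_neg (Real.log _), exp_log (rr_pos hy), div_eq_mul_inv]
  have : Real.log (rr y) * (2 * k₂ - 1) = -y + (-Real.log (rr y)) + (k₂ * Real.log (rr y) + (1/2)*y)
    + (k₂ * Real.log (rr y) + (1/2)*y) := by ring
  rw [this, exp_add, exp_add, exp_add, exp_add, e]
  simp
  ring

lemma Gl_memLp (k₂ t : ℝ) (v : ℝ → ℂ) (hm : AEStronglyMeasurable (Gl k₂ t v))
    (hv : IntegrableOn (fun y => ‖v y‖^2 * rr y ^ (2*k₂-1)) (Ioi 0)) : MemLp (Gl k₂ t v) 2 := by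
  rw [memLp_two_iff_integrable_sq_norm hm]
  have : IntegrableOn (fun u => ‖Gl k₂ t v u‖^2) (Iio 0) := by
    rw [sub_lr_int]
    exact hv.congr_fun (fun y hy => (Gl_norm_lr k₂ t v hy).symm) measurableSet_Ioi
  refine (this.integrable_indicator measurableSet_Iio).congr (ae_of_all _ fun u => ?_)
  by_cases h : u ∈ Iio zR <;> simp [indicator, h, Gl]

lemma Gl_normsq (k₂ t : ℝ) (v : ℝ → ℂ) :
    ∫ u, ‖Gl k₂ t v u‖^2 = ∫ y in Ioi zR, ‖v y‖^2 * rr y ^ (2*k₂-1) := by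
  have : ∫ u, ‖Gl k₂ t v u‖^2 = ∫ u in Iio zR, ‖Gl k₂ t v u‖^2 := by
    rw [← integral_indicator measurableSet_Iio]
    congr 1; ext u
    by_cases h : u ∈ Iio zR <;> simp [indicator, h, Gl]
  rw [this, sub_lr]
  exact setIntegral_congr_fun measurableSet_Ioi (fun y hy => (Gl_norm_lr k₂ t v hy))

lemma vj_aesm (a b δ N : ℝ) (hab : 0 < a + b) (hδ : 0 < δ) {M : ℝ} {f : ℝ → ℂ} (h : BF δ N M f) :
    AEStronglyMeasurable (vj a b f) (volume.restrict (Ioi 0)) :=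
  (vj_cont a b δ N hab hδ h).aestronglyMeasurable measurableSet_Ioi

lemma mv_prod_int (a b t δ N : ℝ) (hab : 0 < a + b) (hδ : 0 < δ) {M : ℝ} {f : ℝ → ℂ}
    (h : BF δ N M f) (P : ℂ) (hP : 0 < P.re) :
    Integrable (fun p : ℝ × ℝ => f p.1 * (kr t P p.2 * jk a b p.1 p.2))
      (volume.prod (volume.restrict (Ioi 0))) := by
  obtain ⟨C, hC, H⟩ := jk_bounds a b δ N hab hδ
  have hb : Integrable (fun p : ℝ × ℝ => (Icc δ N).indicator (fun _ => M * C) p.1 *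
      (rr p.2 ^ (P.re-1) * exp (-p.2/2))) (volume.prod (volume.restrict (Ioi 0))) :=
    (ind_integrable δ N (M*C)).mul_prod (ker_int P.re hP)
  have hae : ∀ᵐ p : ℝ × ℝ ∂(volume.prod (volume.restrict (Ioi 0))), 0 < p.2 := by
    have : (volume : Measure ℝ).prod (volume.restrict (Ioi zR)) =
        ((volume : Measure ℝ).prod volume).restrict (univ ×ˢ Ioi 0) := by
      rw [← Measure.prod_restrict, Measure.restrict_univ]
    rw [this]
    filter_upwards [ae_restrict_mem (MeasurableSet.univ.prod measurableSet_Ioi)] with p hp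
    exact hp.2
  refine hb.mono' ?_ ?_
  · have m1 : Measurable (fun p : ℝ × ℝ => f p.1 * (kr t P p.2 *
        ({p : ℝ × ℝ | 0 < p.2}.indicator fun p => jk a b p.1 p.2) p)) :=
      (h.meas.comp measurable_fst).mul (((kr_meas t P).comp measurable_snd).mul (measurable_jk a b hab))
    refine m1.aestronglyMeasurable.congr ?_
    filter_upwards [hae] with p hp
    simp [indicator, hp]
  · filter_upwards [hae] with p hp
    rw [show f p.1 * (kr t P p.2 * jk a b p.1 p.2) = (f p.1 * jk a b p.1 p.2) * kr t P p.2 by ring,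
      norm_mul, kr_norm t P hp]
    exact mul_le_mul_of_nonneg_right (h.prod_le (fun ρ => jk a b ρ p.2) C (fun ρ hρ => ((H ρ hρ).2.2 p.2 hp).1) p.1)
      (mul_nonneg (rpow_nonneg (rr_pos hp).le _) (exp_pos _).le)

lemma mv_vj (a b t δ N : ℝ) (hab : 0 < a + b) (hδ : 0 < δ) {M : ℝ} {f : ℝ → ℂ}
    (h : BF δ N M f) (P : ℂ) (hP : 0 < P.re) :
    ∫ ρ, f ρ * mv t (jk a b ρ) P = mv t (vj a b f) P := by
  have hi := mv_prod_int a b t δ N hab hδ h P hP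
  have := integral_integral_swap (f := fun ρ y => f ρ * (kr t P y * jk a b ρ y)) hi
  simp only [mv, vj]
  simp_rw [← integral_const_mul]
  rw [this]
  congr 1; ext y
  congr 1; ext ρ; ring

def Kf (a t ρ : ℝ) : ℂ := Complex.Gamma (a+1/2+I*t) / (Complex.Gamma (1/2+I*t+I*ρ) * Complex.Gamma (1/2+I*t-I*ρ))

lemma Kf_cont (a t : ℝ) : Continuous (Kf a t) := by
  have h := differentiable_one_div_Gamma.continuous
  have e : Kf a t = fun ρ : ℝ => Complex.Gamma (a+1/2+I*t) * ((Complex.Gamma (1/2+I*t+I*ρ))⁻¹ *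
      (Complex.Gamma (1/2+I*t-I*ρ))⁻¹) := by
    ext ρ; rw [Kf, div_eq_mul_inv, mul_inv]
  rw [e]
  have h1 : Continuous (fun ρ : ℝ => (Complex.Gamma (1/2+I*t+I*ρ))⁻¹) := h.comp bfun
  have h2 : Continuous (fun ρ : ℝ => (Complex.Gamma (1/2+I*t-I*ρ))⁻¹) := h.comp bfun
  fun_prop

/-- the sum S -/
lemma F32_eq (k₁ k₂ t ρ : ℝ) (hk₂ : 0 < k₂) (hdiff : -(1/2) < k₂ - k₁) (x : ℂ)
    (h1 : 0 < k₂ + (I * x).re) (h2 : 0 < k₁ + (I * x).re) :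
    F32 ((k₂ : ℂ) - I * x) ((k₂ : ℂ) - (k₁ : ℂ) + 1/2 + I * ρ)
      ((k₂ : ℂ) - (k₁ : ℂ) + 1/2 - I * ρ) (2 * (k₂ : ℂ)) ((k₂ : ℂ) - (k₁ : ℂ) + I * t + 1) 1 =
    Kf aₖ t ρ * Complex.Gamma (k₁ + I*t + I*x) / Complex.Gamma (k₂ + I * x) *
      mv t (jk aₖ bₖ ρ) (k₂ + I * x) := by
  have h := mm_thomae aₖ bₖ t ρ blin blin (k₂ + I * x)
    (by rw [add_re, ofReal_re]; exact h1)
    (by rw [add_re, ofReal_re]; linarith)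
  have e := h.tsum_eq
  unfold F32 pFq Kf
  rw [show Complex.Gamma (1 / 2 - ((k₂-k₁+1/2 : ℝ) : ℂ) + I * t + (k₂ + I * x)) = Complex.Gamma (k₁ + I*t + I*x) by
    congr 1; push_cast; ring] at e
  have e2 : ∀ A B C D E : ℂ, A / B * C / D * E = A * C / (B * D) * E := by
    intros; simp only [div_eq_mul_inv, mul_inv]; ring
  rw [e2, ← e]
  refine tsum_congr fun n => ?_
  simp only [List.map_cons, List.map_nil, List.prod_cons, List.prod_nil, hc, one_pow, mul_one]
  push_cast
  rw [show ((k₂:ℂ)-k₁+1/2 + bₖ) = 2 * k₂ by ring, show (2*(k₂:ℂ) - (k₂ + I*x)) = k₂ - I*x by ring,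
    show ((k₂:ℂ)-k₁+1/2+1/2+I*t) = k₂ - k₁ + I*t + 1 by ring, div_mul_div_comm, div_div]
  congr 1 <;> ring

def pref (k₁ k₂ t φ : ℝ) (x : ℝ) : ℂ := cexp ((π - 2*φ) * x) /
  (Complex.Gamma (k₁ - I*t - I*x) * Complex.Gamma (k₂ + I*x))

def wR (k₁ k₂ t φ : ℝ) (x : ℝ) : ℝ := 1/(2*π) * exp ((2*x+t)*(2*φ-π)) *
  ‖Complex.Gamma (k₁ + I*t + I*x)‖^2 * ‖Complex.Gamma (k₂ + I*x)‖^2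

set_option hygiene false in
local notation "wRₖ" => wR k₁ k₂ t φ

lemma conj_s (k₁ t x : ℝ) : Complex.Gamma (k₁ - I*t - I*x) = conj (Complex.Gamma (k₁ + I*t + I*x)) := by
  rw [← Gamma_conj]; congr 1; simp; ring

lemma conj_p (k₂ x : ℝ) : Complex.Gamma (k₂ - I*x) = conj (Complex.Gamma (k₂ + I*x)) := by
  rw [← Gamma_conj]; congr 1; simp; ring

lemma wfun_eq (k₁ k₂ t φ x : ℝ) : wfun k₁ k₂ t φ x = (wRₖ x : ℂ) := by
  unfold wfun wR
  rw [conj_s, conj_p]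
  push_cast
  rw [← mul_conj', ← mul_conj']
  ring

lemma Gs_ne (k₁ t x : ℝ) (hk : 0 < k₁) : Complex.Gamma (k₁ + I*t + I*x) ≠ 0 :=
  Gamma_ne_zero_of_re_pos (by simpa using hk)

lemma Gs_ne' (k₁ t x : ℝ) (hk : 0 < k₁) : Complex.Gamma (k₁ - I*t - I*x) ≠ 0 :=
  Gamma_ne_zero_of_re_pos (by simpa using hk)

lemma Gp_ne (k₂ x : ℝ) (hk : 0 < k₂) : Complex.Gamma (k₂ + I*x) ≠ 0 :=
  Gamma_ne_zero_of_re_pos (by simpa using hk)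

lemma pref_w (k₁ k₂ t φ x : ℝ) (hk₁ : 0 < k₁) (hk₂ : 0 < k₂) :
    ‖pref k₁ k₂ t φ x‖^2 * wRₖ x = 1/(2*π) * exp (t*(2*φ-π)) := by
  have h1 : ‖Complex.Gamma (k₁ + I*t + I*x)‖ ≠ 0 := norm_ne_zero_iff.mpr (Gs_ne k₁ t x hk₁)
  have h2 : ‖Complex.Gamma (k₂ + I*x)‖ ≠ 0 := norm_ne_zero_iff.mpr (Gp_ne k₂ x hk₂)
  unfold pref wR
  rw [conj_s, norm_div, norm_mul, norm_conj, norm_exp]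
  have e : (((π:ℂ) - 2 * φ) * x).re = (π - 2*φ)*x := by simp
  have e2 : exp (t*(2*φ-π)) = exp ((π - 2*φ)*x) * exp ((π - 2*φ)*x) *
    exp ((2*x+t)*(2*φ-π)) := by rw [← exp_add, ← exp_add]; congr 1; ring
  rw [e, e2]
  generalize exp ((π - 2*φ)*x) = E
  generalize exp ((2*x+t)*(2*φ-π)) = E'
  have := pi_pos.ne'
  field_simp

lemma sin_pi_ne {z : ℂ} (hz : z.im ≠ 0) : Complex.sin (π * z) ≠ 0 := by
  intro h
  rw [Complex.sin_eq_zero_iff] at h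
  obtain ⟨n, hn⟩ := h
  have hpi : (π : ℂ) ≠ 0 := by exact_mod_cast pi_pos.ne'
  have : z = n := by
    rw [mul_comm] at hn; exact mul_right_cancel₀ hpi hn
  rw [this] at hz
  simp at hz

lemma phi_eq (k₁ k₂ t φ ρ x : ℝ) (hk₁ : 0 < k₁) (hk₂ : 0 < k₂) (hdiff : -(1/2) < k₂ - k₁) (hx : x ≠ -t) :
    phiCₖ ρ x = pref k₁ k₂ t φ x * (Kf aₖ t ρ *
      mv t (jk aₖ bₖ ρ) (k₂ + I * x)) := by
  unfold phiC
  rw [F32_eq k₁ k₂ t ρ hk₂ hdiff x (by simpa using hk₂) (by simpa using hk₁)]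
  have hpi : (π : ℂ) ≠ 0 := by exact_mod_cast pi_pos.ne'
  have hsin : Complex.sin (π * (k₁ - I*t - I*x)) ≠ 0 := by
    refine sin_pi_ne ?_
    simp; intro h; apply hx; linarith
  have hG := Gamma_mul_Gamma_one_sub (k₁ - I*t - I*x)
  have hs := Gs_ne k₁ t x hk₁
  have hs' := Gs_ne' k₁ t x hk₁
  have hp := Gp_ne k₂ x hk₂
  rw [show (1 - (k₁ - I*t - I*x) : ℂ) = 1 - k₁ + I*t + I*x by ring] at hG
  rw [show ((k₁:ℂ) + I*x + I*t) = k₁ + I*t + I*x by ring]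
  unfold pper pref
  rw [show cexp ((π - 2*φ) * x) = cexp (-2*φ*x) * cexp (π * x) by
    rw [← Complex.exp_add]; congr 1; ring]
  rw [eq_div_iff hsin] at hG
  generalize Complex.Gamma (1 - k₁ + I*t + I*x : ℂ) = g1 at *
  generalize Complex.Gamma (k₁ - I*t - I*x : ℂ) = g2 at *
  generalize Complex.Gamma (k₁ + I*t + I*x : ℂ) = g3 at *
  generalize Complex.Gamma (k₂ + I*x : ℂ) = g4 at *
  generalize Complex.sin (π * (k₁ - I*t - I*x) : ℂ) = s at *
  generalize mv t (jk aₖ bₖ ρ) (k₂ + I * x) = m at *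
  generalize Kf aₖ t ρ = κ at *
  generalize cexp (-2*φ*x) = e1
  generalize cexp (π*x) = e2
  field_simp
  linear_combination e1 * e2 * κ * m * hG

def Uf (k₁ k₂ t φ : ℝ) (f : ℝ → ℂ) (x : ℝ) : ℂ := ∫ ρ, f ρ * phiCₖ ρ x

set_option hygiene false in
local notation "Ufₖ" => Uf k₁ k₂ t φ

lemma Uf_eq (k₁ k₂ t φ x δ N : ℝ) (hk₁ : 0 < k₁) (hk₂ : 0 < k₂) (hdiff : -(1/2) < k₂ - k₁) (hx : x ≠ -t)
    (hδ : 0 < δ) {M M' : ℝ} {f : ℝ → ℂ} (h : BF δ N M' (fun ρ => f ρ * Kf aₖ t ρ)) :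
    Ufₖ f x = pref k₁ k₂ t φ x * mv t (vj aₖ bₖ
      (fun ρ => f ρ * Kf aₖ t ρ)) (k₂ + I * x) := by
  unfold Uf
  simp_rw [phi_eq k₁ k₂ t φ _ x hk₁ hk₂ hdiff hx]
  rw [← mv_vj aₖ bₖ t δ N blin hδ h (k₂ + I*x) (by simpa using hk₂), ← integral_const_mul]
  congr 1; ext ρ; ring

lemma kap_Kf_W0 (k₁ k₂ t φ ρ : ℝ) (hk₂ : 0 < k₂) (hρ : 0 < ρ) (hdiff : -(1/2) < k₂ - k₁) :
    W0ₖ ρ * (2*π * exp (t*(2*φ-π)) *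
      ‖Kf aₖ t ρ * kap aₖ bₖ ρ‖^2) = 1 := by
  have e1 : Complex.Gamma (((k₂-k₁+1/2 : ℝ):ℂ) - I * ρ) = conj (Complex.Gamma ((k₂:ℂ) - k₁ + 1/2 + I*ρ)) := by
    rw [← Gamma_conj]; congr 1; simp [map_ofNat]; ring
  have e2 : Complex.Gamma (((k₁+k₂-1/2 : ℝ):ℂ) - I * ρ) = conj (Complex.Gamma ((k₁:ℂ) + k₂ - 1/2 + I*ρ)) := by
    rw [← Gamma_conj]; congr 1; simp [map_ofNat]; ring
  have e3 : Complex.Gamma (-2 * I * ρ) = conj (Complex.Gamma (2 * I * ρ)) := by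
    rw [← Gamma_conj]; congr 1; simp [map_ofNat]
  have e4 : Complex.Gamma (1/2 + I*t - I*ρ) = conj (Complex.Gamma (1/2 - I*t + I*ρ)) := by
    rw [← Gamma_conj]; congr 1; simp [map_ofNat]; ring
  have n1 : Complex.Gamma ((k₂:ℂ) - k₁ + 1/2 + I*ρ) ≠ 0 :=
    Gamma_ne_zero_of_re_pos bsl
  have n2 : Complex.Gamma ((k₁:ℂ) + k₂ - 1/2 + I*ρ) ≠ 0 := Gamma_ne_zero fun m h => by
    have := congrArg im h; simp at this; exact hρ.ne' this
  have n3 : Complex.Gamma (2 * I * ρ) ≠ 0 := Gamma_ne_zero fun m h => by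
    have := congrArg im h; simp at this; exact hρ.ne' this
  have n4 : Complex.Gamma (1/2 - I*t + I*ρ) ≠ 0 := Gamma_ne_zero_of_re_pos bsimp
  have n5 : Complex.Gamma (1/2 + I*t + I*ρ) ≠ 0 := Gamma_ne_zero_of_re_pos bsimp
  have n6 : Complex.Gamma (2 * (k₂:ℂ)) ≠ 0 := Gamma_ne_zero_of_re_pos bsl
  have n7 : Complex.Gamma ((k₂:ℂ) - k₁ + I*t + 1) ≠ 0 := Gamma_ne_zero_of_re_pos bsl
  unfold W0 Kf kap
  rw [e1, e2, e3, e4, show (((k₂-k₁+1/2 : ℝ):ℂ) + ((k₁+k₂-1/2 : ℝ):ℂ)) = 2 * k₂ by push_cast; ring,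
    show (((k₂-k₁+1/2 : ℝ):ℂ) + 1/2 + I*t) = k₂ - k₁ + I*t + 1 by push_cast; ring]
  have ee : exp (-t * (2*φ-π)) = (exp (t*(2*φ-π)))⁻¹ := by
    rw [← exp_neg]; congr 1; ring
  rw [ee]
  have hE := (exp_pos (t*(2*φ-π))).ne'
  have hpi := pi_pos.ne'
  simp only [norm_mul, norm_div, norm_conj]
  rw [← norm_ne_zero_iff] at n1 n2 n3 n4 n5 n6 n7
  generalize ‖Complex.Gamma ((k₂:ℂ) - k₁ + 1/2 + I*ρ)‖ = g1 at *
  generalize ‖Complex.Gamma ((k₁:ℂ) + k₂ - 1/2 + I*ρ)‖ = g2 at *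
  generalize ‖Complex.Gamma (2 * I * ρ)‖ = g3 at *
  generalize ‖Complex.Gamma (1/2 - I*t + I*ρ)‖ = g4 at *
  generalize ‖Complex.Gamma (1/2 + I*t + I*ρ)‖ = g5 at *
  generalize ‖Complex.Gamma (2 * (k₂:ℂ))‖ = g6 at *
  generalize ‖Complex.Gamma ((k₂:ℂ) - k₁ + I*t + 1)‖ = g7 at *
  generalize exp (t*(2*φ-π)) = E at *
  field_simp

/-- the data of `m_{f}` -/
lemma mv_data (k₁ k₂ t δ N : ℝ) (hk₂ : 0 < k₂) (hδ : 0 < δ) (hN : δ ≤ N) {M : ℝ} {f : ℝ → ℂ} (h : BF δ N M f) :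
    Integrable (Gl k₂ t (vj aₖ bₖ f)) ∧ MemLp (Gl k₂ t (vj aₖ bₖ f)) 2 ∧
    MemLp (fun x : ℝ => mv t (vj aₖ bₖ f) (k₂ + I * x)) 2 ∧
    ∫ x : ℝ, ‖mv t (vj aₖ bₖ f) (k₂ + I * x)‖^2 = (2*π)^2 *
      ∫ ρ, ‖f ρ * kap aₖ bₖ ρ‖^2 := by
  have hab : 0 < aₖ + bₖ := by linarith
  obtain ⟨C, hC, H⟩ := vj_asym _ _ δ N hab hδ hN
  obtain ⟨C', hC', H'⟩ := vj_L2 _ _ δ N hab hδ hN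
  have hi := Gl_integrable k₂ t hk₂ _ (M*C) (vj_aesm _ _ δ N hab hδ h) (fun y hy => ((H M f h).2.2 y hy).1)
  have e : aₖ + bₖ - 1 = 2*k₂ - 1 := by ring
  have h2 := (H' M f h).2.1
  rw [e] at h2
  have hm := Gl_memLp k₂ t _ hi.1 h2
  have eF : (fun x : ℝ => mv t (vj aₖ bₖ f) (k₂ + I * x)) = FT (Gl k₂ t (vj aₖ bₖ f)) :=
    funext fun x => (Gl_FT k₂ t _ x).symm
  refine ⟨hi, hm, ?_, ?_⟩
  · rw [eF]; exact FT_memLp _ hi hm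
  · have := FT_normsq _ hi hm
    rw [← eF, Gl_normsq, ← e, J_norm hab hδ hN h] at this
    rw [this]; ring

lemma I1 (k₁ k₂ t φ δ N : ℝ) (hk₁ : 0 < k₁) (hk₂ : 0 < k₂) (hdiff : -(1/2) < k₂ - k₁)
    (hδ : 0 < δ) (hN : δ ≤ N) {M : ℝ} {f : ℝ → ℂ} (h : BF δ N M f) :
    Integrable (fun x => ‖Ufₖ f x‖^2 * wRₖ x) ∧
    ∫ x, ‖Ufₖ f x‖^2 * wRₖ x = ∫ ρ, ‖f ρ‖^2 / W0ₖ ρ := by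
  obtain ⟨M', h'⟩ := h.mul_cont (Kf_cont aₖ t)
  obtain ⟨-, -, hm, hn⟩ := mv_data k₁ k₂ t δ N hk₂ hδ hN h'
  have hm' : Integrable (fun x : ℝ => ‖mv t (vj aₖ bₖ (fun ρ => f ρ * Kf aₖ t ρ)) (k₂ + I * x)‖^2) :=
    hm.integrable_norm_pow bnum
  have hae : ∀ᵐ x : ℝ, x ≠ -t := by simp [ae_iff]
  have key : (fun x => ‖Ufₖ f x‖^2 * wRₖ x) =ᵐ[volume] fun x : ℝ =>
      1/(2*π) * exp (t*(2*φ-π)) *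
      ‖mv t (vj aₖ bₖ (fun ρ => f ρ * Kf aₖ t ρ)) (k₂ + I * x)‖^2 := by
    filter_upwards [hae] with x hx
    rw [Uf_eq k₁ k₂ t φ x δ N hk₁ hk₂ hdiff hx hδ (M := M) h', ← pref_w k₁ k₂ t φ x hk₁ hk₂, norm_mul]
    ring
  refine ⟨(hm'.const_mul _).congr key.symm, ?_⟩
  rw [integral_congr_ae key, integral_const_mul, hn, ← integral_const_mul, ← integral_const_mul]
  congr 1; ext ρ
  by_cases hρ : ρ ∈ Icc δ N
  · have hρ0 : 0 < ρ := lt_of_lt_of_le hδ hρ.1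
    have hW := kap_Kf_W0 k₁ k₂ t φ ρ hk₂ hρ0 hdiff
    have hW0 : W0ₖ ρ ≠ 0 := left_ne_zero_of_mul_eq_one hW
    rw [eq_div_iff hW0, mul_assoc (f ρ), norm_mul (f ρ)]
    have hpi := pi_pos.ne'
    generalize ‖Kf aₖ t ρ * kap aₖ bₖ ρ‖ = z at *
    field_simp
    linear_combination ‖f ρ‖^2 * hW
  · simp [h.supp ρ hρ]

lemma int_inv_sq : Integrable (fun τ : ℝ => (1 + τ^2)⁻¹) := integrable_inv_one_add_sq

/-- integrability on a line -/
lemma line_int (f : ℝ → ℂ) (hf : Continuous f) (C : ℝ) (hb : ∀ τ : ℝ, 1 ≤ |τ| → ‖f τ‖ ≤ C / τ^2) :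
    Integrable f := by
  obtain ⟨B, hB⟩ := (isCompact_Icc (a := (-1:ℝ)) (b := 1)).exists_bound_of_continuousOn hf.continuousOn
  refine (int_inv_sq.const_mul (2 * (|B| + |C|))).mono' hf.aestronglyMeasurable (ae_of_all _ fun τ => ?_)
  rw [← div_eq_mul_inv, le_div_iff₀ bpos]
  have a1 := abs_nonneg B
  have a2 := abs_nonneg C
  rcases le_total |τ| 1 with h | h
  · have h1 : ‖f τ‖ ≤ |B| := (hB τ (abs_le.mp h)).trans (le_abs_self B)
    have h2 : τ^2 ≤ 1 := by rw [← sq_abs]; nlinarith [abs_nonneg τ]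
    have : 0 ≤ ‖f τ‖ := norm_nonneg _
    nlinarith
  · have h0 : 1 ≤ τ^2 := by rw [← sq_abs]; nlinarith
    have h1 := hb τ h
    rw [le_div_iff₀ blin] at h1
    have : ‖f τ‖ ≤ ‖f τ‖ * τ^2 := le_mul_of_one_le_right nnn h0
    have := le_abs_self C
    linarith

lemma strip_shift (g : ℂ → ℂ) (σ₁ σ₂ C : ℝ) (hσ : σ₁ ≤ σ₂)
    (hd : ∀ p : ℂ, σ₁ ≤ p.re → p.re ≤ σ₂ → DifferentiableAt ℂ g p)
    (hb : ∀ p : ℂ, σ₁ ≤ p.re → p.re ≤ σ₂ → 1 ≤ |p.im| → ‖g p‖ ≤ C / p.im^2) :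
    ∫ τ : ℝ, g (σ₁ + I * τ) = ∫ τ : ℝ, g (σ₂ + I * τ) := by
  have hint : ∀ σ, σ₁ ≤ σ → σ ≤ σ₂ → Integrable (fun τ : ℝ => g (σ + I * τ)) := by
    intro σ h1 h2
    refine line_int _ ?_ C ?_
    · refine continuous_iff_continuousAt.mpr fun τ => ?_
      have := (hd (σ + I * τ) (by simpa using h1) (by simpa using h2)).continuousAt
      exact ContinuousAt.comp (f := fun τ : ℝ => (σ + I * τ : ℂ)) this bfun
    · intro τ hτ
      simpa using hb (σ + I * τ) (by simpa using h1) (by simpa using h2) (by simpa using hτ)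
  have lim : ∀ σ, σ₁ ≤ σ → σ ≤ σ₂ → Tendsto (fun T : ℝ => ∫ τ in (-T)..T, g (σ + τ * I)) atTop
      (𝓝 (∫ τ : ℝ, g (σ + I * τ))) := by
    intro σ h1 h2
    have := intervalIntegral_tendsto_integral (hint σ h1 h2) tendsto_neg_atTop_atBot tendsto_id
    simpa [mul_comm] using this
  have hz : Tendsto (fun T : ℝ => C / T^2 * (σ₂ - σ₁)) atTop (𝓝 0) := by
    have : Tendsto (fun T : ℝ => C / T^2) atTop (𝓝 0) :=
      Tendsto.div_atTop tendsto_const_nhds (tendsto_pow_atTop bnum)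
    simpa using this.mul_const (σ₂ - σ₁)
  have edge : ∀ T : ℝ, 1 ≤ |T| → ‖∫ x in σ₁..σ₂, g (x + T * I)‖ ≤ C / T^2 * (σ₂ - σ₁) := by
    intro T hT
    have := intervalIntegral.norm_integral_le_of_norm_le_const (a := σ₁) (b := σ₂) (f := fun x : ℝ => g (x + T * I))
      (C := C/T^2) ?_
    · rwa [abs_of_nonneg blin] at this
    · intro x hx
      rw [uIoc_of_le hσ] at hx
      simpa using hb (x + T * I) (by simpa using hx.1.le) (by simpa using hx.2) (by simpa using hT)
  have e1 : Tendsto (fun T : ℝ => ∫ x in σ₁..σ₂, g (x + T * I)) atTop (𝓝 0) := by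
    refine squeeze_zero_norm' ?_ hz
    filter_upwards [eventually_ge_atTop 1] with T hT
    exact edge T (by rw [abs_of_nonneg blin]; exact hT)
  have e2 : Tendsto (fun T : ℝ => ∫ x in σ₁..σ₂, g (x + (-T : ℝ) * I)) atTop (𝓝 0) := by
    refine squeeze_zero_norm' ?_ hz
    filter_upwards [eventually_ge_atTop 1] with T hT
    have := edge (-T) (by rw [abs_neg, abs_of_nonneg blin]; exact hT)
    simpa using this
  have key : ∀ T : ℝ, (∫ x in σ₁..σ₂, g (x + (-T : ℝ) * I)) - (∫ x in σ₁..σ₂, g (x + T * I)) +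
      I * (∫ τ in (-T)..T, g (σ₂ + τ * I)) - I * (∫ τ in (-T)..T, g (σ₁ + τ * I)) = 0 := by
    intro T
    have := Complex.integral_boundary_rect_eq_zero_of_differentiableOn g (σ₁ + (-T : ℝ) * I) (σ₂ + T * I) ?_
    · simpa using this
    · intro p hp
      have : p.re ∈ uIcc σ₁ σ₂ := by simpa using hp.1
      rw [uIcc_of_le hσ] at this
      exact (hd p this.1 this.2).differentiableWithinAt
  have L := ((e2.sub e1).add ((lim σ₂ hσ le_rfl).const_mul I)).sub ((lim σ₁ le_rfl hσ).const_mul I)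
  simp_rw [key] at L
  have := tendsto_nhds_unique L tendsto_const_nhds
  have h3 : I * ((∫ τ : ℝ, g (σ₂ + I * τ)) - ∫ τ : ℝ, g (σ₁ + I * τ)) = 0 := by linear_combination this
  rw [mul_eq_zero, or_iff_right I_ne_zero, sub_eq_zero] at h3
  exact h3.symm

def ksub (q : ℂ) : ℂ := -4 / (q * (q^2 - 4))

lemma lor_int (a : ℝ) (ha : a ≠ 0) : Integrable (fun τ : ℝ => a / (a^2 + τ^2)) := by
  have h := (integrable_inv_one_add_sq.comp_div ha).mul_const a⁻¹
  refine h.congr (ae_of_all _ fun τ => ?_)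
  simp only; field_simp

lemma lor_val (a : ℝ) (ha : 0 < a) : ∫ τ : ℝ, a / (a^2 + τ^2) = π := by
  have h := Measure.integral_comp_div (fun τ : ℝ => (1 + τ^2)⁻¹) a
  rw [integral_univ_inv_one_add_sq, abs_of_pos ha, smul_eq_mul] at h
  have h2 : ∫ τ : ℝ, a / (a^2 + τ^2) = ∫ τ : ℝ, a⁻¹ * (1 + (τ/a)^2)⁻¹ := by
    congr 1; ext τ; field_simp
  rw [h2, integral_const_mul, h]; field_simp

lemma ksub_re (ε τ : ℝ) (h0 : ε ≠ 0) (h2 : ε - 2 ≠ 0) (h3 : ε + 2 ≠ 0) : ((ksub (ε + I * τ)).re : ℝ) =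
    ε / (ε^2 + τ^2) - 1/2 * ((ε-2)/((ε-2)^2 + τ^2)) - 1/2 * ((ε+2)/((ε+2)^2+τ^2)) := by
  have hinv : ∀ a : ℝ, ((a + I * τ : ℂ)⁻¹).re = a / (a^2 + τ^2) := by
    intro a; simp [Complex.inv_re, normSq_apply]; ring_nf
  have n : ∀ a : ℝ, a ≠ 0 → (a + I * τ : ℂ) ≠ 0 := by
    intro a ha h; have := congrArg re h; simp at this; exact ha this
  have e : ksub (ε + I*τ) = (ε + I*τ : ℂ)⁻¹ - ((1/2 : ℝ) : ℂ) * (((ε-2 : ℝ) : ℂ) + I*τ)⁻¹ -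
      ((1/2 : ℝ) : ℂ) * (((ε+2 : ℝ) : ℂ) + I*τ)⁻¹ := by
    have n1 := n ε h0
    have n2 := n _ h2
    have n3 := n _ h3
    have e4 : ((ε + I*τ : ℂ))^2 - 4 = (((ε-2 : ℝ) : ℂ) + I*τ) * (((ε+2 : ℝ) : ℂ) + I*τ) := by push_cast; ring
    unfold ksub
    rw [e4]
    field_simp
    push_cast
    ring
  rw [e, sub_re, sub_re, re_ofReal_mul, re_ofReal_mul, hinv, hinv, hinv]

lemma ksub_bound (p : ℂ) (h1 : |p.re| ≤ 1) (h2 : 1 ≤ |p.im|) : ‖ksub p‖ ≤ 4 / p.im^2 := by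
  have hp : |p.im| ≤ ‖p‖ := abs_im_le_norm p
  have hre : (p^2 - 4).re ≤ -3 - p.im^2 := by
    simp [pow_two]
    nlinarith [abs_le.mp h1]
  have hn : 3 + p.im^2 ≤ ‖p^2 - 4‖ := by
    have := abs_re_le_norm (p^2-4)
    have := neg_le_abs (p^2-4).re
    linarith
  have him : 0 < p.im^2 := by rw [← sq_abs]; positivity
  unfold ksub
  rw [norm_div, norm_mul, norm_neg]
  simp only [norm_ofNat]
  refine div_le_div_of_nonneg_left bnum him ?_
  nlinarith [norm_nonneg p]

lemma ksub_cont (ε : ℝ) (h0 : ε ≠ 0) (h1 : |ε| ≤ 1) : Continuous (fun τ : ℝ => ksub (ε + I * τ)) := by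
  unfold ksub
  refine Continuous.div₀ bfun bfun fun τ => ?_
  refine mul_ne_zero (fun h => h0 ?_) fun h => ?_
  · have := congrArg re h; simpa using this
  · have := congrArg re h
    simp [pow_two] at this
    nlinarith [abs_le.mp h1]

lemma ksub_integrable (ε : ℝ) (h0 : ε ≠ 0) (h1 : |ε| ≤ 1) : Integrable (fun τ : ℝ => ksub (ε + I * τ)) :=
  line_int _ (ksub_cont ε h0 h1) 4 fun τ hτ => by
    simpa using ksub_bound (ε + I * τ) (by simpa using h1) (by simpa using hτ)

lemma ksub_val (ε : ℝ) (h0 : ε ≠ 0) (h1 : |ε| ≤ 1) : ∫ τ : ℝ, ksub (ε + I * τ) =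
    (((∫ τ : ℝ, ε/(ε^2+τ^2)) : ℝ) : ℂ) := by
  have hi := ksub_integrable ε h0 h1
  have h1' := abs_le.mp h1
  have e1 : ∫ τ : ℝ, ksub (ε + I * τ) = ∫ τ : ℝ, conj (ksub (ε + I * τ)) := by
    rw [← integral_neg_eq_self]
    congr 1; ext τ
    unfold ksub
    simp [map_ofNat]
  rw [integral_conj] at e1
  have e2 := Complex.conj_eq_iff_re.mp e1.symm
  rw [← e2]
  congr 1
  have := integral_re hi
  simp only [RCLike.re_eq_complex_re] at this
  rw [← this]
  simp_rw [ksub_re ε _ h0 (by linarith : ε - 2 < 0).ne (by linarith : 0 < ε + 2).ne']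
  have i1 := lor_int ε h0
  have i2 := (lor_int (ε-2) (by linarith : ε - 2 < 0).ne).const_mul (1/2)
  have i3 := (lor_int (ε+2) (by linarith : 0 < ε + 2).ne').const_mul (1/2)
  have e := integral_sub (i1.sub i2) i3
  simp only [Pi.sub_apply] at e
  rw [e, integral_sub i1 i2, integral_const_mul, integral_const_mul, lor_val (ε+2) blin]
  have : ∫ τ : ℝ, (ε-2)/((ε-2)^2+τ^2) = -π := by
    rw [← lor_val (2-ε) blin, ← integral_neg]
    congr 1; ext τ
    rw [show (2-ε)^2 = (ε-2)^2 by ring, ← neg_div]; congr 1; ring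
  rw [this]; ring

lemma pole_shift (n : ℂ → ℂ) (ε C : ℝ) (h0 : 0 < ε) (h1 : ε < 1)
    (hd : ∀ q : ℂ, ε - 1 ≤ q.re → q.re ≤ ε → DifferentiableAt ℂ n q)
    (hb : ∀ q : ℂ, ε - 1 ≤ q.re → q.re ≤ ε → 1 ≤ |q.im| → ‖n q / q‖ ≤ C / q.im^2) :
    ∫ τ : ℝ, n (ε + I * τ) / (ε + I * τ) = (∫ τ : ℝ, n (((ε - 1 : ℝ) : ℂ) + I * τ) / (((ε - 1 : ℝ) : ℂ) + I * τ)) +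
      2 * π * n 0 := by
  let m : ℂ → ℂ := fun q => n q + n 0 * (4 / (q^2 - 4))
  have hm0 : m 0 = 0 := by simp only [m]; norm_num
  have hq4 : ∀ q : ℂ, ε - 1 ≤ q.re → q.re ≤ ε → q^2 - 4 ≠ 0 := by
    intro q ha hb h
    have e : (q-2)*(q+2) = 0 := by linear_combination h
    rcases mul_eq_zero.mp e with h | h
    · have := congrArg re h; simp at this; linarith
    · have := congrArg re h; simp at this; linarith
  have hmd : ∀ q : ℂ, ε - 1 ≤ q.re → q.re ≤ ε → DifferentiableAt ℂ m q := fun q ha hb =>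
    (hd q ha hb).add ((differentiableAt_const _).mul ((differentiableAt_const _).div bfun (hq4 q ha hb)))
  have hds : ∀ q : ℂ, q ≠ 0 → dslope m 0 q = n q / q - n 0 * ksub q := by
    intro q hq
    rw [dslope_of_ne _ hq, slope_def_field, hm0]
    simp only [m, ksub, sub_zero]
    by_cases h4 : q^2 - 4 = 0
    · simp [h4]
    · field_simp; ring
  have := strip_shift (dslope m 0) (ε-1) ε (C + ‖n 0‖ * 4) blin ?_ ?_
  · have ne : ∀ a : ℝ, a ≠ 0 → ∀ τ : ℝ, (a + I * τ : ℂ) ≠ 0 := by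
      intro a ha τ h; have := congrArg re h; simp at this; exact ha this
    have n1 := ne (ε-1) (by linarith : ε - 1 < 0).ne
    have n2 := ne ε h0.ne'
    simp_rw [hds _ (n1 _), hds _ (n2 _)] at this
    have hi : ∀ a : ℝ, a ≠ 0 → ε - 1 ≤ a → a ≤ ε → Integrable (fun τ : ℝ => n (a + I*τ) / (a + I * τ)) := by
      intro a ha h2 h3
      refine line_int _ ?_ C ?_
      · refine Continuous.div₀ ?_ bfun (ne a ha)
        refine continuous_iff_continuousAt.mpr fun τ => ?_
        have := (hd (a + I * τ) (by simpa using h2) (by simpa using h3)).continuousAt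
        exact ContinuousAt.comp (f := fun τ : ℝ => (a + I * τ : ℂ)) this bfun
      · intro τ hτ
        simpa using hb (a + I * τ) (by simpa using h2) (by simpa using h3) (by simpa using hτ)
    have a1 : |ε - 1| ≤ 1 := abs_le.mpr ⟨by linarith, by linarith⟩
    have a2 : |ε| ≤ 1 := abs_le.mpr ⟨by linarith, by linarith⟩
    have b1 : ε - 1 ≠ 0 := (by linarith : ε - 1 < 0).ne
    rw [integral_sub (hi _ b1 le_rfl blin) ((ksub_integrable _ b1 a1).const_mul _),
      integral_sub (hi _ h0.ne' blin le_rfl) ((ksub_integrable _ h0.ne' a2).const_mul _),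
      integral_const_mul, integral_const_mul, ksub_val _ b1 a1, ksub_val _ h0.ne' a2, lor_val ε h0] at this
    have e5 : ∫ τ : ℝ, (ε-1)/((ε-1)^2+τ^2) = -π := by
      rw [← lor_val (1-ε) blin, ← integral_neg]
      congr 1; ext τ
      rw [show (1-ε)^2 = (ε-1)^2 by ring, ← neg_div]; congr 1; ring
    rw [e5] at this
    push_cast at this ⊢
    linear_combination -this
  · intro q ha hb
    by_cases hq : q = 0
    · have h0' : ∀ᶠ z in 𝓝 (0:ℂ), DifferentiableAt ℂ m z := by
        have : {z : ℂ | ε - 1 < z.re ∧ z.re < ε} ∈ 𝓝 (0:ℂ) := by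
          refine IsOpen.mem_nhds ?_ ⟨by simp; linarith, by simpa using h0⟩
          exact (isOpen_lt continuous_const continuous_re).inter
            (isOpen_lt continuous_re continuous_const)
        filter_upwards [this] with z hz
        exact hmd z hz.1.le hz.2.le
      obtain ⟨s, hs, hs'⟩ := h0'.exists_mem
      have : DifferentiableOn ℂ (dslope m 0) s :=
        (Complex.differentiableOn_dslope hs).mpr fun z hz => (hs' z hz).differentiableWithinAt
      rw [hq]; exact this.differentiableAt hs
    · exact (differentiableAt_dslope_of_ne hq).mpr (hmd q ha hb)
  · intro q ha hb' hτ
    have hq : q ≠ 0 := by rintro rfl; simp at hτ; linarith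
    rw [hds q hq, add_div]
    refine (norm_sub_le _ _).trans (add_le_add (hb q ha hb' hτ) ?_)
    rw [norm_mul, mul_div_assoc]
    exact mul_le_mul_of_nonneg_left (ksub_bound q (abs_le.mpr ⟨by linarith, by linarith⟩) hτ) nnn

lemma gr0 (u β : ℂ) (hu : 1 ≤ u.re) (hβ : 0 < β.re) :
    ‖Complex.Gamma u / Complex.Gamma (u+β)‖ ≤ (∫ x in Ioo zR 1, x^((1:ℝ)-1) * (1-x)^(β.re-1)) / ‖Complex.Gamma β‖ := by
  have hb := Gamma_ne_zero_of_re_pos hβ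
  have e := beta_integral (u := u) (v := β) blin hβ
  have : Complex.Gamma u / Complex.Gamma (u+β) = (∫ x in Ioo zR 1, xC^(u-1) * (1 - xC)^(β-1)) / Complex.Gamma β := by
    rw [e]; field_simp
  rw [this, norm_div]
  refine div_le_div_of_nonneg_right ?_ nnn
  refine norm_integral_le_of_norm_le (beta_integrable_real one_pos hβ) ?_
  filter_upwards [ae_restrict_mem measurableSet_Ioo] with x hx
  rw [norm_cpow_unit hx]
  refine mul_le_mul_of_nonneg_right ?_ (rpow_nonneg (by linarith [hx.2]) _)
  exact rpow_le_rpow_of_exponent_ge hx.1 hx.2.le blin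

lemma Gamma_zero_iff' (s : ℂ) (h : Complex.Gamma s ≠ 0) : ∀ m : ℕ, s ≠ -m := by
  intro m hm; exact h ((Complex.Gamma_eq_zero_iff s).2 ⟨m, hm⟩)

lemma poch_le_pow (u : ℂ) (m : ℕ) : ‖poch u m‖ ≤ (‖u‖ + m)^m := by
  have : ∀ j ≤ m, ‖poch u j‖ ≤ (‖u‖ + m)^j := by
    intro j
    induction j with
    | zero => simp [poch_zero]
    | succ j ih =>
      intro hj
      rw [poch_succ, norm_mul, pow_succ]
      refine mul_le_mul (ih bomega) ?_ nnn bpos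
      refine (norm_add_le _ _).trans ?_
      have : (j:ℝ) ≤ m := by exact_mod_cast (by omega : j ≤ m)
      simpa using this
  exact this m le_rfl

lemma gr1 (β : ℂ) : ∃ C : ℝ, 0 < C ∧ ∃ m : ℕ, ∀ u : ℂ, 1 ≤ u.re →
    ‖Complex.Gamma u / Complex.Gamma (u+β)‖ ≤ C * (1 + ‖u‖)^m := by
  obtain ⟨m, hm⟩ := exists_nat_gt (-β.re)
  have hβ : 0 < (β + m).re := by simp; linarith
  set B := (∫ x in Ioo zR 1, x^((1:ℝ)-1) * (1-x)^((β+m).re-1)) / ‖Complex.Gamma (β+m)‖ with hB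
  refine ⟨|B| * (1 + ‖β‖ + m)^m + 1, by positivity, m, fun u hu => ?_⟩
  by_cases h0 : Complex.Gamma (u+β) = 0
  · rw [h0]; simp; positivity
  have e := Gamma_add_nat (Gamma_zero_iff' _ h0) m
  have hne := poch_ne_zero (Gamma_zero_iff' _ h0) m
  have h1 := gr0 u (β+m) hu hβ
  have e2 : Complex.Gamma u / Complex.Gamma (u+β) = Complex.Gamma u / Complex.Gamma (u+(β+m)) * poch (u+β) m := by
    rw [show u + (β+m) = u + β + m by ring, e]; field_simp
  rw [e2, norm_mul]
  have h2 : ‖poch (u+β) m‖ ≤ ((1 + ‖β‖ + m) * (1 + ‖u‖))^m := by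
    refine (poch_le_pow _ _).trans (pow_le_pow_left₀ bpos ?_ _)
    have := norm_add_le u β
    nlinarith [norm_nonneg u, norm_nonneg β, mul_nonneg (norm_nonneg u) (norm_nonneg β), mul_nonneg (norm_nonneg u) (Nat.cast_nonneg (α := ℝ) m)]
  calc _ ≤ |B| * ((1 + ‖β‖ + m) * (1 + ‖u‖))^m :=
        mul_le_mul (h1.trans (le_abs_self _)) h2 nnn (abs_nonneg _)
    _ = |B| * (1 + ‖β‖ + m)^m * (1 + ‖u‖)^m := by rw [mul_pow]; ring
    _ ≤ _ := by nlinarith [pow_nonneg (by positivity : 0 ≤ 1 + ‖u‖) m]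

lemma gr2 (p β : ℂ) (N : ℕ) (hp : ∀ m : ℕ, p ≠ -m) :
    ‖Complex.Gamma p / Complex.Gamma (p+β)‖ ≤
      ‖Complex.Gamma (p+N) / Complex.Gamma (p+N+β)‖ * ‖poch (p+β) N / poch p N‖ := by
  by_cases h0 : Complex.Gamma (p+β) = 0
  · rw [h0]; simp; positivity
  rw [← norm_mul]
  have e := Gamma_add_nat (Gamma_zero_iff' _ h0) N
  have hne := poch_ne_zero (Gamma_zero_iff' _ h0) N
  have hne2 := poch_ne_zero hp N
  rw [show p + N + β = p + β + N by ring, e, Gamma_add_nat hp N]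
  refine le_of_eq (congrArg _ ?_)
  generalize Complex.Gamma (p+β) = A at *
  generalize poch (p+β) N = B at *
  generalize poch p N = C at *
  field_simp

lemma poch_ratio_step (p β : ℂ) (N : ℕ) (x : ℕ → ℝ)
    (hx : ∀ j < N, ‖β‖ / ‖p + j‖ ≤ x j) (h0 : ∀ j < N, p + j ≠ 0) :
    ‖poch (p+β) N / poch p N‖ ≤ ∏ j ∈ Finset.range N, (1 + x j) := by
  induction N with
  | zero => simp [poch_zero]
  | succ N ih =>
    rw [poch_succ, poch_succ, Finset.prod_range_succ, mul_div_mul_comm, norm_mul]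
    have h := h0 N bomega
    refine mul_le_mul (ih (fun j hj => hx j bomega) (fun j hj => h0 j bomega)) ?_ nnn ?_
    · rw [show (p + β + N) / (p + N) = 1 + β / (p+N) by field_simp; ring]
      refine (norm_add_le _ _).trans ?_
      rw [norm_one, norm_div]
      linarith [hx N bomega]
    · refine Finset.prod_nonneg fun j hj => ?_
      have := hx j (by have := Finset.mem_range.1 hj; omega)
      have : 0 ≤ ‖β‖ / ‖p + j‖ := by positivity
      linarith

/-- strip bound -/
lemma gr3 (β : ℂ) (A d : ℝ) (hd : 0 < d) : ∃ C : ℝ, 0 < C ∧ ∃ m : ℕ, ∀ p : ℂ, A ≤ p.re → (∀ j : ℕ, d ≤ ‖p + j‖) →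
    ‖Complex.Gamma p / Complex.Gamma (p+β)‖ ≤ C * (1 + ‖p‖)^m := by
  obtain ⟨C, hC, m, h⟩ := gr1 β
  obtain ⟨N, hN⟩ := exists_nat_gt (1 - A)
  refine ⟨C * (1 + N)^m * (1 + ‖β‖/d)^N, by positivity, m, fun p hp hj => ?_⟩
  have hne : ∀ j : ℕ, p + j ≠ 0 := fun j h0 => by have := hj j; rw [h0] at this; simp at this; linarith
  have h1 := gr2 p β N (fun j h0 => hne j (by rw [h0]; ring))
  have h2 := h (p+N) bsl
  have h3 := poch_ratio_step p β N (fun _ => ‖β‖/d)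
    (fun j _ => div_le_div_of_nonneg_left nnn hd (hj j)) (fun j _ => hne j)
  rw [Finset.prod_const, Finset.card_range] at h3
  have h4 : (1 + ‖p + N‖)^m ≤ ((1+N) * (1 + ‖p‖))^m := by
    refine pow_le_pow_left₀ bpos ?_ _
    have := norm_add_le p (N:ℂ)
    simp at this
    nlinarith [norm_nonneg p, mul_nonneg (norm_nonneg p) (Nat.cast_nonneg (α := ℝ) N)]
  rw [mul_pow] at h4
  calc _ ≤ _ := h1
    _ ≤ (C * ((1+N)^m * (1 + ‖p‖)^m)) * (1 + ‖β‖/d)^N :=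
      mul_le_mul (h2.trans (mul_le_mul_of_nonneg_left h4 hC.le)) h3 nnn bpos
    _ = _ := by ring

lemma prod_choose (M N : ℕ) : ∏ j ∈ Finset.range N, (1 + (M:ℝ)/jR) ≤ ((N:ℝ)+1)^M := by
  induction N with
  | zero => simp
  | succ N ih =>
    rw [Finset.prod_range_succ]
    have h1 : (1 + (M:ℝ)/((N:ℝ)+1)) ≤ (1 + 1/((N:ℝ)+1))^M := by
      have := one_add_mul_le_pow (a := 1/((N:ℝ)+1)) (by have : zR ≤ 1/((N:ℝ)+1) := by positivity
                                                        linarith) M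
      calc _ = 1 + (M:ℝ) * (1/((N:ℝ)+1)) := by ring
        _ ≤ _ := this
    calc _ ≤ ((N:ℝ)+1)^M * (1 + 1/((N:ℝ)+1))^M := mul_le_mul ih h1 bpos bpos
      _ = ((((N:ℝ)+1)) * (1 + 1/((N:ℝ)+1)))^M := by rw [mul_pow]
      _ = _ := by congr 1; push_cast; field_simp

/-- line bound uniform in N -/
lemma gr4 (β : ℂ) (ε : ℝ) (h0 : 0 < ε) (h1 : ε < 1) : ∃ C : ℝ, 0 < C ∧ ∃ m M : ℕ, ∀ (N : ℕ) (p : ℂ), p.re = ε - N →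
    ‖Complex.Gamma p / Complex.Gamma (p+β)‖ ≤ C * ((N:ℝ)+2)^M * (1 + ‖p‖)^m := by
  obtain ⟨C, hC, m, h⟩ := gr1 β
  obtain ⟨M, hM⟩ := exists_nat_gt (‖β‖/(1-ε))
  refine ⟨C * (1 + ‖β‖/ε), by positivity, m, m + M, fun N p hp => ?_⟩
  have hre : ∀ j : ℕ, (p + j).re = ε - N + j := fun j => by simp [hp]
  have hne : ∀ j : ℕ, p + j ≠ 0 := fun j h => by
    have h2 := hre j; rw [h] at h2; simp at h2
    rcases le_or_gt N j with hj | hj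
    · have : (N:ℝ) ≤ j := by exact_mod_cast hj
      linarith
    · have : (j:ℝ) + 1 ≤ N := by exact_mod_cast hj
      linarith
  have hp1 := gr2 p β (N+1) (fun j h0 => hne j (by rw [h0]; ring))
  have h2 := h (p+(N+1:ℕ)) (by rw [hre]; push_cast; linarith)
  have h3 := poch_ratio_step p β N (fun j => (M:ℝ)/(((N - 1 - j : ℕ):ℝ)+1)) (fun j hj => by
      have hc : ((N - 1 - j : ℕ):ℝ) = (N:ℝ) - 1 - j := by
        rw [Nat.cast_sub bomega, Nat.cast_sub bomega]; simp
      rw [hc]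
      have hjN : (j:ℝ) + 1 ≤ N := by exact_mod_cast hj
      have h5 : (1-ε) * ((N:ℝ) - 1 - j + 1) ≤ ‖p + j‖ := by
        refine le_trans ?_ (abs_re_le_norm _)
        rw [hre, abs_of_neg blin]
        nlinarith
      calc ‖β‖ / ‖p+j‖ ≤ ‖β‖ / ((1-ε) * ((N:ℝ) - 1 - j + 1)) :=
            div_le_div_of_nonneg_left nnn (by apply mul_pos <;> linarith) h5
        _ = ‖β‖/(1-ε)/((N:ℝ) - 1 - j + 1) := by rw [div_div]
        _ ≤ _ := div_le_div_of_nonneg_right hM.le blin) (fun j _ => hne j)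
  rw [Finset.prod_range_reflect (fun j => 1 + (M:ℝ)/jR) N] at h3
  have h3' := h3.trans (prod_choose M N)
  have h4 : ‖poch (p+β) (N+1) / poch p (N+1)‖ ≤ ((N:ℝ)+2)^M * (1 + ‖β‖/ε) := by
    rw [poch_succ, poch_succ, mul_div_mul_comm, norm_mul]
    have hh := hne N
    refine mul_le_mul (h3'.trans (pow_le_pow_left₀ bpos blin _)) ?_ nnn bpos
    rw [show (p + β + N) / (p + N) = 1 + β / (p+N) by field_simp; ring]
    refine (norm_add_le _ _).trans ?_
    rw [norm_one, norm_div]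
    gcongr
    refine le_trans ?_ (abs_re_le_norm _)
    rw [hre]; exact (by linarith : ε ≤ ε - N + N).trans (le_abs_self _)
  have h5 : (1 + ‖p + (N+1:ℕ)‖)^m ≤ (((N:ℝ)+2) * (1 + ‖p‖))^m := by
    refine pow_le_pow_left₀ bpos ?_ _
    have := norm_add_le p ((N+1:ℕ):ℂ)
    rw [Complex.norm_natCast] at this
    push_cast at this ⊢
    nlinarith [norm_nonneg p, mul_nonneg (norm_nonneg p) (Nat.cast_nonneg (α := ℝ) N)]
  calc _ ≤ _ := hp1
    _ ≤ (C * (((N:ℝ)+2) * (1 + ‖p‖))^m) * (((N:ℝ)+2)^M * (1 + ‖β‖/ε)) :=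
      mul_le_mul (h2.trans (mul_le_mul_of_nonneg_left h5 hC.le)) h4 nnn bpos
    _ = _ := by rw [mul_pow, pow_add]; ring

lemma norm_add_nat_ge (p : ℂ) (h : 1 ≤ |p.im|) (j : ℕ) : 1 ≤ ‖p + j‖ := by
  refine h.trans ?_
  have := abs_im_le_norm (p + j)
  simpa using this

lemma poch_sub_nat (n : ℕ) : poch (-nC) n = (-1)^n * (n.factorial : ℂ) := by
  have : ∀ j ≤ n, poch (-nC) j * ((n-j).factorial : ℂ) = (-1)^j * (n.factorial : ℂ) := by
    intro j
    induction j with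
    | zero => simp [poch_zero]
    | succ j ih =>
      intro hj
      rw [poch_succ, pow_succ, mul_right_comm, mul_neg_one, neg_mul, ← ih bomega]
      have : n - j = (n - (j+1)) + 1 := by omega
      rw [this, Nat.factorial_succ]
      push_cast [← this, Nat.cast_sub (by omega : j ≤ n), Nat.cast_sub hj]
      ring
  have := this n le_rfl
  simpa using this

/-- contour shift to the left, collecting the residues of Gamma -/
lemma contour_sum (G : ℂ → ℂ) (β : ℂ) (k u₀ : ℝ) (hk : 0 < k) (hu : u₀ < 0)
    (hd : ∀ p : ℂ, p.re ≤ k → DifferentiableAt ℂ G p)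
    (hG : ∀ j : ℕ, ∃ C : ℝ, ∀ p : ℂ, p.re ≤ k → ‖G p‖ * (1 + ‖p‖)^j ≤ C * exp (u₀ * (k - p.re))) :
    Tendsto (fun N : ℕ => ∑ n ∈ Finset.range N, 2 * π * ((-1)^n / (n.factorial : ℂ) *
      (G (-n) / Complex.Gamma (-n + β)))) atTop
      (𝓝 (∫ τ : ℝ, Complex.Gamma (k + I*τ) / Complex.Gamma (k + I*τ + β) * G (k + I * τ))) := by
  set ε : ℝ := min k (1/2) with hε
  have e0 : 0 < ε := lt_min hk bnum
  have e1 : ε < 1 := lt_of_le_of_lt (min_le_right _ _) bnum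
  have ek : ε ≤ k := min_le_left _ _
  set g : ℂ → ℂ := fun p => Complex.Gamma p / Complex.Gamma (p + β) * G p with hg
  have hexp : ∀ p : ℂ, p.re ≤ k → exp (u₀ * (k - p.re)) ≤ 1 := fun p hp =>
    exp_le_one_iff.2 (mul_nonpos_of_nonpos_of_nonneg hu.le blin)
  have him : ∀ p : ℂ, p.im^2 ≤ (1 + ‖p‖)^2 := fun p => by
    rw [← sq_abs]
    exact pow_le_pow_left₀ (abs_nonneg _) (by linarith [abs_im_le_norm p]) _
  -- strip bound
  have hstrip : ∀ A d : ℝ, 0 < d → ∃ C : ℝ, ∀ p : ℂ, A ≤ p.re → p.re ≤ k → (∀ j : ℕ, d ≤ ‖p + j‖) →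
      ‖g p‖ * p.im^2 ≤ C := by
    intro A d hd'
    obtain ⟨C, hC, m, h⟩ := gr3 β A d hd'
    obtain ⟨C', h'⟩ := hG (m+2)
    refine ⟨C * C', fun p h1 h2 h3 => ?_⟩
    have hC' : 0 ≤ C' := by
      have := h' p h2
      have h4 : 0 ≤ C' * exp (u₀ * (k - p.re)) := le_trans bpos this
      exact nonneg_of_mul_nonneg_left h4 (exp_pos _)
    have h4 : ‖G p‖ * (1 + ‖p‖)^(m+2) ≤ C' := (h' p h2).trans (by nlinarith [hexp p h2])
    calc ‖g p‖ * p.im^2 = ‖Complex.Gamma p / Complex.Gamma (p+β)‖ * ‖G p‖ * p.im^2 := by rw [hg]; simp only [norm_mul]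
      _ ≤ (C * (1 + ‖p‖)^m) * ‖G p‖ * (1 + ‖p‖)^2 := by
        refine mul_le_mul (mul_le_mul_of_nonneg_right (h p h1 h3) nnn) (him p) (sq_nonneg _) bpos
      _ = C * (‖G p‖ * (1 + ‖p‖)^(m+2)) := by rw [pow_add]; ring
      _ ≤ _ := mul_le_mul_of_nonneg_left h4 hC.le
  have hdG : ∀ p : ℂ, DifferentiableAt ℂ (fun p : ℂ => (Complex.Gamma (p + β))⁻¹) p := fun p =>
    DifferentiableAt.comp (g := fun s : ℂ => (Complex.Gamma s)⁻¹) (f := fun p : ℂ => p + β) p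
      (differentiable_one_div_Gamma (p + β)) bfun
  -- first strip
  have step0 : ∫ τ : ℝ, g (ε + I * τ) = ∫ τ : ℝ, g (k + I * τ) := by
    obtain ⟨C, hC⟩ := hstrip ε ε e0
    refine strip_shift g ε k C ek (fun p h1 h2 => ?_) (fun p h1 h2 h3 => ?_)
    · have := (differentiableAt_Gamma p (ne_neg_nat_of_re_pos blin)).mul (hdG p)
      exact (this.mul (hd p h2))
    · rw [le_div_iff₀ (by rw [← sq_abs]; nlinarith)]
      refine hC p h1 h2 fun j => ?_
      refine le_trans ?_ (re_le_norm _)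
      simp; have : zR ≤ j := by positivity
      linarith
  -- successive strips
  have step : ∀ n : ℕ, ∫ τ : ℝ, g (((ε - n : ℝ) : ℂ) + I * τ) = (∫ τ : ℝ, g (((ε - (n+1:ℕ) : ℝ) : ℂ) + I * τ)) +
      2 * π * ((-1)^n / (n.factorial : ℂ) * (G (-n) / Complex.Gamma (-n + β))) := by
    intro n
    set nn : ℂ → ℂ := fun q => Complex.Gamma (q + 1) / poch (q - n) n * (Complex.Gamma (q - n + β))⁻¹ * G (q - n) with hnn
    have key : ∀ q : ℂ, (∀ m : ℕ, q - n ≠ -m) → nn q / q = g (q - n) := by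
      intro q hq
      have hq0 : q ≠ 0 := fun h => hq n (by rw [h]; ring)
      have := Gamma_add_nat hq (n+1)
      rw [poch_succ] at this
      have hp := poch_ne_zero hq n
      simp only [hnn, hg]
      rw [show q + 1 = q - n + (n+1:ℕ) by push_cast; ring, this]
      generalize poch (q-n) n = A at *
      generalize Complex.Gamma (q-n) = B at *
      generalize Complex.Gamma (q-n+β) = D at *
      rw [show q - n + n = q by ring]
      field_simp
    obtain ⟨C, hC⟩ := hstrip (ε - 1 - n) 1 one_pos
    have hps := pole_shift nn ε C e0 e1 (fun q h1 h2 => ?_) (fun q h1 h2 h3 => ?_)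
    · have k1 : ∀ τ : ℝ, nn (ε + I * τ) / (ε + I * τ) = g (((ε - n : ℝ) : ℂ) + I * τ) := by
        intro τ
        rw [key]
        · congr 1; push_cast; ring
        · intro m hm
          have h2 := congrArg re hm
          simp at h2
          rcases le_or_gt n m with hj | hj
          · have : (n:ℝ) ≤ m := by exact_mod_cast hj
            linarith
          · have : (m:ℝ) + 1 ≤ n := by exact_mod_cast hj
            linarith
      have k2 : ∀ τ : ℝ, nn (((ε - 1 : ℝ) : ℂ) + I * τ) / (((ε - 1 : ℝ) : ℂ) + I * τ) = g (((ε - (n+1:ℕ) : ℝ) : ℂ) + I * τ) := by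
        intro τ
        rw [key]
        · congr 1; push_cast; ring
        · intro m hm
          have h2 := congrArg re hm
          simp at h2
          rcases le_or_gt (n+1) m with hj | hj
          · have : (n:ℝ) + 1 ≤ m := by exact_mod_cast hj
            linarith
          · have : (m:ℝ) + 1 ≤ n + 1 := by exact_mod_cast hj
            linarith
      simp_rw [k1, k2] at hps
      rw [hps]
      congr 2
      simp only [hnn, zero_add, Complex.Gamma_one, zero_sub]
      rw [poch_sub_nat]
      have : ((-1:ℂ)^n)⁻¹ = (-1)^n := by
        rw [← inv_pow]; norm_num
      rw [one_div, mul_inv, this]; ring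
    · have a1 := (differentiableAt_Gamma (q+1) (ne_neg_nat_of_re_pos bsl)).comp q
        (by fun_prop : DifferentiableAt ℂ (fun p : ℂ => p + 1) q)
      have a2 : DifferentiableAt ℂ (fun q : ℂ => poch (q - n) n) q := by
        have : ∀ m : ℕ, DifferentiableAt ℂ (fun q : ℂ => poch (q - n) m) q := by
          intro m
          induction m with
          | zero => simp [poch_zero]
          | succ m ih => simp only [poch_succ]; exact ih.mul bfun
        exact this n
      have a3 : poch (q - n) n ≠ 0 := by
        have : ∀ m ≤ n, poch (q - n) m ≠ 0 := by
          intro m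
          induction m with
          | zero => simp [poch_zero]
          | succ m ih =>
            intro hm
            rw [poch_succ]
            refine mul_ne_zero (ih bomega) fun h => ?_
            have h2 := congrArg re h
            simp at h2
            have : (m:ℝ) + 1 ≤ n := by exact_mod_cast hm
            linarith
        exact this n le_rfl
      have hs : DifferentiableAt ℂ (fun q : ℂ => q - n) q := by fun_prop
      have a4 := DifferentiableAt.comp q (hdG (q - n)) hs
      have a5 := DifferentiableAt.comp q (hd (q - n) (by simp; have : zR ≤ n := by positivity
                                                         linarith)) hs
      exact ((a1.div a2 a3).mul a4).mul a5
    · rw [key q]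
      · rw [le_div_iff₀ (by rw [← sq_abs]; nlinarith)]
        have := hC (q - n) bsl (by simp; have : zR ≤ n := by positivity
                                   linarith) (norm_add_nat_ge _ (by simpa using h3))
        simpa using this
      · refine ne_neg_nat_of_im_ne ?_
        simp; intro h; rw [h] at h3; simp at h3; linarith
  have hsum : ∀ N : ℕ, ∑ n ∈ Finset.range N, 2 * π * ((-1)^n / (n.factorial : ℂ) * (G (-n) / Complex.Gamma (-n + β)))
      = (∫ τ : ℝ, g (k + I * τ)) - ∫ τ : ℝ, g (((ε - N : ℝ) : ℂ) + I * τ) := by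
    intro N
    induction N with
    | zero => rw [← step0]; simp
    | succ N ih => rw [Finset.sum_range_succ, ih, step N]; ring
  simp_rw [hsum]
  have hrem : Tendsto (fun N : ℕ => ∫ τ : ℝ, g (((ε - N : ℝ) : ℂ) + I * τ)) atTop (𝓝 0) := by
    obtain ⟨C, hC, m, M, h⟩ := gr4 β ε e0 e1
    obtain ⟨C', h'⟩ := hG (m+2)
    have hb : ∀ N : ℕ, ‖∫ τ : ℝ, g (((ε - N : ℝ) : ℂ) + I * τ)‖ ≤ C * C' * π * (((N:ℝ)+2)^M * exp (u₀ * (N:ℝ))) := by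
      intro N
      have hi : ∫ τ : ℝ, (1 + τ^2)⁻¹ * (C * C' * (((N:ℝ)+2)^M * exp (u₀ * (N:ℝ)))) =
          C * C' * π * (((N:ℝ)+2)^M * exp (u₀ * (N:ℝ))) := by
        rw [integral_mul_const, integral_univ_inv_one_add_sq]; ring
      rw [← hi]
      refine norm_integral_le_of_norm_le (int_inv_sq.mul_const _) (ae_of_all _ fun τ => ?_)
      set p : ℂ := ((ε - N : ℝ) : ℂ) + I * τ with hp
      have hre : p.re = ε - N := by simp [hp]
      have hpi : p.im = τ := by simp [hp]
      have hN0 : zR ≤ N := by positivity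
      have hpk : p.re ≤ k := by rw [hre]; linarith
      have hp' := h' p hpk
      have hC' : 0 ≤ C' := nonneg_of_mul_nonneg_left (le_trans bpos hp') (exp_pos _)
      have hE : exp (u₀ * (k - p.re)) ≤ exp (u₀ * N) := by
        refine exp_le_exp.2 ?_
        rw [hre]; nlinarith
      have ht : 1 + τ^2 ≤ (1 + ‖p‖)^2 := by
        have := abs_im_le_norm p
        rw [hpi] at this
        rw [← sq_abs]; nlinarith [abs_nonneg τ]
      have h6 := h N p hre
      rw [inv_mul_eq_div, le_div_iff₀ bpos]
      calc ‖g p‖ * (1 + τ^2) = ‖Complex.Gamma p / Complex.Gamma (p+β)‖ * ‖G p‖ * (1 + τ^2) := by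
            rw [hg]; simp only [norm_mul]
        _ ≤ (C * ((N:ℝ)+2)^M * (1 + ‖p‖)^m) * ‖G p‖ * (1 + ‖p‖)^2 := by
          refine mul_le_mul (mul_le_mul_of_nonneg_right h6 nnn) ht bpos bpos
        _ = C * ((N:ℝ)+2)^M * (‖G p‖ * (1 + ‖p‖)^(m+2)) := by rw [pow_add]; ring
        _ ≤ C * ((N:ℝ)+2)^M * (C' * exp (u₀ * N)) := by
          refine mul_le_mul_of_nonneg_left (hp'.trans (mul_le_mul_of_nonneg_left hE hC')) bpos
        _ = _ := by ring
    refine squeeze_zero_norm hb ?_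
    rw [show zR = C * C' * π * 0 by ring]
    refine Tendsto.const_mul _ ?_
    have h1 := (tendsto_pow_const_mul_const_pow_of_abs_lt_one M (r := exp u₀)
      (by rw [abs_of_pos (exp_pos _)]; simpa using hu)).comp (tendsto_add_atTop_nat 2)
    have h2 := h1.mul_const (exp (-(u₀*2)))
    rw [zero_mul] at h2
    refine h2.congr fun N => ?_
    simp only [Function.comp_apply]
    rw [mul_assoc, ← Real.exp_nat_mul, ← exp_add]
    push_cast
    congr 2; ring
  have := (tendsto_const_nhds (x := ∫ τ : ℝ, g (k + I * τ))).sub hrem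
  rwa [sub_zero] at this

lemma lap_bound (ℓ x δ σ₁ σ₂ : ℝ) (hδ : 0 < δ) (h1 : δ ≤ x - σ₁) (h2 : δ ≤ σ₂ - x) :
    |ℓ| * exp (x * ℓ) ≤ 1/δ * (exp (σ₁ * ℓ) + exp (σ₂ * ℓ)) := by
  rw [one_div, inv_mul_eq_div, le_div_iff₀ hδ]
  have key : ∀ y : ℝ, 0 ≤ y → y * δ ≤ exp (δ * y) := fun y hy => by
    have := add_one_le_exp (δ * y); linarith
  rcases le_total 0 ℓ with h | h
  · rw [abs_of_nonneg h]
    calc ℓ * exp (x*ℓ) * δ = (ℓ * δ) * exp (x*ℓ) := by ring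
      _ ≤ exp (δ * ℓ) * exp (x*ℓ) := mul_le_mul_of_nonneg_right (key ℓ h) (exp_pos _).le
      _ = exp (δ*ℓ + x*ℓ) := (exp_add _ _).symm
      _ ≤ exp (σ₂ * ℓ) := exp_le_exp.2 (by nlinarith)
      _ ≤ _ := by linarith [exp_pos (σ₁ * ℓ)]
  · rw [abs_of_nonpos h]
    calc -ℓ * exp (x*ℓ) * δ = (-ℓ * δ) * exp (x*ℓ) := by ring
      _ ≤ exp (δ * -ℓ) * exp (x*ℓ) := mul_le_mul_of_nonneg_right (key (-ℓ) blin) (exp_pos _).le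
      _ = exp (δ*(-ℓ) + x*ℓ) := (exp_add _ _).symm
      _ ≤ exp (σ₁ * ℓ) := exp_le_exp.2 (by nlinarith)
      _ ≤ _ := by linarith [exp_pos (σ₂ * ℓ)]

lemma laplace_diff (μ : Measure ℝ) (ℓ : ℝ → ℝ) (w : ℝ → ℂ) (hℓ : Measurable ℓ) (hw : AEStronglyMeasurable w μ)
    (σ₁ σ₂ : ℝ) (i1 : Integrable (fun y => cexp (σ₁ * ℓ y) * w y) μ)
    (i2 : Integrable (fun y => cexp (σ₂ * ℓ y) * w y) μ) (z : ℂ) (h1 : σ₁ < z.re) (h2 : z.re < σ₂) :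
    DifferentiableAt ℂ (fun z : ℂ => ∫ y, cexp (z * ℓ y) * w y ∂μ) z := by
  set δ := min (z.re - σ₁) (σ₂ - z.re) / 2 with hδ
  have hδ0 : 0 < δ := by rw [hδ]; have := lt_min (sub_pos.2 h1) (sub_pos.2 h2); linarith
  have hδ1 : δ + δ ≤ z.re - σ₁ := by rw [hδ]; linarith [min_le_left (z.re - σ₁) (σ₂ - z.re)]
  have hδ2 : δ + δ ≤ σ₂ - z.re := by rw [hδ]; linarith [min_le_right (z.re - σ₁) (σ₂ - z.re)]
  have mm : ∀ z : ℂ, AEStronglyMeasurable (fun y => cexp (z * ℓ y)) μ := fun z => by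
    refine Measurable.aestronglyMeasurable ?_
    fun_prop
  have nn : ∀ (z : ℂ) (y : ℝ), ‖cexp (z * ℓ y)‖ = exp (z.re * ℓ y) := fun z y => by
    rw [norm_exp]; simp
  refine (hasDerivAt_integral_of_dominated_loc_of_deriv_le (μ := μ) (𝕜 := ℂ)
    (F := fun z y => cexp (z * ℓ y) * w y) (F' := fun z y => (ℓ y * cexp (z * ℓ y)) * w y)
    (x₀ := z) (s := Metric.ball z δ)
    (bound := fun y => 1/δ * (‖cexp (σ₁ * ℓ y) * w y‖ + ‖cexp (σ₂ * ℓ y) * w y‖))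
    (Metric.ball_mem_nhds z hδ0) ?_ ?_ ?_ ?_ ?_ ?_).2.differentiableAt
  · exact Eventually.of_forall fun z => (mm z).mul hw
  · refine (i1.norm.add i2.norm).mono' ((mm z).mul hw) (ae_of_all _ fun y => ?_)
    simp only [Pi.add_apply, norm_mul, nn, ofReal_re]
    rw [← add_mul]
    refine mul_le_mul_of_nonneg_right ?_ nnn
    rcases le_total 0 (ℓ y) with h | h
    · have : exp (z.re * ℓ y) ≤ exp (σ₂ * ℓ y) := exp_le_exp.2 (by nlinarith)
      linarith [exp_pos (σ₁ * ℓ y)]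
    · have : exp (z.re * ℓ y) ≤ exp (σ₁ * ℓ y) := exp_le_exp.2 (by nlinarith)
      linarith [exp_pos (σ₂ * ℓ y)]
  · refine (AEStronglyMeasurable.mul ?_ (mm z)).mul hw
    refine Measurable.aestronglyMeasurable ?_
    fun_prop
  · refine ae_of_all _ fun y z' hz' => ?_
    have hz : |z'.re - z.re| < δ := by
      have := abs_re_le_norm (z' - z)
      rw [Metric.mem_ball, dist_eq_norm] at hz'
      simp at this; linarith
    rw [abs_lt] at hz
    simp only [norm_mul, nn, ofReal_re, norm_real, norm_eq_abs]
    rw [← add_mul, ← mul_assoc]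
    exact mul_le_mul_of_nonneg_right (lap_bound _ _ δ _ _ hδ0 blin blin) nnn
  · exact (i1.norm.add i2.norm).const_mul _
  · refine ae_of_all _ fun y z' _ => ?_
    refine HasDerivAt.mul_const ?_ _
    have := ((hasDerivAt_id z').mul_const (ℓ y : ℂ)).cexp
    exact this.congr_deriv (by simp; ring)

lemma rr_meas : Measurable rr := by unfold rr; fun_prop

lemma mv_diff (t : ℝ) (P : ℂ) (hP : 0 < P.re) (v : ℝ → ℂ) (C : ℝ)
    (hv : AEStronglyMeasurable v (volume.restrict (Ioi 0))) (hb : ∀ y > 0, ‖v y‖ ≤ C) :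
    DifferentiableAt ℂ (mv t v) P := by
  set w : ℝ → ℂ := fun y => cexp (-(1:ℂ) * (Real.log (rr y) : ℝ)) * cexp (-(1/2 + I * t) * y) * v y with hw
  have e : ∀ (Q : ℂ) (y : ℝ), y ∈ Ioi zR → cexp (Q * (Real.log (rr y) : ℝ)) * w y = kr t Q y * v y := by
    intro Q y hy
    have h0 : (rr y : ℂ) ≠ 0 := by exact_mod_cast (rr_pos hy).ne'
    rw [hw, kr, cpow_def_of_ne_zero h0, ← ofReal_log (rr_pos hy).le]
    rw [show ((Real.log (rr y) : ℝ) : ℂ) * (Q - 1) = Q * (Real.log (rr y) : ℝ) + -(1:ℂ) * (Real.log (rr y) : ℝ) by ring,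
      Complex.exp_add]
    ring
  have hm : mv t v = fun Q => ∫ y in Ioi zR, cexp (Q * (Real.log (rr y) : ℝ)) * w y := by
    ext Q
    exact (setIntegral_congr_fun measurableSet_Ioi (e Q)).symm
  have hi : ∀ Q : ℂ, 0 < Q.re → IntegrableOn (fun y => cexp (Q * (Real.log (rr y) : ℝ)) * w y) (Ioi 0) := by
    intro Q hQ
    exact (mv_int t Q hQ v C hv hb).congr_fun (fun y hy => (e Q y hy).symm) measurableSet_Ioi
  rw [hm]
  refine laplace_diff (volume.restrict (Ioi 0)) (fun y => Real.log (rr y)) w (measurable_log.comp rr_meas) ?_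
    (P.re/2) (P.re+1) (hi ((P.re/2 : ℝ) : ℂ) (by simpa using hP)) (hi ((P.re+1 : ℝ):ℂ) bsl) P blin blin
  refine AEStronglyMeasurable.mul (Measurable.aestronglyMeasurable ?_) hv
  have := measurable_log.comp rr_meas
  simp only [Function.comp_def] at this
  fun_prop

/-- bilateral Laplace transform -/
def eh (η : ℝ → ℂ) (z : ℂ) : ℂ := ∫ u : ℝ, cexp (z * u) * η u

lemma eh_int (η : ℝ → ℂ) (h1 : Continuous η) (h2 : HasCompactSupport η) (z : ℂ) :
    Integrable (fun u : ℝ => cexp (z * u) * η u) :=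
  Continuous.integrable_of_hasCompactSupport bfun h2.mul_left

lemma eh_diff (η : ℝ → ℂ) (h1 : Continuous η) (h2 : HasCompactSupport η) (z : ℂ) : DifferentiableAt ℂ (eh η) z :=
  laplace_diff volume (fun u => u) η measurable_id h1.aestronglyMeasurable (z.re - 1) (z.re + 1)
    (eh_int η h1 h2 _) (eh_int η h1 h2 _) z blin blin

lemma eh_bound (u₀ : ℝ) (j : ℕ) : ∀ (η : ℝ → ℂ), ContDiff ℝ ((⊤ : ℕ∞) : WithTop ℕ∞) η → HasCompactSupport η →
    tsupport η ⊆ Iic u₀ → ∃ C : ℝ, 0 ≤ C ∧ ∀ z : ℂ, 0 ≤ z.re → ‖eh η z‖ * ‖z‖^j ≤ C * exp (u₀ * z.re) := by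
  induction j with
  | zero =>
    intro η h1 h2 h3
    have hi : Integrable (fun u => ‖η u‖) := (h1.continuous.integrable_of_hasCompactSupport h2).norm
    refine ⟨∫ u, ‖η u‖, integral_nonneg fun _ => norm_nonneg _, fun z hz => ?_⟩
    rw [pow_zero, mul_one, ← integral_mul_const]
    refine norm_integral_le_of_norm_le (hi.mul_const _) (ae_of_all _ fun u => ?_)
    rw [norm_mul, mul_comm]
    by_cases hu : η u = 0
    · simp [hu]
    · refine mul_le_mul_of_nonneg_left ?_ nnn
      have : u ≤ u₀ := h3 (subset_tsupport _ hu)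
      rw [norm_exp]
      refine exp_le_exp.2 ?_
      simp; nlinarith
  | succ j ih =>
    intro η h1 h2 h3
    have hd : Differentiable ℝ η := h1.differentiable bsimp
    obtain ⟨C, hC, h⟩ := ih (deriv η) (contDiff_infty_iff_deriv.1 h1).2 h2.deriv
      (closure_minimal (support_deriv_subset.trans h3) isClosed_Iic)
    refine ⟨C, hC, fun z hz => ?_⟩
    have hc : Continuous (deriv η) := h1.continuous_deriv bsimp
    have e : eh (deriv η) z = -(z * eh η z) := by
      have := integral_mul_deriv_eq_deriv_mul_of_integrable (u := fun u : ℝ => cexp (z * u)) (v := η)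
        (u' := fun u : ℝ => z * cexp (z * u)) (v' := deriv η) (fun u _ => ?_) (fun u _ => (hd u).hasDerivAt)
        (eh_int _ hc h2.deriv z) ?_ (eh_int η h1.continuous h2 z)
      · unfold eh
        rw [this]
        simp_rw [mul_assoc]
        rw [integral_const_mul]
      · have := ((ofRealCLM.hasDerivAt (x := u)).const_mul z).cexp
        refine this.congr_deriv ?_
        simp; ring
      · have := (eh_int η h1.continuous h2 z).const_mul z
        refine this.congr (ae_of_all _ fun u => ?_)
        simp [mul_assoc]
    have := h z hz
    rw [e, norm_neg, norm_mul] at this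
    calc _ = ‖z‖ * ‖eh η z‖ * ‖z‖^j := by rw [pow_succ]; ring
      _ ≤ _ := this

lemma vdm_poch (x y : ℂ) (l : ℕ) : ∑ i ∈ Finset.range (l+1), poch x (l-i) / ((l-i).factorial : ℂ) *
    (poch y i / (i.factorial : ℂ)) = poch (x+y) l / (l.factorial : ℂ) := by
  have hA : ∀ (x : ℂ) (i : ℕ), ((i:ℂ)+1) * (poch x (i+1) / ((i+1).factorial : ℂ)) = (x + i) * (poch x i / (i.factorial : ℂ)) := by
    intro x i
    have h1 := fact_ne i
    rw [poch_succ, Nat.factorial_succ]; push_cast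
    have : (i:ℂ) + 1 ≠ 0 := by exact_mod_cast Nat.succ_ne_zero i
    field_simp
  have main : ∀ l : ℕ, ∑ p ∈ Finset.HasAntidiagonal.antidiagonal l, poch x p.2 / (p.2.factorial : ℂ) *
      (poch y p.1 / (p.1.factorial : ℂ)) = poch (x+y) l / (l.factorial : ℂ) := by
    intro l
    induction l with
    | zero => simp [poch_zero]
    | succ l ih =>
      have hl : (l:ℂ) + 1 ≠ 0 := by exact_mod_cast Nat.succ_ne_zero l
      apply mul_left_cancel₀ hl
      rw [hA, ← ih, Finset.mul_sum, Finset.mul_sum]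
      have e : ∀ p ∈ Finset.HasAntidiagonal.antidiagonal (l+1), ((l:ℂ)+1) * (poch x p.2 / (p.2.factorial : ℂ) *
          (poch y p.1 / (p.1.factorial : ℂ))) = (p.2 : ℂ) * (poch x p.2 / (p.2.factorial : ℂ)) * (poch y p.1 / (p.1.factorial : ℂ))
          + poch x p.2 / (p.2.factorial : ℂ) * ((p.1:ℂ) * (poch y p.1 / (p.1.factorial : ℂ))) := by
        intro p hp
        have := Finset.HasAntidiagonal.mem_antidiagonal.1 hp
        have : (p.1:ℂ) + p.2 = l + 1 := by exact_mod_cast this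
        rw [← this]; ring
      rw [Finset.sum_congr rfl e, Finset.sum_add_distrib, Finset.Nat.sum_antidiagonal_succ', Finset.Nat.sum_antidiagonal_succ]
      simp only [Nat.cast_zero, zero_mul, mul_zero, zero_add, add_zero]
      rw [← Finset.sum_add_distrib]
      refine Finset.sum_congr rfl fun p hp => ?_
      have := Finset.HasAntidiagonal.mem_antidiagonal.1 hp
      have : (p.1:ℂ) + p.2 = l := by exact_mod_cast this
      push_cast
      rw [hA, hA, ← this]; ring
  rw [← main, Finset.Nat.sum_antidiagonal_eq_sum_range_succ_mk]

lemma hc_conv (A B C : ℂ) (hC : ∀ m : ℕ, C ≠ -m) (n : ℕ) :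
    ∑ k ∈ Finset.range (n+1), hc A (C-B) C k * (-1)^k * (poch (A + k) (n-k) / ((n-k).factorial : ℂ)) = hc A B C n := by
  have cv := chu_vandermonde n (C - B) C hC
  rw [sub_sub_cancel] at cv
  have : hc A B C n = poch A n / n.factorial * (poch B n / poch C n) := by rw [hc]; ring
  rw [this, ← cv, Finset.mul_sum]
  refine Finset.sum_congr rfl fun k hk => ?_
  have hk' : k ≤ n := Nat.lt_succ_iff.1 (Finset.mem_range.1 hk)
  simp only [hc]
  have e1 : poch A n = poch A k * poch (A + k) (n-k) := by rw [← poch_add, Nat.add_sub_cancel' hk']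
  have e2 : (n.choose k : ℂ) = n.factorial / (k.factorial * (n-k).factorial) :=
    Nat.cast_choose ℂ hk'
  rw [e1, e2]
  have := fact_ne n
  have := fact_ne k
  have := fact_ne (n-k)
  have := poch_ne_zero hC k
  field_simp

/-- Cauchy product coefficients -/
def gc (a b t ρ : ℝ) (n : ℕ) : ℂ := ∑ k ∈ Finset.range (n+1),
  poch (1/2 + I*t + I*ρ) (n-k) / ((n-k).factorial : ℂ) * pj a b ρ k

lemma poch_neg_nat (n j : ℕ) (hj : j ≤ n) : poch (-nC) j = (-1)^j * (n.factorial : ℂ) / ((n-j).factorial : ℂ) := by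
  have : ∀ j ≤ n, poch (-nC) j * ((n-j).factorial : ℂ) = (-1)^j * (n.factorial : ℂ) := by
    intro j
    induction j with
    | zero => simp [poch_zero]
    | succ j ih =>
      intro hj
      rw [poch_succ, pow_succ, mul_right_comm, mul_neg_one, neg_mul, ← ih bomega]
      have : n - j = (n - (j+1)) + 1 := by omega
      rw [this, Nat.factorial_succ]
      push_cast [← this, Nat.cast_sub (by omega : j ≤ n), Nat.cast_sub hj]
      ring
  rw [← this j hj, mul_div_cancel_right₀ _ (fact_ne _)]

lemma gc_eq (a b t ρ : ℝ) (hab : 0 < a + b) (ha : 0 < a) (n : ℕ) :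
    gc a b t ρ n = poch (a + 1/2 + I*t) n / (n.factorial : ℂ) *
      F32 (-nC) (a + I*ρ) (a - I*ρ) ((a:ℂ)+b) (a + 1/2 + I*t) 1 := by
  have hC := ab_ne a b hab
  have hc' : ∀ m : ℕ, (a + 1/2 + I*t : ℂ) ≠ -m := ne_neg_nat_of_re_pos bsl
  have hpj : ∀ k, pj a b ρ k = ∑ j ∈ Finset.range (k+1), hc (a - I*ρ) (a + I*ρ) ((a:ℂ)+b) j * (-1)^j *
      (poch (a - I*ρ + j) (k-j) / ((k-j).factorial : ℂ)) := by
    intro k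
    have := hc_conv (a - I*ρ) (b - I*ρ) ((a:ℂ)+b) hC k
    rw [show ((a:ℂ)+b) - (b - I*ρ) = a + I*ρ by ring] at this
    rw [this, pj]
  unfold gc
  simp_rw [hpj, Finset.mul_sum]
  rw [Finset.sum_comm' (t' := Finset.range (n+1)) (s' := fun j => Finset.Ico j (n+1)) (by
    intro k j; simp only [Finset.mem_range, Finset.mem_Ico]; omega)]
  have hF : F32 (-nC) (a + I*ρ) (a - I*ρ) ((a:ℂ)+b) (a + 1/2 + I*t) 1 =
      ∑ j ∈ Finset.range (n+1), poch (-nC) j * hc (a - I*ρ) (a + I*ρ) ((a:ℂ)+b) j / poch (a + 1/2 + I*t) j := by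
    unfold F32 pFq
    rw [tsum_eq_sum (s := Finset.range (n+1))]
    · refine Finset.sum_congr rfl fun j _ => ?_
      simp only [List.map, List.prod_cons, List.prod_nil, hc]
      rw [one_pow]
      have := fact_ne j
      have := poch_ne_zero hC j
      have := poch_ne_zero hc' j
      generalize poch (a + 1/2 + I*t : ℂ) j = A at *
      generalize poch ((a:ℂ)+b) j = B at *
      field_simp
    · intro j hj
      have h0 : poch (-nC) j = 0 := poch_zero_of_neg rfl (by simpa using hj)
      simp [h0]
  rw [hF, Finset.mul_sum]
  refine Finset.sum_congr rfl fun j hj => ?_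
  have hj' : j ≤ n := Nat.lt_succ_iff.1 (Finset.mem_range.1 hj)
  rw [Finset.sum_Ico_eq_sum_range, show n + 1 - j = (n - j) + 1 by omega]
  have v := vdm_poch (1/2 + I*t + I*ρ) (a - I*ρ + j) (n-j)
  rw [show (1/2 + I*t + I*ρ : ℂ) + (a - I*ρ + j) = (a + 1/2 + I*t) + j by ring] at v
  have e1 : poch (a + 1/2 + I*t) n = poch (a + 1/2 + I*t) j * poch (a + 1/2 + I*t + j) (n-j) := by
    rw [← poch_add, Nat.add_sub_cancel' hj']
  rw [e1, poch_neg_nat n j hj']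
  have hp := poch_ne_zero hc' j
  have : (poch (a + 1/2 + I*t) j * poch (a + 1/2 + I*t + j) (n-j)) / (n.factorial : ℂ) *
      ((-1)^j * (n.factorial : ℂ) / ((n-j).factorial : ℂ) * hc (a - I*ρ) (a + I*ρ) ((a:ℂ)+b) j / poch (a + 1/2 + I*t) j)
      = hc (a - I*ρ) (a + I*ρ) ((a:ℂ)+b) j * (-1)^j * (poch (a + 1/2 + I*t + j) (n-j) / ((n-j).factorial : ℂ)) := by
    have := fact_ne n
    generalize poch (a + 1/2 + I*t : ℂ) j = A at *
    generalize poch (a + 1/2 + I*t + j : ℂ) (n-j) = B at *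
    field_simp
  rw [this, ← v, Finset.mul_sum]
  refine Finset.sum_congr rfl fun i hi => ?_
  have hi' := Finset.mem_range.1 hi
  rw [show n - (j + i) = n - j - i by omega, show j + i - j = i by omega]
  ring

lemma gc_bound (a b t δ N : ℝ) (hab : 0 < a + b) (hδ : 0 < δ) : ∃ C > 0, ∃ σ : ℝ, ∀ ρ ∈ Icc δ N, ∀ n : ℕ,
    ‖gc a b t ρ n‖ ≤ C * nR^σ := by
  obtain ⟨C, hC, H⟩ := pj_bounds a b δ N hab hδ
  set s : ℝ := 2 + |t| + |N| with hs
  obtain ⟨C2, hC2, H2⟩ := poch_ratio_bound (s:ℂ) 1 one_ne_neg_nat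
  refine ⟨C * C2, by positivity, s, fun ρ hρ n => ?_⟩
  have hρ0 : 0 < ρ := hδ.trans_le hρ.1
  have hb : ∀ m : ℕ, m ≤ n → ‖poch (1/2 + I*t + I*ρ) m / (m.factorial : ℂ)‖ ≤ C2 * nR^(s-1) := by
    intro m hm
    have h1 : ‖(1/2 + I*t + I*ρ : ℂ)‖ ≤ s := by
      refine (norm_add₃_le).trans ?_
      have : |ρ| ≤ |N| := by rw [abs_of_pos hρ0]; exact hρ.2.trans (le_abs_self _)
      simp; norm_num; linarith
    have h2 := norm_poch_le h1 m
    have h3 := H2 m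
    rw [poch_one, norm_div] at h3
    rw [norm_div]
    refine (div_le_div_of_nonneg_right h2 nnn).trans (h3.trans ?_)
    simp only [ofReal_re, one_re]
    refine mul_le_mul_of_nonneg_left ?_ hC2.le
    refine rpow_le_rpow bpos ?_ (by rw [hs]; linarith [abs_nonneg t, abs_nonneg N])
    have : (m:ℝ) ≤ n := by exact_mod_cast hm
    linarith
  unfold gc
  refine (norm_sum_le _ _).trans ?_
  calc ∑ k ∈ Finset.range (n+1), ‖poch (1/2 + I*t + I*ρ) (n-k) / ((n-k).factorial : ℂ) * pj a b ρ k‖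
      ≤ ∑ k ∈ Finset.range (n+1), C2 * nR^(s-1) * C := by
        refine Finset.sum_le_sum fun k hk => ?_
        rw [norm_mul]
        refine mul_le_mul (hb _ bomega) ?_ nnn bpos
        refine ((H ρ hρ).2 k).1.trans (div_le_self hC.le ?_)
        have : zR ≤ k := by positivity
        linarith
    _ = C * C2 * (nR^(s-1) * nR) := by
      rw [Finset.sum_const, Finset.card_range, nsmul_eq_mul]; push_cast; ring
    _ = _ := by rw [← Real.rpow_add_one bpos]; congr 2; ring

lemma gc_hasSum (a b t ρ : ℝ) (hab : 0 < a + b) {y : ℝ} (hy : 0 < y) :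
    HasSum (fun n => gc a b t ρ n * (rr y : ℂ)^n) (cexp ((1/2 + I*t) * y) * jk a b ρ y) := by
  have hr := rr_norm hy
  have hA := binom_hasSum (1/2 + I*t + I*ρ) hr
  have hB := (pj_PB a b ρ hab).hasSum hr
  have sA : Summable (fun n => ‖poch (1/2 + I*t + I*ρ) n / (n.factorial : ℂ) * (rr y : ℂ)^n‖) := hA.summable.norm
  have sB := (pj_PB a b ρ hab).summable hr
  have h := (summable_norm_sum_mul_antidiagonal_of_summable_norm sB sA).of_norm.hasSum
  rw [← tsum_mul_tsum_eq_tsum_sum_antidiagonal_of_summable_norm sB sA, hA.tsum_eq, hB.tsum_eq] at h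
  have e : pser (pj a b ρ) (rr y) * (1 - (rr y : ℂ))^(-(1/2 + I*t + I*ρ)) = cexp ((1/2 + I*t) * y) * jk a b ρ y := by
    have e1 : (1 - (rr y : ℂ)) = ((exp (-y) : ℝ) : ℂ) := by unfold rr; push_cast; ring
    rw [e1, cpow_def_of_ne_zero (by exact_mod_cast (exp_pos _).ne'), ← ofReal_log (exp_pos _).le,
      log_exp, jk]
    rw [← mul_assoc, ← Complex.exp_add, mul_comm (pser _ _)]
    congr 2; push_cast; ring
  rw [e] at h
  refine h.congr_fun fun n => ?_
  rw [gc, Finset.Nat.sum_antidiagonal_eq_sum_range_succ_mk, Finset.sum_mul]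
  refine Finset.sum_congr rfl fun k hk => ?_
  have hk' : k ≤ n := Nat.lt_succ_iff.1 (Finset.mem_range.1 hk)
  have : (rr y : ℂ)^n = (rr y : ℂ)^k * (rr y : ℂ)^(n-k) := by rw [← pow_add, Nat.add_sub_cancel' hk']
  rw [this]; ring

lemma rG_sub (β : ℂ) (n : ℕ) : (Complex.Gamma (-nC+β))⁻¹ = (-1)^n * poch (1-β) n * (Complex.Gamma β)⁻¹ := by
  induction n with
  | zero => simp [poch_zero]
  | succ n ih =>
    rw [Complex.one_div_Gamma_eq_self_mul_one_div_Gamma_add_one, show -((n+1:ℕ):ℂ)+β+1 = -nC+β by push_cast; ring, ih,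
      poch_succ]
    push_cast; ring

lemma gc_meas (a b t : ℝ) (n : ℕ) : Measurable (fun ρ => gc a b t ρ n) := by
  unfold gc
  refine Finset.measurable_sum _ (fun k _ => ?_)
  exact (((continuous_poch _).measurable.comp bfun).div_const _).mul (measurable_pj a b k)

lemma A_sum (a b t δ N : ℝ) (hab : 0 < a + b) (hδ : 0 < δ) (hN : δ ≤ N) {M : ℝ} {f : ℝ → ℂ} (h : BF δ N M f) :
    (∃ C σ : ℝ, 0 ≤ C ∧ ∀ n : ℕ, ‖∫ ρ, f ρ * gc a b t ρ n‖ ≤ C * nR^σ) ∧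
    ∀ y > 0, HasSum (fun n : ℕ => (∫ ρ, f ρ * gc a b t ρ n) * (rr y : ℂ)^n)
      (cexp ((1/2 + I*t) * y) * vj a b f y) := by
  obtain ⟨C, hC, σ, hb⟩ := gc_bound a b t δ N hab hδ
  refine ⟨⟨M*C*(N-δ), σ, mul_nonneg (mul_nonneg h.nonneg hC.le) blin, fun n => ?_⟩, fun y hy => ?_⟩
  · refine (h.norm_integral_le hN _ _ (fun ρ hρ => hb ρ hρ n)).trans (le_of_eq (by ring))
  · have hs := summable_pow_poly σ (rr_pos hy).le (rr_lt y)
    have e := hasSum_integral_of_dominated_convergence (μ := volume)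
      (F := fun (n:ℕ) (ρ:ℝ) => f ρ * gc a b t ρ n * (rr y : ℂ)^n)
      (f := fun ρ => f ρ * (cexp ((1/2 + I*t) * y) * jk a b ρ y))
      (fun n ρ => nR^σ * rr y^n * (Icc δ N).indicator (fun _ => M*C) ρ)
      (fun n => ((h.meas.mul (gc_meas a b t n)).mul_const _).aestronglyMeasurable)
      (fun n => Eventually.of_forall fun ρ => ?_)
      (Eventually.of_forall fun ρ => hs.mul_right _) ?_
      (Eventually.of_forall fun ρ => by
        simpa [mul_assoc] using (gc_hasSum a b t ρ hab hy).mul_left (f ρ))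
    · simp only [integral_mul_const] at e
      have e2 : cexp ((1/2 + I*t) * y) * vj a b f y =
          ∫ ρ, f ρ * (cexp ((1/2 + I*t) * y) * jk a b ρ y) := by
        unfold vj
        rw [← integral_const_mul]
        congr 1; ext ρ; ring
      rw [e2]; exact e
    · by_cases hρ : ρ ∈ Icc δ N
      · rw [indicator_of_mem hρ, norm_mul, norm_mul, norm_pow, norm_real, norm_of_nonneg (rr_pos hy).le]
        have := mul_le_mul (h.bd ρ) (hb ρ hρ n) nnn h.nonneg
        have h2 := pow_nonneg (rr_pos hy).le n
        nlinarith [mul_le_mul_of_nonneg_right this h2]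
      · simp [h.supp ρ hρ, hρ]
    · simp only [tsum_mul_right]
      refine Integrable.const_mul ?_ _
      exact (integrable_indicator_iff measurableSet_Icc).2 (integrableOn_const bsimp)

lemma A_eh (A : ℕ → ℂ) (C σ k₂ u₀ : ℝ) (hu : u₀ < 0) (hA : ∀ n : ℕ, ‖A n‖ ≤ C * nR^σ) (η : ℝ → ℂ)
    (h1 : Continuous η) (h2 : HasCompactSupport η) (h3 : tsupport η ⊆ Iic u₀) (S : ℝ → ℂ)
    (hS : ∀ u < 0, HasSum (fun n => A n * (exp u : ℂ)^n) (S u)) :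
    HasSum (fun n => A n * eh η (k₂ + n)) (∫ u : ℝ, η u * (cexp (k₂*u) * S u)) := by
  have hs := summable_pow_poly σ (exp_pos u₀).le (by simpa using hu)
  have e := hasSum_integral_of_dominated_convergence (μ := volume)
      (F := fun (n:ℕ) (u:ℝ) => A n * (cexp ((k₂+n) * u) * η u))
      (f := fun u => η u * (cexp (k₂*u) * S u))
      (fun n u => C * ((nR^σ * exp u₀^n) * ‖cexp (k₂ * u) * η u‖))
      (fun n => ((eh_int η h1 h2 _).const_mul _).aestronglyMeasurable)
      (fun n => Eventually.of_forall fun u => ?_)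
      (Eventually.of_forall fun ρ => (hs.mul_right _).mul_left _) ?_ (Eventually.of_forall fun u => ?_)
  · simpa only [integral_const_mul, eh] using e
  · by_cases hu1 : u ∈ tsupport η
    · have h4 : cexp ((k₂+n)*u) * η u = (exp u : ℂ)^n * (cexp (k₂*u) * η u) := by
        rw [add_mul, Complex.exp_add, exp_nat_mul]; push_cast; ring
      rw [h4, norm_mul, norm_mul, norm_pow, norm_real, norm_of_nonneg (exp_pos _).le, ← mul_assoc, ← mul_assoc,
        ← mul_assoc]
      refine mul_le_mul_of_nonneg_right (mul_le_mul (hA n) ?_ bpos ((norm_nonneg _).trans (hA n))) nnn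
      exact pow_le_pow_left₀ (exp_pos _).le (exp_le_exp.2 (h3 hu1)) n
    · simp [image_eq_zero_of_notMem_tsupport hu1]
  · simp only [tsum_mul_left, tsum_mul_right]
    exact ((eh_int η h1 h2 _).norm.const_mul _).const_mul _
  · by_cases hu1 : u ∈ tsupport η
    · have := (hS u (lt_of_le_of_lt (h3 hu1) hu)).mul_left (η u * cexp (k₂*u))
      rw [mul_assoc] at this
      refine this.congr_fun ?_ |> id
      intro n
      rw [add_mul, Complex.exp_add, exp_nat_mul]; push_cast; ring
    · simp only [image_eq_zero_of_notMem_tsupport hu1, mul_zero, zero_mul]; exact hasSum_zero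

lemma one_add_pow_le (x : ℝ) (hx : 0 ≤ x) (j : ℕ) : (1+x)^j ≤ 2^j * (1 + x^j) := by
  rcases le_total x 1 with h | h
  · have : (1+x)^j ≤ 2^j := pow_le_pow_left₀ bpos blin j
    nlinarith [pow_nonneg hx j, pow_pos (two_pos : zR < 2) j]
  · have : (1+x)^j ≤ (2*x)^j := pow_le_pow_left₀ bpos blin j
    rw [mul_pow] at this
    nlinarith [pow_pos (two_pos : zR < 2) j]

def Gc (k₁ k₂ t : ℝ) (v η : ℝ → ℂ) (p : ℂ) : ℂ := Complex.Gamma (k₁+k₂+I*t-p) / Complex.Gamma (2*k₂-p) *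
  mv t v (2*k₂-p) * eh η (k₂-p)

lemma Gc_diff (k₁ k₂ t : ℝ) (hk₁ : 0 < k₁) (hk₂ : 0 < k₂) (v η : ℝ → ℂ) (C : ℝ)
    (hv : AEStronglyMeasurable v (volume.restrict (Ioi 0))) (hb : ∀ y > 0, ‖v y‖ ≤ C)
    (h1 : Continuous η) (h2 : HasCompactSupport η) (p : ℂ) (hp : p.re ≤ k₂) :
    DifferentiableAt ℂ (Gc k₁ k₂ t v η) p := by
  have n1 : ∀ m : ℕ, (k₁+k₂+I*t-p : ℂ) ≠ -m := ne_neg_nat_of_re_pos bsl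
  have d1 : DifferentiableAt ℂ (fun p : ℂ => Complex.Gamma (k₁+k₂+I*t-p)) p :=
    DifferentiableAt.comp (g := Complex.Gamma) (f := fun p : ℂ => (k₁+k₂+I*t-p : ℂ)) p
      (differentiableAt_Gamma _ n1) bfun
  have d2 : DifferentiableAt ℂ (fun p : ℂ => (Complex.Gamma (2*k₂-p))⁻¹) p :=
    DifferentiableAt.comp (g := fun s : ℂ => (Complex.Gamma s)⁻¹) (f := fun p : ℂ => (2*k₂-p : ℂ)) p
      differentiable_one_div_Gamma.differentiableAt bfun
  have d3 : DifferentiableAt ℂ (fun p : ℂ => mv t v (2*k₂-p)) p :=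
    DifferentiableAt.comp (g := mv t v) (f := fun p : ℂ => (2*k₂-p : ℂ)) p
      (mv_diff t _ bsl v C hv hb) bfun
  have d4 : DifferentiableAt ℂ (fun p : ℂ => eh η (k₂-p)) p :=
    DifferentiableAt.comp (g := eh η) (f := fun p : ℂ => (k₂-p : ℂ)) p (eh_diff η h1 h2 _) bfun
  unfold Gc
  simp only [div_eq_mul_inv]
  exact ((d1.mul d2).mul d3).mul d4

lemma mv_unif (t k : ℝ) (hk : 0 < k) (v : ℝ → ℂ) (C : ℝ) (hb : ∀ y > 0, ‖v y‖ ≤ C) (P : ℂ) (hP : k ≤ P.re) :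
    ‖mv t v P‖ ≤ (∫ y in Ioi zR, rr y ^ (k - 1) * exp (-y / 2)) * C := by
  refine (mv_bound t P blin v C hb).trans (mul_le_mul_of_nonneg_right ?_ ((norm_nonneg _).trans (hb 1 one_pos)))
  refine setIntegral_mono_on (ker_int _ blin) (ker_int _ hk) measurableSet_Ioi (fun y hy => ?_)
  exact mul_le_mul_of_nonneg_right (rpow_le_rpow_of_exponent_ge (rr_pos hy) (rr_lt y).le blin) (exp_pos _).le

lemma Gc_bound (k₁ k₂ t u₀ : ℝ) (hk₁ : 0 < k₁) (hk₂ : 0 < k₂) (v η : ℝ → ℂ) (C : ℝ)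
    (hb : ∀ y > 0, ‖v y‖ ≤ C)
    (h1 : ContDiff ℝ ((⊤ : ℕ∞) : WithTop ℕ∞) η) (h2 : HasCompactSupport η) (h3 : tsupport η ⊆ Iic u₀) (j : ℕ) :
    ∃ C', ∀ p : ℂ, p.re ≤ k₂ → ‖Gc k₁ k₂ t v η p‖ * (1 + ‖p‖)^j ≤ C' * exp (u₀ * (k₂ - p.re)) := by
  obtain ⟨C1, hC1, m, hg⟩ := gr3 (k₂-k₁-I*t) k₁ k₁ hk₁
  obtain ⟨E0, hE0, he0⟩ := eh_bound u₀ 0 η h1 h2 h3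
  obtain ⟨E1, hE1, he1⟩ := eh_bound u₀ (m+j) η h1 h2 h3
  set K := (∫ y in Ioi zR, rr y ^ (k₂ - 1) * exp (-y / 2)) * C
  set B := 1 + k₂ + ‖(k₁:ℂ) + k₂ + I*t‖
  have hB : 1 ≤ B := by have := norm_nonneg ((k₁:ℂ) + k₂ + I*t); simp only [B]; linarith
  refine ⟨C1*B^m*K*B^j*(2^(m+j)*(E0+E1)), fun p hp => ?_⟩
  set x := ‖(k₂:ℂ) - p‖
  have hx : 0 ≤ x := norm_nonneg _
  have hpx : ‖p‖ ≤ k₂ + x := by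
    calc ‖p‖ = ‖(k₂:ℂ) - (k₂ - p)‖ := by ring_nf
      _ ≤ ‖(k₂:ℂ)‖ + x := norm_sub_le _ _
      _ = k₂ + x := by rw [norm_real, norm_of_nonneg hk₂.le]
  have b1 : 1 + ‖p‖ ≤ B*(1+x) := by
    have := norm_nonneg ((k₁:ℂ) + k₂ + I*t)
    simp only [B]; nlinarith
  have b2 : 1 + ‖(k₁+k₂+I*t-p : ℂ)‖ ≤ B*(1+x) := by
    have e : ‖(k₁+k₂+I*t-p : ℂ)‖ ≤ ‖(k₁:ℂ) + k₂ + I*t‖ + ‖p‖ := norm_sub_le _ _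
    have := norm_nonneg ((k₁:ℂ) + k₂ + I*t)
    simp only [B]; nlinarith
  have g1 := hg (k₁+k₂+I*t-p) bsl (fun i => by
    refine le_trans ?_ (re_le_norm _)
    simp; nlinarith [(Nat.cast_nonneg i : zR ≤ i)])
  rw [show (k₁+k₂+I*t-p : ℂ) + (k₂-k₁-I*t) = 2*k₂-p by ring] at g1
  have m1 : ‖mv t v (2*k₂-p)‖ ≤ K := mv_unif t k₂ hk₂ v C hb _ bsl
  have hK : 0 ≤ K := (norm_nonneg _).trans m1
  have q0 := he0 (k₂-p) bsl
  have q1 := he1 (k₂-p) bsl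
  simp only [sub_re, ofReal_re] at q0 q1
  have g2 : ‖Complex.Gamma (k₁+k₂+I*t-p) / Complex.Gamma (2*k₂-p)‖ ≤ C1 * (B*(1+x))^m :=
    g1.trans (mul_le_mul_of_nonneg_left (pow_le_pow_left₀ bpos b2 m) hC1.le)
  have q2 : ‖eh η (k₂-p)‖ * (1+x)^(m+j) ≤ 2^(m+j)*(E0+E1) * exp (u₀ * (k₂ - p.re)) := by
    calc _ ≤ ‖eh η (k₂-p)‖ * (2^(m+j) * (1 + x^(m+j))) :=
          mul_le_mul_of_nonneg_left (one_add_pow_le x hx _) nnn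
      _ = 2^(m+j) * (‖eh η (k₂-p)‖ * x^0 + ‖eh η (k₂-p)‖ * x^(m+j)) := by ring
      _ ≤ 2^(m+j) * (E0 * exp (u₀ * (k₂ - p.re)) + E1 * exp (u₀ * (k₂ - p.re))) := by gcongr
      _ = _ := by ring
  unfold Gc
  rw [norm_mul, norm_mul]
  calc _ ≤ C1 * (B*(1+x))^m * K * ‖eh η (k₂-p)‖ * (B*(1+x))^j := by gcongr
    _ = C1*B^m*K*B^j*(‖eh η (k₂-p)‖ * (1+x)^(m+j)) := by rw [mul_pow, mul_pow, pow_add]; ring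
    _ ≤ C1*B^m*K*B^j*(2^(m+j)*(E0+E1) * exp (u₀ * (k₂ - p.re))) := by gcongr
    _ = _ := by ring

def th (k₁ k₂ t x : ℝ) : ℂ := Complex.Gamma (k₂-I*x)*Complex.Gamma (k₁+I*t+I*x)/
  (Complex.Gamma (k₂+I*x)*Complex.Gamma (k₁-I*t-I*x))

def Kc (k₁ k₂ t : ℝ) (f : ℝ → ℂ) (u : ℝ) : ℂ := 2*π*(Complex.Gamma (k₁-k₂-I*t))⁻¹ * (cexp (k₂*u) *
  (cexp ((1/2+I*t)*yl u) * vj aₖ bₖ f (yl u)))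

lemma core (k₁ k₂ t δ N : ℝ) (hk₁ : 0 < k₁) (hk₂ : 0 < k₂) (hdiff : -(1/2) < k₂ - k₁) (hδ : 0 < δ) (hN : δ ≤ N)
    {M : ℝ} {f : ℝ → ℂ} (h : BF δ N M f) (η : ℝ → ℂ) (h1 : ContDiff ℝ ((⊤ : ℕ∞) : WithTop ℕ∞) η)
    (h2 : HasCompactSupport η) (h3 : tsupport η ⊆ Iio 0) :
    ∫ x : ℝ, th k₁ k₂ t x * mv t (vj aₖ bₖ (fun ρ => f ρ * Kf aₖ t ρ)) (k₂+I*x) *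
      FT η x = ∫ u : ℝ, η u * Kc k₁ k₂ t f u := by
  obtain ⟨u₀, hu, h4⟩ : ∃ u₀ < 0, tsupport η ⊆ Iic u₀ := by
    rcases (tsupport η).eq_empty_or_nonempty with he | he
    · exact ⟨-1, by norm_num, by simp [he]⟩
    · obtain ⟨u, hu, hm⟩ := h2.exists_isMaxOn he continuousOn_id
      exact ⟨u, h3 hu, fun y hy => hm hy⟩
  set a := k₂-k₁+1/2 with ha
  set b := k₁+k₂-1/2 with hb
  have hab : 0 < a + b := by rw [ha, hb]; linarith
  obtain ⟨M', hK⟩ := h.mul_cont (Kf_cont a t)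
  set v := vj a b (fun ρ => f ρ * Kf a t ρ) with hv
  obtain ⟨C, hC, hB⟩ := vj_asym a b δ N hab hδ hN
  have hvb : ∀ y > 0, ‖v y‖ ≤ M' * C := fun y hy => ((hB M' _ hK).2.2 y hy).1
  have T := contour_sum (Gc k₁ k₂ t v η) (k₁-k₂-I*t) k₂ u₀ hk₂ hu
    (fun p hp => Gc_diff k₁ k₂ t hk₁ hk₂ v η _ (vj_aesm a b δ N hab hδ hK) hvb h1.continuous h2 p hp)
    (Gc_bound k₁ k₂ t u₀ hk₁ hk₂ v η _ hvb h1 h2 h4)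
  obtain ⟨⟨C', σ, _, hA⟩, hS⟩ := A_sum a b t δ N hab hδ hN h
  have hs := (A_eh _ C' σ k₂ u₀ hu hA η h1.continuous h2 h4
    (fun u => cexp ((1/2+I*t)*yl u) * vj a b f (yl u)) (fun u hu => by
      have := hS (yl u) (yl_pos hu)
      rwa [rr_yl hu] at this)).mul_left (2*π*(Complex.Gamma (k₁-k₂-I*t))⁻¹ : ℂ)
  have T2 := hs.tendsto_sum_nat
  have E : ∫ u : ℝ, η u * Kc k₁ k₂ t f u = 2*π*(Complex.Gamma (k₁-k₂-I*t))⁻¹ *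
      ∫ u : ℝ, η u * (cexp (k₂*u) * (cexp ((1/2+I*t)*yl u) * vj a b f (yl u))) := by
    rw [← integral_const_mul]; congr 1; ext u; simp only [Kc]; ring
  rw [E]
  have E2 : ∫ x : ℝ, th k₁ k₂ t x * mv t v (k₂+I*x) * FT η x = ∫ τ : ℝ, Complex.Gamma (k₂ + I*τ) /
      Complex.Gamma (k₂ + I*τ + (k₁-k₂-I*t)) * Gc k₁ k₂ t v η (k₂+I*τ) := by
    rw [← integral_neg_eq_self]
    congr 1; ext x
    simp only [th, Gc, ofReal_neg]
    rw [show (k₂ + I*x + (k₁-k₂-I*t) : ℂ) = k₁-I*t-I*(-x) by ring, show (k₁+k₂+I*t-(k₂+I*x):ℂ) = k₁+I*t+I*(-x) by ring,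
      show (2*k₂-(k₂+I*x):ℂ) = k₂+I*(-x) by ring, show (k₂ - (k₂+I*x):ℂ) = I*(-x) by ring,
      show (k₂ - I*(-x):ℂ) = k₂+I*x by ring]
    simp only [FT, eh, ofReal_neg]
    ring
  rw [E2]
  refine tendsto_nhds_unique T (T2.congr fun n => Finset.sum_congr rfl fun n _ => ?_)
  rw [div_eq_mul_inv _ (Complex.Gamma (-nC + _)), rG_sub]
  have key : Complex.Gamma (k₁+k₂+I*t+n) / Complex.Gamma (2*k₂+n) * mv t v (2*k₂+n) =
      ∫ ρ, f ρ * F32 (-nC) (a + I*ρ) (a - I*ρ) ((a:ℂ)+b) (a + 1/2 + I*t) 1 := by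
    rw [hv, ← mv_vj a b t δ N hab hδ hK (2*k₂+n) (by simp; positivity), ← integral_const_mul]
    congr 1; ext ρ
    have := F32_eq k₁ k₂ t ρ hk₂ hdiff (-I*(k₂+n)) (by simp [← mul_assoc]; positivity) (by simp [← mul_assoc]; positivity)
    rw [show (I*(-I*(k₂+n)):ℂ) = k₂+n by rw [← mul_assoc]; simp] at this
    rw [show (k₂ - (k₂+n):ℂ) = -nC by ring, show (k₂ - k₁ + 1/2 : ℂ) = a by simp [ha],
      show (2*k₂:ℂ) = (a:ℂ)+b by simp [ha, hb]; ring, show (k₂-k₁+I*t+1:ℂ) = a+1/2+I*t by simp [ha]; ring] at this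
    rw [this, show (k₁+I*t+(k₂+n):ℂ) = k₁+k₂+I*t+n by ring, show (k₂+(k₂+n):ℂ) = 2*k₂+n by ring, ← ha, ← hb]
    ring
  have key2 : (∫ ρ, f ρ * gc a b t ρ n) = poch (a+1/2+I*t) n / (n.factorial:ℂ) *
      (Complex.Gamma (k₁+k₂+I*t+n) / Complex.Gamma (2*k₂+n) * mv t v (2*k₂+n)) := by
    rw [key, ← integral_const_mul]
    congr 1; ext ρ
    rw [gc_eq a b t ρ hab (by rw [ha]; linarith)]; ring
  rw [key2]
  simp only [Gc, sub_neg_eq_add]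
  rw [show (1 - (k₁-k₂-I*t) : ℂ) = a+1/2+I*t by simp [ha]; ring]
  have : ((-1:ℂ)^n)*(-1)^n = 1 := by rw [← mul_pow]; simp
  linear_combination (2*π*poch (a+1/2+I*t) n / (n.factorial:ℂ) * (Complex.Gamma (k₁-k₂-I*t))⁻¹ *
      (Complex.Gamma (k₁+k₂+I*t+n) / Complex.Gamma (2*k₂+n) * mv t v (2*k₂+n)) * eh η (k₂+n)) * (-this)

lemma polar1 {γ : Type*} [MeasurableSpace γ] {m : Measure γ} (T : γ → ℂ) (R : ℂ → γ → ℝ)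
    (hT : ∀ᵐ x ∂m, T x = 1/4 * (R 1 x - R (-1) x + I * R I x - I * R (-I) x)) (hR : ∀ c, Integrable (R c) m) :
    ∫ x, T x ∂m = 1/4 * (((∫ x, R 1 x ∂m : ℝ):ℂ) - (∫ x, R (-1) x ∂m : ℝ) + I * (∫ x, R I x ∂m : ℝ) - I * (∫ x, R (-I) x ∂m : ℝ)) := by
  rw [integral_congr_ae hT, integral_const_mul, integral_sub, integral_add, integral_sub, integral_const_mul,
    integral_const_mul]
  · simp only [integral_complex_ofReal]
  · exact (hR 1).ofReal
  · exact (hR (-1)).ofReal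
  · exact (hR 1).ofReal.sub (hR (-1)).ofReal
  · exact (hR I).ofReal.const_mul _
  · exact ((hR 1).ofReal.sub (hR (-1)).ofReal).add ((hR I).ofReal.const_mul _)
  · exact (hR (-I)).ofReal.const_mul _

lemma polar0 {α β : Type*} [MeasurableSpace α] [MeasurableSpace β] {μ : Measure α} {ν : Measure β} (S : α → ℂ) (Q : ℂ → α → ℝ)
    (S' : β → ℂ) (Q' : ℂ → β → ℝ) (K : ℝ)
    (hS : ∀ᵐ x ∂μ, S x = 1/4 * (Q 1 x - Q (-1) x + I * Q I x - I * Q (-I) x))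
    (hS' : ∀ᵐ x ∂ν, S' x = 1/4 * (Q' 1 x - Q' (-1) x + I * Q' I x - I * Q' (-I) x))
    (h : ∀ c, Integrable (Q c) μ ∧ Integrable (Q' c) ν ∧ ∫ x, Q c x ∂μ = K * ∫ x, Q' c x ∂ν) :
    ∫ x, S x ∂μ = K * ∫ x, S' x ∂ν := by
  rw [polar1 S Q hS fun c => (h c).1, polar1 S' Q' hS' fun c => (h c).2.1]
  simp only [(h _).2.2]
  push_cast; ring

lemma polar_pt (z w : ℂ) : z * conj w = 1/4 * (((‖z + 1*w‖^2 : ℝ):ℂ) - ((‖z + (-1)*w‖^2 : ℝ):ℂ) +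
    I * ((‖z + I*w‖^2 : ℝ):ℂ) - I * ((‖z + (-I)*w‖^2 : ℝ):ℂ)) := by
  push_cast
  simp only [← mul_conj', map_add, map_mul, map_neg, map_one, conj_I]
  linear_combination (1/2 * z * conj w - 1/2 * conj z * w) * I_sq

lemma J_polar {a b δ N : ℝ} (hab : 0 < a + b) (hδ : 0 < δ) (hN : δ ≤ N) {M M' : ℝ} {f g : ℝ → ℂ} (h : BF δ N M f)
    (h' : BF δ N M' g) : ∫ y in Ioi zR, vj a b f y * vj a b g y * ((rr y ^ (a+b-1) : ℝ) : ℂ) =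
      2*π * ∫ ρ, f ρ * g ρ * (‖kap a b ρ‖^2 : ℝ) := by
  have hc : ∀ c : ℂ, ∃ M'', BF δ N M'' (fun ρ => f ρ + conj (g ρ) * c) := fun c =>
    ⟨_, h.add (h'.conj.mul (k := fun _ => c) measurable_const (fun _ _ => le_rfl) (norm_nonneg c))⟩
  obtain ⟨C, hC, hB⟩ := vj_asym a b δ N hab hδ hN
  obtain ⟨C2, hC2, hL⟩ := vj_L2 a b δ N hab hδ hN
  have := polar0 (μ := volume.restrict (Ioi 0)) (ν := volume)
    (fun y => vj a b f y * vj a b g y * ((rr y ^ (a+b-1) : ℝ) : ℂ))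
    (fun c y => ‖vj a b (fun ρ => f ρ + conj (g ρ) * c) y‖^2 * rr y ^ (a+b-1))
    (fun ρ => f ρ * g ρ * (‖kap a b ρ‖^2 : ℝ))
    (fun c ρ => ‖(f ρ + conj (g ρ) * c) * kap a b ρ‖^2) (2*π) ?_ ?_ ?_
  · simpa using this
  · filter_upwards [ae_restrict_mem measurableSet_Ioi] with y hy
    have e : ∀ c, vj a b (fun ρ => f ρ + conj (g ρ) * c) y = vj a b f y + c * conj (vj a b g y) := fun c => by
      rw [vj_add hab hδ h (h'.conj.mul (k := fun _ => c) measurable_const (fun _ _ => le_rfl) (norm_nonneg c)) hy,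
        vj_smul, vj_conj hab _ hy]
    have := polar_pt (vj a b f y) (conj (vj a b g y))
    rw [conj_conj] at this
    rw [this]; simp only [e]; push_cast; ring
  · refine Eventually.of_forall fun ρ => ?_
    have := polar_pt (f ρ) (conj (g ρ))
    rw [conj_conj] at this
    rw [this]; simp only [norm_mul, mul_pow, mul_comm (conj (g ρ))]; push_cast; ring
  · intro c
    obtain ⟨M'', hb⟩ := hc c
    exact ⟨(hL _ _ hb).2.1, (hB _ _ hb).1.memLp.integrable_norm_pow bnum, J_norm hab hδ hN hb⟩

lemma th_norm (k₁ k₂ t x : ℝ) (hk₁ : 0 < k₁) (hk₂ : 0 < k₂) : ‖th k₁ k₂ t x‖ = 1 := by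
  have e1 := Gs_ne k₁ t x hk₁
  have e2 := Gp_ne k₂ x hk₂
  unfold th
  rw [conj_p, conj_s, norm_div, norm_mul, norm_mul, RCLike.norm_conj, RCLike.norm_conj, div_self]
  exact mul_ne_zero (norm_ne_zero_iff.2 e2) (norm_ne_zero_iff.2 e1)

lemma pref_th (k₁ k₂ t φ x : ℝ) (hk₁ : 0 < k₁) (hk₂ : 0 < k₂) : pref k₁ k₂ t φ x^2 * wRₖ x =
    (1/(2*π) * exp (t*(2*φ-π)) : ℝ) * th k₁ k₂ t x := by
  rw [← wfun_eq]
  have e1 := Gs_ne' k₁ t x hk₁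
  have e2 := Gp_ne k₂ x hk₂
  have hE : cexp ((π - 2*φ) * x)^2 * cexp ((2*x+t)*(2*φ-π)) = cexp (t*(2*φ-π)) := by
    rw [← exp_nat_mul, ← Complex.exp_add]; congr 1; push_cast; ring
  unfold pref wfun th
  push_cast
  rw [← hE]
  generalize Complex.Gamma (k₁ - I*t - I*x) = s' at *
  generalize Complex.Gamma (k₂ + I*x) = P at *
  field_simp

lemma hK_eq (k₁ k₂ t ρ : ℝ) (hdiff : -(1/2) < k₂ - k₁) : conj (hfun k₁ k₂ t ρ) * conj (Kf aₖ t ρ) =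
    (Complex.Gamma (k₁-k₂-I*t))⁻¹ := by
  rw [← map_mul, show (k₁-k₂-I*t : ℂ) = conj (k₁-k₂+I*t : ℂ) by simp; ring, Gamma_conj, ← map_inv₀]
  congr 1
  have e1 : Complex.Gamma (1/2+I*t+I*ρ) ≠ 0 := Gamma_ne_zero_of_re_pos bsimp
  have e2 : Complex.Gamma (1/2+I*t-I*ρ) ≠ 0 := Gamma_ne_zero_of_re_pos bsimp
  have e3 : Complex.Gamma (k₂-k₁+I*t+1) ≠ 0 := Gamma_ne_zero_of_re_pos bsl
  unfold hfun Kf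
  push_cast
  rw [show (k₂-k₁+1/2+1/2+I*t : ℂ) = k₂-k₁+I*t+1 by ring]
  generalize Complex.Gamma (k₂-k₁+I*t+1) = g1 at *
  generalize Complex.Gamma (1/2+I*t+I*ρ) = g2 at *
  generalize Complex.Gamma (1/2+I*t-I*ρ) = g3 at *
  generalize Complex.Gamma (k₁-k₂+I*t) = g4
  rw [div_mul_div_comm, ← one_div]
  rcases eq_or_ne g4 0 with h | h
  · simp [h]
  · field_simp

lemma XX (k₁ k₂ t φ δ N : ℝ) (hk₁ : 0 < k₁) (hk₂ : 0 < k₂) (hdiff : -(1/2) < k₂ - k₁)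
    (hδ : 0 < δ) (hN : δ ≤ N) {M M' : ℝ} {f g : ℝ → ℂ} (h : BF δ N M f) (h' : BF δ N M' g) :
    ∫ x, Ufₖ f x * Ufₖ g x * wRₖ x = ∫ ρ, conj (hfun k₁ k₂ t ρ) * f ρ * g ρ / W0ₖ ρ := by
  obtain ⟨Mf, hf⟩ := h.mul_cont (Kf_cont aₖ t)
  obtain ⟨Mg, hg⟩ := h'.mul_cont (Kf_cont aₖ t)
  obtain ⟨-, -, f3, -⟩ := mv_data (k₁ := k₁) k₂ t δ N hk₂ hδ hN hf
  obtain ⟨g1, g2, -, -⟩ := mv_data (k₁ := k₁) k₂ t δ N hk₂ hδ hN hg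
  have hab : 0 < aₖ + bₖ := by linarith
  have hcr := FT_cross (fun x => th k₁ k₂ t x * mv t (vj aₖ bₖ (fun ρ => f ρ * Kf aₖ t ρ)) (k₂+I*x))
    (Gl k₂ t (vj aₖ bₖ (fun ρ => g ρ * Kf aₖ t ρ))) (Kc k₁ k₂ t f) (Iio 0) isOpen_Iio ?_ g1 g2
    (fun y hy => by rw [Gl_ind, indicator_of_notMem hy]) ?_ (fun η e1 e2 e3 => by
      refine core k₁ k₂ t δ N hk₁ hk₂ hdiff hδ hN h (fun y => (η y:ℂ)) (ofRealCLM.contDiff.comp e1) ?_ ?_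
      · exact e2.comp_left (g := fun x : ℝ => xC) ofReal_zero
      · refine (closure_mono ?_).trans e3
        intro y hy h0
        exact hy (by simp [h0]))
  rotate_left
  · refine f3.of_le (AEStronglyMeasurable.mul (Measurable.aestronglyMeasurable ?_) f3.1) (Eventually.of_forall fun x => ?_)
    · have := measurable_Gamma
      unfold th; fun_prop
    · simp [th_norm k₁ k₂ t x hk₁ hk₂]
  · refine ContinuousOn.locallyIntegrableOn ?_ measurableSet_Iio
    have hy : ContinuousOn yl (Iio 0) := by
      unfold yl
      refine (ContinuousOn.log bfun fun u hu => ?_).neg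
      have : exp u < 1 := by simpa using hu
      linarith
    unfold Kc
    refine continuousOn_const.mul (ContinuousOn.mul bfun (ContinuousOn.mul ?_ ?_))
    · exact Complex.continuous_exp.comp_continuousOn (continuousOn_const.mul (continuous_ofReal.comp_continuousOn hy))
    · exact (vj_cont _ _ δ N hab hδ h).comp hy (fun u hu => yl_pos hu)
  have eL : ∫ x, Ufₖ f x * Ufₖ g x * wRₖ x = (1/(2*π) * exp (t*(2*φ-π)) : ℝ) *
      ∫ u, Kc k₁ k₂ t f u * Gl k₂ t (vj aₖ bₖ (fun ρ => g ρ * Kf aₖ t ρ)) u := by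
    rw [← hcr, ← integral_const_mul]
    refine integral_congr_ae ?_
    filter_upwards [Measure.ae_ne volume (-t)] with x hx
    rw [Uf_eq k₁ k₂ t φ x δ N hk₁ hk₂ hdiff hx hδ (M := M) hf, Uf_eq k₁ k₂ t φ x δ N hk₁ hk₂ hdiff hx hδ (M := M) hg, Gl_FT]
    linear_combination (mv t (vj aₖ bₖ (fun ρ => f ρ * Kf aₖ t ρ)) (k₂+I*x) *
      mv t (vj aₖ bₖ (fun ρ => g ρ * Kf aₖ t ρ)) (k₂+I*x)) * pref_th k₁ k₂ t φ x hk₁ hk₂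
  rw [eL]
  have eR : ∫ u, Kc k₁ k₂ t f u * Gl k₂ t (vj aₖ bₖ (fun ρ => g ρ * Kf aₖ t ρ)) u =
      2*π*(Complex.Gamma (k₁-k₂-I*t))⁻¹ * (2*π * ∫ ρ, f ρ * (g ρ * Kf aₖ t ρ) *
        (‖kap aₖ bₖ ρ‖^2 : ℝ)) := by
    rw [← J_polar hab hδ hN h hg, ← integral_const_mul, ← setIntegral_eq_integral_of_forall_compl_eq_zero (s := Iio zR)
      (fun u hu => by rw [Gl_ind, indicator_of_notMem hu, mul_zero]), sub_lr]
    refine setIntegral_congr_fun measurableSet_Ioi fun y hy => ?_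
    have hr := rr_pos hy
    have hr0 : (rr y : ℂ) ≠ 0 := by exact_mod_cast hr.ne'
    have e := Gl_lr k₂ t (vj aₖ bₖ (fun ρ => g ρ * Kf aₖ t ρ)) hy
    beta_reduce
    rw [← mul_smul_comm, e]
    simp only [Kc, yl_lr hy, kr]
    rw [ofReal_cpow hr.le, show ((aₖ + bₖ - 1 : ℝ):ℂ) = (k₂:ℂ) + (k₂-1) by push_cast; ring,
      cpow_add _ _ hr0, show cexp (k₂ * (Real.log (rr y) : ℝ)) = (rr y:ℂ)^(k₂:ℂ) by
        rw [cpow_def_of_ne_zero hr0, ofReal_log hr.le, mul_comm]]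
    have e2 : cexp ((1/2+I*t)*y) * cexp (-(1/2+I*t)*y) = 1 := by rw [← Complex.exp_add, ← add_mul, add_neg_cancel]; simp
    linear_combination (2*π*(Complex.Gamma (k₁-k₂-I*t))⁻¹ * (rr y:ℂ)^(k₂:ℂ) * vj aₖ bₖ f y *
      (rr y:ℂ)^(k₂-1:ℂ) * vj aₖ bₖ (fun ρ => g ρ * Kf aₖ t ρ) y) * e2
  rw [eR, ← integral_const_mul, ← integral_const_mul, ← integral_const_mul]
  congr 1; ext ρ
  by_cases hρ : ρ ∈ Icc δ N
  · have e := kap_Kf_W0 k₁ k₂ t φ ρ hk₂ (by linarith [hρ.1]) hdiff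
    have hW : (W0ₖ ρ : ℂ) ≠ 0 := by
      norm_cast; intro h0; rw [h0] at e; simp at e
    rw [← hK_eq k₁ k₂ t ρ hdiff, eq_div_iff hW]
    have e' := congrArg (fun x : ℝ => xC) e
    simp only [norm_mul, mul_pow] at e'
    push_cast at e' ⊢
    rw [← mul_conj' (Kf _ _ _)] at e'
    have hpi : (π:ℂ) ≠ 0 := by exact_mod_cast pi_ne_zero
    generalize Kf _ _ _ = kk at *
    generalize kap _ _ _ = kp at *
    field_simp
    linear_combination (conj (hfun k₁ k₂ t ρ) * f ρ * g ρ) * e'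
  · simp [h.supp ρ hρ]

lemma G_half (x : ℝ) : ‖Complex.Gamma (1/2 + I*x)‖^2 = π / cosh (π*x) := by
  have h := Gamma_mul_Gamma_one_sub (1/2 + I*x)
  rw [show (1 - (1/2 + I*x) : ℂ) = conj (1/2 + I*x : ℂ) by simp [map_ofNat]; ring, Gamma_conj, mul_conj',
    show (π * (1/2+I*x) : ℂ) = (π*x : ℝ)*I + π/2 by push_cast; ring, Complex.sin_add_pi_div_two, Complex.cos_mul_I,
    ← ofReal_cosh] at h
  exact_mod_cast h

lemma cosh_prod (s t : ℝ) : cosh (s+t) * cosh (s-t) = (cosh (2*s) + cosh (2*t))/2 := by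
  rw [Real.cosh_add, Real.cosh_sub, cosh_two_mul, cosh_two_mul]
  nlinarith [cosh_sq s, cosh_sq t]

lemma G_half_prod (t ρ : ℝ) : ‖Complex.Gamma (1/2+I*t+I*ρ)‖^2 * ‖Complex.Gamma (1/2+I*t-I*ρ)‖^2 =
    2*π^2 / (cosh (2*π*ρ) + cosh (2*π*t)) := by
  have e1 := G_half (t+ρ)
  have e2 := G_half (t-ρ)
  have e3 := cosh_prod (π*t) (π*ρ)
  rw [show (1/2+I*t+I*ρ:ℂ) = 1/2 + I*(t+ρ:ℝ) by push_cast; ring, show (1/2+I*t-I*ρ:ℂ) = 1/2 + I*(t-ρ:ℝ) by push_cast; ring, e1, e2,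
    div_mul_div_comm, mul_add, mul_sub, e3, ← mul_assoc, ← mul_assoc]
  have := cosh_pos (2*π*t)
  have := cosh_pos (2*π*ρ)
  field_simp
  ring

lemma sin_sq (x t : ℝ) : ‖Complex.sin (π*(x+I*t))‖^2 = (cosh (2*π*t) - cos (2*π*x))/2 := by
  rw [show (π*(x+I*t):ℂ) = (π*x:ℝ) + (π*t:ℝ)*I by push_cast; ring, ← normSq_eq_norm_sq, Complex.sin_add_mul_I,
    ← ofReal_sin, ← ofReal_cos, ← ofReal_sinh, ← ofReal_cosh, ← ofReal_mul, ← ofReal_mul,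
    Complex.normSq_add_mul_I, mul_assoc 2, mul_assoc 2, cosh_two_mul, Real.cos_two_mul]
  nlinarith [cosh_sq (π*t), sin_sq_add_cos_sq (π*x)]

def hden (k₁ k₂ ρ : ℝ) : ℝ := cosh (2*π*ρ) + cos (2*π*(k₁-k₂))

lemma hden_pos (k₁ k₂ ρ : ℝ) (hρ : 0 < ρ) : 0 < hden k₁ k₂ ρ := by
  have h1 : 1 < cosh (2*π*ρ) := Real.one_lt_cosh.2 bpos
  unfold hden; linarith [neg_one_le_cos (2*π*(k₁-k₂))]

lemma h_sq (k₁ k₂ t ρ : ℝ) : 1 - ‖hfun k₁ k₂ t ρ‖^2 = hden k₁ k₂ ρ / (cosh (2*π*ρ) + cosh (2*π*t)) := by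
  have e : ‖Complex.Gamma (k₁-k₂+I*t)‖^2 * ‖Complex.Gamma (k₂-k₁+I*t+1)‖^2 = π^2 /
      ((cosh (2*π*t) - cos (2*π*(k₁-k₂)))/2) := by
    have h := Gamma_mul_Gamma_one_sub (k₁-k₂+I*t)
    rw [show (1 - (k₁-k₂+I*t):ℂ) = conj (k₂-k₁+I*t+1 : ℂ) by simp; ring, Gamma_conj] at h
    have h2 := congrArg (fun z : ℂ => ‖z‖^2) h
    have h3 := sin_sq (k₁-k₂) t
    push_cast at h3
    simp only [norm_mul, RCLike.norm_conj, mul_pow, norm_div, div_pow, h3, norm_real, norm_eq_abs, sq_abs] at h2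
    simpa using h2
  unfold hfun
  rw [norm_div, norm_mul, norm_mul, div_pow, mul_pow, mul_pow, e, G_half_prod]
  have p1 := cosh_pos (2*π*t)
  have p2 := cosh_pos (2*π*ρ)
  have p3 : cosh (2*π*ρ) + cosh (2*π*t) ≠ 0 := by positivity
  unfold hden
  rcases eq_or_ne (cosh (2*π*t) - cos (2*π*(k₁-k₂))) 0 with h | h
  · rw [h]; simp; rw [eq_div_iff p3]; linarith
  · field_simp; ring

lemma h_lt (k₁ k₂ t ρ : ℝ) (hρ : 0 < ρ) : 0 < 1 - ‖hfun k₁ k₂ t ρ‖^2 := by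
  rw [h_sq]
  have := hden_pos k₁ k₂ ρ hρ
  have := cosh_pos (2*π*t)
  have := cosh_pos (2*π*ρ)
  positivity

lemma W0_pos (k₁ k₂ t φ ρ : ℝ) (hk₂ : 0 < k₂) (hρ : 0 < ρ) (hdiff : -(1/2) < k₂ - k₁) : 0 < W0ₖ ρ := by
  have e := kap_Kf_W0 k₁ k₂ t φ ρ hk₂ hρ hdiff
  by_contra h
  have : 0 ≤ 2*π * exp (t*(2*φ-π)) * ‖Kf aₖ t ρ * kap aₖ bₖ ρ‖^2 := by positivity
  nlinarith [mul_nonneg (sub_nonneg.2 (not_lt.1 h)) this]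

lemma h_meas (k₁ k₂ t : ℝ) : Measurable (hfun k₁ k₂ t) := by
  have := measurable_Gamma
  unfold hfun; fun_prop

lemma W0_meas (k₁ k₂ t φ : ℝ) : Measurable (W0ₖ) := by
  have := measurable_Gamma
  unfold W0; fun_prop

lemma wR_meas (k₁ k₂ t φ : ℝ) : Measurable (wRₖ) := by
  have := measurable_Gamma
  unfold wR; fun_prop

lemma wR_nonneg (k₁ k₂ t φ x : ℝ) : 0 ≤ wRₖ x := by unfold wR; positivity

lemma Uf_aesm (k₁ k₂ t φ δ N : ℝ) (hk₁ : 0 < k₁) (hk₂ : 0 < k₂) (hdiff : -(1/2) < k₂ - k₁)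
    (hδ : 0 < δ) (hN : δ ≤ N) {M : ℝ} {f : ℝ → ℂ} (h : BF δ N M f) : AEStronglyMeasurable (Ufₖ f) volume := by
  obtain ⟨Mf, hf⟩ := h.mul_cont (Kf_cont aₖ t)
  obtain ⟨-, -, f3, -⟩ := mv_data (k₁ := k₁) k₂ t δ N hk₂ hδ hN hf
  have hp : Measurable (pref k₁ k₂ t φ) := by
    have := measurable_Gamma
    unfold pref; fun_prop
  refine (hp.aestronglyMeasurable.mul f3.1).congr ?_
  filter_upwards [Measure.ae_ne volume (-t)] with x hx
  exact (Uf_eq k₁ k₂ t φ x δ N hk₁ hk₂ hdiff hx hδ (M := M) hf).symm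

def Qd (k₁ k₂ t φ : ℝ) (F G : ℝ → ℂ) (ρ : ℝ) : ℝ :=
  (‖F ρ‖^2 + ‖G ρ‖^2 + 2 * (conj (hfun k₁ k₂ t ρ) * F ρ * G ρ).re) / W0ₖ ρ

set_option hygiene false in
local notation "Qdₖ" => Qd k₁ k₂ t φ

lemma cross_le (z w : ℂ) : ‖z * w‖ ≤ (‖z‖^2 + ‖w‖^2)/2 := by
  rw [norm_mul]; nlinarith [sq_nonneg (‖z‖ - ‖w‖)]

lemma add_conj_sq (z w : ℂ) : ‖z + conj w‖^2 = ‖z‖^2 + ‖w‖^2 + 2 * (z*w).re := by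
  rw [← normSq_eq_norm_sq, ← normSq_eq_norm_sq, ← normSq_eq_norm_sq, Complex.normSq_add, conj_conj,
    Complex.normSq_conj]

lemma Qd_nonneg (k₁ k₂ t φ : ℝ) (F G : ℝ → ℂ) (ρ : ℝ) (hρ : 0 < ρ) : 0 ≤ Qdₖ F G ρ := by
  refine div_nonneg ?_ (by unfold W0; positivity)
  have h1 := h_lt k₁ k₂ t ρ hρ
  have h2 : ‖hfun k₁ k₂ t ρ‖ ≤ 1 := by nlinarith [norm_nonneg (hfun k₁ k₂ t ρ)]
  have h3 := (abs_le.1 (abs_re_le_norm (conj (hfun k₁ k₂ t ρ) * F ρ * G ρ))).1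
  rw [mul_assoc, norm_mul, RCLike.norm_conj] at h3
  rw [mul_assoc (conj _)]
  have h4 := cross_le (F ρ) (G ρ)
  nlinarith [mul_le_mul_of_nonneg_right h2 (norm_nonneg (F ρ * G ρ))]

lemma iso_BF (k₁ k₂ t φ δ N : ℝ) (hk₁ : 0 < k₁) (hk₂ : 0 < k₂) (hdiff : -(1/2) < k₂ - k₁)
    (hδ : 0 < δ) (hN : δ ≤ N) {M M' : ℝ} {f g : ℝ → ℂ} (h : BF δ N M f) (h' : BF δ N M' g) :
    Integrable (fun x => ‖Ufₖ f x + conj (Ufₖ g x)‖^2 * wRₖ x) ∧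
    ∫ x, ‖Ufₖ f x + conj (Ufₖ g x)‖^2 * wRₖ x = ∫ ρ, Qdₖ f g ρ := by
  obtain ⟨i1, e1⟩ := I1 k₁ k₂ t φ δ N hk₁ hk₂ hdiff hδ hN h
  obtain ⟨i2, e2⟩ := I1 k₁ k₂ t φ δ N hk₁ hk₂ hdiff hδ hN h'
  have i3 : Integrable (fun x => Ufₖ f x * Ufₖ g x * wRₖ x) := by
    refine ((i1.add i2).div_const 2).mono' (((Uf_aesm k₁ k₂ t φ δ N hk₁ hk₂ hdiff hδ hN h).mul
      (Uf_aesm k₁ k₂ t φ δ N hk₁ hk₂ hdiff hδ hN h')).mul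
      (measurable_ofReal.comp (wR_meas k₁ k₂ t φ)).aestronglyMeasurable) (Eventually.of_forall fun x => ?_)
    have := mul_le_mul_of_nonneg_right (cross_le (Ufₖ f x) (Ufₖ g x)) (wR_nonneg k₁ k₂ t φ x)
    simp only [Pi.add_apply]
    rw [norm_mul, norm_real, norm_of_nonneg (wR_nonneg k₁ k₂ t φ x)]
    linarith
  have jj : ∀ {M : ℝ} {f : ℝ → ℂ}, BF δ N M f → Integrable (fun ρ => ‖f ρ‖^2 / W0ₖ ρ) := by
    intro M f h
    obtain ⟨Mf, hf⟩ := h.mul_cont (Kf_cont aₖ t)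
    obtain ⟨C, hC, hB⟩ := vj_asym aₖ bₖ δ N blin hδ hN
    have i : Integrable (fun ρ => ‖f ρ * Kf aₖ t ρ * kap aₖ bₖ ρ‖^2) :=
      (hB _ _ hf).1.memLp.integrable_norm_pow bnum
    refine (i.const_mul (2*π * exp (t*(2*φ-π)))).congr (Eventually.of_forall fun ρ => ?_)
    by_cases hρ : ρ ∈ Icc δ N
    · have e := kap_Kf_W0 k₁ k₂ t φ ρ hk₂ (by linarith [hρ.1]) hdiff
      have hW := W0_pos k₁ k₂ t φ ρ hk₂ (by linarith [hρ.1]) hdiff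
      simp only [norm_mul, mul_pow] at e ⊢
      rw [eq_div_iff hW.ne']
      linear_combination ‖f ρ‖^2 * e
    · simp [h.supp ρ hρ]
  have i4 : Integrable (fun ρ => conj (hfun k₁ k₂ t ρ) * f ρ * g ρ / W0ₖ ρ) := by
    refine (((jj h).add (jj h')).div_const 2).mono' (Measurable.aestronglyMeasurable ?_) (Eventually.of_forall fun ρ => ?_)
    · exact (((continuous_conj.measurable.comp (h_meas k₁ k₂ t)).mul h.meas).mul h'.meas).div
        (measurable_ofReal.comp (W0_meas k₁ k₂ t φ))
    · by_cases hρ : ρ ∈ Icc δ N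
      · have h0 : 0 < ρ := by linarith [hρ.1]
        have h1 := h_lt k₁ k₂ t ρ h0
        have h2 : ‖hfun k₁ k₂ t ρ‖ ≤ 1 := by nlinarith [norm_nonneg (hfun k₁ k₂ t ρ)]
        have hW := W0_pos k₁ k₂ t φ ρ hk₂ h0 hdiff
        simp only [Pi.add_apply]
        rw [← add_div, div_right_comm, norm_div, norm_real, norm_of_nonneg hW.le, mul_assoc, norm_mul, RCLike.norm_conj]
        refine div_le_div_of_nonneg_right ?_ hW.le
        nlinarith [cross_le (f ρ) (g ρ), mul_le_mul_of_nonneg_right h2 (norm_nonneg (f ρ * g ρ))]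
      · simp [h.supp ρ hρ, h'.supp ρ hρ]
  have hx := XX k₁ k₂ t φ δ N hk₁ hk₂ hdiff hδ hN h h'
  have s1 : (fun x => ‖Ufₖ f x + conj (Ufₖ g x)‖^2 * wRₖ x) = fun x =>
      ‖Ufₖ f x‖^2 * wRₖ x + ‖Ufₖ g x‖^2 * wRₖ x +
      2 * (Ufₖ f x * Ufₖ g x * wRₖ x).re := by
    ext x; rw [add_conj_sq, Complex.re_mul_ofReal]; ring
  have s2 : Qdₖ f g = fun ρ => ‖f ρ‖^2 / W0ₖ ρ + ‖g ρ‖^2 / W0ₖ ρ +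
      2 * (conj (hfun k₁ k₂ t ρ) * f ρ * g ρ / W0ₖ ρ).re := by
    ext ρ; rw [Qd, Complex.div_ofReal_re]; ring
  have r3 := (i3.re).const_mul 2
  have r4 := (i4.re).const_mul 2
  have q3 : ∫ x, (Ufₖ f x * Ufₖ g x * wRₖ x).re = (∫ x, Ufₖ f x * Ufₖ g x * wRₖ x).re :=
    integral_re i3
  have q4 : ∫ ρ, (conj (hfun k₁ k₂ t ρ) * f ρ * g ρ / W0ₖ ρ).re = (∫ ρ, conj (hfun k₁ k₂ t ρ) * f ρ * g ρ / W0ₖ ρ).re :=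
    integral_re i4
  rw [s1, s2]
  refine ⟨(i1.add i2).add r3, ?_⟩
  have a1 := integral_add (i1.add i2) r3
  have a2 := integral_add ((jj h).add (jj h')) r4
  simp only [Pi.add_apply, RCLike.re_to_complex] at a1 a2
  rw [a1, a2, integral_add i1 i2, integral_add (jj h) (jj h'), integral_const_mul, integral_const_mul, q3, q4, hx, e1, e2]

lemma fatou_real {S : ℕ → ℝ → ℝ} {s : ℝ → ℝ} {R : ℝ} (h0 : ∀ n x, 0 ≤ S n x) (hi : ∀ n, Integrable (S n))
    (hR : ∀ n, ∫ x, S n x ≤ R) (hl : ∀ᵐ x, Tendsto (fun n => S n x) atTop (𝓝 (s x))) :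
    Integrable s ∧ ∫ x, s x ≤ R := by
  have hm : AEStronglyMeasurable s volume := aestronglyMeasurable_of_tendsto_ae atTop (fun n => (hi n).1) hl
  have hs : 0 ≤ᵐ[volume] s := by
    filter_upwards [hl] with x hx
    exact ge_of_tendsto' hx fun n => h0 n x
  have R0 : 0 ≤ R := (integral_nonneg (h0 0)).trans (hR 0)
  have key : ∫⁻ x, ENNReal.ofReal (s x) ≤ ENNReal.ofReal R := by
    calc ∫⁻ x, ENNReal.ofReal (s x) = ∫⁻ x, liminf (fun n => ENNReal.ofReal (S n x)) atTop := by
          refine lintegral_congr_ae ?_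
          filter_upwards [hl] with x hx
          exact ((ENNReal.continuous_ofReal.tendsto _).comp hx).liminf_eq.symm
      _ ≤ liminf (fun n => ∫⁻ x, ENNReal.ofReal (S n x)) atTop :=
          lintegral_liminf_le' fun n => (hi n).1.aemeasurable.ennreal_ofReal
      _ ≤ ENNReal.ofReal R := by
          refine liminf_le_of_le (by isBoundedDefault) fun b hb => ?_
          obtain ⟨n, hn⟩ := hb.exists
          refine hn.trans ?_
          rw [← ofReal_integral_eq_lintegral_ofReal (hi n) (Eventually.of_forall (h0 n))]
          exact ENNReal.ofReal_le_ofReal (hR n)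
  constructor
  · exact ⟨hm, (hasFiniteIntegral_iff_ofReal hs).2 (key.trans_lt ENNReal.ofReal_lt_top)⟩
  · rw [integral_eq_lintegral_of_nonneg_ae hs hm]
    exact ENNReal.toReal_le_of_le_ofReal R0 key

structure Adm (k₁ k₂ t φ : ℝ) (F G : ℝ → ℂ) : Prop where
  mF : Measurable F
  mG : Measurable G
  zF : ∀ ρ ≤ 0, F ρ = 0
  zG : ∀ ρ ≤ 0, G ρ = 0
  iQ : Integrable (Qdₖ F G)
  iF : ∀ x : ℝ, x ≠ -t → Integrable (fun ρ : ℝ => F ρ * phiCₖ ρ x)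
  iG : ∀ x : ℝ, x ≠ -t → Integrable (fun ρ : ℝ => G ρ * phiCₖ ρ x)

set_option hygiene false in
local notation "Admₖ" => Adm k₁ k₂ t φ

def trA (F G : ℝ → ℂ) (n : ℕ) : Set ℝ := Icc (1/nR) (n+1) ∩ ({ρ | ‖F ρ‖ ≤ n} ∩ {ρ | ‖G ρ‖ ≤ n})

lemma trA_meas {F G : ℝ → ℂ} (mF : Measurable F) (mG : Measurable G) (n : ℕ) : MeasurableSet (trA F G n) :=
  measurableSet_Icc.inter ((measurableSet_le mF.norm measurable_const).inter (measurableSet_le mG.norm measurable_const))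

lemma trA_ev (F G : ℝ → ℂ) (ρ : ℝ) (h : 0 < ρ) : ∀ᶠ n : ℕ in atTop, ρ ∈ trA F G n := by
  have c := tendsto_natCast_atTop_atTop (R := ℝ)
  filter_upwards [c.eventually_ge_atTop (1/ρ), c.eventually_ge_atTop ρ, c.eventually_ge_atTop ‖F ρ‖, c.eventually_ge_atTop ‖G ρ‖]
    with n h1 h2 h3 h4
  refine ⟨⟨?_, by linarith⟩, h3, h4⟩
  rw [div_le_iff₀ h] at h1
  rw [div_le_iff₀ bpos]
  nlinarith

lemma tr_BF {F G : ℝ → ℂ} (mF : Measurable F) (mG : Measurable G) (n : ℕ) {H : ℝ → ℂ} (mH : Measurable H)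
    (hH : ∀ ρ ∈ trA F G n, ‖H ρ‖ ≤ n) : BF (1/nR) (n+1) n ((trA F G n).indicator H) := by
  refine ⟨mH.indicator (trA_meas mF mG n), fun ρ => ?_, fun ρ hρ => ?_⟩
  · by_cases h : ρ ∈ trA F G n
    · rw [indicator_of_mem h]; exact hH ρ h
    · rw [indicator_of_notMem h]; simp
  · exact indicator_of_notMem (fun h => hρ h.1) _

lemma Qd_ind (k₁ k₂ t φ : ℝ) (A : Set ℝ) (F G : ℝ → ℂ) : Qdₖ (A.indicator F) (A.indicator G) = A.indicator (Qdₖ F G) := by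
  ext ρ
  by_cases h : ρ ∈ A <;> simp [Qd, h]

lemma Qd_nn {k₁ k₂ t φ : ℝ} {F G : ℝ → ℂ} (h : Admₖ F G) (ρ : ℝ) : 0 ≤ Qdₖ F G ρ := by
  rcases lt_or_ge 0 ρ with hρ | hρ
  · exact Qd_nonneg _ _ _ _ _ _ _ hρ
  · simp [Qd, h.zF ρ hρ, h.zG ρ hρ]

lemma tr_lim {F G H : ℝ → ℂ} (z : ∀ ρ ≤ 0, H ρ = 0) (ρ : ℝ) :
    ∀ᶠ n : ℕ in atTop, (trA F G n).indicator H ρ = H ρ := by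
  rcases lt_or_ge 0 ρ with hρ | hρ
  · filter_upwards [trA_ev F G ρ hρ] with n hn
    rw [indicator_of_mem hn]
  · refine Eventually.of_forall fun n => ?_
    by_cases h : ρ ∈ trA F G n <;> simp [h, z ρ hρ]

lemma Uf_lim (k₁ k₂ t φ : ℝ) {F G H : ℝ → ℂ} (mF : Measurable F) (mG : Measurable G) (z : ∀ ρ ≤ 0, H ρ = 0) (x : ℝ)
    (hi : Integrable (fun ρ : ℝ => H ρ * phiCₖ ρ x)) :
    Tendsto (fun n => Ufₖ ((trA F G n).indicator H) x) atTop (𝓝 (Ufₖ H x)) := by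
  unfold Uf
  have e : ∀ n, (fun ρ : ℝ => (trA F G n).indicator H ρ * phiCₖ ρ x) =
      (trA F G n).indicator (fun ρ : ℝ => H ρ * phiCₖ ρ x) := by
    intro n; ext ρ; by_cases h : ρ ∈ trA F G n <;> simp [h]
  refine tendsto_integral_of_dominated_convergence (fun ρ => ‖H ρ * phiCₖ ρ x‖) (fun n => ?_) hi.norm
    (fun n => Eventually.of_forall fun ρ => ?_) (Eventually.of_forall fun ρ => ?_)
  · rw [e]; exact hi.1.indicator (trA_meas mF mG n)
  · have := congrFun (e n) ρ
    beta_reduce at this; rw [this]; exact norm_indicator_le_norm_self _ _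
  · refine tendsto_const_nhds.congr' ?_
    filter_upwards [tr_lim (F := F) (G := G) z ρ] with n hn
    rw [hn]

lemma Qd_lim {k₁ k₂ t φ : ℝ} {F G : ℝ → ℂ} (h : Admₖ F G) :
    Tendsto (fun n => ∫ ρ, Qdₖ ((trA F G n).indicator F) ((trA F G n).indicator G) ρ) atTop (𝓝 (∫ ρ, Qdₖ F G ρ)) := by
  simp only [Qd_ind]
  refine tendsto_integral_of_dominated_convergence (fun ρ => ‖Qdₖ F G ρ‖) (fun n => h.iQ.1.indicator (trA_meas h.mF h.mG n)) h.iQ.norm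
    (fun n => Eventually.of_forall fun ρ => norm_indicator_le_norm_self _ _) (Eventually.of_forall fun ρ => ?_)
  refine tendsto_const_nhds.congr' ?_
  filter_upwards [tr_lim (F := F) (G := G) h.zF ρ, tr_lim (F := F) (G := G) h.zG ρ] with n hn hn'
  have := congrFun (Qd_ind k₁ k₂ t φ (trA F G n) F G) ρ
  rw [← this]; simp only [Qd, hn, hn']

def Sf (k₁ k₂ t φ : ℝ) (F G : ℝ → ℂ) (x : ℝ) : ℝ := ‖Ufₖ F x + conj (Ufₖ G x)‖^2 * wRₖ x

set_option hygiene false in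
local notation "Sfₖ" => Sf k₁ k₂ t φ

lemma iso_tr {k₁ k₂ t φ : ℝ} (hk₁ : 0 < k₁) (hk₂ : 0 < k₂) (hdiff : -(1/2) < k₂ - k₁) {F G : ℝ → ℂ} (h : Admₖ F G) (n : ℕ) :
    Integrable (Sfₖ ((trA F G n).indicator F) ((trA F G n).indicator G)) ∧
    ∫ x, Sfₖ ((trA F G n).indicator F) ((trA F G n).indicator G) x =
      ∫ ρ, Qdₖ ((trA F G n).indicator F) ((trA F G n).indicator G) ρ := by
  refine iso_BF k₁ k₂ t φ (1/nR) (n+1) hk₁ hk₂ hdiff bpos ?_ (tr_BF h.mF h.mG n h.mF fun ρ hρ => hρ.2.1)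
    (tr_BF h.mF h.mG n h.mG fun ρ hρ => hρ.2.2)
  rw [div_le_iff₀ bpos]
  have : zR ≤ n := by positivity
  nlinarith

lemma iso_le {k₁ k₂ t φ : ℝ} (hk₁ : 0 < k₁) (hk₂ : 0 < k₂) (hdiff : -(1/2) < k₂ - k₁) {F G : ℝ → ℂ} (h : Admₖ F G) :
    Integrable (Sfₖ F G) ∧ ∫ x, Sfₖ F G x ≤ ∫ ρ, Qdₖ F G ρ := by
  refine fatou_real (S := fun n => Sfₖ ((trA F G n).indicator F) ((trA F G n).indicator G))
    (fun n x => mul_nonneg (sq_nonneg _) (wR_nonneg _ _ _ _ _)) (fun n => (iso_tr hk₁ hk₂ hdiff h n).1) (fun n => ?_) ?_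
  · rw [(iso_tr hk₁ hk₂ hdiff h n).2, Qd_ind]
    refine integral_mono (h.iQ.indicator (trA_meas h.mF h.mG n)) h.iQ fun ρ => ?_
    exact indicator_le_self' (fun _ _ => Qd_nn h _) ρ
  · filter_upwards [Measure.ae_ne volume (-t)] with x hx
    exact (((Uf_lim k₁ k₂ t φ h.mF h.mG h.zF x (h.iF x hx)).add
      ((continuous_conj.tendsto _).comp (Uf_lim k₁ k₂ t φ h.mF h.mG h.zG x (h.iG x hx)))).norm.pow 2).mul_const _

lemma Uf_smul_sub (k₁ k₂ t φ : ℝ) (A : Set ℝ) (hA : MeasurableSet A) (F : ℝ → ℂ) (x : ℝ)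
    (hi : Integrable (fun ρ : ℝ => F ρ * phiCₖ ρ x)) :
    Integrable (fun ρ : ℝ => (2 * A.indicator F ρ - F ρ) * phiCₖ ρ x) ∧
    Ufₖ (fun ρ => 2 * A.indicator F ρ - F ρ) x = 2 * Ufₖ (A.indicator F) x - Ufₖ F x := by
  have e : (fun ρ : ℝ => A.indicator F ρ * phiCₖ ρ x) = A.indicator (fun ρ : ℝ => F ρ * phiCₖ ρ x) := by
    ext ρ; by_cases h : ρ ∈ A <;> simp [h]
  have i1 : Integrable (fun ρ : ℝ => A.indicator F ρ * phiCₖ ρ x) := by rw [e]; exact hi.indicator hA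
  have e2 : (fun ρ : ℝ => (2 * A.indicator F ρ - F ρ) * phiCₖ ρ x) =
     fun ρ : ℝ => 2 * (A.indicator F ρ * phiCₖ ρ x) - F ρ * phiCₖ ρ x := by ext ρ; ring
  unfold Uf
  rw [e2, integral_sub (i1.const_mul 2) hi, integral_const_mul]
  exact ⟨(i1.const_mul 2).sub hi, rfl⟩

lemma iso_eq {k₁ k₂ t φ : ℝ} (hk₁ : 0 < k₁) (hk₂ : 0 < k₂) (hdiff : -(1/2) < k₂ - k₁) {F G : ℝ → ℂ} (h : Admₖ F G) :
    Integrable (Sfₖ F G) ∧ ∫ x, Sfₖ F G x = ∫ ρ, Qdₖ F G ρ := by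
  obtain ⟨i0, l0⟩ := iso_le hk₁ hk₂ hdiff h
  refine ⟨i0, le_antisymm l0 ?_⟩
  have hl := ((Qd_lim h).const_mul 2).sub_const (∫ ρ, Qdₖ F G ρ)
  rw [two_mul, add_sub_cancel_right] at hl
  refine le_of_tendsto' hl fun n => ?_
  set A := trA F G n
  have hA : MeasurableSet A := trA_meas h.mF h.mG n
  have eQ : Qdₖ (fun ρ => 2 * A.indicator F ρ - F ρ) (fun ρ => 2 * A.indicator G ρ - G ρ) = Qdₖ F G := by
    ext ρ
    by_cases hρ : ρ ∈ A
    · simp only [Qd, indicator_of_mem hρ, two_mul, add_sub_cancel_right]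
    · simp [Qd, indicator_of_notMem hρ]
  have h2 : Admₖ (fun ρ => 2 * A.indicator F ρ - F ρ) (fun ρ => 2 * A.indicator G ρ - G ρ) := by
    refine ⟨((h.mF.indicator hA).const_mul 2).sub h.mF, ((h.mG.indicator hA).const_mul 2).sub h.mG, fun ρ hρ => ?_, fun ρ hρ => ?_, ?_,
      fun x hx => (Uf_smul_sub k₁ k₂ t φ A hA F x (h.iF x hx)).1, fun x hx => (Uf_smul_sub k₁ k₂ t φ A hA G x (h.iG x hx)).1⟩
    · by_cases h' : ρ ∈ A <;> simp [h', h.zF ρ hρ]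
    · by_cases h' : ρ ∈ A <;> simp [h', h.zG ρ hρ]
    · rw [eQ]; exact h.iQ
  obtain ⟨i2, l2⟩ := iso_le hk₁ hk₂ hdiff h2
  obtain ⟨i1, l1⟩ := iso_tr hk₁ hk₂ hdiff h n
  rw [eQ] at l2
  have m : ∫ x, 2 * Sfₖ (A.indicator F) (A.indicator G) x ≤
      ∫ x, (Sfₖ F G x + Sfₖ (fun ρ => 2 * A.indicator F ρ - F ρ) (fun ρ => 2 * A.indicator G ρ - G ρ) x) := by
    refine integral_mono_ae (i1.const_mul 2) (i0.add i2) ?_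
    filter_upwards [Measure.ae_ne volume (-t)] with x hx
    simp only [Sf, (Uf_smul_sub k₁ k₂ t φ A hA F x (h.iF x hx)).2, (Uf_smul_sub k₁ k₂ t φ A hA G x (h.iG x hx)).2]
    rw [← add_mul, ← mul_assoc]
    refine mul_le_mul_of_nonneg_right ?_ (wR_nonneg _ _ _ _ _)
    set z := Ufₖ F x + conj (Ufₖ G x) with hz
    set w := Ufₖ (A.indicator F) x + conj (Ufₖ (A.indicator G) x) with hw
    have e : 2 * Ufₖ (A.indicator F) x - Ufₖ F x + conj (2 * Ufₖ (A.indicator G) x - Ufₖ G x) = 2*w - z := by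
      rw [hw, hz, map_sub, map_mul, Complex.conj_ofNat]; ring
    rw [e]
    have := norm_add_le z (2*w-z)
    rw [show z + (2*w - z) = 2*w by ring, norm_mul, norm_ofNat] at this
    nlinarith [norm_nonneg w, sq_nonneg (‖z‖ - ‖2*w-z‖)]
  rw [integral_const_mul, integral_add i0 i2, l1] at m
  linarith

lemma G_up (α : ℝ) (hα : 0 < α) : ∃ C : ℝ, 0 < C ∧ ∃ m : ℕ, ∀ ρ : ℝ, 0 ≤ ρ →
    ‖Complex.Gamma (α + I*ρ)‖^2 ≤ C * (1+ρ)^m * exp (-(π*ρ)) := by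
  obtain ⟨C, hC, m, h⟩ := gr3 (1/2-α) α α hα
  refine ⟨(C * (1+α)^m)^2 * (2*π), by positivity, m+m, fun ρ hρ => ?_⟩
  have h1 := h (α + I*ρ) bsimp (fun j => by
    refine le_trans ?_ (re_le_norm _)
    simp)
  rw [show (α + I*ρ + (1/2-α) : ℂ) = 1/2 + I*ρ by ring, norm_div,
    div_le_iff₀ (norm_pos_iff.2 (Gamma_ne_zero_of_re_pos bsimp))] at h1
  have h2 : ‖(α + I*ρ : ℂ)‖ ≤ α + ρ := by
    refine (norm_add_le _ _).trans ?_
    simp [abs_of_nonneg hρ, abs_of_pos hα]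
  have h3 : (1 + ‖(α + I*ρ : ℂ)‖)^m ≤ ((1+α)*(1+ρ))^m := by
    gcongr; nlinarith
  have h4 : ‖Complex.Gamma (1/2 + I*ρ)‖^2 ≤ 2*π * exp (-(π*ρ)) := by
    rw [G_half, div_le_iff₀ (cosh_pos _), cosh_eq]
    have : exp (-(π*ρ)) * exp (π*ρ) = 1 := by rw [← exp_add]; simp
    have h5 := exp_pos (-(π*ρ))
    have h6 := pi_pos
    nlinarith [mul_pos h6 (mul_pos h5 h5)]
  have h5 : ‖Complex.Gamma (α + I*ρ)‖ ≤ C * (1+α)^m * (1+ρ)^m * ‖Complex.Gamma (1/2+I*ρ)‖ := by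
    refine h1.trans ?_
    rw [mul_assoc C ((1+α)^m), ← mul_pow]; gcongr
  calc ‖Complex.Gamma (α + I*ρ)‖^2 ≤ (C * (1+α)^m * (1+ρ)^m * ‖Complex.Gamma (1/2+I*ρ)‖)^2 := by gcongr
    _ = (C * (1+α)^m)^2 * (1+ρ)^(m+m) * ‖Complex.Gamma (1/2+I*ρ)‖^2 := by ring
    _ ≤ (C * (1+α)^m)^2 * (1+ρ)^(m+m) * (2*π * exp (-(π*ρ))) := by gcongr
    _ = _ := by ring

lemma G_lo (α : ℝ) (hα : 0 < α) : ∃ C : ℝ, 0 < C ∧ ∃ m : ℕ, ∀ ρ : ℝ, 0 ≤ ρ →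
    (‖Complex.Gamma (α + I*ρ)‖^2)⁻¹ ≤ C * (1+ρ)^m * exp (π*ρ) := by
  obtain ⟨C, hC, m, h⟩ := gr3 (α-1/2) (1/2) (1/2) bnum
  refine ⟨(C * 2^m)^2, by positivity, m+m, fun ρ hρ => ?_⟩
  have h1 := h (1/2 + I*ρ) bsimp (fun j => by
    refine le_trans ?_ (re_le_norm _)
    simp)
  rw [show (1/2 + I*ρ + (α-1/2) : ℂ) = α + I*ρ by ring, norm_div] at h1
  have h2 : ‖(1/2 + I*ρ : ℂ)‖ ≤ 1/2 + ρ := by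
    refine (norm_add_le _ _).trans ?_
    simp [abs_of_nonneg hρ]
  have h3 : (1 + ‖(1/2 + I*ρ : ℂ)‖)^m ≤ (2*(1+ρ))^m := by
    gcongr; nlinarith
  have h4 : π * exp (-(π*ρ)) ≤ ‖Complex.Gamma (1/2 + I*ρ)‖^2 := by
    rw [G_half, le_div_iff₀ (cosh_pos _), mul_assoc]
    have : exp (-(π*ρ)) * exp (π*ρ) = 1 := by rw [← exp_add]; simp
    have h5 : exp (-(π*ρ)) ≤ 1 := exp_le_one_iff.2 (by have := pi_pos; nlinarith)
    have h6 := pi_pos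
    have h7 := exp_pos (-(π*ρ))
    have h8 : exp (-(π*ρ)) * cosh (π*ρ) ≤ 1 := by
      rw [cosh_eq]; nlinarith
    nlinarith
  have hp : 0 < ‖Complex.Gamma (α + I*ρ)‖ := norm_pos_iff.2 (Gamma_ne_zero_of_re_pos (by simpa))
  have h5 : (‖Complex.Gamma (1/2+I*ρ)‖ / ‖Complex.Gamma (α + I*ρ)‖)^2 ≤ (C * 2^m * (1+ρ)^m)^2 := by
    gcongr
    refine h1.trans ?_
    rw [mul_assoc C (2^m), ← mul_pow]; gcongr
  rw [div_pow, div_eq_mul_inv] at h5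
  have h6 : exp (-(π*ρ)) * (‖Complex.Gamma (α + I*ρ)‖^2)⁻¹ ≤ (C * 2^m * (1+ρ)^m)^2 := by
    refine le_trans ?_ h5
    gcongr
    refine le_trans ?_ h4
    nlinarith [exp_pos (-(π*ρ)), pi_gt_three]
  rw [exp_neg, inv_mul_le_iff₀ (exp_pos _)] at h6
  refine h6.trans (le_of_eq ?_); ring

lemma G_2i (ρ : ℝ) (hρ : 0 < ρ) : ‖Complex.Gamma (2*I*ρ)‖^2 * (2*ρ * sinh (2*π*ρ)) = π := by
  have h := Gamma_mul_Gamma_one_sub (2*I*ρ)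
  have hne : (-(2*I*ρ):ℂ) ≠ 0 := by simp [hρ.ne']
  have h1 := Gamma_add_one _ hne
  rw [show (1 - 2*I*ρ : ℂ) = -(2*I*ρ) + 1 by ring, h1, show (-(2*I*ρ):ℂ) = conj (2*I*ρ) by simp [map_ofNat], Gamma_conj,
    show (Complex.Gamma (2*I*ρ) * (conj (2*I*ρ) * conj (Complex.Gamma (2*I*ρ)))) =
      conj (2*I*ρ) * (Complex.Gamma (2*I*ρ) * conj (Complex.Gamma (2*I*ρ))) by ring, mul_conj',
      show (π * (2*I*ρ) : ℂ) = ((2*π*ρ : ℝ):ℂ)*I by push_cast; ring, Complex.sin_mul_I, ← ofReal_sinh] at h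
  have hs : zR < sinh (2*π*ρ) := sinh_pos_iff.2 bpos
  have hsc : ((sinh (2*π*ρ) : ℝ):ℂ) ≠ 0 := by exact_mod_cast hs.ne'
  rw [eq_div_iff (mul_ne_zero hsc I_ne_zero), show (conj (2*I*ρ) : ℂ) = -(2*I*ρ) by simp [map_ofNat]] at h
  have : ((‖Complex.Gamma (2*I*ρ)‖^2 * (2*ρ * sinh (2*π*ρ)) : ℝ):ℂ) = (π:ℝ) := by
    rw [← h]; push_cast
    linear_combination (2 * (‖Complex.Gamma (2*I*ρ)‖:ℂ)^2 * ρ * Complex.sinh (2*π*ρ)) * I_sq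
  exact_mod_cast this

lemma W_eq (k₁ k₂ t φ : ℝ) (hk₂ : 0 < k₂) (hdiff : -(1/2) < k₂ - k₁) : ∃ C : ℝ, 0 < C ∧ ∀ ρ : ℝ, 0 < ρ →
    W0ₖ ρ / (1 - ‖hfun k₁ k₂ t ρ‖^2) = C * ‖Complex.Gamma ((k₂-k₁+1/2:ℝ) + I*ρ)‖^2 * ‖Complex.Gamma ((k₁+k₂-1/2:ℝ) + I*ρ)‖^2 *
      (ρ * sinh (2*π*ρ) / hden k₁ k₂ ρ) := by
  have g1 : 0 < ‖Complex.Gamma (2*k₂)‖ := norm_pos_iff.2 (Gamma_ne_zero_of_re_pos (by simpa))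
  have g2 : 0 < ‖Complex.Gamma (k₂-k₁+I*t+1)‖ := norm_pos_iff.2 (Gamma_ne_zero_of_re_pos bsl)
  refine ⟨(1 / (2 * π)) * exp (-t * (2 * φ - π)) * 4 * π / (‖Complex.Gamma (2*k₂)‖^2*‖Complex.Gamma (k₂-k₁+I*t+1)‖^2),
    by positivity, fun ρ hρ => ?_⟩
  have e1 := G_half_prod t ρ
  have e2 : ‖Complex.Gamma (1/2 - I*t + I*ρ)‖ = ‖Complex.Gamma (1/2+I*t-I*ρ)‖ := by
    rw [show (1/2 - I*t + I*ρ : ℂ) = conj (1/2+I*t-I*ρ : ℂ) by simp [map_ofNat]; ring, Gamma_conj, RCLike.norm_conj]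
  have e3 := G_2i ρ hρ
  have hd := hden_pos k₁ k₂ ρ hρ
  have p1 := cosh_pos (2*π*t)
  have p2 := cosh_pos (2*π*ρ)
  have hs : zR < sinh (2*π*ρ) := sinh_pos_iff.2 bpos
  have g3 : ‖Complex.Gamma (2*I*ρ)‖^2 = π / (2*ρ * sinh (2*π*ρ)) := by
    rw [eq_div_iff bpos]; exact e3
  rw [h_sq, W0]
  simp only [norm_div, norm_mul, mul_pow, div_pow]
  rw [e2, mul_assoc (‖Complex.Gamma _‖^2*‖Complex.Gamma _‖^2), e1, ]
  push_cast
  rw [show (‖Complex.Gamma (2*I*ρ)‖:ℝ)^2 = π / (2*ρ * sinh (2*π*ρ)) from g3]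
  have := pi_pos
  generalize ‖Complex.Gamma (2*k₂)‖ = X1 at *
  generalize ‖Complex.Gamma (k₂-k₁+I*t+1)‖ = X2 at *
  generalize ‖Complex.Gamma (k₂-k₁+1/2+I*ρ)‖ = X3 at *
  generalize ‖Complex.Gamma (k₁+k₂-1/2+I*ρ)‖ = X4 at *
  generalize cosh (2*π*t) = X5 at *
  generalize cosh (2*π*ρ) = X6 at *
  generalize sinh (2*π*ρ) = X7 at *
  generalize hden k₁ k₂ ρ = X8 at *
  field_simp
  ring

lemma sinh_le_mul_cosh (x : ℝ) (hx : 0 ≤ x) : sinh x ≤ x * cosh x := by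
  have h : MonotoneOn (fun x : ℝ => x * cosh x - sinh x) (Ici 0) := by
    refine monotoneOn_of_deriv_nonneg (convex_Ici 0) bfun bfun fun y hy => ?_
    have hd : HasDerivAt (fun x : ℝ => x * cosh x - sinh x) (1 * cosh y + y * sinh y - cosh y) y :=
      ((hasDerivAt_id y).mul (Real.hasDerivAt_cosh y)).sub (Real.hasDerivAt_sinh y)
    rw [hd.deriv]
    rw [interior_Ici] at hy
    have := mul_pos hy (sinh_pos_iff.2 hy)
    linarith
  have := h (mem_Ici.2 le_rfl) (mem_Ici.2 hx) hx
  simp at this; linarith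

lemma W_bound (k₁ k₂ t φ : ℝ) (hk₁ : 0 < k₁) (hk₂ : 0 < k₂) (hsum : 1/2 ≤ k₁ + k₂) (hdiff : -(1/2) < k₂ - k₁) :
    ∃ C : ℝ, 0 < C ∧ ∃ m : ℕ, ∀ ρ : ℝ, 0 < ρ →
    W0ₖ ρ / (1 - ‖hfun k₁ k₂ t ρ‖^2) ≤ C * (1+ρ)^m * exp (-(2*π*ρ)) := by
  obtain ⟨C0, hC0, h0⟩ := W_eq k₁ k₂ t φ hk₂ hdiff
  obtain ⟨C1, hC1, m1, h1⟩ := G_up aₖ blin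
  have key : ∃ C : ℝ, 0 < C ∧ ∃ m : ℕ, ∀ ρ : ℝ, 0 < ρ → ‖Complex.Gamma ((k₁+k₂-1/2:ℝ) + I*ρ)‖^2 *
      (ρ * sinh (2*π*ρ) / hden k₁ k₂ ρ) ≤ C * (1+ρ)^m * exp (-(π*ρ)) := by
    rcases hsum.lt_or_eq with hb | hb
    · obtain ⟨C2, hC2, m2, h2⟩ := G_up bₖ blin
      refine ⟨C2, hC2, m2+1, fun ρ hρ => ?_⟩
      have hd := hden_pos k₁ k₂ ρ hρ
      have hs : 0 < sinh (2*π*ρ) := sinh_pos_iff.2 bpos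
      have b : ρ * sinh (2*π*ρ) / hden k₁ k₂ ρ ≤ 1 + ρ := by
        rw [div_le_iff₀ hd]
        have : cosh (2*π*ρ) - 1 ≤ hden k₁ k₂ ρ := by
          unfold hden; linarith [neg_one_le_cos (2*π*(k₁-k₂))]
        refine le_trans ?_ (mul_le_mul_of_nonneg_left this blin)
        rw [mul_assoc 2, sinh_two_mul, cosh_two_mul, cosh_sq]
        have s1 : π*ρ ≤ sinh (π*ρ) := Real.self_le_sinh_iff.2 bpos
        have s2 : cosh (π*ρ) ≤ sinh (π*ρ) + 1 := by
          have := Real.cosh_sub_sinh (π*ρ)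
          have : exp (-(π*ρ)) ≤ 1 := exp_le_one_iff.2 (by have := pi_pos; nlinarith)
          linarith
        have s3 : ρ ≤ sinh (π*ρ) := le_trans (by nlinarith [pi_gt_three]) s1
        nlinarith [mul_le_mul_of_nonneg_left s2 (mul_nonneg hρ.le (hρ.le.trans s3)), mul_le_mul_of_nonneg_right s3 (hρ.le.trans s3)]
      refine (mul_le_mul (h2 ρ hρ.le) b bpos bpos).trans (le_of_eq ?_)
      ring
    · obtain ⟨C2, hC2, m2, h2⟩ := G_up 1 one_pos
      have hq : -1 < cos (2*π*(k₁-k₂)) := by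
        rw [← Real.cos_abs, ← Real.cos_pi]
        refine Real.cos_lt_cos_of_nonneg_of_le_pi (abs_nonneg _) le_rfl ?_
        have hpi := pi_pos
        rw [abs_lt]; constructor <;> nlinarith
      set q := cos (2*π*(k₁-k₂)) with hqd
      refine ⟨C2 * (2*π/(1+q)), mul_pos hC2 (div_pos bpos blin), m2, fun ρ hρ => ?_⟩
      have hd := hden_pos k₁ k₂ ρ hρ
      have hs : 0 < sinh (2*π*ρ) := sinh_pos_iff.2 bpos
      have e : ‖Complex.Gamma ((k₁+k₂-1/2:ℝ) + I*ρ)‖^2 = ‖Complex.Gamma ((1:ℝ) + I*ρ)‖^2 / ρ^2 := by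
        rw [← hb, sub_self, ofReal_zero, zero_add, ofReal_one, add_comm 1, Gamma_add_one _ (by simp [hρ.ne']), norm_mul, norm_mul,
          norm_I, norm_real, norm_of_nonneg hρ.le]
        field_simp
      have b : sinh (2*π*ρ) / (ρ * hden k₁ k₂ ρ) ≤ 2*π/(1+q) := by
        rw [div_le_div_iff₀ bpos blin]
        have s1 := sinh_le_mul_cosh (π*ρ) bpos
        have hq1 : q ≤ 1 := Real.cos_le_one _
        have c0 := cosh_pos (π*ρ)
        have s2 : (1+q) * cosh (π*ρ)^2 ≤ hden k₁ k₂ ρ := by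
          unfold hden
          rw [← hqd, mul_assoc 2, cosh_two_mul, Real.sinh_sq]
          nlinarith [mul_nonneg (sub_nonneg.2 hq1) (sub_nonneg.2 (one_le_pow₀ (n := 2) (Real.one_le_cosh (π*ρ))))]
        calc sinh (2*π*ρ) * (1+q) = 2 * (sinh (π*ρ) * cosh (π*ρ)) * (1+q) := by
              rw [mul_assoc 2, sinh_two_mul]; ring
          _ ≤ 2 * (π*ρ * cosh (π*ρ) * cosh (π*ρ)) * (1+q) := by
              have : 0 ≤ 1 + q := by linarith
              gcongr
          _ = 2 * π * ρ * ((1+q) * cosh (π*ρ)^2) := by ring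
          _ ≤ 2 * π * ρ * hden k₁ k₂ ρ := by gcongr
          _ = _ := by ring
      rw [e, show ‖Complex.Gamma ((1:ℝ) + I*ρ)‖^2 / ρ^2 * (ρ * sinh (2*π*ρ) / hden k₁ k₂ ρ) =
        ‖Complex.Gamma ((1:ℝ) + I*ρ)‖^2 * (sinh (2*π*ρ) / (ρ * hden k₁ k₂ ρ)) by field_simp]
      refine (mul_le_mul (h2 ρ hρ.le) b bpos bpos).trans (le_of_eq ?_)
      ring
  obtain ⟨C2, hC2, m2, h2⟩ := key
  refine ⟨C0*C1*C2, by positivity, m1+m2, fun ρ hρ => ?_⟩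
  have hd := hden_pos k₁ k₂ ρ hρ
  have hs : 0 < sinh (2*π*ρ) := sinh_pos_iff.2 bpos
  rw [h0 ρ hρ, mul_assoc]
  calc _ ≤ C0 * (C1 * (1+ρ)^m1 * exp (-(π*ρ))) * (C2 * (1+ρ)^m2 * exp (-(π*ρ))) :=
        mul_le_mul (mul_le_mul_of_nonneg_left (h1 ρ hρ.le) hC0.le) (h2 ρ hρ) bpos bpos
    _ = C0*C1*C2 * (1+ρ)^(m1+m2) * (exp (-(π*ρ)) * exp (-(π*ρ))) := by ring
    _ = _ := by rw [← exp_add]; congr 2; ring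

lemma gauss_sum (A B C : ℂ) (hA : 0 < A.re) (hB : 0 < B.re) (hC : A.re + B.re < C.re) :
    HasSum (hc A B C) (Complex.Gamma C * Complex.Gamma (C-A-B) / (Complex.Gamma (C-A) * Complex.Gamma (C-B))) := by
  obtain ⟨K, hK, h1⟩ := poch_ratio_bound A 1 one_ne_neg_nat
  have hb := (beta_series (c := fun n => poch A n / n.factorial) (C := K) (σ := A.re) hA (fun n => by
    have := h1 n; rwa [poch_one, one_re] at this) (u := B) (v := C - B) hB (by rw [sub_re]; linarith)).2
  have e : ∫ x in Ioo zR 1, xC^(B-1) * (1 - xC)^(C-B-1) * pser (fun n => poch A n / n.factorial) x =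
      Complex.Gamma B * Complex.Gamma (C-A-B) / Complex.Gamma (C-A) := by
    rw [show C - A = B + (C-A-B) by ring, show B + (C-A-B) - B = C-A-B by ring, ← beta_integral hB (by simp only [sub_re]; linarith)]
    refine setIntegral_congr_fun measurableSet_Ioo fun x hx => ?_
    beta_reduce
    have : pser (fun n => poch A n / n.factorial) x = (1-xC)^(-A) :=
      (binom_hasSum A (z := xC) (by rw [norm_real, norm_of_nonneg hx.1.le]; exact hx.2)).tsum_eq
    have hne : (1 - xC) ≠ 0 := by
      have : (1:ℝ) - x ≠ 0 := by linarith [hx.2]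
      exact_mod_cast this
    rw [this, mul_assoc, ← cpow_add _ _ hne]
    congr 2; ring
  rw [e] at hb
  have gB := Gamma_ne_zero_of_re_pos hB
  have gC := Gamma_ne_zero_of_re_pos (s := C) blin
  have gCB := Gamma_ne_zero_of_re_pos (s := C-B) (by rw [sub_re]; linarith)
  have gCA := Gamma_ne_zero_of_re_pos (s := C-A) (by rw [sub_re]; linarith)
  have := hb.mul_right (Complex.Gamma C / (Complex.Gamma B * Complex.Gamma (C-B)))
  rw [show Complex.Gamma B * Complex.Gamma (C-A-B) / Complex.Gamma (C-A) * (Complex.Gamma C / (Complex.Gamma B * Complex.Gamma (C-B))) =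
    Complex.Gamma C * Complex.Gamma (C-A-B) / (Complex.Gamma (C-A) * Complex.Gamma (C-B)) by field_simp] at this
  have e2 : ∀ n : ℕ, hc A B C n = poch A n / n.factorial * (Complex.Gamma (B+n) * Complex.Gamma (C-B) / Complex.Gamma (B+n+(C-B))) * (Complex.Gamma C / (Complex.Gamma B * Complex.Gamma (C-B))) := by
    intro n
    rw [show B + n + (C-B) = C + n by ring, Gamma_add_nat (ne_neg_nat_of_re_pos hB), Gamma_add_nat (ne_neg_nat_of_re_pos (by linarith : 0 < C.re)), hc]
    have := poch_ne_zero (ne_neg_nat_of_re_pos (by linarith : 0 < C.re)) n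
    have := fact_ne n
    field_simp
  rw [show hc A B C = _ from funext e2]; exact this

lemma hc_nonneg (a k ρ : ℝ) (hk : 0 ≤ k) (n : ℕ) : ((‖hc (a+I*ρ) (a-I*ρ) (k:ℝ) n‖:ℝ):ℂ) = hc (a+I*ρ) (a-I*ρ) (k:ℝ) n := by
  rw [hc, show (a - I*ρ : ℂ) = conj (a + I*ρ : ℂ) by simp [sub_eq_add_neg], poch_conj, mul_conj', ← norm_poch_real hk]
  simp

lemma F32_term (k₁ k₂ t : ℝ) (hk₁ : 0 < k₁) (hk₂ : 0 < k₂) (hdiff : -(1/2) < k₂ - k₁) (P : ℂ) (hP : P.re = k₂) :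
    ∃ C : ℝ, 0 < C ∧ ∀ (ρ : ℝ) (n : ℕ), ‖poch P n * (poch (k₂-k₁+1/2+I*ρ) n * poch (k₂-k₁+1/2-I*ρ) n) /
      (poch (2*k₂) n * poch (k₂-k₁+I*t+1) n) * 1^n / n.factorial‖ ≤
      C * ‖hc ((k₂-k₁+1/2:ℝ)+I*ρ) ((k₂-k₁+1/2:ℝ)-I*ρ) ((2*aₖ+k₁:ℝ)) n‖ := by
  have hD1 : ∀ m : ℕ, (2*k₂:ℂ) ≠ -m := ne_neg_nat_of_re_pos (by simpa)
  have hD2 : ∀ m : ℕ, (k₂-k₁+I*t+1:ℂ) ≠ -m := ne_neg_nat_of_re_pos bsl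
  have hD3 : ∀ m : ℕ, ((2*aₖ+k₁:ℝ):ℂ) ≠ -m := ne_neg_nat_of_re_pos (by rw [ofReal_re]; linarith)
  obtain ⟨C1, hC1, h1⟩ := poch_ratio_bound P (2*k₂) hD1
  obtain ⟨C2, hC2, h2⟩ := poch_ratio_bound ((2*aₖ+k₁:ℝ)) (k₂-k₁+I*t+1) hD2
  refine ⟨C1*C2, by positivity, fun ρ n => ?_⟩
  have e : poch P n * (poch (k₂-k₁+1/2+I*ρ) n * poch (k₂-k₁+1/2-I*ρ) n) /
      (poch (2*k₂) n * poch (k₂-k₁+I*t+1) n) * 1^n / n.factorial =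
      poch P n / poch (2*k₂) n * (poch ((2*aₖ+k₁:ℝ)) n / poch (k₂-k₁+I*t+1) n) *
      hc ((k₂-k₁+1/2:ℝ)+I*ρ) ((k₂-k₁+1/2:ℝ)-I*ρ) ((2*aₖ+k₁:ℝ)) n := by
    have n1 := poch_ne_zero hD1 n
    have n2 := poch_ne_zero hD2 n
    have n3 := poch_ne_zero hD3 n
    have n4 := fact_ne n
    rw [hc, one_pow, show ((k₂-k₁+1/2:ℝ):ℂ) = k₂-k₁+1/2 by push_cast; ring]
    generalize poch (2*k₂:ℂ) n = X1 at *
    generalize poch (k₂-k₁+I*t+1:ℂ) n = X2 at *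
    generalize poch ((2*aₖ+k₁:ℝ):ℂ) n = X3 at *
    generalize poch (k₂-k₁+1/2+I*ρ:ℂ) n = X4 at *
    generalize poch (k₂-k₁+1/2-I*ρ:ℂ) n = X5 at *
    field_simp
  rw [e, norm_mul]
  refine mul_le_mul_of_nonneg_right ?_ nnn
  rw [norm_mul]
  refine (mul_le_mul (h1 n) (h2 n) nnn bpos).trans (le_of_eq ?_)
  rw [mul_mul_mul_comm, ← rpow_add bpos, hP]
  have : k₂ - (2*(k₂:ℂ)).re + (((2*aₖ+k₁:ℝ):ℂ).re - (k₂-k₁+I*t+1:ℂ).re) = 0 := by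
    simp; ring
  rw [this, rpow_zero, mul_one]

lemma phi_bound (k₁ k₂ t φ x : ℝ) (hk₁ : 0 < k₁) (hk₂ : 0 < k₂) (hdiff : -(1/2) < k₂ - k₁) :
    Measurable (fun ρ : ℝ => phiCₖ ρ x) ∧
    ∃ C : ℝ, 0 < C ∧ ∃ m : ℕ, ∀ ρ : ℝ, 0 ≤ ρ → ‖phiCₖ ρ x‖ ≤ C * (1+ρ)^m * exp (π*ρ) := by
  set a := k₂ - k₁ + 1/2 with ha
  obtain ⟨C, hC, hT⟩ := F32_term k₁ k₂ t hk₁ hk₂ hdiff (k₂ - I*x) bsimp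
  have hg : ∀ ρ : ℝ, HasSum (fun n => ‖hc ((a:ℝ)+I*ρ) ((a:ℝ)-I*ρ) ((2*a+k₁:ℝ)) n‖)
      (‖Complex.Gamma ((2*a+k₁:ℝ))‖ * ‖Complex.Gamma k₁‖ * (‖Complex.Gamma ((k₂+1/2:ℝ) + I*ρ)‖^2)⁻¹) := by
    intro ρ
    have h := gauss_sum ((a:ℝ)+I*ρ) ((a:ℝ)-I*ρ) ((2*a+k₁:ℝ)) bsl bsl bsl
    have hs := h.summable.norm
    convert hs.hasSum using 1
    have h2 : ((∑' n, ‖hc ((a:ℝ)+I*ρ) ((a:ℝ)-I*ρ) ((2*a+k₁:ℝ)) n‖ : ℝ) : ℂ) = ∑' n, hc ((a:ℝ)+I*ρ) ((a:ℝ)-I*ρ) ((2*a+k₁:ℝ)) n := by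
      rw [Complex.ofReal_tsum]
      exact tsum_congr fun n => hc_nonneg a _ ρ blin n
    rw [h.tsum_eq] at h2
    have h3 := congrArg norm h2
    rw [norm_real, norm_of_nonneg (tsum_nonneg fun _ => norm_nonneg _)] at h3
    rw [h3, norm_div, norm_mul, norm_mul, show (((2*a+k₁:ℝ):ℂ) - (a+I*ρ) - (a - I*ρ)) = k₁ by push_cast; ring,
      show (((2*a+k₁:ℝ):ℂ) - (a - I*ρ)) = ((k₂+1/2:ℝ) + I*ρ) by rw [ha]; push_cast; ring,
      show (((2*a+k₁:ℝ):ℂ) - (a + I*ρ)) = conj ((k₂+1/2:ℝ) + I*ρ : ℂ) by rw [ha]; simp [map_ofNat]; ring, Gamma_conj, RCLike.norm_conj, sq, ← div_eq_mul_inv]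
  have hsm : ∀ ρ : ℝ, Summable fun n => ‖poch (k₂ - I*x) n * (poch (k₂-k₁+1/2+I*ρ) n * poch (k₂-k₁+1/2-I*ρ) n) /
      (poch (2*k₂) n * poch (k₂-k₁+I*t+1) n) * 1^n / n.factorial‖ := fun ρ =>
    Summable.of_nonneg_of_le (fun _ => norm_nonneg _) (hT ρ) ((hg ρ).summable.mul_left C)
  have hF : ∀ ρ : ℝ, F32 ((k₂ : ℂ) - I * x) ((k₂ : ℂ) - (k₁ : ℂ) + 1/2 + I * ρ)
      ((k₂ : ℂ) - (k₁ : ℂ) + 1/2 - I * ρ) (2 * (k₂ : ℂ)) ((k₂ : ℂ) - (k₁ : ℂ) + I * t + 1) 1 =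
      ∑' n : ℕ, poch (k₂ - I*x) n * (poch (k₂-k₁+1/2+I*ρ) n * poch (k₂-k₁+1/2-I*ρ) n) /
      (poch (2*k₂) n * poch (k₂-k₁+I*t+1) n) * 1^n / n.factorial := by
    intro ρ
    simp only [F32, pFq, List.map_cons, List.map_nil, List.prod_cons, List.prod_nil, mul_one]
  unfold phiC
  simp only [hF]
  constructor
  · refine Measurable.const_mul ?_ _
    have := measurable_tsum_on (fun n (ρ:ℝ) => poch (k₂ - I*x) n * (poch (k₂-k₁+1/2+I*ρ) n * poch (k₂-k₁+1/2-I*ρ) n) /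
      (poch (2*k₂) n * poch (k₂-k₁+I*t+1) n) * 1^n / n.factorial) (fun n => by
        have h := (continuous_poch n).measurable
        have h1 : Measurable fun ρ : ℝ => poch (k₂-k₁+1/2+I*ρ) n := h.comp bfun
        have h2 : Measurable fun ρ : ℝ => poch (k₂-k₁+1/2-I*ρ) n := h.comp bfun
        fun_prop) univ MeasurableSet.univ (fun ρ _ => (hsm ρ).of_norm)
    rwa [indicator_univ] at this
  · obtain ⟨C3, hC3, m, h3⟩ := G_lo (k₂+1/2) blin
    set pre := cexp (-2 * (φ : ℂ) * x) * pper k₁ t x *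
      (Complex.Gamma (1 - (k₁ : ℂ) + I * t + I * x) / Complex.Gamma ((k₁ : ℂ) + I * x + I * t))
    refine ⟨(‖pre‖ + 1) * (C * (‖Complex.Gamma ((2*a+k₁:ℝ))‖ * ‖Complex.Gamma k₁‖ + 1) * C3), by positivity, m, fun ρ hρ => ?_⟩
    rw [norm_mul]
    have h4 := tsum_of_norm_bounded ((hg ρ).mul_left C) (hT ρ)
    calc _ ≤ (‖pre‖+1) * (C * ((‖Complex.Gamma ((2*a+k₁:ℝ))‖ * ‖Complex.Gamma k₁‖ + 1) * (C3 * (1+ρ)^m * exp (π*ρ)))) := by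
          refine mul_le_mul blin (h4.trans ?_) nnn bpos
          have := h3 ρ hρ
          gcongr
          linarith
      _ = _ := by ring

lemma meas_deriv {M : Set ℂ} (hM : IsOpen M) {g : ℝ → ℂ → ℂ} (hg : ∀ ρ, DifferentiableOn ℂ (g ρ) M)
    (hm : ∀ z ∈ M, Measurable fun ρ => g ρ z) (z : ℂ) (hz : z ∈ M) : Measurable fun ρ => deriv (g ρ) z := by
  have hl : Tendsto (fun k : ℕ => (1/((k:ℂ)+1))) atTop (𝓝 0) := tendsto_one_div_add_atTop_nhds_zero_nat
  have hl2 : Tendsto (fun k : ℕ => z + (1/((k:ℂ)+1))) atTop (𝓝 z) := by simpa using hl.const_add z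
  obtain ⟨N, hN⟩ := eventually_atTop.1 (hl2.eventually (hM.mem_nhds hz))
  have hl3 : Tendsto (fun k : ℕ => (1/(((k+N:ℕ):ℂ)+1))) atTop (𝓝[≠] 0) := by
    refine tendsto_nhdsWithin_iff.2 ⟨(tendsto_add_atTop_iff_nat N).2 hl, Eventually.of_forall fun k => ?_⟩
    have : ((k+N:ℕ):ℂ)+1 ≠ 0 := by exact_mod_cast Nat.succ_ne_zero (k+N)
    simpa using this
  refine measurable_of_tendsto_metrizable (f := fun (k:ℕ) ρ => (1/(((k+N:ℕ):ℂ)+1))⁻¹ • (g ρ (z + (1/(((k+N:ℕ):ℂ)+1))) - g ρ z)) (fun k => ?_) ?_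
  · have h1 : Measurable fun ρ => g ρ (z + (1/(((k+N:ℕ):ℂ)+1))) := hm _ (hN (k+N) bomega)
    have h2 := hm z hz
    fun_prop
  · rw [tendsto_pi_nhds]
    intro ρ
    have := hasDerivAt_iff_tendsto_slope_zero.1 ((hg ρ).differentiableAt (hM.mem_nhds hz)).hasDerivAt
    exact this.comp hl3

lemma meas_iter {M : Set ℂ} (hM : IsOpen M) {g : ℝ → ℂ → ℂ} (hg : ∀ ρ, DifferentiableOn ℂ (g ρ) M)
    (hm : ∀ z ∈ M, Measurable fun ρ => g ρ z) (n : ℕ) : (∀ ρ, DifferentiableOn ℂ (iteratedDeriv n (g ρ)) M) ∧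
    ∀ z ∈ M, Measurable fun ρ => iteratedDeriv n (g ρ) z := by
  induction n with
  | zero => simpa [iteratedDeriv_zero] using ⟨hg, hm⟩
  | succ n ih =>
    simp only [iteratedDeriv_succ]
    exact ⟨fun ρ => (ih.1 ρ).deriv hM, fun z hz => meas_deriv hM ih.1 ih.2 z hz⟩

lemma meas_cont {D : Set ℂ} (hD : IsOpen D) (hDc : IsPreconnected D) {g : ℝ → ℂ → ℂ} (hg : ∀ ρ, DifferentiableOn ℂ (g ρ) D)
    (V : Set ℂ) (hV : IsOpen V) (z₀ : ℂ) (h0 : z₀ ∈ V) (hVD : V ⊆ D) (hm : ∀ z ∈ V, Measurable fun ρ => g ρ z) :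
    ∀ z ∈ D, Measurable fun ρ => g ρ z := by
  set M := interior {z | z ∈ D ∧ Measurable fun ρ => g ρ z} with hMd
  have hMo : IsOpen M := isOpen_interior
  have hMs : M ⊆ {z | z ∈ D ∧ Measurable fun ρ => g ρ z} := interior_subset
  have hVM : V ⊆ M := interior_maximal (fun z hz => ⟨hVD hz, hm z hz⟩) hV
  have key : D ⊆ M := by
    refine hDc.subset_of_closure_inter_subset hMo ⟨z₀, hVD h0, hVM h0⟩ ?_
    rintro z ⟨hz, hzD⟩
    obtain ⟨r, hr, hb⟩ := Metric.isOpen_iff.1 hD z hzD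
    obtain ⟨w, hw, hd⟩ := Metric.mem_closure_iff.1 hz (r/2) bpos
    have hsub : Metric.ball w (r/2) ⊆ D := fun y hy => hb (by
      rw [Metric.mem_ball] at hy ⊢
      rw [dist_comm] at hd
      linarith [dist_triangle y w z])
    refine interior_maximal (s := {z | z ∈ D ∧ Measurable fun ρ => g ρ z}) (t := Metric.ball w (r/2)) (fun y hy => ⟨hsub hy, ?_⟩) Metric.isOpen_ball hd
    have hs : ∀ ρ, HasSum (fun n : ℕ => ((n.factorial:ℂ)⁻¹ * (y - w)^n) * iteratedDeriv n (g ρ) w) (g ρ y) := by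
      intro ρ
      have := Complex.hasSum_taylorSeries_on_ball (f := g ρ) (c := w) (r := r/2) ((hg ρ).mono hsub) hy
      simpa [mul_assoc] using this
    have h2 := measurable_tsum_on (fun n ρ => ((n.factorial:ℂ)⁻¹ * (y - w)^n) * iteratedDeriv n (g ρ) w) (fun n =>
      ((meas_iter hMo (fun ρ => (hg ρ).mono fun z hz => (hMs hz).1) (fun z hz => (hMs hz).2) n).2 w hw).const_mul _)
      univ MeasurableSet.univ (fun ρ _ => (hs ρ).summable)
    rw [indicator_univ] at h2
    convert h2 using 2 with ρ
    exact (hs ρ).tsum_eq.symm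
  exact fun z hz => (hMs (key hz)).2

lemma energy {g g1 g2 : ℝ → ℂ} (hg : ∀ u, HasDerivAt g (g1 u) u) (hg1 : ∀ u, HasDerivAt g1 (g2 u) u) (τ A B : ℝ) (hA : 0 ≤ A) (hB : 0 ≤ B)
    (ode : ∀ u : ℝ, ((1+u^2 : ℝ):ℂ) * g2 u = ((2*τ - (2*A+1)*u : ℝ):ℂ) * g1 u - (B:ℂ) * g u) (u : ℝ) (hu : 0 ≤ u) :
    B * ‖g u‖^2 ≤ exp (4*|τ| * u) * (‖g1 0‖^2 + B * ‖g 0‖^2) := by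
  have hE : ∀ u : ℝ, HasDerivAt (fun u => ((1+u^2) * ‖g1 u‖^2 + B * ‖g u‖^2) * exp (-(4*|τ|)*u))
      ((4*τ - 4*A*u) * ‖g1 u‖^2 * exp (-(4*|τ|)*u) +
       ((1+u^2) * ‖g1 u‖^2 + B * ‖g u‖^2) * (exp (-(4*|τ|)*u) * (-(4*|τ|)))) u := by
    intro u
    have d1 := ((hasDerivAt_pow 2 u).const_add 1).mul (hg1 u).norm_sq
    have d2 := (hg u).norm_sq.const_mul B
    have d3 : HasDerivAt (fun u : ℝ => exp (-(4*|τ|)*u)) (exp (-(4*|τ|)*u) * (-(4*|τ|))) u := by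
      simpa using ((hasDerivAt_id u).const_mul (-(4*|τ|))).exp
    refine ((d1.add d2).mul d3).congr_deriv ?_
    congr 2
    have e := congrArg (fun w => inner ℝ (g1 u) w) (ode u)
    beta_reduce at e
    simp only [Complex.inner] at e ⊢
    have e1 : (conj (g1 u) * (((1+u^2:ℝ):ℂ) * g2 u)).re = (1+u^2) * (conj (g1 u) * g2 u).re := by
      rw [mul_left_comm, re_ofReal_mul]
    have e2 : (conj (g1 u) * (((2*τ - (2*A+1)*u : ℝ):ℂ) * g1 u - (B:ℂ) * g u)).re = (2*τ - (2*A+1)*u) * ‖g1 u‖^2 - B * (conj (g u) * g1 u).re := by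
      rw [mul_sub, sub_re, mul_left_comm, re_ofReal_mul, mul_left_comm (conj (g1 u)), re_ofReal_mul, mul_comm (conj (g1 u)) (g1 u), mul_conj']
      have : (conj (g1 u) * g u).re = (conj (g u) * g1 u).re := by simp; ring
      rw [this]; norm_cast
    have e3 : (g2 u * conj (g1 u)).re = (conj (g1 u) * g2 u).re := by rw [mul_comm]
    have e4 : (g1 u * conj (g u)).re = (conj (g u) * g1 u).re := by rw [mul_comm]
    rw [mul_comm _ (conj (g1 u)), mul_comm _ (conj (g1 u)), e1, e2] at e
    rw [e3, e4]
    push_cast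
    linear_combination 2 * e
  have hanti : AntitoneOn (fun u => ((1+u^2) * ‖g1 u‖^2 + B * ‖g u‖^2) * exp (-(4*|τ|)*u)) (Ici 0) := by
    refine antitoneOn_of_deriv_nonpos (convex_Ici 0) (fun u _ => (hE u).continuousAt.continuousWithinAt)
      (fun u _ => (hE u).differentiableAt.differentiableWithinAt) fun u hu => ?_
    rw [interior_Ici] at hu
    rw [(hE u).deriv]
    have h1 := le_abs_self τ
    have h2 : 0 ≤ A * u := mul_nonneg hA (le_of_lt hu)
    have h3 : (4*τ - 4*A*u) * ‖g1 u‖^2 ≤ 4*|τ| * ‖g1 u‖^2 := by gcongr; linarith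
    have h4 : ‖g1 u‖^2 ≤ (1+u^2) * ‖g1 u‖^2 + B * ‖g u‖^2 := by nlinarith [mul_nonneg hB (sq_nonneg ‖g u‖), mul_nonneg (sq_nonneg u) (sq_nonneg ‖g1 u‖)]
    have h5 := mul_le_mul_of_nonneg_left h4 (by positivity : 0 ≤ 4*|τ|)
    have h6 := exp_pos (-(4*|τ|)*u)
    nlinarith
  have := hanti (mem_Ici.2 le_rfl) (mem_Ici.2 hu) hu
  beta_reduce at this
  rw [neg_mul, exp_neg, ← div_eq_mul_inv, div_le_iff₀ (exp_pos _)] at this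
  simp at this
  nlinarith [mul_nonneg (by positivity : 0 ≤ 1 + u^2) (sq_nonneg ‖g1 u‖)]

lemma D_open : IsOpen {z : ℂ | 1 - z ∈ slitPlane} :=
  Complex.isOpen_slitPlane.preimage (by fun_prop : Continuous fun z : ℂ => 1 - z)

lemma D_conn : IsPreconnected {z : ℂ | 1 - z ∈ slitPlane} := by
  have h : IsPreconnected slitPlane := (Complex.starConvex_one_slitPlane.isPathConnected Complex.one_mem_slitPlane).isConnected.isPreconnected
  have := h.image (fun z : ℂ => 1 - z) bfun
  convert this using 1
  ext z
  constructor
  · intro hz; exact ⟨1 - z, hz, by ring⟩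
  · rintro ⟨w, hw, rfl⟩; simpa using hw

lemma half_bound (C : ℂ) (hC : 0 < C.re) : ∃ K : ℝ, 0 < K ∧ ∀ (A ρ : ℝ), 0 ≤ A → 0 ≤ ρ →
    ‖pser (hc (A+I*ρ) (A-I*ρ) C) (1/2)‖ ≤ K * 16^(A+ρ) ∧ ‖pser (dsh (hc (A+I*ρ) (A-I*ρ) C)) (1/2)‖ ≤ 2 * K * 16^(A+ρ) := by
  obtain ⟨K1, hK1, h1⟩ := poch_ratio_bound 1 C (ne_neg_nat_of_re_pos hC)
  set σ := (1:ℂ).re - C.re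
  obtain ⟨K2, hK2⟩ := (summable_pow_poly (σ+1) (x := 8/9) bnum bnum).tendsto_atTop_zero.bddAbove_range
  have hK2' : ∀ n : ℕ, nR^(σ+1) * (8/9:ℝ)^n ≤ K2 := fun n => hK2 ⟨n, rfl⟩
  have hK20 : 0 < K2 := lt_of_lt_of_le bpos (hK2' 0)
  refine ⟨K1*K2, by positivity, fun A ρ hA hρ => ?_⟩
  have hs : 0 ≤ A + ρ := by linarith
  have n1 : ‖(A + I*ρ : ℂ)‖ ≤ A + ρ := by
    refine (norm_add_le _ _).trans ?_
    simp [abs_of_nonneg hA, abs_of_nonneg hρ]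
  have n2 : ‖(A - I*ρ : ℂ)‖ ≤ A + ρ := by
    refine (norm_sub_le _ _).trans ?_
    simp [abs_of_nonneg hA, abs_of_nonneg hρ]
  have hb := binom_hasSum_real (s := A+ρ) (x := 3/4) hs bnum bnum
  set S : ℝ := (1 - 3/4 : ℝ)^(-(A+ρ)) with hS
  have hS0 : 0 ≤ S := by positivity
  have hSS : S * S = 16^(A+ρ) := by
    rw [hS, ← mul_rpow bnum bnum, rpow_neg bnum, ← Real.inv_rpow bnum]; norm_num
  have key : ∀ n : ℕ, nR * ‖hc (A+I*ρ) (A-I*ρ) C n‖ * (1/2)^n ≤ K1*K2*S * (‖poch ((A+ρ:ℝ):ℂ) n‖ / n.factorial * (3/4)^n) := by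
    intro n
    set P := ‖poch ((A+ρ:ℝ):ℂ) n‖ / n.factorial with hP
    have hf : zR < n.factorial := by positivity
    have e : ‖hc (A+I*ρ) (A-I*ρ) C n‖ = ‖poch (A+I*ρ) n‖ / n.factorial * (‖poch (A-I*ρ) n‖ / n.factorial) * ‖poch 1 n / poch C n‖ := by
      rw [hc, poch_one, norm_div, norm_mul, norm_mul, norm_div]
      have := norm_pos_iff.2 (poch_ne_zero (ne_neg_nat_of_re_pos hC) n)
      simp only [Complex.norm_natCast]
      field_simp
    have b1 : ‖hc (A+I*ρ) (A-I*ρ) C n‖ ≤ P * P * (K1 * nR^σ) := by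
      rw [e]
      gcongr
      · exact div_le_div_of_nonneg_right (norm_poch_le n1 n) hf.le
      · exact div_le_div_of_nonneg_right (norm_poch_le n2 n) hf.le
      · exact h1 n
    have b2 : P * (3/4)^n ≤ S := le_hasSum hb n fun m _ => by positivity
    have b3 : nR^(σ+1) = nR^σ * nR := by rw [rpow_add bpos, rpow_one]
    have b4 : (1/2:ℝ)^n = (8/9)^n * ((3/4)^n * (3/4)^n) := by rw [← mul_pow, ← mul_pow]; norm_num
    have hP0 : 0 ≤ P := by positivity
    calc nR * ‖hc (A+I*ρ) (A-I*ρ) C n‖ * (1/2)^n ≤ nR * (P * P * (K1 * nR^σ)) * (1/2)^n := by gcongr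
      _ = K1 * (nR^(σ+1) * (8/9:ℝ)^n) * (P * (3/4)^n) * (P * (3/4)^n) := by rw [b3, b4]; ring
      _ ≤ K1 * K2 * S * (P * (3/4)^n) := by
        gcongr
        exact hK2' n
  have hsum := hb.mul_left (K1*K2*S)
  rw [mul_assoc (K1*K2) S S, hSS] at hsum
  constructor
  · refine tsum_of_norm_bounded hsum fun n => le_trans ?_ (key n)
    rw [norm_mul, norm_pow, show ‖(1/2:ℂ)‖ = 1/2 by norm_num]
    have : ‖hc (A+I*ρ) (A-I*ρ) C n‖ ≤ nR * ‖hc (A+I*ρ) (A-I*ρ) C n‖ := by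
      nlinarith [norm_nonneg (hc (A+I*ρ) (A-I*ρ) C n), (Nat.cast_nonneg n : zR ≤ n)]
    gcongr
  · have hsh := (summable_nat_add_iff 1).2 hsum.summable
    have hle : ∑' n : ℕ, K1*K2*S * (‖poch ((A+ρ:ℝ):ℂ) (n+1)‖ / (n+1).factorial * (3/4)^(n+1)) ≤ K1*K2*16^(A+ρ) := by
      rw [← hsum.tsum_eq, hsum.summable.tsum_eq_zero_add]
      have : 0 ≤ K1*K2*S * (‖poch ((A+ρ:ℝ):ℂ) 0‖ / (Nat.factorial 0) * (3/4)^0) := by positivity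
      linarith
    refine (tsum_of_norm_bounded ((hsh.hasSum).mul_left 2) fun n => ?_).trans blin
    have k := key (n+1)
    rw [norm_mul, norm_pow, show ‖(1/2:ℂ)‖ = 1/2 by norm_num, dsh, norm_mul, show (nC+1) = ((n+1:ℕ):ℂ) by push_cast; ring, Complex.norm_natCast]
    refine le_trans ?_ (mul_le_mul_of_nonneg_left k (by norm_num : zR ≤ 2))
    push_cast
    rw [pow_succ]
    have : 0 ≤ ‖hc (A+I*ρ) (A-I*ρ) C (n+1)‖ * (1/2:ℝ)^n := by positivity
    nlinarith

lemma F_ode (F : ℂ → ℂ → ℂ → ℂ → ℂ) (hFan : ∀ a b c, AnalyticOnNhd ℂ (F a b c) {z | 1 - z ∈ slitPlane})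
    (hFeq : ∀ a b c z, ‖z‖ < 1 → F a b c z = F21 a b c z) (a b c : ℂ) (hcc : 0 < c.re) :
    (∀ z : ℂ, ‖z‖ < 1 → deriv (F a b c) z = pser (dsh (hc a b c)) z) ∧
    ∀ z, 1 - z ∈ slitPlane → z * (1-z) * deriv (deriv (F a b c)) z + (c - (a+b+1)*z) * deriv (F a b c) z - a*b*F a b c z = 0 := by
  have hD := ne_neg_nat_of_re_pos hcc
  have hP := hc_PB a b c hD
  have hev : ∀ z : ℂ, ‖z‖ < 1 → ∀ᶠ w in 𝓝 z, ‖w‖ < 1 := fun z hz => (continuous_norm.tendsto z).eventually (gt_mem_nhds hz)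
  have d1 : ∀ z : ℂ, ‖z‖ < 1 → deriv (F a b c) z = pser (dsh (hc a b c)) z := by
    intro z hz
    have : F a b c =ᶠ[𝓝 z] pser (hc a b c) := by
      filter_upwards [hev z hz] with w hw
      rw [hFeq _ _ _ _ hw, F21_pser]
    rw [this.deriv_eq]; exact (hP.hasDerivAt hz).deriv
  have d2 : ∀ z : ℂ, ‖z‖ < 1 → deriv (deriv (F a b c)) z = pser (dsh (dsh (hc a b c))) z := by
    intro z hz
    have : deriv (F a b c) =ᶠ[𝓝 z] pser (dsh (hc a b c)) := by
      filter_upwards [hev z hz] with w hw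
      exact d1 w hw
    rw [this.deriv_eq]; exact (hP.dsh.hasDerivAt hz).deriv
  refine ⟨d1, ?_⟩
  have an0 := hFan a b c
  have an1 := an0.deriv
  have an2 := an1.deriv
  have anid : AnalyticOnNhd ℂ (fun z : ℂ => z) {z | 1 - z ∈ slitPlane} := analyticOnNhd_id
  have anL : AnalyticOnNhd ℂ (fun z => z * (1-z) * deriv (deriv (F a b c)) z + (c - (a+b+1)*z) * deriv (F a b c) z - a*b*F a b c z)
      {z | 1 - z ∈ slitPlane} :=
    (((anid.mul (analyticOnNhd_const.sub anid)).mul an2).add ((analyticOnNhd_const.sub (analyticOnNhd_const.mul anid)).mul an1)).sub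
      ((analyticOnNhd_const (v := a*b)).mul an0)
  have := anL.eqOn_zero_of_preconnected_of_eventuallyEq_zero D_conn (z₀ := 0) bsimp (by
    filter_upwards [hev 0 bsimp] with z hz
    rw [d1 z hz, d2 z hz, hFeq _ _ _ _ hz, F21_pser]
    exact F21_ode a b c hD hz)
  exact fun z hz => this hz

lemma line_slit (v : ℝ) : 1 - ((1 + I*v)/2 : ℂ) ∈ slitPlane := by
  left; simp; norm_num

lemma F_bound (F : ℂ → ℂ → ℂ → ℂ → ℂ) (hFan : ∀ a b c, AnalyticOnNhd ℂ (F a b c) {z | 1 - z ∈ slitPlane})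
    (hFeq : ∀ a b c z, ‖z‖ < 1 → F a b c z = F21 a b c z) (A t v : ℝ) (hA : 0 < A) :
    ∃ K : ℝ, 0 < K ∧ ∀ ρ : ℝ, 0 ≤ ρ → ‖F (A+I*ρ) (A-I*ρ) (A+1/2+I*t) ((1+I*v)/2)‖ ≤ K * 16^ρ := by
  obtain ⟨K, hK, hb⟩ := half_bound (A+1/2+I*t) bsl
  obtain ⟨s, hs, u, hu, hsu⟩ : ∃ s : ℝ, s^2 = 1 ∧ ∃ u : ℝ, 0 ≤ u ∧ s*u = v := by
    rcases le_total 0 v with h | h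
    · exact ⟨1, by norm_num, v, h, by ring⟩
    · exact ⟨-1, by norm_num, -v, by linarith, by ring⟩
  refine ⟨sqrt (exp (4*|s*t| * u) * (1/A^2+1)) * K * 16^A, by positivity, fun ρ hρ => ?_⟩
  set f := F (A+I*ρ) (A-I*ρ) (A+1/2+I*t) with hf
  obtain ⟨hd, ode⟩ := F_ode F hFan hFeq (A+I*ρ) (A-I*ρ) (A+1/2+I*t) bsl
  rw [← hf] at hd ode
  have an0 := hFan (A+I*ρ) (A-I*ρ) (A+1/2+I*t)
  have an1 := an0.deriv
  have hz : ∀ u : ℝ, HasDerivAt (fun u : ℝ => ((1+I*(s*u:ℝ))/2 : ℂ)) (I*s/2) u := by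
    intro u
    have := (((ofRealCLM.hasDerivAt (x := u)).const_mul (I*s)).const_add 1).div_const 2
    have e : (fun u : ℝ => ((1+I*(s*u:ℝ))/2 : ℂ)) = fun x : ℝ => (1 + I*s*ofRealCLM x)/2 := by
      ext u; simp [mul_assoc]
    rw [e]
    exact this.congr_deriv bsimp
  have hg : ∀ u : ℝ, HasDerivAt (fun u : ℝ => f ((1+I*(s*u:ℝ))/2)) (I*s/2 * deriv f ((1+I*(s*u:ℝ))/2)) u := by
    intro u
    have h := (an0 ((1+I*(s*u:ℝ))/2) (line_slit _)).differentiableAt.hasDerivAt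
    refine (HasDerivAt.comp u h (hz u)).congr_deriv (mul_comm _ _)
  have hg1 : ∀ u : ℝ, HasDerivAt (fun u : ℝ => I*s/2 * deriv f ((1+I*(s*u:ℝ))/2)) (I*s/2 * (I*s/2 * deriv (deriv f) ((1+I*(s*u:ℝ))/2))) u := by
    intro u
    have h := (an1 ((1+I*(s*u:ℝ))/2) (line_slit _)).differentiableAt.hasDerivAt
    exact ((HasDerivAt.comp u h (hz u)).congr_deriv (mul_comm _ _)).const_mul _
  have hsc : (s:ℂ)^2 = 1 := by exact_mod_cast hs
  have en := energy hg hg1 (s*t) A (A^2+ρ^2) hA.le bpos (fun u => by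
    have o := ode ((1+I*(s*u:ℝ))/2) (line_slit _)
    generalize deriv (deriv f) ((1+I*(s*u:ℝ))/2) = f2 at *
    generalize deriv f ((1+I*(s*u:ℝ))/2) = f1 at *
    generalize f ((1+I*(s*u:ℝ))/2) = f0 at *
    push_cast at o ⊢
    have hI := I_sq
    generalize (I:ℂ) = i at *
    have hi4 : i^3 = -i := by rw [pow_succ, hI]; ring
    have hi5 : i^4 = 1 := by rw [show 4 = 2*2 by norm_num, pow_mul, hI]; norm_num
    have hs3 : (s:ℂ)^3 = s := by rw [pow_succ, hsc]; ring
    have hs4 : (s:ℂ)^4 = 1 := by rw [show 4 = 2*2 by norm_num, pow_mul, hsc]; norm_num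
    ring_nf at o ⊢
    simp only [hI, hsc] at o ⊢
    linear_combination (-1) * o) u hu
  beta_reduce at en
  rw [hsu] at en
  simp only [mul_zero, ofReal_zero, add_zero] at en
  obtain ⟨b0, b1⟩ := hb A ρ hA.le hρ
  rw [← F21_pser, ← hFeq _ _ _ _ bnum, ← hf] at b0
  rw [← hd _ bnum] at b1
  have h16 : (16:ℝ)^(A+ρ) = 16^A * 16^ρ := rpow_add bnum _ _
  have hn : ‖I*s/2 * deriv f (1/2)‖ ≤ K * 16^(A+ρ) := by
    have : ‖(s:ℂ)‖ = 1 := by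
      rw [norm_real, norm_eq_abs]
      exact (pow_eq_one_iff_of_nonneg (abs_nonneg s) two_ne_zero).1 (by rw [sq_abs, hs])
    rw [norm_mul, norm_div, norm_mul, this, norm_I, norm_ofNat]
    linarith
  have hB : A^2 ≤ A^2 + ρ^2 := by nlinarith
  have hfin : ‖f ((1+I*v)/2)‖^2 ≤ (exp (4*|s*t| * u) * (1/A^2+1)) * (K * 16^(A+ρ))^2 := by
    have hBp : 0 < A^2 + ρ^2 := by positivity
    have e1 : ‖I*s/2 * deriv f (1/2)‖^2 ≤ (K * 16^(A+ρ))^2 := by gcongr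
    have e2 : ‖f (1/2)‖^2 ≤ (K * 16^(A+ρ))^2 := by gcongr
    have e3 : (1:ℝ) ≤ (A^2+ρ^2) * (1/A^2) := by
      rw [mul_one_div, le_div_iff₀ bpos]; linarith
    refine le_of_mul_le_mul_left (en.trans ?_) hBp
    set X := (K * 16^(A+ρ))^2
    have hX : 0 ≤ X := sq_nonneg _
    calc _ ≤ exp (4*|s*t| * u) * (X + (A^2+ρ^2) * X) := by gcongr
      _ ≤ exp (4*|s*t| * u) * ((A^2+ρ^2) * (1/A^2) * X + (A^2+ρ^2) * X) := by
        gcongr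
        nlinarith
      _ = _ := by ring
  have := Real.sqrt_le_sqrt hfin
  rw [sqrt_sq nnn, Real.sqrt_mul bpos, sqrt_sq bpos, h16] at this
  linarith

def Gr (f : ℝ → ℂ) : Prop := Measurable f ∧ ∃ C : ℝ, 0 ≤ C ∧ ∃ m : ℕ, ∀ ρ : ℝ, 0 < ρ → ‖f ρ‖ ≤ C * (1+ρ)^m * 16^ρ

lemma Gr.add {f g : ℝ → ℂ} (hf : Gr f) (hg : Gr g) : Gr (fun ρ => f ρ + g ρ) := by
  obtain ⟨mf, C, hC, m, h⟩ := hf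
  obtain ⟨mg, C', hC', m', h'⟩ := hg
  refine ⟨mf.add mg, C + C', by positivity, m + m', fun ρ hρ => ?_⟩
  have e1 : (1+ρ)^m ≤ (1+ρ)^(m+m') := pow_le_pow_right₀ blin bomega
  have e2 : (1+ρ)^m' ≤ (1+ρ)^(m+m') := pow_le_pow_right₀ blin bomega
  calc _ ≤ ‖f ρ‖ + ‖g ρ‖ := norm_add_le _ _
    _ ≤ C * (1+ρ)^m * 16^ρ + C' * (1+ρ)^m' * 16^ρ := add_le_add (h ρ hρ) (h' ρ hρ)
    _ ≤ C * (1+ρ)^(m+m') * 16^ρ + C' * (1+ρ)^(m+m') * 16^ρ := by gcongr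
    _ = _ := by ring

lemma Gr.smul {f : ℝ → ℂ} (hf : Gr f) (c : ℂ) : Gr (fun ρ => c * f ρ) := by
  obtain ⟨mf, C, hC, m, h⟩ := hf
  refine ⟨mf.const_mul c, ‖c‖ * C, by positivity, m, fun ρ hρ => ?_⟩
  rw [norm_mul, mul_assoc, mul_assoc, ← mul_assoc C]
  exact mul_le_mul_of_nonneg_left (h ρ hρ) nnn

lemma Gr.conj {f : ℝ → ℂ} (hf : Gr f) : Gr (fun ρ => conj (f ρ)) := by
  obtain ⟨mf, C, hC, m, h⟩ := hf
  exact ⟨continuous_conj.measurable.comp mf, C, hC, m, fun ρ hρ => by rw [norm_conj]; exact h ρ hρ⟩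

lemma poch_poly (a : ℂ) (e : ℝ) (he : |e| = 1) (n : ℕ) (ρ : ℝ) (hρ : 0 ≤ ρ) : ‖poch (a + I*(e*ρ:ℝ)) n‖ ≤ (‖a‖+1+n)^n * (1+ρ)^n := by
  rw [poch, norm_prod, ← mul_pow]
  conv_rhs => rw [← Finset.card_range n, ← Finset.prod_const]
  refine Finset.prod_le_prod (fun _ _ => norm_nonneg _) fun k hk => ?_
  have hk' : (k:ℝ) ≤ n := by exact_mod_cast (Finset.mem_range.1 hk).le
  calc _ ≤ ‖a‖ + ‖I*(e*ρ:ℝ)‖ + ‖(k:ℂ)‖ := norm_add₃_le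
    _ = ‖a‖ + ρ + k := by
      rw [norm_mul, norm_I, norm_real, norm_eq_abs, abs_mul, he, abs_of_nonneg hρ, Complex.norm_natCast]; ring
    _ ≤ _ := by
      rw [Finset.card_range]
      nlinarith [norm_nonneg a, (Nat.cast_nonneg n : zR ≤ n), mul_nonneg (norm_nonneg a) hρ, mul_nonneg (Nat.cast_nonneg n : zR ≤ n) hρ]

lemma F_meas (F : ℂ → ℂ → ℂ → ℂ → ℂ) (hFan : ∀ a b c, AnalyticOnNhd ℂ (F a b c) {z | 1 - z ∈ slitPlane})
    (hFeq : ∀ a b c z, ‖z‖ < 1 → F a b c z = F21 a b c z) (a C : ℂ) (hC : 0 < C.re) (z : ℂ) (hz : 1 - z ∈ slitPlane) :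
    Measurable fun ρ : ℝ => F (a+I*ρ) (a-I*ρ) C z := by
  refine meas_cont (g := fun (ρ : ℝ) z => F (a+I*ρ) (a-I*ρ) C z) D_open D_conn (fun ρ => (hFan _ _ _).differentiableOn) (Metric.ball 0 1) Metric.isOpen_ball 0
    bsimp (fun w hw => ?_) (fun w hw => ?_) z hz
  · have := mem_ball_zero_iff.1 hw
    left
    have h2 := (abs_re_le_norm w)
    have := (le_abs_self w.re).trans h2
    simp; linarith
  · have hw' := mem_ball_zero_iff.1 hw
    have h := measurable_tsum_on (fun n (ρ : ℝ) => hc (a+I*ρ) (a-I*ρ) C n * w^n)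
      (fun n => (measurable_hc _ _ _ bfun bfun measurable_const n).mul_const _) univ MeasurableSet.univ
      (fun ρ _ => ((hc_PB _ _ _ (ne_neg_nat_of_re_pos hC)).summable hw').of_norm)
    rw [indicator_univ] at h
    convert h using 2 with ρ
    rw [hFeq _ _ _ _ hw', F21_pser]; rfl

lemma z_line (φ : ℝ) (h0 : 0 < φ) (h1 : φ < π) : 1 / (1 - cexp (2*I*φ)) = ((1 + I*(cos φ / sin φ : ℝ))/2 : ℂ) := by
  have hs : (sin φ : ℂ) ≠ 0 := by exact_mod_cast (Real.sin_pos_of_pos_of_lt_pi h0 h1).ne'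
  have e : cexp (2*I*φ) = (cos φ + sin φ * I)^2 := by
    rw [ofReal_cos, ofReal_sin, ← exp_mul_I, ← exp_nat_mul]; congr 1; push_cast; ring
  have hsc : (sin φ : ℂ)^2 + (cos φ:ℂ)^2 = 1 := by exact_mod_cast sin_sq_add_cos_sq φ
  rw [e]
  push_cast [-ofReal_sin, -ofReal_cos]
  generalize (sin φ : ℂ) = s at *
  generalize (cos φ : ℂ) = c at *
  have hm : (1 - (c + s*I)^2) * ((1 + I*(c/s))/2) = 1 := by
    have hI := I_sq
    field_simp
    linear_combination (s - I*c) * hsc + (-c*s^2*I - 2*c^2*s - s^3) * hI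
  exact (eq_one_div_of_mul_eq_one_right hm).symm

lemma q_Gr (k₁ k₂ t φ : ℝ) (hdiff : -(1/2) < k₂ - k₁) (h0 : 0 < φ) (h1 : φ < π) (F : ℂ → ℂ → ℂ → ℂ → ℂ)
    (hFan : ∀ a b c, AnalyticOnNhd ℂ (F a b c) {z | 1 - z ∈ slitPlane})
    (hFeq : ∀ a b c z, ‖z‖ < 1 → F a b c z = F21 a b c z) (n : ℕ) : Gr (qfun k₁ k₂ t φ F n) := by
  set A : ℝ := n + k₂ - k₁ + 1/2 with hAd
  have hA : 0 < A := by have := (Nat.cast_nonneg n : zR ≤ n); linarith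
  set v := cos φ / sin φ
  obtain ⟨K, hK, hb⟩ := F_bound F hFan hFeq A t v hA
  obtain ⟨c, hc⟩ : ∃ c : ℂ, ∀ ρ : ℝ, qfun k₁ k₂ t φ F n ρ = c * (poch (((k₂-k₁+1/2:ℝ):ℂ) + I*(1*ρ:ℝ)) n *
      poch (((k₂-k₁+1/2:ℝ):ℂ) + I*((-1)*ρ:ℝ)) n * F (A+I*ρ) (A-I*ρ) (A+1/2+I*t) ((1+I*v)/2)) := by
    refine ⟨cexp (((t * (2 * φ - π) : ℝ) : ℂ)) *
      (-cexp (-I * φ) / (1 - cexp (-2 * I * φ))) ^ (2 * (k₂ : ℂ) + n) * ((-1 : ℂ) ^ n * Complex.Gamma (2 * (k₂ : ℂ))) /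
      ((n.factorial : ℂ) * poch ((k₂ : ℂ) - k₁ + I * t + 1) n), fun ρ => ?_⟩
    rw [qfun, z_line φ h0 h1, show (nC + k₂ - k₁ + 1/2) = (A:ℂ) by rw [hAd]; push_cast; ring,
      show (nC + k₂ - k₁ + I*t + 1) = (A:ℂ) + 1/2 + I*t by rw [hAd]; push_cast; ring,
      show ((k₂-k₁+1/2:ℝ):ℂ) + I*(1*ρ:ℝ) = (k₂:ℂ) - k₁ + 1/2 + I*ρ by push_cast; ring,
      show ((k₂-k₁+1/2:ℝ):ℂ) + I*((-1)*ρ:ℝ) = (k₂:ℂ) - k₁ + 1/2 - I*ρ by push_cast; ring]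
    ring
  rw [show qfun k₁ k₂ t φ F n = _ from funext hc]
  refine Gr.smul ⟨?_, (‖((k₂-k₁+1/2:ℝ):ℂ)‖+1+n)^n * (‖((k₂-k₁+1/2:ℝ):ℂ)‖+1+n)^n * K, by positivity, n + n, fun ρ hρ => ?_⟩ c
  · have h := (continuous_poch n).measurable
    refine ((h.comp bfun).mul (h.comp bfun)).mul (F_meas F hFan hFeq _ _ bsl _ (line_slit v))
  · rw [norm_mul, norm_mul]
    calc _ ≤ ((‖((k₂-k₁+1/2:ℝ):ℂ)‖+1+n)^n * (1+ρ)^n) * ((‖((k₂-k₁+1/2:ℝ):ℂ)‖+1+n)^n * (1+ρ)^n) * (K * 16^ρ) := by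
          gcongr
          · exact poch_poly _ 1 bnum n ρ hρ.le
          · exact poch_poly _ (-1) bnum n ρ hρ.le
          · exact hb ρ hρ.le
      _ = _ := by rw [pow_add]; ring

lemma span_Gr (k₁ k₂ t φ : ℝ) (hdiff : -(1/2) < k₂ - k₁) (h0 : 0 < φ) (h1 : φ < π) (F : ℂ → ℂ → ℂ → ℂ → ℂ)
    (hFan : ∀ a b c, AnalyticOnNhd ℂ (F a b c) {z | 1 - z ∈ slitPlane})
    (hFeq : ∀ a b c z, ‖z‖ < 1 → F a b c z = F21 a b c z) (f : ℝ → ℂ × ℂ)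
    (hf : f ∈ Submodule.span ℂ (Set.range (qpair k₁ k₂ t φ F))) : Gr (fun ρ => (f ρ).1) ∧ Gr (fun ρ => (f ρ).2) := by
  induction hf using Submodule.span_induction with
  | mem x hx =>
    obtain ⟨n, rfl⟩ := hx
    have := q_Gr k₁ k₂ t φ hdiff h0 h1 F hFan hFeq n
    exact ⟨this.conj, this⟩
  | zero =>
    have : Gr (fun _ => 0) := ⟨measurable_const, 0, le_rfl, 0, fun ρ _ => by simp⟩
    exact ⟨this, this⟩
  | add x y _ _ hx hy => exact ⟨hx.1.add hy.1, hx.2.add hy.2⟩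
  | smul a x _ hx => exact ⟨hx.1.smul a, hx.2.smul a⟩

lemma eps_pos : 0 < π - Real.log 16 := by
  have h : Real.log 16 = 4 * Real.log 2 := by
    rw [show (16:ℝ) = 2^4 by norm_num, Real.log_pow]; norm_num
  have := Real.log_two_lt_d9
  have := pi_gt_three
  rw [h]; linarith

lemma rpow16 (ρ : ℝ) : (16:ℝ)^ρ = exp (Real.log 16 * ρ) := by
  rw [rpow_def_of_pos bnum]

lemma int_g {E : Type*} [NormedAddCommGroup E] {u : ℝ → E} (mu : AEStronglyMeasurable u) (z : ∀ ρ ≤ 0, u ρ = 0) (C : ℝ) (hC : 0 ≤ C) (m : ℕ)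
    (hb : ∀ ρ : ℝ, 0 < ρ → ‖u ρ‖ ≤ C * (1+ρ)^m * exp (-((π - Real.log 16)*ρ))) : Integrable u := by
  have he := eps_pos
  set ε := π - Real.log 16
  set δ := ε/2 with hδ
  have hd : 0 < δ := by positivity
  have hi : IntegrableOn (fun ρ : ℝ => C * (m.factorial / δ^m * exp δ) * exp (-δ*ρ)) (Ioi 0) :=
    (exp_neg_integrableOn_Ioi 0 hd).const_mul _
  have hu : IntegrableOn u (Ioi 0) := by
    refine hi.mono' mu.restrict ?_
    filter_upwards [ae_restrict_mem measurableSet_Ioi] with ρ hρ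
    refine (hb ρ hρ).trans ?_
    have hρ' : 0 < 1 + ρ := by have := mem_Ioi.1 hρ; linarith
    have k := Real.pow_div_factorial_le_exp (δ*(1+ρ)) bpos m
    have k2 : (1+ρ)^m ≤ m.factorial / δ^m * (exp δ * exp (δ*ρ)) := by
      rw [← exp_add, show δ + δ*ρ = δ*(1+ρ) by ring]
      rw [mul_pow, div_le_iff₀ bpos] at k
      rw [div_mul_eq_mul_div, le_div_iff₀ bpos]
      linarith
    calc _ ≤ C * (m.factorial / δ^m * (exp δ * exp (δ*ρ))) * exp (-(ε*ρ)) := by gcongr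
      _ = C * (m.factorial / δ^m * exp δ) * (exp (δ*ρ) * exp (-(ε*ρ))) := by ring
      _ = _ := by rw [← exp_add]; congr 2; rw [hδ]; ring
  refine (integrableOn_iff_integrable_of_support_subset fun ρ hρ => ?_).1 hu
  by_contra h
  exact hρ (z ρ (not_lt.1 h))

def wt (k₁ k₂ t φ ρ : ℝ) : ℝ := W0ₖ ρ / (1 - ‖hfun k₁ k₂ t ρ‖^2)

set_option hygiene false in
local notation "wtₖ" => wt k₁ k₂ t φ

def ZF (k₁ k₂ t φ : ℝ) (f : ℝ → ℂ × ℂ) : ℝ → ℂ :=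
  (Ioi 0).indicator fun ρ => ((f ρ).1 - hfun k₁ k₂ t ρ * (f ρ).2) * (wtₖ ρ : ℂ)

set_option hygiene false in
local notation "ZFₖ" => ZF k₁ k₂ t φ

def ZG (k₁ k₂ t φ : ℝ) (f : ℝ → ℂ × ℂ) : ℝ → ℂ :=
  (Ioi 0).indicator fun ρ => conj ((f ρ).2 - conj (hfun k₁ k₂ t ρ) * (f ρ).1) * (wtₖ ρ : ℂ)

set_option hygiene false in
local notation "ZGₖ" => ZG k₁ k₂ t φ

def Nd (k₁ k₂ t φ : ℝ) (f : ℝ → ℂ × ℂ) (ρ : ℝ) : ℝ :=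
  (‖(f ρ).1‖^2 + ‖(f ρ).2‖^2 - 2*(hfun k₁ k₂ t ρ * conj (f ρ).1 * (f ρ).2).re) * wtₖ ρ

lemma Qd_Z (k₁ k₂ t φ : ℝ) (hk₂ : 0 < k₂) (hdiff : -(1/2) < k₂ - k₁) (f : ℝ → ℂ × ℂ) :
    Qdₖ (ZFₖ f) (ZGₖ f) = (Ioi 0).indicator (Nd k₁ k₂ t φ f) := by
  ext ρ
  by_cases hρ : ρ ∈ Ioi zR
  · have hW := W0_pos k₁ k₂ t φ ρ hk₂ hρ hdiff
    have hh := h_lt k₁ k₂ t ρ hρ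
    rw [Qd, ZF, ZG, indicator_of_mem hρ, indicator_of_mem hρ, indicator_of_mem hρ, Nd]
    have e : wtₖ ρ * (1 - ‖hfun k₁ k₂ t ρ‖^2) = W0ₖ ρ := by rw [wt]; field_simp
    rw [div_eq_iff hW.ne', ← e]
    generalize wtₖ ρ = w
    generalize (f ρ).1 = a
    generalize (f ρ).2 = b
    generalize hfun k₁ k₂ t ρ = h
    simp only [norm_mul, mul_pow, norm_real, norm_eq_abs, sq_abs, ← normSq_eq_norm_sq, normSq_apply,
      Complex.mul_re, Complex.mul_im, sub_re, Complex.sub_im, Complex.conj_re, Complex.conj_im, ofReal_re, Complex.ofReal_im]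
    ring
  · simp [Qd, ZF, ZG, hρ]

lemma Gr.of_pair {f g : ℝ → ℂ × ℂ} (c : ℂ) (hf : Gr (fun ρ => (f ρ).1) ∧ Gr (fun ρ => (f ρ).2)) (hg : Gr (fun ρ => (g ρ).1) ∧ Gr (fun ρ => (g ρ).2)) :
    Gr (fun ρ => ((fun ρ => f ρ + c • g ρ) ρ).1) ∧ Gr (fun ρ => ((fun ρ => f ρ + c • g ρ) ρ).2) :=
  ⟨hf.1.add (hg.1.smul c), hf.2.add (hg.2.smul c)⟩

lemma wt_meas (k₁ k₂ t φ : ℝ) : Measurable (wtₖ) :=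
  (W0_meas k₁ k₂ t φ).div ((h_meas k₁ k₂ t).norm.pow_const 2 |>.const_sub 1)

lemma adm_Z (k₁ k₂ t φ : ℝ) (hk₁ : 0 < k₁) (hk₂ : 0 < k₂) (hsum : 1/2 ≤ k₁ + k₂) (hdiff : -(1/2) < k₂ - k₁) {f : ℝ → ℂ × ℂ}
    (h1 : Gr (fun ρ => (f ρ).1)) (h2 : Gr (fun ρ => (f ρ).2)) : Admₖ (ZFₖ f) (ZGₖ f) := by
  obtain ⟨m1, C1, hC1, n1, b1⟩ := h1
  obtain ⟨m2, C2, hC2, n2, b2⟩ := h2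
  have mh := h_meas k₁ k₂ t
  have mw := wt_meas k₁ k₂ t φ
  have mc : Measurable (fun z : ℂ => conj z) := continuous_conj.measurable
  have mF : Measurable (ZFₖ f) := Measurable.indicator bfun measurableSet_Ioi
  have mG : Measurable (ZGₖ f) := Measurable.indicator
    ((mc.comp (m2.sub ((mc.comp mh).mul m1))).mul (measurable_ofReal.comp mw)) measurableSet_Ioi
  have zF : ∀ ρ ≤ 0, ZFₖ f ρ = 0 := fun ρ hρ => indicator_of_notMem (by simpa using hρ) _
  have zG : ∀ ρ ≤ 0, ZGₖ f ρ = 0 := fun ρ hρ => indicator_of_notMem (by simpa using hρ) _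
  obtain ⟨Cw, hCw, mW, bW⟩ := W_bound k₁ k₂ t φ hk₁ hk₂ hsum hdiff
  have hw0 : ∀ ρ : ℝ, 0 < ρ → 0 ≤ wtₖ ρ := fun ρ hρ => (div_pos (W0_pos k₁ k₂ t φ ρ hk₂ hρ hdiff) (h_lt k₁ k₂ t ρ hρ)).le
  have hh1 : ∀ ρ : ℝ, 0 < ρ → ‖hfun k₁ k₂ t ρ‖ ≤ 1 := fun ρ hρ => by
    have := h_lt k₁ k₂ t ρ hρ
    nlinarith [norm_nonneg (hfun k₁ k₂ t ρ)]
  set C := C1 + C2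
  set n := n1 + n2
  have bs : ∀ ρ : ℝ, 0 < ρ → ‖(f ρ).1‖ + ‖(f ρ).2‖ ≤ C * (1+ρ)^n * 16^ρ := fun ρ hρ => by
    have e1 : (1+ρ)^n1 ≤ (1+ρ)^n := pow_le_pow_right₀ blin bomega
    have e2 : (1+ρ)^n2 ≤ (1+ρ)^n := pow_le_pow_right₀ blin bomega
    calc _ ≤ C1 * (1+ρ)^n1 * 16^ρ + C2 * (1+ρ)^n2 * 16^ρ := add_le_add (b1 ρ hρ) (b2 ρ hρ)
      _ ≤ C1 * (1+ρ)^n * 16^ρ + C2 * (1+ρ)^n * 16^ρ := by gcongr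
      _ = _ := by ring
  have bF : ∀ ρ : ℝ, 0 < ρ → ‖ZFₖ f ρ‖ ≤ (‖(f ρ).1‖ + ‖(f ρ).2‖) * wtₖ ρ := fun ρ hρ => by
    rw [ZF, indicator_of_mem (mem_Ioi.2 hρ), norm_mul, norm_real, norm_of_nonneg (hw0 ρ hρ)]
    refine mul_le_mul_of_nonneg_right ((norm_sub_le _ _).trans ?_) (hw0 ρ hρ)
    rw [norm_mul]
    nlinarith [norm_nonneg (f ρ).2, hh1 ρ hρ]
  have bG : ∀ ρ : ℝ, 0 < ρ → ‖ZGₖ f ρ‖ ≤ (‖(f ρ).1‖ + ‖(f ρ).2‖) * wtₖ ρ := fun ρ hρ => by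
    rw [ZG, indicator_of_mem (mem_Ioi.2 hρ), norm_mul, norm_real, norm_of_nonneg (hw0 ρ hρ), norm_conj]
    refine mul_le_mul_of_nonneg_right ((norm_sub_le _ _).trans ?_) (hw0 ρ hρ)
    rw [norm_mul, norm_conj]
    nlinarith [norm_nonneg (f ρ).1, hh1 ρ hρ]
  have iP : ∀ (Z : ℝ → ℂ), Measurable Z → (∀ ρ ≤ 0, Z ρ = 0) → (∀ ρ : ℝ, 0 < ρ → ‖Z ρ‖ ≤ (‖(f ρ).1‖ + ‖(f ρ).2‖) * wtₖ ρ) →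
      ∀ x : ℝ, Integrable (fun ρ : ℝ => Z ρ * phiCₖ ρ x) := by
    intro Z mZ zZ bZ x
    obtain ⟨mp, Cp, hCp, np, bp⟩ := phi_bound k₁ k₂ t φ x hk₁ hk₂ hdiff
    refine int_g (mZ.mul mp).aestronglyMeasurable (fun ρ hρ => by rw [zZ ρ hρ, zero_mul]) (C*Cw*Cp) bpos (n+mW+np) fun ρ hρ => ?_
    rw [norm_mul]
    calc _ ≤ (C * (1+ρ)^n * 16^ρ * (Cw * (1+ρ)^mW * exp (-(2*π*ρ)))) * (Cp * (1+ρ)^np * exp (π*ρ)) := by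
          have := hw0 ρ hρ
          gcongr
          · exact (bZ ρ hρ).trans (mul_le_mul (bs ρ hρ) (bW ρ hρ) this bpos)
          · exact bp ρ hρ.le
      _ = C*Cw*Cp * (1+ρ)^(n+mW+np) * (16^ρ * exp (-(2*π*ρ)) * exp (π*ρ)) := by rw [pow_add, pow_add]; ring
      _ = _ := by rw [rpow16, ← exp_add, ← exp_add]; congr 2; ring
  refine ⟨mF, mG, zF, zG, ?_, fun x _ => iP _ mF zF bF x, fun x _ => iP _ mG zG bG x⟩
  rw [Qd_Z k₁ k₂ t φ hk₂ hdiff]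
  have mN : Measurable (Nd k₁ k₂ t φ f) := by
    have := (Complex.measurable_re.comp ((mh.mul (mc.comp m1)).mul m2)).const_mul 2
    exact (((m1.norm.pow_const 2).add (m2.norm.pow_const 2)).sub this).mul mw
  refine int_g (mN.indicator measurableSet_Ioi).aestronglyMeasurable (fun ρ hρ => indicator_of_notMem (by simpa using hρ) _) (C*C*Cw) bpos (n+n+mW)
    fun ρ hρ => ?_
  rw [indicator_of_mem (mem_Ioi.2 hρ), Nd, norm_mul, norm_of_nonneg (hw0 ρ hρ)]
  have q : ‖‖(f ρ).1‖^2 + ‖(f ρ).2‖^2 - 2*(hfun k₁ k₂ t ρ * conj (f ρ).1 * (f ρ).2).re‖ ≤ (‖(f ρ).1‖ + ‖(f ρ).2‖)^2 := by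
    have r := abs_re_le_norm (hfun k₁ k₂ t ρ * conj (f ρ).1 * (f ρ).2)
    rw [norm_mul, norm_mul, norm_conj] at r
    have r2 := mul_le_mul_of_nonneg_right (hh1 ρ hρ) (mul_nonneg (norm_nonneg (f ρ).1) (norm_nonneg (f ρ).2))
    rw [← mul_assoc] at r2
    rw [norm_eq_abs]
    have r3 := abs_le.1 (r.trans r2)
    rw [abs_le]; constructor <;> nlinarith [norm_nonneg (f ρ).1, norm_nonneg (f ρ).2, mul_nonneg (norm_nonneg (f ρ).1) (norm_nonneg (f ρ).2)]
  have he := eps_pos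
  calc _ ≤ (C * (1+ρ)^n * 16^ρ)^2 * (Cw * (1+ρ)^mW * exp (-(2*π*ρ))) := by
        have := hw0 ρ hρ
        gcongr
        · exact q.trans (pow_le_pow_left₀ bpos (bs ρ hρ) 2)
        · exact bW ρ hρ
    _ = C*C*Cw * (1+ρ)^(n+n+mW) * (16^ρ * 16^ρ * exp (-(2*π*ρ))) := by rw [pow_add, pow_add]; ring
    _ ≤ _ := by
      gcongr
      rw [rpow16, ← exp_add, ← exp_add, exp_le_exp]
      nlinarith [mul_pos he hρ]

lemma Fop_Z {k₁ k₂ t φ : ℝ} {f : ℝ → ℂ × ℂ} (h : Admₖ (ZFₖ f) (ZGₖ f)) (x : ℝ) (hx : x ≠ -t) :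
    Fop k₁ k₂ t φ f x = Ufₖ (ZFₖ f) x + conj (Ufₖ (ZGₖ f) x) := by
  have i2 : Integrable (fun ρ : ℝ => conj (ZGₖ f ρ * phiCₖ ρ x)) := Complex.conjCLE.toContinuousLinearMap.integrable_comp (h.iG x hx)
  rw [Uf, Uf, ← integral_conj, ← integral_add (h.iF x hx) i2, Fop, ← integral_indicator measurableSet_Ioi]
  congr 1
  ext ρ
  by_cases hρ : ρ ∈ Ioi zR
  · rw [ZF, ZG, indicator_of_mem hρ, indicator_of_mem hρ, indicator_of_mem hρ]
    simp only [map_mul, conj_conj, conj_ofReal, wt]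
    ring
  · simp [ZF, ZG, hρ]

lemma Uf_lin {k₁ k₂ t φ x : ℝ} (c : ℂ) {F F' F'' : ℝ → ℂ} (h : Integrable (fun ρ : ℝ => F ρ * phiCₖ ρ x))
    (h' : Integrable (fun ρ : ℝ => F' ρ * phiCₖ ρ x)) (e : ∀ ρ, F'' ρ = F ρ + c * F' ρ) :
    Ufₖ F'' x = Ufₖ F x + c * Ufₖ F' x := by
  rw [Uf, Uf, Uf, ← integral_const_mul, ← integral_add h (h'.const_mul c)]
  congr 1; ext ρ; rw [e]; ring

lemma ZF_lin (k₁ k₂ t φ : ℝ) (c : ℂ) (f g : ℝ → ℂ × ℂ) (ρ : ℝ) :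
    ZFₖ (fun ρ => f ρ + c • g ρ) ρ = ZFₖ f ρ + c * ZFₖ g ρ := by
  by_cases hρ : ρ ∈ Ioi zR
  · simp only [ZF, indicator_of_mem hρ, Prod.fst_add, Prod.snd_add, Prod.smul_fst, Prod.smul_snd, smul_eq_mul]; ring
  · simp [ZF, hρ]

lemma ZG_lin (k₁ k₂ t φ : ℝ) (c : ℂ) (f g : ℝ → ℂ × ℂ) (ρ : ℝ) :
    ZGₖ (fun ρ => f ρ + c • g ρ) ρ = ZGₖ f ρ + conj c * ZGₖ g ρ := by
  by_cases hρ : ρ ∈ Ioi zR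
  · simp only [ZG, indicator_of_mem hρ, Prod.fst_add, Prod.snd_add, Prod.smul_fst, Prod.smul_snd, smul_eq_mul, map_add, map_sub, map_mul]; ring
  · simp [ZG, hρ]

lemma Nd_c (k₁ k₂ t φ : ℝ) (f : ℝ → ℂ × ℂ) (ρ : ℝ) : (Nd k₁ k₂ t φ f ρ : ℂ) = ((f ρ).1 * conj (f ρ).1 + (f ρ).2 * conj (f ρ).2 -
    hfun k₁ k₂ t ρ * conj (f ρ).1 * (f ρ).2 - conj (hfun k₁ k₂ t ρ) * conj (f ρ).2 * (f ρ).1) * wtₖ ρ := by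
  rw [mul_conj', mul_conj', Nd]
  have := Complex.add_conj (hfun k₁ k₂ t ρ * conj (f ρ).1 * (f ρ).2)
  push_cast at this ⊢
  rw [← this]
  simp only [map_mul, conj_conj]
  ring

theorem hahn_transform_isometry' (k₁ k₂ : ℝ) (hk₁ : 0 < k₁) (hk₂ : 0 < k₂)
    (hsum : 1 / 2 ≤ k₁ + k₂) (hdiff : -(1 / 2) < k₂ - k₁) (t φ : ℝ) (f g : ℝ → ℂ × ℂ)
    (hf : Gr (fun ρ => (f ρ).1) ∧ Gr (fun ρ => (f ρ).2)) (hg : Gr (fun ρ => (g ρ).1) ∧ Gr (fun ρ => (g ρ).2)) :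
    (∫ x : ℝ, Fop k₁ k₂ t φ f x * conj (Fop k₁ k₂ t φ g x) * wfun k₁ k₂ t φ x) =
      ∫ ρ in Ioi zR, (conj (g ρ).1 * (f ρ).1 - hfun k₁ k₂ t ρ * conj (g ρ).1 * (f ρ).2 -
        conj (hfun k₁ k₂ t ρ) * conj (g ρ).2 * (f ρ).1 + conj (g ρ).2 * (f ρ).2) *
        (((W0ₖ ρ / (1 - ‖hfun k₁ k₂ t ρ‖ ^ 2)) : ℝ) : ℂ) := by
  have ad : ∀ c : ℂ, Admₖ (ZFₖ fun ρ => f ρ + c • g ρ) (ZGₖ fun ρ => f ρ + c • g ρ) := fun c =>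
    adm_Z k₁ k₂ t φ hk₁ hk₂ hsum hdiff (Gr.of_pair c hf hg).1 (Gr.of_pair c hf hg).2
  have adf := adm_Z k₁ k₂ t φ hk₁ hk₂ hsum hdiff hf.1 hf.2
  have adg := adm_Z k₁ k₂ t φ hk₁ hk₂ hsum hdiff hg.1 hg.2
  refine (polar0 _ (fun c => Sfₖ (ZFₖ fun ρ => f ρ + c • g ρ) (ZGₖ fun ρ => f ρ + c • g ρ)) _
    (fun c => Nd k₁ k₂ t φ fun ρ => f ρ + c • g ρ) 1 ?_ ?_ ?_).trans ((congrArg (· * _) ofReal_one).trans (one_mul _))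
  · filter_upwards [Measure.ae_ne volume (-t)] with x hx
    have sf : ∀ c : ℂ, Sfₖ (ZFₖ fun ρ => f ρ + c • g ρ) (ZGₖ fun ρ => f ρ + c • g ρ) x =
        ‖Fop k₁ k₂ t φ f x + c * Fop k₁ k₂ t φ g x‖^2 * wRₖ x := fun c => by
      rw [Sf, Uf_lin c (adf.iF x hx) (adg.iF x hx) (ZF_lin k₁ k₂ t φ c f g), Uf_lin (conj c) (adf.iG x hx) (adg.iG x hx) (ZG_lin k₁ k₂ t φ c f g),
        Fop_Z adf x hx, Fop_Z adg x hx]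
      congr 3
      simp only [map_add, map_mul, conj_conj]; ring
    simp only [sf]
    rw [polar_pt, wfun_eq]; push_cast; ring
  · refine Eventually.of_forall fun ρ => ?_
    simp only [Nd_c, Prod.fst_add, Prod.snd_add, Prod.smul_fst, Prod.smul_snd, smul_eq_mul, map_add, map_mul, map_neg, map_one, conj_I]
    rw [← wt]
    generalize (wtₖ ρ : ℂ) = w
    generalize hfun k₁ k₂ t ρ = h
    generalize (f ρ).1 = a
    generalize (f ρ).2 = b
    generalize (g ρ).1 = p
    generalize (g ρ).2 = q
    linear_combination (1/2) * ((conj p * a - h * conj p * b - conj h * conj q * a + conj q * b) -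
      (conj a * p - h * conj a * q - conj h * conj b * p + conj b * q)) * w * I_sq
  · intro c
    obtain ⟨i, e⟩ := iso_eq hk₁ hk₂ hdiff (ad c)
    have iq := (ad c).iQ
    rw [Qd_Z k₁ k₂ t φ hk₂ hdiff] at e iq
    rw [integral_indicator measurableSet_Ioi] at e
    exact ⟨i, (integrable_indicator_iff measurableSet_Ioi).1 iq, by rw [one_mul]; exact e⟩

/-- The continuous Hahn transform is an isometry on the span of the `𝐪_n`. -/
theorem hahn_transform_isometry (k₁ k₂ : ℝ) (hk₁ : 0 < k₁) (hk₂ : 0 < k₂)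
    (hsum : 1/2 ≤ k₁ + k₂) (hdiff : -(1/2) < k₂ - k₁) (t : ℝ)
    (φ : ℝ) (hφ₀ : 0 < φ) (hφπ : φ < Real.pi)
    (F : ℂ → ℂ → ℂ → ℂ → ℂ)
    (hFan : ∀ a b c : ℂ, AnalyticOnNhd ℂ (F a b c) {z : ℂ | 1 - z ∈ Complex.slitPlane})
    (hFeq : ∀ a b c z : ℂ, ‖z‖ < 1 → F a b c z = F21 a b c z) :
    ∀ f g : ℝ → ℂ × ℂ,
      f ∈ Submodule.span ℂ (Set.range (qpair k₁ k₂ t φ F)) →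
      g ∈ Submodule.span ℂ (Set.range (qpair k₁ k₂ t φ F)) →
      (∫ x : ℝ, Fop k₁ k₂ t φ f x * conj (Fop k₁ k₂ t φ g x) * wfun k₁ k₂ t φ (x : ℂ)) =
        ∫ ρ in Ioi (0:ℝ),
          (conj (g ρ).1 * (f ρ).1 - hfun k₁ k₂ t ρ * conj (g ρ).1 * (f ρ).2 -
              conj (hfun k₁ k₂ t ρ) * conj (g ρ).2 * (f ρ).1 + conj (g ρ).2 * (f ρ).2) *
            (((W0 k₁ k₂ t φ ρ / (1 - ‖hfun k₁ k₂ t ρ‖ ^ 2)) : ℝ) : ℂ) := by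
  intro f g hf hg
  exact hahn_transform_isometry' k₁ k₂ hk₁ hk₂ hsum hdiff t φ f g
    (span_Gr k₁ k₂ t φ hdiff hφ₀ hφπ F hFan hFeq f hf) (span_Gr k₁ k₂ t φ hdiff hφ₀ hφπ F hFan hFeq g hg)
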